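/- Let ℛ_J = ⟨ℝ, (r)_{r∈ℝ}, +, −, ·, <, (J^{(k)}_{re}, J^{(k)}_{im})_{k=0,1,2}, sin⌈_{[−π,π]}, cos⌈_{[−π,π]}, exp⟩ be the expansion of the ordered field of real numbers by the unrestricted exponential function exp, the restricted sine and cosine (equal to 0 outside [−π,π]), and the binary functions J^{(k)}_{re}(x,y) = Re(J^{(k)}(x+iy)) and J^{(k)}_{im}(x,y) = Im(J^{(k)}(x+iy)) for |x| ≤ 1/2 and y ≥ √3/2, and equal to 0 elsewhere, where J^{(k)} is the k-th complex derivative of J with J^{(0)} = J. Then the theory of ℛ_J is strongly model complete. -/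

import Mathlib

open FirstOrder Complex
noncomputable section
/-- A theory of an `L`-structure with interpretation `S` on `M` is strongly model complete:
every formula is equivalent to an existential formula with a quantifier-free matrix whose
witnesses are unique. -/
def StronglyModelComplete (L : FirstOrder.Language) (M : Type*) (S : L.Structure M) : Prop :=
  letI := S
  ∀ (k : ℕ) (φ : L.Formula (Fin k)),
    ∃ (m : ℕ) (ψ : L.Formula (Fin k ⊕ Fin m)),
      FirstOrder.Language.BoundedFormula.IsQF ψ ∧
      (∀ x : Fin k → M, φ.Realize x ↔ ∃ w : Fin m → M, ψ.Realize (Sum.elim x w)) ∧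
      (∀ (x : Fin k → M) (w w' : Fin m → M),
        ψ.Realize (Sum.elim x w) → ψ.Realize (Sum.elim x w') → w = w')

/-- `ζ(k) = Σ_{r≥1} r⁻ᵏ`, as a complex number. -/
def zetaC (k : ℕ) : ℂ := ∑' n : ℕ, 1 / ((n : ℂ) + 1) ^ k

/-- The normalized weight-`k` level-one Eisenstein series
`E_k(τ) = (1/(2ζ(k))) Σ_{(m,n)≠(0,0)} (mτ+n)⁻ᵏ` (for `k = 4, 6`). -/
def Eis (k : ℕ) (τ : ℂ) : ℂ :=
  1 / (2 * zetaC k) *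
    ∑' p : ℤ × ℤ, if p = (0, 0) then 0 else 1 / ((p.1 : ℂ) * τ + (p.2 : ℂ)) ^ k

/-- The modular function `J = E₄³/(E₄³ - E₆²)` on the upper half-plane. -/
def Jmod (τ : ℂ) : ℂ := Eis 4 τ ^ 3 / (Eis 4 τ ^ 3 - Eis 6 τ ^ 2)

/-- The language of `ℛ_J`: constants for all real numbers, `-`, `+`, `·`, `<`, the
restricted sine and cosine `sin⌈[-π,π]`, `cos⌈[-π,π]`, the unrestricted exponential
function, and binary function symbols `J^{(k)}_{re}`, `J^{(k)}_{im}` for `k = 0, 1, 2`. -/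
def LJ : FirstOrder.Language where
  Functions := fun k =>
    match k with
    | 0 => ℝ              -- a constant for each real number
    | 1 => Unit ⊕ Fin 3   -- negation; sin⌈[-π,π], cos⌈[-π,π], exp
    | 2 => Fin 2 ⊕ (Fin 3 × Bool)  -- +, · and the symbols J^{(k)}_{re}, J^{(k)}_{im}
    | _ + 3 => Empty
  Relations := fun k =>
    match k with
    | 2 => PUnit  -- the order relation <
    | _ => Empty

/-- The structure `ℛ_J`: the symbol `(k, b)` is interpreted by the real (if `b`) or
imaginary (if `¬b`) part of `J^{(k)}(x+iy)` on `|x| ≤ 1/2`, `y ≥ √3/2`, and by `0`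
elsewhere; `sin` and `cos` are restricted to `[-π,π]` (and `0` elsewhere) and `exp` is
unrestricted. -/
def LJStructure : LJ.Structure ℝ where
  funMap := fun {k} f x =>
    match k, f, x with
    | 0, r, _ => (show ℝ from r)
    | 1, Sum.inl _, x => -x 0
    | 1, Sum.inr c, x =>
        if c = 0 then (if -Real.pi ≤ x 0 ∧ x 0 ≤ Real.pi then Real.sin (x 0) else 0)
        else if c = 1 then (if -Real.pi ≤ x 0 ∧ x 0 ≤ Real.pi then Real.cos (x 0) else 0)
        else Real.exp (x 0)
    | 2, Sum.inl c, x => if c = 0 then x 0 + x 1 else x 0 * x 1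
    | 2, Sum.inr s, x =>
        if |x 0| ≤ 1 / 2 ∧ Real.sqrt 3 / 2 ≤ x 1 then
          if s.2 then
            (iteratedDeriv (s.1 : ℕ) Jmod ((x 0 : ℂ) + (x 1 : ℂ) * Complex.I)).re
          else
            (iteratedDeriv (s.1 : ℕ) Jmod ((x 0 : ℂ) + (x 1 : ℂ) * Complex.I)).im
        else 0
    | _ + 3, e, _ => e.elim
  RelMap := fun {k} r x =>
    match k, r, x with
    | 2, _, x => x 0 < x 1

section TameCalculus

open FirstOrder.Language

attribute [instance] LJStructure

variable {α : Type}

/-- A set defined by a quantifier-free formula of `ℛ_J`. -/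
def QFSet (A : Set (α → ℝ)) : Prop :=
  ∃ ψ : LJ.Formula α, BoundedFormula.IsQF ψ ∧ ∀ x, ψ.Realize x ↔ x ∈ A

theorem QFSet.inter {A B : Set (α → ℝ)} (hA : QFSet A) (hB : QFSet B) :
    QFSet (A ∩ B) := by
  obtain ⟨φ, h1, h2⟩ := hA
  obtain ⟨ψ, h3, h4⟩ := hB
  exact ⟨φ ⊓ ψ, h1.inf h3, fun x => by rw [Formula.realize_inf, h2, h4]; rfl⟩

theorem QFSet.compl {A : Set (α → ℝ)} (hA : QFSet A) : QFSet Aᶜ := by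
  obtain ⟨φ, h1, h2⟩ := hA
  exact ⟨φ.not, h1.not, fun x => by rw [Formula.realize_not, h2]; rfl⟩

theorem QFSet.union {A B : Set (α → ℝ)} (hA : QFSet A) (hB : QFSet B) :
    QFSet (A ∪ B) := by
  have := (hA.compl.inter hB.compl).compl
  rwa [← Set.compl_union, compl_compl] at this

theorem QFSet.univ : QFSet (Set.univ : Set (α → ℝ)) :=
  ⟨⊤, BoundedFormula.IsQF.top, fun x => by simp [Formula.Realize]⟩

theorem QFSet.preimage {β : Type} {A : Set (α → ℝ)} (hA : QFSet A) (σ : α → β) :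
    QFSet {y : β → ℝ | y ∘ σ ∈ A} := by
  obtain ⟨φ, h1, h2⟩ := hA
  exact ⟨φ.relabel σ, h1.relabel _, fun x => by rw [Formula.realize_relabel, h2]; rfl⟩

theorem QFSet.iInter {κ : Type} [Finite κ] {A : κ → Set (α → ℝ)} (hA : ∀ k, QFSet (A k)) :
    QFSet (⋂ k, A k) := by
  classical
  have := Fintype.ofFinite κ
  have key : ∀ s : Finset κ, QFSet (⋂ k ∈ s, A k) := by
    intro s
    induction s using Finset.induction_on with
    | empty => simpa using QFSet.univ
    | insert a s ha ih =>
      rw [Finset.set_biInter_insert]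
      exact (hA a).inter ih
  simpa using key Finset.univ

theorem QFSet.term_eq (s t : LJ.Term α) :
    QFSet {x : α → ℝ | s.realize x = t.realize x} :=
  ⟨s.equal t, (BoundedFormula.IsAtomic.equal _ _).isQF, fun x => by simp⟩

theorem QFSet.lt (a b : α) : QFSet {x : α → ℝ | x a < x b} :=
  ⟨Relations.formula₂ (L := LJ) (show LJ.Relations 2 from PUnit.unit) (Term.var a) (Term.var b),
    (BoundedFormula.IsAtomic.rel _ _).isQF, fun x => by
      rw [Formula.realize_rel₂]; rfl⟩

/-- A function which is a component of a tuple whose graph is quantifier-free definable. -/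
def Tame (f : (α → ℝ) → ℝ) : Prop :=
  ∃ (ι : Type) (_ : Finite ι) (g : (α → ℝ) → ι → ℝ) (A : Set (α ⊕ ι → ℝ)),
    QFSet A ∧ (∀ x w, Sum.elim x w ∈ A ↔ w = g x) ∧ ∃ j, ∀ x, f x = g x j

variable {f g : (α → ℝ) → ℝ}

theorem Tame.of_graph {κ ι : Type} [Finite κ] [Finite ι] {g : κ → (α → ℝ) → ℝ}
    (hg : ∀ k, Tame (g k)) {h : (α → ℝ) → ι → ℝ} {A : Set (κ ⊕ ι → ℝ)} (hA : QFSet A)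
    (hh : ∀ x w, Sum.elim (fun k => g k x) w ∈ A ↔ w = h x) (j : ι) :
    Tame fun x => h x j := by
  choose ι' hι' g' A' hA' hg' j' hj' using hg
  refine ⟨ι ⊕ (Σ k, ι' k), inferInstance, fun x => Sum.elim (h x) (fun p => g' p.1 x p.2),
    (⋂ k, {y | y ∘ (Sum.elim Sum.inl (fun i => Sum.inr (Sum.inr ⟨k, i⟩)) :
      α ⊕ ι' k → α ⊕ (ι ⊕ (Σ k, ι' k))) ∈ A' k}) ∩
      {y | y ∘ (Sum.elim (fun k => Sum.inr (Sum.inr ⟨k, j' k⟩)) (fun i => Sum.inr (Sum.inl i)) :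
        κ ⊕ ι → α ⊕ (ι ⊕ (Σ k, ι' k))) ∈ A},
    (QFSet.iInter fun k => (hA' k).preimage _).inter (hA.preimage _), ?_, Sum.inl j, fun x => rfl⟩
  intro x w
  have e1 : ∀ k, (Sum.elim x w ∘ (Sum.elim Sum.inl (fun i => Sum.inr (Sum.inr ⟨k, i⟩)) :
      α ⊕ ι' k → α ⊕ (ι ⊕ (Σ k, ι' k)))) = Sum.elim x (fun i => w (Sum.inr ⟨k, i⟩)) := by
    intro k; funext t; cases t <;> rfl
  have e2 : (Sum.elim x w ∘ (Sum.elim (fun k => Sum.inr (Sum.inr ⟨k, j' k⟩))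
      (fun i => Sum.inr (Sum.inl i)) : κ ⊕ ι → α ⊕ (ι ⊕ (Σ k, ι' k)))) =
      Sum.elim (fun k => w (Sum.inr ⟨k, j' k⟩)) (fun i => w (Sum.inl i)) := by
    funext t; cases t <;> rfl
  simp only [Set.mem_inter_iff, Set.mem_iInter, Set.mem_ofPred_eq, e1, e2, hg']
  constructor
  · rintro ⟨h1, h2⟩
    have e3 : (fun k => w (Sum.inr ⟨k, j' k⟩)) = fun k => g k x := by
      funext k
      rw [hj' k x, ← h1 k]
    rw [e3, hh] at h2
    funext t
    rcases t with t | ⟨k, i⟩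
    · exact congrFun h2 t
    · exact congrFun (h1 k) i
  · rintro rfl
    refine ⟨fun k => rfl, ?_⟩
    have e3 : (fun k => Sum.elim (h x) (fun p : Σ k, ι' k => g' p.1 x p.2)
        (Sum.inr ⟨k, j' k⟩)) = fun k => g k x := by
      funext k
      simp [hj' k x]
    rw [e3, hh]
    rfl

theorem Tame.comp {β : Type} [Finite β] {f : (β → ℝ) → ℝ} (hf : Tame f)
    {g : β → (α → ℝ) → ℝ} (hg : ∀ b, Tame (g b)) : Tame fun x => f fun b => g b x := by
  obtain ⟨ι, _, h, A, hA, hh, j, hj⟩ := hf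
  have := Tame.of_graph hg (h := fun x => h fun b => g b x) hA (fun x w => hh _ w) j
  simpa only [hj] using this

theorem Tame.congr (hf : Tame f) (h : ∀ x, g x = f x) : Tame g := by
  rwa [show g = f from funext h]

theorem Tame.proj (a : α) : Tame fun x : α → ℝ => x a := by
  refine ⟨Unit, inferInstance, fun x _ => x a, {y | y (Sum.inr ()) = y (Sum.inl a)},
    QFSet.term_eq (Term.var (Sum.inr ())) (Term.var (Sum.inl a)), ?_, (), fun x => rfl⟩
  intro x w
  constructor
  · intro h; funext i; exact h
  · rintro rfl; rfl

theorem Tame.funMap {n : ℕ} (F : LJ.Functions n) {g : Fin n → (α → ℝ) → ℝ}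
    (hg : ∀ k, Tame (g k)) : Tame fun x => Structure.funMap F fun k => g k x := by
  refine Tame.of_graph (ι := Unit) hg (h := fun x _ => Structure.funMap F fun k => g k x)
    (QFSet.term_eq (Term.var (Sum.inr ())) (Term.func F fun k => Term.var (Sum.inl k))) ?_ ()
  intro x w
  constructor
  · intro h; funext i; exact h
  · rintro rfl; rfl

theorem Tame.const (r : ℝ) : Tame fun _ : α → ℝ => r :=
  (Tame.funMap (α := α) (n := 0) (show LJ.Functions 0 from r) (g := fun k => k.elim0)
    fun k => k.elim0).congr fun _ => rfl

theorem Tame.neg (hf : Tame f) : Tame fun x => -f x :=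
  (Tame.funMap (n := 1) (show LJ.Functions 1 from Sum.inl ()) (g := fun _ => f)
    fun _ => hf).congr fun _ => rfl

theorem Tame.add (hf : Tame f) (hg : Tame g) :
    Tame fun x => f x + g x :=
  (Tame.funMap (n := 2) (show LJ.Functions 2 from Sum.inl 0) (g := ![f, g])
    (Fin.forall_fin_two.2 ⟨hf, hg⟩)).congr fun _ => rfl

theorem Tame.mul (hf : Tame f) (hg : Tame g) :
    Tame fun x => f x * g x :=
  (Tame.funMap (n := 2) (show LJ.Functions 2 from Sum.inl 1) (g := ![f, g])
    (Fin.forall_fin_two.2 ⟨hf, hg⟩)).congr fun _ => rfl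

theorem Tame.sub (hf : Tame f) (hg : Tame g) :
    Tame fun x => f x - g x :=
  (hf.add hg.neg).congr fun _ => by ring

theorem Tame.exp (hf : Tame f) : Tame fun x => Real.exp (f x) :=
  (Tame.funMap (n := 1) (show LJ.Functions 1 from Sum.inr 2) (g := fun _ => f)
    fun _ => hf).congr fun _ => rfl

theorem Tame.sinR (hf : Tame f) :
    Tame fun x => if -Real.pi ≤ f x ∧ f x ≤ Real.pi then Real.sin (f x) else 0 :=
  (Tame.funMap (n := 1) (show LJ.Functions 1 from Sum.inr 0) (g := fun _ => f)
    fun _ => hf).congr fun _ => rfl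

theorem Tame.cosR (hf : Tame f) :
    Tame fun x => if -Real.pi ≤ f x ∧ f x ≤ Real.pi then Real.cos (f x) else 0 :=
  (Tame.funMap (n := 1) (show LJ.Functions 1 from Sum.inr 1) (g := fun _ => f)
    fun _ => hf).congr fun _ => rfl

theorem Tame.Jre (hf : Tame f) (hg : Tame g) (k : Fin 3) :
    Tame fun x => if |f x| ≤ 1 / 2 ∧ Real.sqrt 3 / 2 ≤ g x then
      (iteratedDeriv (k : ℕ) Jmod ((f x : ℂ) + (g x : ℂ) * Complex.I)).re else 0 :=
  (Tame.funMap (n := 2) (show LJ.Functions 2 from Sum.inr (k, true)) (g := ![f, g])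
    (Fin.forall_fin_two.2 ⟨hf, hg⟩)).congr fun _ => rfl

theorem Tame.Jim (hf : Tame f) (hg : Tame g) (k : Fin 3) :
    Tame fun x => if |f x| ≤ 1 / 2 ∧ Real.sqrt 3 / 2 ≤ g x then
      (iteratedDeriv (k : ℕ) Jmod ((f x : ℂ) + (g x : ℂ) * Complex.I)).im else 0 :=
  (Tame.funMap (n := 2) (show LJ.Functions 2 from Sum.inr (k, false)) (g := ![f, g])
    (Fin.forall_fin_two.2 ⟨hf, hg⟩)).congr fun _ => rfl

open scoped Classical in
/-- A predicate whose characteristic function is tame. -/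
def TPred (p : (α → ℝ) → Prop) : Prop := Tame fun x => if p x then 1 else 0

variable {p q : (α → ℝ) → Prop}

theorem TPred.congr (hp : TPred p) (h : ∀ x, q x ↔ p x) :
    TPred q := by
  rwa [show q = p from funext fun x => propext (h x)]

theorem TPred.of_qf {κ : Type} [Finite κ] {g : κ → (α → ℝ) → ℝ} (hg : ∀ k, Tame (g k))
    {A : Set (κ → ℝ)} (hA : QFSet A) : TPred fun x => (fun k => g k x) ∈ A := by
  classical
  have h1 : ∀ r : ℝ, QFSet {y : κ ⊕ Unit → ℝ | y (Sum.inr ()) = r} := fun r =>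
    QFSet.term_eq (Term.var (Sum.inr ())) (Term.func (show LJ.Functions 0 from r) fun k => k.elim0)
  refine Tame.of_graph (ι := Unit) hg (h := fun x _ => if (fun k => g k x) ∈ A then 1 else 0)
    (A := ({y | y ∘ Sum.inl ∈ A} ∩ {y | y (Sum.inr ()) = 1}) ∪
      ({y | y ∘ Sum.inl ∈ A}ᶜ ∩ {y | y (Sum.inr ()) = 0}))
    (((hA.preimage _).inter (h1 1)).union ((hA.preimage _).compl.inter (h1 0))) ?_ ()
  intro x w
  have e : (Sum.elim (fun k => g k x) w ∘ Sum.inl) = fun k => g k x := rfl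
  simp only [Set.mem_union, Set.mem_inter_iff, Set.mem_ofPred_eq, Set.mem_compl_iff, e,
    Sum.elim_inr]
  have e3 : ∀ r : ℝ, (w = fun _ => r) ↔ w () = r := fun r =>
    ⟨fun h => by rw [h], fun h => funext fun _ => h⟩
  by_cases hx : (fun k => g k x) ∈ A <;> simp [hx, e3]

theorem TPred.lt (hf : Tame f) (hg : Tame g) :
    TPred fun x => f x < g x :=
  (TPred.of_qf (κ := Fin 2) (g := ![f, g]) (Fin.forall_fin_two.2 ⟨hf, hg⟩)
    (QFSet.lt 0 1)).congr fun _ => Iff.rfl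

theorem TPred.not (hp : TPred p) : TPred fun x => ¬ p x := by
  classical
  exact ((Tame.const 1).sub hp).congr fun x => by by_cases h : p x <;> simp [h]

theorem TPred.and (hp : TPred p) (hq : TPred q) :
    TPred fun x => p x ∧ q x := by
  classical
  exact (Tame.mul hp hq).congr fun x => by by_cases h : p x <;> simp [h]

theorem TPred.or (hp : TPred p) (hq : TPred q) :
    TPred fun x => p x ∨ q x :=
  (hp.not.and hq.not).not.congr fun x => by tauto

theorem TPred.imp (hp : TPred p) (hq : TPred q) :
    TPred fun x => p x → q x :=
  (hp.and hq.not).not.congr fun x => by tauto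

theorem TPred.const (p : Prop) : TPred fun _ : α → ℝ => p := by
  classical
  exact Tame.const _

theorem TPred.forall {κ : Type} [Finite κ] {p : κ → (α → ℝ) → Prop} (hp : ∀ k, TPred (p k)) :
    TPred fun x => ∀ k, p k x := by
  classical
  have := Fintype.ofFinite κ
  have key : ∀ s : Finset κ, TPred fun x => ∀ k ∈ s, p k x := by
    intro s
    induction s using Finset.induction_on with
    | empty => exact (TPred.const True).congr fun x => by simp
    | insert a s ha ih => exact ((hp a).and ih).congr fun x => by simp
  exact (key Finset.univ).congr fun x => by simp

theorem TPred.exists {κ : Type} [Finite κ] {p : κ → (α → ℝ) → Prop} (hp : ∀ k, TPred (p k)) :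
    TPred fun x => ∃ k, p k x :=
  (TPred.forall fun k => (hp k).not).not.congr fun x => by simp

theorem TPred.le (hf : Tame f) (hg : Tame g) :
    TPred fun x => f x ≤ g x :=
  (TPred.lt hg hf).not.congr fun _ => not_lt.symm

theorem TPred.eq (hf : Tame f) (hg : Tame g) :
    TPred fun x => f x = g x :=
  ((TPred.le hf hg).and (TPred.le hg hf)).congr fun _ => le_antisymm_iff

theorem Tame.ite [∀ x, Decidable (p x)] (hp : TPred p)
    (hf : Tame f) (hg : Tame g) : Tame fun x => if p x then f x else g x := by
  classical
  exact ((Tame.mul hp hf).add (Tame.mul hp.not hg)).congr fun x => by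
    by_cases h : p x <;> simp [h]

theorem TPred.comp {β : Type} [Finite β] {p : (β → ℝ) → Prop} (hp : TPred p)
    {g : β → (α → ℝ) → ℝ} (hg : ∀ b, Tame (g b)) : TPred fun x => p fun b => g b x := by
  classical
  exact Tame.comp hp hg

theorem TPred.exists_qf (hp : TPred p) :
    ∃ (ι : Type) (_ : Finite ι) (B : Set (α ⊕ ι → ℝ)), QFSet B ∧
      (∀ x, p x ↔ ∃ w, Sum.elim x w ∈ B) ∧
      ∀ x w w', Sum.elim x w ∈ B → Sum.elim x w' ∈ B → w = w' := by
  obtain ⟨ι, _, g, A, hA, hg, j, hj⟩ := hp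
  refine ⟨ι, inferInstance, A ∩ {y | y (Sum.inr j) = 1}, hA.inter (QFSet.term_eq (Term.var _)
    (Term.func (show LJ.Functions 0 from (1 : ℝ)) fun k => k.elim0)), fun x => ?_,
    fun x w w' h h' => ((hg x w).1 h.1).trans ((hg x w').1 h'.1).symm⟩
  have : p x ↔ g x j = 1 := by
    rw [← hj]
    by_cases hx : p x <;> simp [hx]
  simp [hg, this]

theorem elim_comp_sumAssoc {β γ : Type} (x : α → ℝ) (w : β ⊕ γ → ℝ) :
    Sum.elim x w ∘ Equiv.sumAssoc α β γ = Sum.elim (Sum.elim x (w ∘ Sum.inl)) (w ∘ Sum.inr) := by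
  funext t
  rcases t with (t | t) | t <;> rfl

/-- Unique solutions of tame conditions are tame. -/
theorem Tame.of_unique {ι : Type} [Finite ι] {p : (α ⊕ ι → ℝ) → Prop} (hp : TPred p)
    {h : (α → ℝ) → ι → ℝ} (hh : ∀ x w, p (Sum.elim x w) ↔ w = h x) (j : ι) :
    Tame fun x => h x j := by
  obtain ⟨ι', _, B, hB, h1, h2⟩ := hp.exists_qf
  choose v hv using fun x => (h1 _).1 ((hh x _).2 rfl)
  refine ⟨ι ⊕ ι', inferInstance, fun x => Sum.elim (h x) (v x), _,
    hB.preimage (Equiv.sumAssoc α ι ι'), fun x w => ?_, Sum.inl j, fun _ => rfl⟩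
  rw [Set.mem_ofPred_eq, elim_comp_sumAssoc]
  refine ⟨fun hw => ?_, fun h => h ▸ hv x⟩
  have h3 := (hh _ _).1 ((h1 _).2 ⟨_, hw⟩)
  simp only [← h2 _ _ _ (h3 ▸ hw) (hv x), ← h3, Sum.elim_comp_inl_inr]

theorem Tame.of_unique_one {p : (α → ℝ) → ℝ → Prop}
    (hp : TPred fun y : α ⊕ Unit → ℝ => p (y ∘ Sum.inl) (y (Sum.inr ())))
    {h : (α → ℝ) → ℝ} (hh : ∀ x w, p x w ↔ w = h x) : Tame h :=
  Tame.of_unique (ι := Unit) hp (h := fun x _ => h x) (fun x w => by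
    have : (Sum.elim x w : α ⊕ Unit → ℝ) ∘ Sum.inl = x := rfl
    rw [this, Sum.elim_inr, hh]
    exact ⟨fun h => funext fun _ => h, fun h => by rw [h]⟩) ()

theorem Tame.reindex {β : Type} (hf : Tame f) (σ : α → β) :
    Tame fun y : β → ℝ => f (y ∘ σ) := by
  obtain ⟨ι, _, g, A, hA, hg, j, hj⟩ := hf
  refine ⟨ι, inferInstance, fun y => g (y ∘ σ), {y | y ∘ Sum.map σ id ∈ A}, hA.preimage _, ?_, j,
    fun x => hj _⟩
  intro x w
  have : (Sum.elim x w ∘ Sum.map σ id) = Sum.elim (x ∘ σ) w := by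
    funext t; cases t <;> rfl
  simp only [Set.mem_ofPred_eq, this, hg]

theorem Tame.inv (hf : Tame f) : Tame fun x => (f x)⁻¹ := by
  refine Tame.of_unique_one (p := fun x w => (f x = 0 ∧ w = 0) ∨ (¬ f x = 0 ∧ f x * w = 1)) ?_ ?_
  · have h1 := hf.reindex (Sum.inl : α → α ⊕ Unit)
    have h2 : Tame fun y : α ⊕ Unit → ℝ => y (Sum.inr ()) := Tame.proj _
    exact ((TPred.eq h1 (Tame.const 0)).and (TPred.eq h2 (Tame.const 0))).or
      ((TPred.eq h1 (Tame.const 0)).not.and (TPred.eq (h1.mul h2) (Tame.const 1)))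
  · intro x w
    by_cases h : f x = 0
    · simp [h]
    · simp only [h, false_and, not_false_eq_true, true_and, false_or]
      constructor
      · intro h2; field_simp; linarith
      · rintro rfl; field_simp

end TameCalculus

section TameComplex

/-- Complex-valued functions with tame real and imaginary parts. -/
def TameC {α : Type} (f : (α → ℝ) → ℂ) : Prop :=
  Tame (fun x => (f x).re) ∧ Tame (fun x => (f x).im)

variable {α : Type}

variable {f g : (α → ℝ) → ℂ}

theorem TameC.congr (hf : TameC f) (h : ∀ x, g x = f x) : TameC g := by
  rwa [show g = f from funext h]

theorem TameC.const (c : ℂ) : TameC fun _ : α → ℝ => c := ⟨Tame.const _, Tame.const _⟩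

theorem TameC.ofReal {f : (α → ℝ) → ℝ} (hf : Tame f) : TameC fun x => (f x : ℂ) :=
  ⟨by simpa using hf, by simpa using Tame.const 0⟩

theorem TameC.mk' {f g : (α → ℝ) → ℝ} (hf : Tame f) (hg : Tame g) :
    TameC fun x => (⟨f x, g x⟩ : ℂ) := ⟨hf, hg⟩

theorem TameC.add (hf : TameC f) (hg : TameC g) :
    TameC fun x => f x + g x :=
  ⟨(hf.1.add hg.1).congr fun _ => by simp, (hf.2.add hg.2).congr fun _ => by simp⟩

theorem TameC.neg (hf : TameC f) : TameC fun x => -f x :=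
  ⟨(hf.1.neg).congr fun _ => by simp, (hf.2.neg).congr fun _ => by simp⟩

theorem TameC.sub (hf : TameC f) (hg : TameC g) :
    TameC fun x => f x - g x :=
  (hf.add hg.neg).congr fun _ => by ring

theorem TameC.mul (hf : TameC f) (hg : TameC g) :
    TameC fun x => f x * g x :=
  ⟨((hf.1.mul hg.1).sub (hf.2.mul hg.2)).congr fun _ => by simp,
    ((hf.1.mul hg.2).add (hf.2.mul hg.1)).congr fun _ => by simp⟩

theorem TameC.pow (hf : TameC f) (n : ℕ) : TameC fun x => f x ^ n := by
  induction n with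
  | zero => simpa using TameC.const 1
  | succ n ih => exact (ih.mul hf).congr fun x => pow_succ _ _

theorem TameC.sum {κ : Type} {f : κ → (α → ℝ) → ℂ} (s : Finset κ)
    (hf : ∀ k ∈ s, TameC (f k)) : TameC fun x => ∑ k ∈ s, f k x := by
  classical
  induction s using Finset.induction_on with
  | empty => simpa using TameC.const 0
  | insert a s ha ih =>
    exact ((hf a (by simp)).add (ih fun k hk => hf k (by simp [hk]))).congr fun x =>
      Finset.sum_insert ha

theorem TameC.prod {κ : Type} {f : κ → (α → ℝ) → ℂ} (s : Finset κ)
    (hf : ∀ k ∈ s, TameC (f k)) : TameC fun x => ∏ k ∈ s, f k x := by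
  classical
  induction s using Finset.induction_on with
  | empty => simpa using TameC.const 1
  | insert a s ha ih =>
    exact ((hf a (by simp)).mul (ih fun k hk => hf k (by simp [hk]))).congr fun x =>
      Finset.prod_insert ha

theorem TameC.conj (hf : TameC f) :
    TameC fun x => (starRingEnd ℂ) (f x) :=
  ⟨hf.1.congr fun _ => by simp, hf.2.neg.congr fun _ => by simp⟩

theorem TameC.normSq (hf : TameC f) : Tame fun x => Complex.normSq (f x) :=
  ((hf.1.mul hf.1).add (hf.2.mul hf.2)).congr fun _ => Complex.normSq_apply _

theorem TameC.inv (hf : TameC f) : TameC fun x => (f x)⁻¹ :=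
  ⟨(hf.1.mul hf.normSq.inv).congr fun _ => by rw [Complex.inv_re, div_eq_mul_inv],
    (hf.2.neg.mul hf.normSq.inv).congr fun _ => by rw [Complex.inv_im, div_eq_mul_inv]⟩

theorem TameC.div (hf : TameC f) (hg : TameC g) :
    TameC fun x => f x / g x :=
  (hf.mul hg.inv).congr fun _ => div_eq_mul_inv _ _

theorem TameC.eq (hf : TameC f) (hg : TameC g) : TPred fun x => f x = g x :=
  ((TPred.eq hf.1 hg.1).and (TPred.eq hf.2 hg.2)).congr fun _ => Complex.ext_iff

theorem TameC.norm_lt (hf : TameC f) (r : ℝ) : TPred fun x => ‖f x‖ < r := by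
  rcases lt_or_ge 0 r with hr | hr
  · refine (TPred.lt hf.normSq (Tame.const (r ^ 2))).congr fun x => ?_
    rw [Complex.normSq_eq_norm_sq, sq_lt_sq₀ (norm_nonneg _) hr.le]
  · exact (TPred.const False).congr fun x => by
      simp only [iff_false, not_lt]; exact hr.trans (norm_nonneg _)

theorem TameC.ite {p : (α → ℝ) → Prop} [∀ x, Decidable (p x)] (hp : TPred p)
    (hf : TameC f) (hg : TameC g) :
    TameC fun x => if p x then f x else g x :=
  ⟨(Tame.ite hp hf.1 hg.1).congr fun x => by dsimp only; split_ifs <;> rfl,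
    (Tame.ite hp hf.2 hg.2).congr fun x => by dsimp only; split_ifs <;> rfl⟩

/-- The complex tuple encoded by a real tuple. -/
def cplx {κ : Type} (v : κ × Bool → ℝ) (k : κ) : ℂ := ⟨v (k, true), v (k, false)⟩

/-- The real tuple encoding a complex tuple. -/
def recplx {κ : Type} (z : κ → ℂ) (p : κ × Bool) : ℝ := if p.2 then (z p.1).re else (z p.1).im

theorem cplx_recplx {κ : Type} (z : κ → ℂ) : cplx (recplx z) = z := by
  funext k; simp [cplx, recplx]

theorem recplx_cplx {κ : Type} (v : κ × Bool → ℝ) : recplx (cplx v) = v := by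
  funext ⟨k, b⟩; cases b <;> simp [cplx, recplx]

theorem TameC.cplx {κ : Type} (k : κ) : TameC fun v : κ × Bool → ℝ => cplx v k :=
  ⟨Tame.proj _, Tame.proj _⟩

theorem TameC.recplx {κ : Type} {g : κ → (α → ℝ) → ℂ} (hg : ∀ k, TameC (g k)) (p : κ × Bool) :
    Tame fun x => recplx (fun k => g k x) p := by
  obtain ⟨k, b⟩ := p
  cases b
  · exact (hg k).2.congr fun _ => by simp [_root_.recplx]
  · exact (hg k).1.congr fun _ => by simp [_root_.recplx]

theorem TameC.comp {κ : Type} [Finite κ] {F : (κ → ℂ) → ℂ}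
    (hF : TameC fun v : κ × Bool → ℝ => F (_root_.cplx v))
    {g : κ → (α → ℝ) → ℂ} (hg : ∀ k, TameC (g k)) : TameC fun x => F fun k => g k x :=
  ⟨(hF.1.comp (TameC.recplx hg)).congr fun x => by rw [← cplx_recplx fun k => g k x]; rfl,
    (hF.2.comp (TameC.recplx hg)).congr fun x => by rw [← cplx_recplx fun k => g k x]; rfl⟩

theorem TameC.reindex {β : Type} (hf : TameC f) (σ : α → β) :
    TameC fun y : β → ℝ => f (y ∘ σ) := ⟨hf.1.reindex σ, hf.2.reindex σ⟩

/-- Unique complex solutions of tame conditions are tame. -/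
theorem TameC.of_unique {κ : Type} [Finite κ] {p : (α → ℝ) → (κ → ℂ) → Prop}
    (hp : TPred fun y : α ⊕ (κ × Bool) → ℝ => p (y ∘ Sum.inl) (_root_.cplx (y ∘ Sum.inr)))
    {h : (α → ℝ) → κ → ℂ} (hh : ∀ x w, p x w ↔ w = h x) (k : κ) : TameC fun x => h x k := by
  have key := Tame.of_unique hp (h := fun x => _root_.recplx (h x)) (fun x w => by
    have e1 : (Sum.elim x w : α ⊕ (κ × Bool) → ℝ) ∘ Sum.inl = x := rfl
    have e2 : (Sum.elim x w : α ⊕ (κ × Bool) → ℝ) ∘ Sum.inr = w := rfl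
    rw [e1, e2, hh]
    constructor
    · intro h; rw [← h, recplx_cplx]
    · intro h; rw [h, cplx_recplx])
  exact ⟨(key (k, true)).congr fun x => by simp [_root_.recplx],
    (key (k, false)).congr fun x => by simp [_root_.recplx]⟩

theorem TameC.inl {β : Type} (hf : TameC f) :
    TameC fun y : α ⊕ β → ℝ => f (y ∘ Sum.inl) := hf.reindex _

theorem TameC.inr {κ : Type} (k : κ) :
    TameC fun y : α ⊕ (κ × Bool) → ℝ => _root_.cplx (y ∘ Sum.inr) k :=
  (TameC.cplx k).reindex Sum.inr

/-- Lexicographic order on complex numbers. -/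
def cLex (z : ℂ) : ℝ ×ₗ ℝ := toLex (z.re, z.im)

theorem cLex_injective : Function.Injective cLex := by
  intro z w h
  have : (z.re, z.im) = (w.re, w.im) := toLex.injective h
  exact Complex.ext (by simpa using congrArg Prod.fst this) (by simpa using congrArg Prod.snd this)

theorem cLex_le {z w : ℂ} : cLex z ≤ cLex w ↔ z.re < w.re ∨ (z.re = w.re ∧ z.im ≤ w.im) :=
  Prod.Lex.le_iff

theorem eq_of_monotone_of_prod_eq {n : ℕ} {r s : Fin n → ℂ} (hr : Monotone (cLex ∘ r))
    (hs : Monotone (cLex ∘ s)) (h : ∀ z : ℂ, ∏ i, (z - r i) = ∏ i, (z - s i)) : r = s := by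
  classical
  have h1 : ∏ i, (Polynomial.X - Polynomial.C (r i)) = ∏ i, (Polynomial.X - Polynomial.C (s i)) := by
    apply Polynomial.funext
    intro z
    simpa [Polynomial.eval_prod] using h z
  have h0 : ∀ t : Fin n → ℂ, ((∏ i, (Polynomial.X - Polynomial.C (t i))).roots) =
      Multiset.ofList (List.ofFn t) := by
    intro t
    rw [← Fin.univ_val_map, ← Polynomial.roots_multiset_prod_X_sub_C (Finset.univ.val.map t),
      Multiset.map_map]
    rfl
  have h2 : (List.ofFn r).Perm (List.ofFn s) := by
    have := congrArg Polynomial.roots h1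
    rw [h0, h0] at this
    exact Multiset.coe_eq_coe.1 this
  have h3 : (List.ofFn (cLex ∘ r)).Perm (List.ofFn (cLex ∘ s)) := by
    rw [← List.map_ofFn, ← List.map_ofFn]
    exact h2.map _
  have h4 := List.ofFn_injective (h3.eq_of_sortedLE hr.sortedLE_ofFn hs.sortedLE_ofFn)
  funext i
  exact cLex_injective (congrFun h4 i)

theorem exists_monotone_prod_eq {n : ℕ} (a : Fin n → ℂ) :
    ∃ r : Fin n → ℂ, Monotone (cLex ∘ r) ∧
      ∀ z : ℂ, z ^ n + ∑ i, a i * z ^ (i : ℕ) = ∏ i, (z - r i) := by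
  classical
  set Q : Polynomial ℂ := ∑ i : Fin n, Polynomial.C (a i) * Polynomial.X ^ (i : ℕ) with hQ
  have hQd : Q.degree < n := by
    simpa [hQ] using Polynomial.degree_sum_fin_lt a
  set P : Polynomial ℂ := Polynomial.X ^ n + Q with hP
  have hPm : P.Monic := Polynomial.monic_X_pow_add hQd
  have hPd : P.natDegree = n := by
    have : P.degree = n := by
      rw [hP, Polynomial.degree_add_eq_left_of_degree_lt] <;> simp [hQd]
    exact Polynomial.natDegree_eq_of_degree_eq_some this
  have hs := IsAlgClosed.splits P
  have hc : P.roots.toList.length = n := by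
    rw [Multiset.length_toList, ← hPd]
    exact hs.natDegree_eq_card_roots.symm
  have h1 : P = (P.roots.map fun b => Polynomial.X - Polynomial.C b).prod :=
    hs.eq_prod_roots_of_monic hPm
  let r : Fin n → ℂ := fun i => P.roots.toList.get (i.cast hc.symm)
  have hr : Multiset.ofList (List.ofFn r) = P.roots := by
    have : List.ofFn r = P.roots.toList := by
      apply List.ext_get
      · simp [hc]
      · intro i h1 h2
        simp [r]
    rw [this, Multiset.coe_toList]
  have h2 : P = ∏ i, (Polynomial.X - Polynomial.C (r i)) := by
    rw [h1, ← hr, ← Fin.univ_val_map, Multiset.map_map]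
    rfl
  refine ⟨r ∘ Tuple.sort (cLex ∘ r), ?_, fun z => ?_⟩
  · exact Tuple.monotone_sort (cLex ∘ r)
  · have h3 := congrArg (Polynomial.eval z) h2
    rw [hP, hQ, Polynomial.eval_add, Polynomial.eval_finsetSum, Polynomial.eval_prod] at h3
    simp only [Polynomial.eval_mul, Polynomial.eval_C, Polynomial.eval_pow, Polynomial.eval_X,
      Polynomial.eval_sub] at h3
    rw [h3]
    exact (Equiv.prod_comp (Tuple.sort (cLex ∘ r)) fun i => z - r i).symm

theorem monic_eq_prod_of_eval_eq {n : ℕ} (a r : Fin n → ℂ)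
    (h : ∀ k : Fin (n + 1), ((k : ℕ) : ℂ) ^ n + ∑ i, a i * ((k : ℕ) : ℂ) ^ (i : ℕ) =
      ∏ i, (((k : ℕ) : ℂ) - r i)) (z : ℂ) :
    z ^ n + ∑ i, a i * z ^ (i : ℕ) = ∏ i, (z - r i) := by
  classical
  have key : (Polynomial.X ^ n + ∑ i : Fin n, Polynomial.C (a i) * Polynomial.X ^ (i : ℕ)) =
      ∏ i, (Polynomial.X - Polynomial.C (r i)) := by
    refine Polynomial.eq_of_degree_sub_lt_of_eval_finset_eq
      (Finset.univ.image fun k : Fin (n + 1) => ((k : ℕ) : ℂ)) ?_ ?_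
    · rw [Finset.card_image_of_injective _ fun a b h => Fin.ext (by exact_mod_cast h)]
      refine (Polynomial.degree_sub_le _ _).trans_lt (max_lt ?_ ?_)
      · refine (Polynomial.degree_add_le _ _).trans_lt (max_lt ?_ ?_)
        · rw [Polynomial.degree_X_pow]
          simp only [Finset.card_univ, Fintype.card_fin]
          exact_mod_cast Nat.lt_succ_self n
        · refine (Polynomial.degree_sum_fin_lt a).trans ?_
          simp only [Finset.card_univ, Fintype.card_fin]
          exact_mod_cast Nat.lt_succ_self n
      · rw [Polynomial.degree_prod]
        simp only [Polynomial.degree_X_sub_C, Finset.sum_const, Finset.card_univ, Fintype.card_fin,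
          nsmul_eq_mul, mul_one]
        exact_mod_cast Nat.lt_succ_self n
    · intro x hx
      obtain ⟨k, -, rfl⟩ := Finset.mem_image.1 hx
      simpa [Polynomial.eval_finsetSum, Polynomial.eval_prod] using h k
  simpa [Polynomial.eval_finsetSum, Polynomial.eval_prod] using congrArg (Polynomial.eval z) key

/-- The roots of a monic polynomial with tame coefficients are tame functions. -/
theorem TameC.exists_roots {n : ℕ} {a : Fin n → (α → ℝ) → ℂ} (ha : ∀ i, TameC (a i)) :
    ∃ r : Fin n → (α → ℝ) → ℂ, (∀ i, TameC (r i)) ∧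
      ∀ x z, z ^ n + ∑ i, a i x * z ^ (i : ℕ) = ∏ i, (z - r i x) := by
  choose r hr1 hr2 using fun x => exists_monotone_prod_eq fun i => a i x
  refine ⟨fun i x => r x i, fun i => ?_, hr2⟩
  refine TameC.of_unique (κ := Fin n) (p := fun x w =>
    (∀ k : Fin (n + 1), ((k : ℕ) : ℂ) ^ n + ∑ i, a i x * ((k : ℕ) : ℂ) ^ (i : ℕ) =
      ∏ i, (((k : ℕ) : ℂ) - w i)) ∧ ∀ i j : Fin n, i ≤ j → cLex (w i) ≤ cLex (w j)) ?_ ?_ i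
  · refine (TPred.forall fun k => ?_).and (TPred.forall fun i => TPred.forall fun j =>
      (TPred.const _).imp ?_)
    · exact TameC.eq ((TameC.const _).add (TameC.sum _ fun i _ => (ha i).inl.mul (TameC.const _)))
        (TameC.prod _ fun i _ => (TameC.const _).sub (TameC.inr i))
    · simp only [cLex_le]
      exact (TPred.lt (TameC.inr i).1 (TameC.inr j).1).or ((TPred.eq (TameC.inr i).1
        (TameC.inr j).1).and (TPred.le (TameC.inr i).2 (TameC.inr j).2))
  · intro x w
    constructor
    · rintro ⟨h1, h2⟩
      refine eq_of_monotone_of_prod_eq (fun i j h => h2 i j h) (hr1 x) fun z => ?_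
      rw [← hr2, ← monic_eq_prod_of_eval_eq _ _ h1]
    · rintro rfl
      exact ⟨fun k => hr2 x _, fun i j h => hr1 x h⟩

end TameComplex

section AnalyticSystem

open Filter Topology

variable {κ ι : Type} [Fintype κ] [Fintype ι]

/-- Definability of the germ at the origin of a function of several complex variables. -/
def DefAt (F : (κ → ℂ) → ℂ) : Prop :=
  ∃ ε > 0, TameC fun v : κ × Bool → ℝ => if ‖cplx v‖ < ε then F (cplx v) else 0

open Classical in
/-- The complex partial derivative. -/
def pd (i : κ) (F : (κ → ℂ) → ℂ) (z : κ → ℂ) : ℂ := fderiv ℂ F z (Pi.single i 1)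

/-- Sets of definable holomorphic germs closed under partial derivatives. -/
def AnSys (S : Set ((κ → ℂ) → ℂ)) : Prop :=
  ∀ G ∈ S, DefAt G ∧ (∀ᶠ z in 𝓝 0, DifferentiableAt ℂ G z) ∧
    ∀ i, ∃ H ∈ S, pd i G =ᶠ[𝓝 0] H

/-- Definable holomorphic germs all of whose partial derivatives are definable. -/
def IsAn (F : (κ → ℂ) → ℂ) : Prop := ∃ S, AnSys S ∧ F ∈ S

theorem TPred.norm_lt {α : Type} {g : κ → (α → ℝ) → ℂ} (hg : ∀ k, TameC (g k)) {ε : ℝ}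
    (hε : 0 < ε) : TPred fun x => ‖fun k => g k x‖ < ε := by
  simp only [pi_norm_lt_iff hε]
  exact TPred.forall fun k => (hg k).norm_lt ε

variable {F G : (κ → ℂ) → ℂ}

theorem DefAt.comp_tame (hF : DefAt F) :
    ∃ ε > 0, ∀ δ, 0 < δ → δ ≤ ε → ∀ {α : Type} {g : κ → (α → ℝ) → ℂ}, (∀ k, TameC (g k)) →
      TameC fun x => if ‖fun k => g k x‖ < δ then F (fun k => g k x) else 0 := by
  obtain ⟨ε, hε, h⟩ := hF
  refine ⟨ε, hε, fun δ hδ hδε α g hg => ?_⟩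
  have := TameC.ite (TPred.norm_lt hg hδ)
    (TameC.comp (F := fun z => if ‖z‖ < ε then F z else 0) h hg) (TameC.const 0)
  refine this.congr fun x => ?_
  split_ifs with h1 h2
  · rfl
  · exact absurd (h1.trans_le hδε) h2
  · rfl

theorem DefAt.of_le (hF : DefAt F) : ∃ ε > 0, ∀ δ, 0 < δ → δ ≤ ε →
    TameC fun v : κ × Bool → ℝ => if ‖cplx v‖ < δ then F (cplx v) else 0 := by
  obtain ⟨ε, hε, h⟩ := hF.comp_tame
  exact ⟨ε, hε, fun δ h1 h2 => h δ h1 h2 TameC.cplx⟩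

theorem DefAt.congr (hF : DefAt F) (h : F =ᶠ[𝓝 0] G) : DefAt G := by
  obtain ⟨ε, hε, h1⟩ := hF.of_le
  obtain ⟨δ, hδ, h2⟩ := Metric.eventually_nhds_iff.1 h
  refine ⟨min ε δ, lt_min hε hδ, (h1 _ (lt_min hε hδ) (min_le_left _ _)).congr fun v => ?_⟩
  split_ifs with h3
  · exact (h2 (by simpa using h3.trans_le (min_le_right _ _))).symm
  · rfl

theorem DefAt.map₂ (hF : DefAt F) (hG : DefAt G) {o : ℂ → ℂ → ℂ}
    (ho : ∀ {α : Type} {f g : (α → ℝ) → ℂ}, TameC f → TameC g → TameC fun x => o (f x) (g x)) :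
    DefAt fun z => o (F z) (G z) := by
  obtain ⟨ε, hε, h1⟩ := hF.of_le
  obtain ⟨δ, hδ, h2⟩ := hG.of_le
  have h0 := lt_min hε hδ
  refine ⟨min ε δ, h0, (TameC.ite (TPred.norm_lt TameC.cplx h0)
    (ho (h1 _ h0 (min_le_left _ _)) (h2 _ h0 (min_le_right _ _)))
    (TameC.const 0)).congr fun v => ?_⟩
  change (if ‖cplx v‖ < min ε δ then _ else _) = if ‖cplx v‖ < min ε δ then _ else _
  split_ifs <;> rfl

theorem DefAt.const (c : ℂ) : DefAt fun _ : κ → ℂ => c :=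
  ⟨1, one_pos, TameC.ite (TPred.norm_lt TameC.cplx one_pos) (TameC.const _) (TameC.const _)⟩

theorem DefAt.coord (i : κ) : DefAt fun z : κ → ℂ => z i :=
  ⟨1, one_pos, TameC.ite (TPred.norm_lt TameC.cplx one_pos) (TameC.cplx i) (TameC.const _)⟩

theorem pd_congr (h : F =ᶠ[𝓝 0] G) (i : κ) : pd i F =ᶠ[𝓝 0] pd i G := by
  filter_upwards [h.eventuallyEq_nhds] with z hz
  rw [pd, pd, hz.fderiv_eq]

theorem IsAn.defAt (hF : IsAn F) : DefAt F := by
  obtain ⟨S, hS, h⟩ := hF; exact (hS F h).1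

theorem IsAn.diff (hF : IsAn F) : ∀ᶠ z in 𝓝 0, DifferentiableAt ℂ F z := by
  obtain ⟨S, hS, h⟩ := hF; exact (hS F h).2.1

theorem AnSys.congr {S : Set ((κ → ℂ) → ℂ)} (hS : AnSys S) :
    AnSys {F | ∃ G ∈ S, G =ᶠ[𝓝 0] F} := by
  rintro F ⟨G, hG, h⟩
  obtain ⟨h1, h2, h3⟩ := hS G hG
  refine ⟨h1.congr h, ?_, fun i => ?_⟩
  · filter_upwards [h2, h.eventuallyEq_nhds] with z hz h'
    exact (h'.differentiableAt_iff).1 hz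
  · obtain ⟨H, hH, h'⟩ := h3 i
    exact ⟨H, ⟨H, hH, EventuallyEq.rfl⟩, (pd_congr h.symm i).trans h'⟩

theorem IsAn.congr (hF : IsAn F) (h : F =ᶠ[𝓝 0] G) : IsAn G := by
  obtain ⟨S, hS, h1⟩ := hF
  exact ⟨_, hS.congr, F, h1, h⟩

theorem IsAn.pd (hF : IsAn F) (i : κ) : IsAn (pd i F) := by
  obtain ⟨S, hS, h1⟩ := hF
  obtain ⟨H, hH, h⟩ := (hS F h1).2.2 i
  exact IsAn.congr ⟨S, hS, hH⟩ h.symm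

theorem pd_add {z : κ → ℂ} (hF : DifferentiableAt ℂ F z)
    (hG : DifferentiableAt ℂ G z) (i : κ) : _root_.pd i (F + G) z = _root_.pd i F z +
      _root_.pd i G z := by
  simp [_root_.pd, fderiv_add hF hG]

theorem pd_mul {z : κ → ℂ} (hF : DifferentiableAt ℂ F z)
    (hG : DifferentiableAt ℂ G z) (i : κ) :
    _root_.pd i (F * G) z = _root_.pd i F z * G z + F z * _root_.pd i G z := by
  simp [_root_.pd, fderiv_mul hF hG]; ring

/-- A set of definable holomorphic germs whose partial derivatives are polynomials in the set
and in known germs consists of known germs. -/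
theorem IsAn.of_adjoin {S : Set ((κ → ℂ) → ℂ)}
    (hS : ∀ G ∈ S, DefAt G ∧ (∀ᶠ z in 𝓝 0, DifferentiableAt ℂ G z) ∧
      ∀ i, ∃ H ∈ Algebra.adjoin ℂ (S ∪ {F | IsAn F}), _root_.pd i G =ᶠ[𝓝 0] H) {F : (κ → ℂ) → ℂ}
    (hF : F ∈ Algebra.adjoin ℂ (S ∪ {F | IsAn F})) : IsAn F := by
  refine ⟨Algebra.adjoin ℂ (S ∪ {F | IsAn F}), fun G hG => ?_, hF⟩
  induction hG using Algebra.adjoin_induction with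
  | mem G hG =>
    rcases hG with hG | hG
    · exact hS G hG
    · exact ⟨IsAn.defAt hG, IsAn.diff hG, fun i =>
        ⟨_, Algebra.subset_adjoin (Or.inr (IsAn.pd hG i)), EventuallyEq.rfl⟩⟩
  | algebraMap r =>
    refine ⟨DefAt.const r, Eventually.of_forall fun z => differentiableAt_const r, fun i =>
      ⟨0, zero_mem _, Eventually.of_forall fun z => ?_⟩⟩
    change fderiv ℂ (fun _ => r) z _ = 0
    simp
  | add F G _ _ hF hG =>
    refine ⟨hF.1.map₂ hG.1 TameC.add, ?_, fun i => ?_⟩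
    · filter_upwards [hF.2.1, hG.2.1] with z h1 h2 using h1.add h2
    · obtain ⟨F', hF', h1⟩ := hF.2.2 i
      obtain ⟨G', hG', h2⟩ := hG.2.2 i
      refine ⟨F' + G', add_mem hF' hG', ?_⟩
      filter_upwards [hF.2.1, hG.2.1, h1, h2] with z a b c d
      rw [pd_add a b, c, d]; rfl
  | mul F G mF mG hF hG =>
    refine ⟨hF.1.map₂ hG.1 TameC.mul, ?_, fun i => ?_⟩
    · filter_upwards [hF.2.1, hG.2.1] with z h1 h2 using h1.mul h2
    · obtain ⟨F', hF', h1⟩ := hF.2.2 i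
      obtain ⟨G', hG', h2⟩ := hG.2.2 i
      refine ⟨F' * G + F * G', add_mem (mul_mem hF' mG) (mul_mem mF hG'), ?_⟩
      filter_upwards [hF.2.1, hG.2.1, h1, h2] with z a b c d
      rw [pd_mul a b, c, d]; rfl

theorem IsAn.of_system {S : Set ((κ → ℂ) → ℂ)}
    (hS : ∀ G ∈ S, DefAt G ∧ (∀ᶠ z in 𝓝 0, DifferentiableAt ℂ G z) ∧
      ∀ i, ∃ H ∈ Algebra.adjoin ℂ (S ∪ {F | IsAn F}), _root_.pd i G =ᶠ[𝓝 0] H) {F : (κ → ℂ) → ℂ}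
    (hF : F ∈ S) : IsAn F :=
  IsAn.of_adjoin hS (Algebra.subset_adjoin (Or.inl hF))

theorem isAn_of_mem_adjoin (hF : F ∈ Algebra.adjoin ℂ {F : (κ → ℂ) → ℂ | IsAn F}) :
    IsAn F :=
  IsAn.of_adjoin (S := ∅) (by simp) (by simpa using hF)

variable (κ) in
/-- The algebra of definable holomorphic germs. -/
def anAlg : Subalgebra ℂ ((κ → ℂ) → ℂ) := Algebra.adjoin ℂ {F : (κ → ℂ) → ℂ | IsAn F}

theorem mem_anAlg : F ∈ anAlg κ ↔ IsAn F :=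
  ⟨isAn_of_mem_adjoin, fun h => Algebra.subset_adjoin h⟩

theorem IsAn.const (c : ℂ) : IsAn fun _ : κ → ℂ => c :=
  mem_anAlg.1 ((anAlg κ).algebraMap_mem c)

theorem IsAn.add (hF : IsAn F) (hG : IsAn G) : IsAn fun z => F z + G z :=
  mem_anAlg.1 (add_mem (mem_anAlg.2 hF) (mem_anAlg.2 hG))

theorem IsAn.mul (hF : IsAn F) (hG : IsAn G) : IsAn fun z => F z * G z :=
  mem_anAlg.1 (mul_mem (mem_anAlg.2 hF) (mem_anAlg.2 hG))

theorem IsAn.neg (hF : IsAn F) : IsAn fun z => -F z :=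
  mem_anAlg.1 (neg_mem (mem_anAlg.2 hF))

theorem IsAn.sub (hF : IsAn F) (hG : IsAn G) : IsAn fun z => F z - G z :=
  mem_anAlg.1 (sub_mem (mem_anAlg.2 hF) (mem_anAlg.2 hG))

theorem IsAn.pow (hF : IsAn F) (n : ℕ) : IsAn fun z => F z ^ n :=
  mem_anAlg.1 (pow_mem (mem_anAlg.2 hF) n)

theorem IsAn.sum {τ : Type*} {F : τ → (κ → ℂ) → ℂ} (s : Finset τ) (hF : ∀ i ∈ s, IsAn (F i)) :
    IsAn fun z => ∑ i ∈ s, F i z := by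
  have := mem_anAlg.1 (sum_mem (t := s) (f := F) fun i hi => mem_anAlg.2 (hF i hi))
  rwa [show (∑ i ∈ s, F i) = fun z => ∑ i ∈ s, F i z from by ext; simp] at this

theorem IsAn.prod {τ : Type*} {F : τ → (κ → ℂ) → ℂ} (s : Finset τ) (hF : ∀ i ∈ s, IsAn (F i)) :
    IsAn fun z => ∏ i ∈ s, F i z := by
  have := mem_anAlg.1 (prod_mem (t := s) (f := F) fun i hi => mem_anAlg.2 (hF i hi))
  rwa [show (∏ i ∈ s, F i) = fun z => ∏ i ∈ s, F i z from by ext; simp] at this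

theorem pd_coord [DecidableEq κ] (i j : κ) (z : κ → ℂ) :
    _root_.pd i (fun z : κ → ℂ => z j) z = if i = j then 1 else 0 := by
  have : fderiv ℂ (fun z : κ → ℂ => z j) z = ContinuousLinearMap.proj j :=
    (ContinuousLinearMap.proj (R := ℂ) (φ := fun _ : κ => ℂ) j).fderiv
  rw [_root_.pd, this]
  by_cases h : i = j
  · subst h; simp
  · simp [h, Ne.symm h]

theorem IsAn.coord (i : κ) : IsAn fun z : κ → ℂ => z i := by
  classical
  refine IsAn.of_system (S := {fun z : κ → ℂ => z i}) ?_ rfl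
  rintro _ rfl
  refine ⟨DefAt.coord i, Eventually.of_forall fun z => by fun_prop, fun j =>
    ⟨_, Subalgebra.algebraMap_mem _ (if j = i then 1 else 0), Eventually.of_forall fun z => ?_⟩⟩
  rw [pd_coord]; rfl

theorem IsAn.continuousAt (hF : IsAn F) : ContinuousAt F 0 :=
  hF.diff.self_of_nhds.continuousAt

theorem IsAn.tendsto_zero {G : ι → (κ → ℂ) → ℂ} (hG : ∀ i, IsAn (G i)) (h0 : ∀ i, G i 0 = 0) :
    Tendsto (fun z i => G i z) (𝓝 0) (𝓝 0) := by
  refine tendsto_pi_nhds.2 fun i => ?_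
  have := (hG i).continuousAt.tendsto
  rwa [h0 i] at this

theorem DefAt.comp {F : (ι → ℂ) → ℂ} {G : ι → (κ → ℂ) → ℂ} (hF : DefAt F) (hG : ∀ i, DefAt (G i))
    (ht : Tendsto (fun z i => G i z) (𝓝 0) (𝓝 0)) : DefAt fun z => F fun i => G i z := by
  obtain ⟨ε, hε, h1⟩ := hF.comp_tame
  choose δ hδ h2 using fun i => (hG i).of_le
  obtain ⟨η, hη, h3⟩ := Metric.eventually_nhds_iff.1
    (ht.eventually (Metric.ball_mem_nhds 0 hε))
  obtain ⟨θ, hθ, h4⟩ : ∃ θ > 0, ∀ i, θ ≤ δ i := by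
    rcases isEmpty_or_nonempty ι with h | h
    · exact ⟨1, one_pos, fun i => h.elim i⟩
    · obtain ⟨i, hi⟩ := Finite.exists_min δ
      exact ⟨δ i, hδ i, hi⟩
  have h0 := lt_min hη hθ
  refine ⟨min η θ, h0, ?_⟩
  have h5 := h1 ε hε le_rfl (fun i => h2 i _ h0 ((min_le_right _ _).trans (h4 i)))
  refine (TameC.ite (TPred.norm_lt TameC.cplx h0) h5 (TameC.const 0)).congr fun v => ?_
  change (if ‖cplx v‖ < _ then _ else _) = if ‖cplx v‖ < _ then _ else _
  split_ifs with h6 h7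
  · rfl
  · refine absurd ?_ h7
    have := h3 (y := cplx v) (by simpa using h6.trans_le (min_le_left _ _))
    simpa using this
  · rfl

theorem pd_comp {F : (ι → ℂ) → ℂ} {G : ι → (κ → ℂ) → ℂ} {z : κ → ℂ}
    (hF : DifferentiableAt ℂ F fun i => G i z) (hG : ∀ i, DifferentiableAt ℂ (G i) z) (k : κ) :
    _root_.pd k (fun z => F fun i => G i z) z =
      ∑ i, _root_.pd i F (fun i => G i z) * _root_.pd k (G i) z := by
  classical
  have h1 : HasFDerivAt (fun z i => G i z) (ContinuousLinearMap.pi fun i => fderiv ℂ (G i) z) z :=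
    hasFDerivAt_pi.2 fun i => (hG i).hasFDerivAt
  have h2 := (hF.hasFDerivAt.comp z h1).fderiv
  simp only [_root_.pd]
  change fderiv ℂ (F ∘ fun z i => G i z) z _ = _
  rw [h2, ContinuousLinearMap.comp_apply]
  conv_lhs => rw [← Finset.univ_sum_single (ContinuousLinearMap.pi (fun i => fderiv ℂ (G i) z) _)]
  rw [map_sum]
  refine Finset.sum_congr rfl fun i _ => ?_
  rw [ContinuousLinearMap.pi_apply]
  rw [show (Pi.single i (fderiv ℂ (G i) z (Pi.single k 1)) : ι → ℂ) =
    (fderiv ℂ (G i) z (Pi.single k 1)) • Pi.single i 1 by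
      rw [← Pi.single_smul]; simp]
  rw [map_smul, smul_eq_mul, mul_comm]

theorem IsAn.comp {F : (ι → ℂ) → ℂ} {G : ι → (κ → ℂ) → ℂ} (hF : IsAn F) (hG : ∀ i, IsAn (G i))
    (h0 : ∀ i, G i 0 = 0) : IsAn fun z => F fun i => G i z := by
  have ht := IsAn.tendsto_zero hG h0
  refine IsAn.of_system (S := {K | ∃ H : (ι → ℂ) → ℂ, IsAn H ∧ K = fun z => H fun i => G i z}) ?_
    ⟨F, hF, rfl⟩
  rintro _ ⟨H, hH, rfl⟩
  have hd := (ht.eventually hH.diff).and (eventually_all.2 fun i => (hG i).diff)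
  refine ⟨hH.defAt.comp (fun i => (hG i).defAt) ht, ?_, fun k => ?_⟩
  · filter_upwards [hd] with z hz
    exact hz.1.comp z (differentiableAt_pi.2 hz.2)
  · refine ⟨∑ i, (fun z => _root_.pd i H fun i => G i z) * (_root_.pd k (G i)), sum_mem fun i _ =>
      mul_mem (Algebra.subset_adjoin (Or.inl ⟨_, hH.pd i, rfl⟩))
        (Algebra.subset_adjoin (Or.inr ((hG i).pd k))), ?_⟩
    filter_upwards [hd] with z hz
    rw [pd_comp hz.1 hz.2]
    simp

theorem IsAn.inv (hF : IsAn F) (h0 : F 0 ≠ 0) : IsAn fun z => (F z)⁻¹ := by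
  have hne : ∀ᶠ z in 𝓝 0, F z ≠ 0 := hF.continuousAt.eventually_ne h0
  refine IsAn.of_system (S := {fun z => (F z)⁻¹}) ?_ rfl
  rintro _ rfl
  refine ⟨hF.defAt.map₂ hF.defAt (o := fun a _ => a⁻¹) fun h _ => h.inv, ?_, fun k => ?_⟩
  · filter_upwards [hF.diff, hne] with z h1 h2 using h1.inv h2
  · refine ⟨- ((_root_.pd k F) * ((fun z => (F z)⁻¹) * fun z => (F z)⁻¹)),
      neg_mem (mul_mem (Algebra.subset_adjoin (Or.inr (hF.pd k))) (mul_mem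
        (Algebra.subset_adjoin (Or.inl rfl)) (Algebra.subset_adjoin (Or.inl rfl)))), ?_⟩
    filter_upwards [hF.diff, hne] with z h1 h2
    have := ((hasDerivAt_inv h2).comp_hasFDerivAt z h1.hasFDerivAt).fderiv
    change fderiv ℂ (Inv.inv ∘ F) z _ = -(fderiv ℂ F z _ * ((F z)⁻¹ * (F z)⁻¹))
    rw [this]
    simp only [smul_apply, smul_eq_mul]
    field_simp

theorem IsAn.reindex {F : (ι → ℂ) → ℂ} (hF : IsAn F) (σ : ι → κ) :
    IsAn fun z : κ → ℂ => F fun i => z (σ i) :=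
  hF.comp (fun i => IsAn.coord (σ i)) fun _ => rfl

end AnalyticSystem

section ContourIntegrals

open Filter Topology Metric

variable {κ : Type} [Fintype κ]

/-- Adjoin a last complex variable to a tuple. -/
def ocons (t : ℂ) (w : κ → ℂ) (o : Option κ) : ℂ := o.elim t w

theorem ocons_zero : ocons 0 (0 : κ → ℂ) = 0 := by
  funext o; cases o <;> rfl

theorem norm_ocons_lt {t : ℂ} {w : κ → ℂ} {ε : ℝ} : ‖ocons t w‖ < ε ↔ ‖t‖ < ε ∧ ‖w‖ < ε := by
  rcases lt_or_ge 0 ε with h | h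
  · rw [pi_norm_lt_iff h, pi_norm_lt_iff h]
    simp [Option.forall, ocons]
  · exact ⟨fun h' => absurd ((norm_nonneg _).trans_lt h') h.not_gt,
      fun h' => absurd ((norm_nonneg _).trans_lt h'.1) h.not_gt⟩

theorem norm_ocons_le {t : ℂ} {w : κ → ℂ} {ε : ℝ} (h0 : 0 ≤ ε) :
    ‖ocons t w‖ ≤ ε ↔ ‖t‖ ≤ ε ∧ ‖w‖ ≤ ε := by
  rw [pi_norm_le_iff_of_nonneg h0, pi_norm_le_iff_of_nonneg h0]
  simp [Option.forall, ocons]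

theorem continuous_ocons : Continuous fun p : (κ → ℂ) × ℂ => ocons p.2 p.1 := by
  refine continuous_pi fun o => ?_
  cases o
  · exact continuous_snd
  · exact (continuous_apply (A := fun _ : κ => ℂ) _).comp continuous_fst

theorem hasFDerivAt_sum_pd {F : (κ → ℂ) → ℂ} {z : κ → ℂ} (h : DifferentiableAt ℂ F z) :
    HasFDerivAt F (∑ i, pd i F z • (ContinuousLinearMap.proj i : (κ → ℂ) →L[ℂ] ℂ)) z := by
  classical
  refine h.hasFDerivAt.congr_fderiv (ContinuousLinearMap.ext fun v => ?_)
  simp only [sum_apply, _root_.smul_apply,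
    ContinuousLinearMap.proj_apply, smul_eq_mul]
  conv_lhs => rw [← Finset.univ_sum_single v]
  rw [map_sum]
  refine Finset.sum_congr rfl fun i _ => ?_
  rw [show (Pi.single i (v i) : κ → ℂ) = (v i) • Pi.single i 1 by rw [← Pi.single_smul]; simp,
    map_smul, smul_eq_mul, mul_comm]
  rfl

theorem pd_eq_of_hasFDerivAt {F : (κ → ℂ) → ℂ} {z : κ → ℂ} {a : κ → ℂ}
    (h : HasFDerivAt F (∑ i, a i • (ContinuousLinearMap.proj i : (κ → ℂ) →L[ℂ] ℂ)) z) (i : κ) :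
    pd i F z = a i := by
  classical
  rw [pd, h.fderiv]
  simp [Pi.single_apply]

theorem hasFDerivAt_slice {F : (Option κ → ℂ) → ℂ} {t : ℂ} {w : κ → ℂ}
    (h : DifferentiableAt ℂ F (ocons t w)) :
    HasFDerivAt (fun w => F (ocons t w))
      (∑ i, pd (some i) F (ocons t w) • (ContinuousLinearMap.proj i : (κ → ℂ) →L[ℂ] ℂ)) w := by
  have h1 : HasFDerivAt (fun w : κ → ℂ => ocons t w) (ContinuousLinearMap.pi fun o : Option κ =>
      (o.elim 0 fun i => ContinuousLinearMap.proj i : (κ → ℂ) →L[ℂ] ℂ)) w := by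
    refine hasFDerivAt_pi.2 fun o => ?_
    cases o
    · exact hasFDerivAt_const _ _
    · exact (ContinuousLinearMap.proj _ : (κ → ℂ) →L[ℂ] ℂ).hasFDerivAt
  have h2 := (hasFDerivAt_sum_pd h).comp w h1
  refine h2.congr_fderiv (ContinuousLinearMap.ext fun v => ?_)
  simp [Fintype.sum_option]

theorem hasDerivAt_slice {F : (Option κ → ℂ) → ℂ} {t : ℂ} {w : κ → ℂ}
    (h : DifferentiableAt ℂ F (ocons t w)) :
    HasDerivAt (fun t => F (ocons t w)) (pd none F (ocons t w)) t := by
  have h1 : HasDerivAt (fun t : ℂ => ocons t w) (fun o : Option κ => (o.elim 1 fun _ => 0 : ℂ)) t := by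
    refine hasDerivAt_pi.2 fun o => ?_
    cases o
    · exact hasDerivAt_id t
    · exact hasDerivAt_const _ _
  have h2 := (hasFDerivAt_sum_pd h).comp_hasDerivAt t h1
  refine h2.congr_deriv ?_
  simp [Fintype.sum_option]

/-- Differentiation under a contour integral. -/
theorem hasFDerivAt_circleIntegral {Φ : (κ → ℂ) → ℂ → ℂ} {Ψ : κ → (κ → ℂ) → ℂ → ℂ} {R δ : ℝ}
    (hR : 0 ≤ R) (hΦ : ContinuousOn (fun p : (κ → ℂ) × ℂ => Φ p.1 p.2)
      (closedBall 0 δ ×ˢ sphere 0 R))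
    (hΨ : ∀ i, ContinuousOn (fun p : (κ → ℂ) × ℂ => Ψ i p.1 p.2) (closedBall 0 δ ×ˢ sphere 0 R))
    (hd : ∀ w ∈ ball 0 δ, ∀ ζ ∈ sphere 0 R, HasFDerivAt (fun w => Φ w ζ)
      (∑ i, Ψ i w ζ • (ContinuousLinearMap.proj i : (κ → ℂ) →L[ℂ] ℂ)) w) {w : κ → ℂ}
    (hw : w ∈ ball 0 δ) :
    HasFDerivAt (fun w => ∮ ζ in C(0, R), Φ w ζ)
      (∑ i, (∮ ζ in C(0, R), Ψ i w ζ) • (ContinuousLinearMap.proj i : (κ → ℂ) →L[ℂ] ℂ)) w := by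
  have hc : ∀ f : (κ → ℂ) → ℂ → ℂ, ContinuousOn (fun p : (κ → ℂ) × ℂ => f p.1 p.2)
      (closedBall 0 δ ×ˢ sphere 0 R) → ∀ w ∈ closedBall (0 : κ → ℂ) δ,
      Continuous fun θ : ℝ => deriv (circleMap 0 R) θ • f w (circleMap 0 R θ) := by
    intro f hf w hw
    have h1 : Continuous fun θ : ℝ => f w (circleMap 0 R θ) := by
      refine hf.comp_continuous (f := fun θ : ℝ => (w, circleMap 0 R θ)) ?_ ?_
      · exact continuous_const.prodMk (continuous_circleMap 0 R)
      · exact fun θ => ⟨hw, circleMap_mem_sphere 0 hR θ⟩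
    simp only [deriv_circleMap]
    exact ((continuous_circleMap 0 R).mul continuous_const).smul h1
  have hb : ∀ f : (κ → ℂ) → ℂ → ℂ, ContinuousOn (fun p : (κ → ℂ) × ℂ => f p.1 p.2)
      (closedBall 0 δ ×ˢ sphere 0 R) → ∃ B, ∀ w ∈ closedBall (0 : κ → ℂ) δ, ∀ ζ ∈ sphere (0:ℂ) R,
      ‖f w ζ‖ ≤ B := by
    intro f hf
    obtain ⟨B, hB⟩ := ((isCompact_closedBall _ _).prod (isCompact_sphere _
        _)).exists_bound_of_continuousOn hf
    exact ⟨B, fun w hw ζ hζ => hB (w, ζ) ⟨hw, hζ⟩⟩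
  choose B hB using fun i => hb (Ψ i) (hΨ i)
  have hwc : w ∈ closedBall (0 : κ → ℂ) δ := ball_subset_closedBall hw
  have hF'c : Continuous fun θ : ℝ => deriv (circleMap 0 R) θ • ∑ i, Ψ i w (circleMap 0 R θ) •
      (ContinuousLinearMap.proj i : (κ → ℂ) →L[ℂ] ℂ) := by
    simp only [Finset.smul_sum, ← smul_assoc]
    exact continuous_finsetSum _ fun i _ => (hc (Ψ i) (hΨ i) w hwc).smul continuous_const
  have key := intervalIntegral.hasFDerivAt_integral_of_dominated_of_fderiv_le (𝕜 := ℂ)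
    (μ := MeasureTheory.volume) (a := 0) (b := 2 * Real.pi) (s := ball 0 δ) (x₀ := w)
    (F := fun w θ => deriv (circleMap 0 R) θ • Φ w (circleMap 0 R θ))
    (F' := fun w θ => deriv (circleMap 0 R) θ • ∑ i, Ψ i w (circleMap 0 R θ) •
      (ContinuousLinearMap.proj i : (κ → ℂ) →L[ℂ] ℂ))
    (bound := fun θ => R * ∑ i, B i * ‖(ContinuousLinearMap.proj i : (κ → ℂ) →L[ℂ] ℂ)‖)
    (isOpen_ball.mem_nhds hw)
    (by
      filter_upwards [isOpen_ball.mem_nhds hw] with w hw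
      exact (hc Φ hΦ w (ball_subset_closedBall hw)).aestronglyMeasurable)
    ((hc Φ hΦ w hwc).intervalIntegrable _ _)
    hF'c.aestronglyMeasurable
    (by
      refine Eventually.of_forall fun θ _ w hw => ?_
      rw [norm_smul, deriv_circleMap]
      have h1 : ‖circleMap 0 R θ * I‖ = R := by simp [abs_of_nonneg hR]
      rw [h1]
      refine mul_le_mul_of_nonneg_left ((norm_sum_le _ _).trans (Finset.sum_le_sum fun i _ => ?_))
        hR
      rw [norm_smul]
      exact mul_le_mul_of_nonneg_right (hB i w (ball_subset_closedBall hw) _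
        (circleMap_mem_sphere 0 hR θ)) (norm_nonneg _))
    (continuous_const.intervalIntegrable _ _)
    (by
      refine Eventually.of_forall fun θ _ w hw => ?_
      exact (hd w hw _ (circleMap_mem_sphere 0 hR θ)).const_smul (deriv (circleMap 0 R) θ))
  refine key.congr_fderiv (ContinuousLinearMap.ext fun v => ?_)
  rw [ContinuousLinearMap.intervalIntegral_apply (hF'c.intervalIntegrable _ _)]
  simp only [circleIntegral, sum_apply, _root_.smul_apply,
    ContinuousLinearMap.proj_apply, Finset.smul_sum, smul_eq_mul]
  rw [intervalIntegral.integral_finsetSum]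
  · refine Finset.sum_congr rfl fun i _ => ?_
    rw [← intervalIntegral.integral_mul_const]
    simp only [mul_assoc]
  · intro i _
    refine Continuous.intervalIntegrable ?_ _ _
    have := (hc (Ψ i) (hΨ i) w hwc).mul (continuous_const (y := v i))
    refine this.congr fun θ => ?_
    simp [mul_assoc]

end ContourIntegrals

section DividedDifferences

open Filter Topology Metric

variable {κ : Type} [Fintype κ]

/-- Holomorphy on a closed polydisc. -/
def HolOn (F : (κ → ℂ) → ℂ) (ε : ℝ) : Prop := ∀ z, ‖z‖ ≤ ε → DifferentiableAt ℂ F z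

theorem HolOn.mono {F : (κ → ℂ) → ℂ} {ε δ : ℝ} (h : HolOn F ε) (hδ : δ ≤ ε) : HolOn F δ :=
  fun z hz => h z (hz.trans hδ)

theorem IsAn.holOn {F : (κ → ℂ) → ℂ} (hF : IsAn F) : ∃ ε > 0, HolOn F ε := by
  obtain ⟨ε, hε, h⟩ := Metric.eventually_nhds_iff.1 hF.diff
  refine ⟨ε / 2, half_pos hε, fun z hz => h ?_⟩
  simpa using hz.trans_lt (half_lt_self hε)

theorem IsAn.iterate_pd {F : (κ → ℂ) → ℂ} (hF : IsAn F) (i : κ) (k : ℕ) :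
    IsAn ((_root_.pd i)^[k] F) := by
  induction k with
  | zero => exact hF
  | succ k ih => rw [Function.iterate_succ_apply']; exact ih.pd i

theorem HolOn.slice {F : (Option κ → ℂ) → ℂ} {ε : ℝ} (hε : 0 ≤ ε) (h : HolOn F ε) {w : κ → ℂ}
    (hw : ‖w‖ ≤ ε) {t : ℂ} (ht : ‖t‖ ≤ ε) :
    HasDerivAt (fun t => F (ocons t w)) (pd none F (ocons t w)) t :=
  hasDerivAt_slice (h _ ((norm_ocons_le hε).2 ⟨ht, hw⟩))

theorem HolOn.continuousOn_slice {F : (Option κ → ℂ) → ℂ} {ε : ℝ} (hε : 0 ≤ ε) (h : HolOn F ε)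
    {w : κ → ℂ} (hw : ‖w‖ ≤ ε) :
    ContinuousOn (fun t => F (ocons t w)) (closedBall 0 ε) := fun _ ht =>
  (h.slice hε hw (by simpa using ht)).continuousAt.continuousWithinAt

theorem cauchy_iterate_pd {ε : ℝ} (hε : 0 < ε) {w : κ → ℂ} (hw : ‖w‖ ≤ ε) {r : ℂ} (hr : ‖r‖ < ε)
    (k : ℕ) : ∀ {F : (Option κ → ℂ) → ℂ}, (∀ j ≤ k, HolOn ((pd none)^[j] F) ε) →
      (∮ ζ in C(0, ε), F (ocons ζ w) / (ζ - r) ^ (k + 1)) =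
        2 * Real.pi * I * (((pd none)^[k] F) (ocons r w) / (k.factorial : ℂ)) := by
  have hne : ∀ z ∈ sphere (0 : ℂ) ε, z - r ≠ 0 := by
    intro z hz h
    rw [sub_eq_zero] at h
    subst h
    simp only [mem_sphere_iff_norm, sub_zero] at hz
    exact hr.ne hz
  induction k with
  | zero =>
    intro F hF
    have h0 := hF 0 le_rfl
    have := DifferentiableOn.circleIntegral_sub_inv_smul (c := 0) (R := ε) (w := r)
      (f := fun t => F (ocons t w)) (fun t ht => (h0.slice hε.le hw
        (by simpa using ht)).differentiableAt.differentiableWithinAt)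
      (by simpa using hr)
    simp only [smul_eq_mul] at this
    simp only [zero_add, pow_one, Function.iterate_zero, id, Nat.factorial_zero, Nat.cast_one,
      div_one]
    rw [← this]
    refine circleIntegral.integral_congr hε.le fun z _ => ?_
    simp only [div_eq_mul_inv, mul_comm]
  | succ k ih =>
    intro F hF
    have h0 : HolOn F ε := hF 0 (Nat.zero_le _)
    have h1 : HolOn (pd none F) ε := hF 1 (by omega)
    have e1 := ih (F := pd none F) fun j hj => by
      have := hF (j + 1) (by omega)
      rwa [Function.iterate_succ_apply] at this
    have e2 : (∮ ζ in C(0, ε), (pd none F (ocons ζ w) / (ζ - r) ^ (k + 1) -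
        (k + 1) * (F (ocons ζ w) / (ζ - r) ^ (k + 2)))) = 0 := by
      refine circleIntegral.integral_eq_zero_of_hasDerivWithinAt'
        (f := fun ζ => F (ocons ζ w) / (ζ - r) ^ (k + 1)) ?_
      intro z hz
      rw [abs_of_pos hε] at hz
      have hz' : ‖z‖ ≤ ε := by simpa using hz.le
      refine HasDerivAt.hasDerivWithinAt ?_
      have := (h0.slice hε.le hw hz').div (((hasDerivAt_id z).sub_const r).pow (k + 1))
        (pow_ne_zero _ (hne z hz))
      refine this.congr_deriv ?_
      have := hne z hz
      simp only [id, Pi.pow_apply]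
      field_simp
      push_cast
      ring
    have c1 : ContinuousOn (fun ζ => pd none F (ocons ζ w) / (ζ - r) ^ (k + 1)) (sphere 0 ε) :=
      ((h1.continuousOn_slice hε.le hw).mono sphere_subset_closedBall).div (by fun_prop)
        fun z hz => pow_ne_zero _ (hne z hz)
    have c2 : ContinuousOn (fun ζ => F (ocons ζ w) / (ζ - r) ^ (k + 2)) (sphere 0 ε) :=
      ((h0.continuousOn_slice hε.le hw).mono sphere_subset_closedBall).div (by fun_prop)
        fun z hz => pow_ne_zero _ (hne z hz)
    have c2' : ContinuousOn (fun ζ => ((k : ℂ) + 1) * (F (ocons ζ w) / (ζ - r) ^ (k + 2)))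
        (sphere 0 ε) := continuousOn_const.mul c2
    rw [circleIntegral.integral_sub (c1.circleIntegrable hε.le)
      (c2'.circleIntegrable hε.le), e1,
      circleIntegral.integral_const_mul, sub_eq_zero] at e2
    rw [Function.iterate_succ_apply, Nat.factorial_succ]
    have hk : ((k : ℂ) + 1) ≠ 0 := by exact_mod_cast Nat.succ_ne_zero k
    apply mul_left_cancel₀ hk
    rw [← e2]
    push_cast
    field_simp

theorem DefAt.comp_ocons {F : (Option κ → ℂ) → ℂ} (hF : DefAt F) : ∃ ε > 0, ∀ δ, 0 < δ → δ ≤ ε →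
    ∀ {α : Type} {g : κ → (α → ℝ) → ℂ} {r : (α → ℝ) → ℂ}, (∀ k, TameC (g k)) → TameC r →
      TameC fun x => if ‖fun k => g k x‖ < δ ∧ ‖r x‖ < δ then F (ocons (r x) fun k => g k x) else 0 := by
  obtain ⟨ε, hε, h⟩ := hF.comp_tame
  refine ⟨ε, hε, fun δ h1 h2 α g r hg hr => ?_⟩
  refine (h δ h1 h2 (g := fun o : Option κ => o.elim r g) ?_).congr fun x => ?_
  · rintro (_ | k)
    exacts [hr, hg k]
  · have : (fun k : Option κ => (k.elim r g) x) = ocons (r x) fun k => g k x := by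
      funext k; cases k <;> rfl
    rw [this]
    simp only [norm_ocons_lt, and_comm]

theorem divided_difference_step {f : ℂ → ℂ} {ε : ℝ} (hε : 0 < ε) (hf : ContinuousOn f (sphere 0 ε))
    {k : ℕ} {r : Fin (k + 1) → ℂ} (hr : ∀ i, ‖r i‖ < ε) {j : Fin (k + 1)} (hj : r j ≠ r 0) :
    (∮ ζ in C(0, ε), f ζ / ∏ i, (ζ - r i)) =
      ((∮ ζ in C(0, ε), f ζ / ∏ i, (ζ - r (j.succAbove i))) -
        ∮ ζ in C(0, ε), f ζ / ∏ i, (ζ - r ((0 : Fin (k + 1)).succAbove i))) / (r 0 - r j) := by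
  have hne : ∀ z ∈ sphere (0 : ℂ) ε, ∀ i, z - r i ≠ 0 := by
    intro z hz i h
    rw [sub_eq_zero] at h
    subst h
    simp only [mem_sphere_iff_norm, sub_zero] at hz
    exact (hr i).ne hz
  have hc : ∀ l : Fin (k + 1),
      ContinuousOn (fun ζ => f ζ / ∏ i, (ζ - r (l.succAbove i))) (sphere 0 ε) := fun l =>
    hf.div (by fun_prop) fun z hz => Finset.prod_ne_zero_iff.2 fun i _ => hne z hz _
  rw [← circleIntegral.integral_sub ((hc j).circleIntegrable hε.le)
    ((hc 0).circleIntegrable hε.le), eq_div_iff (sub_ne_zero.2 hj.symm), mul_comm,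
    ← circleIntegral.integral_const_mul]
  refine circleIntegral.integral_congr hε.le fun z hz => ?_
  have e1 := Fin.prod_univ_succAbove (fun i => z - r i) j
  have e2 := Fin.prod_univ_succAbove (fun i => z - r i) 0
  have n1 : ∏ i, (z - r (j.succAbove i)) ≠ 0 := Finset.prod_ne_zero_iff.2 fun i _ => hne z hz _
  have n2 : ∏ i, (z - r ((0 : Fin (k + 1)).succAbove i)) ≠ 0 :=
    Finset.prod_ne_zero_iff.2 fun i _ => hne z hz _
  have n0 : ∏ i, (z - r i) ≠ 0 := Finset.prod_ne_zero_iff.2 fun i _ => hne z hz _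
  have h1 : f z / ∏ i, (z - r (j.succAbove i)) = f z * (z - r j) / ∏ i, (z - r i) := by
    rw [e1]; field_simp [hne z hz j]
  have h2 : f z / ∏ i, (z - r ((0 : Fin (k + 1)).succAbove i)) =
      f z * (z - r 0) / ∏ i, (z - r i) := by
    rw [e2]; field_simp [hne z hz 0]
  simp only [h1, h2]
  field_simp
  ring

open Classical in
/-- Divided differences of a definable holomorphic germ are definable. -/
theorem tameC_divided_difference {F : (Option κ → ℂ) → ℂ} {ε : ℝ} (hε : 0 < ε) (k : ℕ)
    (hF : ∀ j < k, HolOn ((pd none)^[j] F) ε) (hF0 : HolOn F ε)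
    (hD : ∀ j < k, ∀ {α : Type} {g : κ → (α → ℝ) → ℂ} {r : (α → ℝ) → ℂ}, (∀ k, TameC (g k)) →
      TameC r → TameC fun x => if ‖fun k => g k x‖ < ε ∧ ‖r x‖ < ε then
        ((pd none)^[j] F) (ocons (r x) fun k => g k x) else 0)
    {α : Type} {g : κ → (α → ℝ) → ℂ} (hg : ∀ k, TameC (g k)) :
    ∀ {r : Fin k → (α → ℝ) → ℂ}, (∀ i, TameC (r i)) →
    TameC fun x => if ‖fun k => g k x‖ < ε ∧ ∀ i, ‖r i x‖ < ε then
      ∮ ζ in C(0, ε), F (ocons ζ fun k => g k x) / ∏ i, (ζ - r i x) else 0 := by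
  induction k with
  | zero =>
    intro r _
    refine (TameC.const 0).congr fun x => ?_
    split_ifs with h
    · simp only [Finset.univ_eq_empty, Finset.prod_empty, div_one]
      refine Complex.circleIntegral_eq_zero_of_differentiable_on_off_countable hε.le
        Set.countable_empty (hF0.continuousOn_slice hε.le h.1.le) fun z hz => ?_
      exact (hF0.slice hε.le h.1.le (by simpa using (mem_ball_zero_iff.1 hz.1).le)).differentiableAt
    · rfl
  | succ k ih =>
    intro r hr
    have ih' := fun (l : Fin (k + 1)) => ih (fun j hj => hF j (by omega))
      (fun j hj => hD j (by omega)) (r := fun i => r (l.succAbove i)) fun i => hr _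
    have hcond : TPred fun x => ‖fun k => g k x‖ < ε ∧ ∀ i, ‖r i x‖ < ε :=
      (TPred.norm_lt hg hε).and (TPred.forall fun i => (hr i).norm_lt ε)
    have hall : TPred fun x => ∀ i, r i x = r 0 x := TPred.forall fun i => (hr i).eq (hr 0)
    have hmin : ∀ j, TPred fun x => (∀ i < j, r i x = r 0 x) ∧ r j x ≠ r 0 x := fun j =>
      (TPred.forall fun i => (TPred.const _).imp ((hr i).eq (hr 0))).and ((hr j).eq (hr 0)).not
    refine (TameC.ite hcond ((TameC.sum Finset.univ fun j _ => TameC.ite (hmin j)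
      (((ih' j).sub (ih' 0)).div ((hr 0).sub (hr j))) (TameC.const 0)).add (TameC.ite hall
      ((TameC.const (2 * Real.pi * I)).mul ((hD k (by omega) hg (hr 0)).div
        (TameC.const (k.factorial : ℂ)))) (TameC.const 0))) (TameC.const 0)).congr fun x => ?_
    by_cases h : ‖fun k => g k x‖ < ε ∧ ∀ i, ‖r i x‖ < ε
    swap
    · rw [if_neg h, if_neg h]
    rw [if_pos h, if_pos h]
    by_cases h1 : ∀ i, r i x = r 0 x
    · rw [if_pos h1, Finset.sum_eq_zero, zero_add, if_pos ⟨h.1, h.2 0⟩,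
        ← cauchy_iterate_pd hε h.1.le (h.2 0) k fun j hj => hF j (by omega)]
      · refine circleIntegral.integral_congr hε.le fun z _ => ?_
        simp [h1]
      · intro j _
        rw [if_neg]
        simp [h1]
    · rw [if_neg h1, add_zero]
      push Not at h1
      obtain ⟨j, hj, hj'⟩ : ∃ j, r j x ≠ r 0 x ∧ ∀ i < j, r i x = r 0 x := by
        obtain ⟨j, hj, hj'⟩ := WellFounded.has_min (wellFounded_lt (α := Fin (k + 1)))
          {i | r i x ≠ r 0 x} h1
        exact ⟨j, hj, fun i hi => by_contra fun h => hj' i h hi⟩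
      rw [Finset.sum_eq_single j]
      · rw [if_pos ⟨hj', hj⟩, if_pos ⟨h.1, fun i => h.2 _⟩, if_pos ⟨h.1, fun i => h.2 _⟩]
        exact divided_difference_step (r := fun i => r i x) hε
          ((hF0.continuousOn_slice hε.le h.1.le).mono sphere_subset_closedBall) h.2 hj
      · intro i _ hij
        rw [if_neg]
        rintro ⟨h2, h3⟩
        rcases lt_or_gt_of_ne hij with h4 | h4
        · exact h3 (hj' i h4)
        · exact hj (h2 j h4)
      · simp

end DividedDifferences

section DistinguishedQuotients

open Filter Topology Metric

variable {κ : Type} [Fintype κ]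

/-- Germs which are monic polynomials in the first variable with small definable roots. -/
structure PolyLike (D : (Option κ → ℂ) → ℂ) : Prop where
  an : IsAn D
  roots : ∃ (M : ℕ) (r : Fin M → (κ → ℂ) → ℂ), (∀ i, DefAt (r i)) ∧
    (∀ i, Tendsto (r i) (𝓝 0) (𝓝 0)) ∧ ∀ᶠ w in 𝓝 0, ∀ t, D (ocons t w) = ∏ i, (t - r i w)

theorem PolyLike.mul {D E : (Option κ → ℂ) → ℂ} (hD : PolyLike D) (hE : PolyLike E) :
    PolyLike fun z => D z * E z := by
  obtain ⟨M, r, h1, h2, h3⟩ := hD.roots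
  obtain ⟨N, s, k1, k2, k3⟩ := hE.roots
  refine ⟨hD.an.mul hE.an, M + N, Fin.append r s, ?_, ?_, ?_⟩
  · refine fun i => Fin.addCases (fun i => ?_) (fun i => ?_) i
    · simpa using h1 i
    · simpa using k1 i
  · refine fun i => Fin.addCases (fun i => ?_) (fun i => ?_) i
    · simpa using h2 i
    · simpa using k2 i
  · filter_upwards [h3, k3] with w h k t
    simp [Fin.prod_univ_add, h, k]

theorem PolyLike.ne_zero {D : (Option κ → ℂ) → ℂ} (hD : PolyLike D) {ε : ℝ} (hε : 0 < ε) :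
    ∀ᶠ w in 𝓝 0, ∀ t : ℂ, ε ≤ ‖t‖ → D (ocons t w) ≠ 0 := by
  obtain ⟨M, r, -, h2, h3⟩ := hD.roots
  filter_upwards [h3, eventually_all.2 fun i => (h2 i).eventually (ball_mem_nhds 0 hε)] with w h k t
    ht
  rw [h]
  refine Finset.prod_ne_zero_iff.2 fun i _ h0 => ?_
  rw [sub_eq_zero] at h0
  subst h0
  exact absurd (by simpa using k i) ht.not_gt

/-- The germ of the contour integral of `N / D` around the roots of `D`. -/
def CInt (N D : (Option κ → ℂ) → ℂ) (f : (κ → ℂ) → ℂ) : Prop :=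
  ∀ᶠ ε in 𝓝[>] (0 : ℝ), ∀ᶠ w in 𝓝 0,
    f w = (2 * Real.pi * I)⁻¹ * ∮ ζ in C(0, ε), N (ocons ζ w) / D (ocons ζ w)

theorem eventually_le_pos {ε₀ : ℝ} (h : 0 < ε₀) : ∀ᶠ ε in 𝓝[>] (0 : ℝ), 0 < ε ∧ ε ≤ ε₀ :=
  Ioc_mem_nhdsGT h

variable {N D : (Option κ → ℂ) → ℂ}

theorem PolyLike.holOn_div {w : κ → ℂ} {t : ℂ} {ε : ℝ} (hε : 0 ≤ ε)
    (hN : HolOn N ε) (hD : HolOn D ε) (hw : ‖w‖ ≤ ε) (ht : ‖t‖ ≤ ε) (h : D (ocons t w) ≠ 0) :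
    DifferentiableAt ℂ (fun t => N (ocons t w) / D (ocons t w)) t :=
  (hN.slice hε hw ht).differentiableAt.div (hD.slice hε hw ht).differentiableAt h

theorem PolyLike.exists_cInt (hD : PolyLike D) (hN : IsAn N) :
    ∃ f, CInt N D f := by
  obtain ⟨ε₁, h1, hN⟩ := hN.holOn
  obtain ⟨ε₂, h2, hD'⟩ := hD.an.holOn
  have h0 := lt_min h1 h2
  refine ⟨fun w => (2 * Real.pi * I)⁻¹ * ∮ ζ in C(0, min ε₁ ε₂), N (ocons ζ w) / D (ocons ζ w), ?_⟩
  filter_upwards [eventually_le_pos h0] with ε hε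
  filter_upwards [hD.ne_zero hε.1, closedBall_mem_nhds 0 h0] with w hw hw'
  have key : ∀ z : ℂ, ‖z‖ ≤ min ε₁ ε₂ → ε ≤ ‖z‖ →
      DifferentiableAt ℂ (fun t => N (ocons t w) / D (ocons t w)) z := fun z hz hz' =>
    PolyLike.holOn_div h0.le (hN.mono (min_le_left _ _)) (hD'.mono (min_le_right _ _))
      (by simpa using hw') hz (hw z hz')
  congr 1
  refine Complex.circleIntegral_eq_of_differentiable_on_annulus_off_countable hε.1 hε.2
    Set.countable_empty (fun z hz => ?_) (fun z hz => ?_)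
  · exact (key z (by simpa using hz.1) (by simpa using hz.2)).continuousAt.continuousWithinAt
  · have a1 := mem_ball_zero_iff.1 hz.1.1
    have a2 := hz.1.2
    simp only [mem_closedBall_zero_iff, not_le] at a2
    exact key z a1.le a2.le

theorem CInt.hasFDerivAt {f : (κ → ℂ) → ℂ} (hD : PolyLike D)
    (hN : IsAn N) (hf : CInt N D f) : (∀ᶠ w in 𝓝 0, DifferentiableAt ℂ f w) ∧
      ∀ i, CInt (fun z => pd (some i) N z * D z - N z * pd (some i) D z) (fun z => D z * D z)
        (pd i f) := by
  have main : ∀ᶠ ε in 𝓝[>] (0 : ℝ), ∀ᶠ w in 𝓝 0, HasFDerivAt f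
      (∑ i, ((2 * Real.pi * I)⁻¹ * ∮ ζ in C(0, ε), (pd (some i) N (ocons ζ w) * D (ocons ζ w) -
        N (ocons ζ w) * pd (some i) D (ocons ζ w)) / (D (ocons ζ w) * D (ocons ζ w))) •
        (ContinuousLinearMap.proj i : (κ → ℂ) →L[ℂ] ℂ)) w := by
    have hpd : ∀ G : (Option κ → ℂ) → ℂ, IsAn G → ∀ᶠ ε in 𝓝[>] (0 : ℝ), HolOn G ε := by
      intro G hG
      obtain ⟨ε₁, h1, hG⟩ := hG.holOn
      filter_upwards [eventually_le_pos h1] with ε hε using hG.mono hε.2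
    filter_upwards [hf, self_mem_nhdsWithin, hpd N hN, hpd D hD.an,
      eventually_all.2 fun i => hpd _ (hN.pd (some i)),
      eventually_all.2 fun i => hpd _ (hD.an.pd (some i))] with ε h1 hε hN1 hD1 hN2 hD2
    have hε : 0 < ε := hε
    obtain ⟨δ, hδ, h2⟩ := Metric.eventually_nhds_iff.1 (h1.and (hD.ne_zero hε))
    have hδ' : 0 < min (δ / 2) ε := lt_min (half_pos hδ) hε
    have h2' : ∀ w ∈ closedBall (0 : κ → ℂ) (min (δ / 2) ε), ‖w‖ ≤ ε ∧ dist w 0 < δ := by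
      intro w hw
      rw [mem_closedBall] at hw
      have := (hw.trans (min_le_left _ _)).trans_lt (half_lt_self hδ)
      exact ⟨by simpa using hw.trans (min_le_right _ _), this⟩
    filter_upwards [ball_mem_nhds 0 hδ'] with w hw
    have hcont : ∀ G, HolOn G ε → ContinuousOn (fun p : (κ → ℂ) × ℂ => G (ocons p.2 p.1))
        (closedBall 0 (min (δ / 2) ε) ×ˢ sphere 0 ε) := by
      rintro G hG ⟨w, t⟩ ⟨hw, ht⟩
      refine ContinuousAt.continuousWithinAt ?_
      refine ContinuousAt.comp (f := fun p : (κ → ℂ) × ℂ => ocons p.2 p.1) (g := G) ?_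
        continuous_ocons.continuousAt
      exact (hG _ ((norm_ocons_le hε.le).2 ⟨by simpa using (mem_sphere_zero_iff_norm.1 ht).le,
        (h2' w hw).1⟩)).continuousAt
    have hne : ∀ p ∈ closedBall (0 : κ → ℂ) (min (δ / 2) ε) ×ˢ sphere (0 : ℂ) ε,
        D (ocons p.2 p.1) ≠ 0 := fun p hp =>
      (h2 (h2' p.1 hp.1).2).2 _ (mem_sphere_zero_iff_norm.1 hp.2).ge
    have key := hasFDerivAt_circleIntegral (R := ε) (δ := min (δ / 2) ε)
      (Φ := fun w ζ => N (ocons ζ w) / D (ocons ζ w))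
      (Ψ := fun i w ζ => (pd (some i) N (ocons ζ w) * D (ocons ζ w) -
        N (ocons ζ w) * pd (some i) D (ocons ζ w)) / (D (ocons ζ w) * D (ocons ζ w))) hε.le
      ((hcont N hN1).div (hcont D hD1) hne)
      (fun i => (((hcont _ (hN2 i)).mul (hcont D hD1)).sub ((hcont N hN1).mul
        (hcont _ (hD2 i)))).div
        ((hcont D hD1).mul (hcont D hD1)) fun p hp => mul_ne_zero (hne p hp) (hne p hp))
      (fun w hw ζ hζ => by
        have hw := ball_subset_closedBall hw
        have hz : ‖ocons ζ w‖ ≤ ε := (norm_ocons_le hε.le).2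
          ⟨by simpa using (mem_sphere_zero_iff_norm.1 hζ).le, (h2' w hw).1⟩
        have hne' := hne (w, ζ) ⟨hw, hζ⟩
        simp only [div_eq_mul_inv (N _)]
        refine ((hasFDerivAt_slice (hN1 _ hz)).mul ((hasDerivAt_inv hne').comp_hasFDerivAt w
          (hasFDerivAt_slice (hD1 _ hz)))).congr_fderiv (ContinuousLinearMap.ext fun v => ?_)
        simp only [smul_apply, _root_.add_apply,
          sum_apply, smul_eq_mul, Finset.mul_sum,
          ← Finset.sum_add_distrib, Function.comp_apply]
        refine Finset.sum_congr rfl fun i _ => ?_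
        field_simp
        ring) hw
    refine ((key.const_mul ((2 * Real.pi * I)⁻¹)).congr_of_eventuallyEq ?_).congr_fderiv ?_
    · filter_upwards [isOpen_ball.mem_nhds hw] with w hw
      exact (h2 (h2' w (ball_subset_closedBall hw)).2).1
    · simp only [Finset.smul_sum, smul_smul]
  constructor
  · obtain ⟨ε, h⟩ := main.exists
    filter_upwards [h] with w hw using hw.differentiableAt
  · intro i
    filter_upwards [main] with ε h
    filter_upwards [h] with w hw using pd_eq_of_hasFDerivAt hw i

theorem CInt.defAt {f : (κ → ℂ) → ℂ} (hD : PolyLike D)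
    (hN : IsAn N) (hf : CInt N D f) : DefAt f := by
  classical
  obtain ⟨M, r, hr, hr0, hprod⟩ := hD.roots
  have hA : ∀ᶠ ε in 𝓝[>] (0 : ℝ), ∀ j : Fin (M + 1), HolOn ((pd none)^[j] N) ε := by
    refine eventually_all.2 fun j => ?_
    obtain ⟨ε₁, h1, hG⟩ := (hN.iterate_pd none j).holOn
    filter_upwards [eventually_le_pos h1] with ε hε using hG.mono hε.2
  have hB : ∀ᶠ ε in 𝓝[>] (0 : ℝ), ∀ j : Fin M, ∀ {α : Type} {g : κ → (α → ℝ) → ℂ}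
      {r : (α → ℝ) → ℂ}, (∀ k, TameC (g k)) → TameC r → TameC fun x =>
        if ‖fun k => g k x‖ < ε ∧ ‖r x‖ < ε then
          ((pd none)^[j] N) (ocons (r x) fun k => g k x) else 0 := by
    refine eventually_all.2 fun j => ?_
    obtain ⟨ε₁, h1, hG⟩ := (hN.iterate_pd none j).defAt.comp_ocons
    filter_upwards [eventually_le_pos h1] with ε hε using hG ε hε.1 hε.2
  obtain ⟨ε, hf, hε, hA, hB⟩ := (hf.and (eventually_mem_nhdsWithin.and (hA.and hB))).exists
  have hε : 0 < ε := hε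
  obtain ⟨δ, hδ, h2⟩ := Metric.eventually_nhds_iff.1 (hf.and (hprod.and
    ((eventually_all.2 fun i => (hr0 i).eventually (ball_mem_nhds 0 hε)).and (ball_mem_nhds 0 hε))))
  choose ρ hρ hr' using fun i => (hr i).of_le
  obtain ⟨θ, hθ, hθ'⟩ : ∃ θ > 0, ∀ i, θ ≤ ρ i := by
    rcases isEmpty_or_nonempty (Fin M) with h | h
    · exact ⟨1, one_pos, fun i => h.elim i⟩
    · obtain ⟨i, hi⟩ := Finite.exists_min ρ
      exact ⟨ρ i, hρ i, hi⟩
  have h0 := lt_min hδ hθ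
  refine ⟨min δ θ, h0, ?_⟩
  have h3 := tameC_divided_difference (F := N) hε M (fun j hj => hA ⟨j, by omega⟩)
    (hA ⟨0, by omega⟩) (fun j hj => hB ⟨j, hj⟩) (α := κ × Bool) (g := fun k v => cplx v k)
    TameC.cplx (r := fun i v => if ‖cplx v‖ < min δ θ then r i (cplx v) else 0) fun i =>
      hr' i _ h0 ((min_le_right _ _).trans (hθ' i))
  refine (TameC.ite (TPred.norm_lt TameC.cplx h0) ((TameC.const (2 * Real.pi * I)⁻¹).mul h3)
    (TameC.const 0)).congr fun v => ?_
  change (if ‖cplx v‖ < _ then _ else _) = if ‖cplx v‖ < _ then _ else _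
  by_cases h : ‖cplx v‖ < min δ θ
  · obtain ⟨h4, h5, h6, h7⟩ := h2 (y := cplx v) (by simpa using h.trans_le (min_le_left _ _))
    simp only [if_pos h]
    have h8 : ‖cplx v‖ < ε ∧ ∀ i, ‖r i (cplx v)‖ < ε :=
      ⟨by simpa using h7, fun i => by simpa using h6 i⟩
    rw [if_pos h8, h4]
    congr 1
    refine circleIntegral.integral_congr hε.le fun z _ => ?_
    simp only [h5]
  · simp only [if_neg h]

theorem CInt.isAn {f : (κ → ℂ) → ℂ} (hD : PolyLike D)
    (hN : IsAn N) (hf : CInt N D f) : IsAn f := by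
  refine IsAn.of_system (S := {f | ∃ N D, IsAn N ∧ PolyLike D ∧ CInt N D f}) ?_ ⟨N, D, hN, hD, hf⟩
  rintro f ⟨N, D, hN, hD, hf⟩
  obtain ⟨h1, h2⟩ := hf.hasFDerivAt hD hN
  refine ⟨hf.defAt hD hN, h1, fun i => ⟨pd i f, Algebra.subset_adjoin
    (Or.inl ⟨_, _, ?_, hD.mul hD, h2 i⟩),
    EventuallyEq.rfl⟩⟩
  exact ((hN.pd _).mul hD.an).sub (hN.mul (hD.an.pd _))

end DistinguishedQuotients

section WeierstrassDivision

open Filter Topology Metric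

variable {κ : Type} [Fintype κ]

theorem exists_root_bound (d : ℕ) {ε : ℝ} (hε : 0 < ε) : ∃ η > 0, ∀ a : Fin d → ℂ,
    (∀ i, ‖a i‖ < η) → ∀ z : ℂ, z ^ d + ∑ i, a i * z ^ (i : ℕ) = 0 → ‖z‖ < ε := by
  wlog h1 : ε ≤ 1 generalizing ε
  · obtain ⟨η, h, h'⟩ := this one_pos le_rfl
    exact ⟨η, h, fun a ha z hz => (h' a ha z hz).trans_le (not_le.1 h1).le⟩
  refine ⟨ε ^ d / (d + 1), by positivity, fun a ha z hz => ?_⟩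
  by_contra! hlt
  rcases Nat.eq_zero_or_pos d with rfl | hd
  · simp at hz
  have e1 : ‖z‖ ^ d ≤ ∑ i : Fin d, ‖a i‖ * ‖z‖ ^ (i : ℕ) := by
    rw [← norm_pow, eq_neg_of_add_eq_zero_left hz, norm_neg]
    refine (norm_sum_le _ _).trans (Finset.sum_le_sum fun i _ => ?_)
    rw [norm_mul, norm_pow]
  have hη : (d : ℝ) * (ε ^ d / (d + 1)) < ε ^ d := by
    have : (0 : ℝ) < ε ^ d := by positivity
    rw [mul_div_assoc', div_lt_iff₀ (by positivity)]
    nlinarith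
  rcases le_total ‖z‖ 1 with h | h
  · have e2 : ∑ i : Fin d, ‖a i‖ * ‖z‖ ^ (i : ℕ) ≤ ∑ i : Fin d, ε ^ d / (d + 1) :=
      Finset.sum_le_sum fun i _ => by
        have := mul_le_mul (ha i).le (pow_le_one₀ (norm_nonneg z) h (n := i)) (by positivity)
          ((norm_nonneg _).trans (ha i).le)
        simpa using this
    simp only [Finset.sum_const, Finset.card_univ, Fintype.card_fin, nsmul_eq_mul] at e2
    have := pow_le_pow_left₀ hε.le hlt d
    linarith
  · have e2 : ∑ i : Fin d, ‖a i‖ * ‖z‖ ^ (i : ℕ) ≤ ∑ i : Fin d, ε ^ d / (d + 1) * ‖z‖ ^ d :=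
      Finset.sum_le_sum fun i _ => mul_le_mul (ha i).le
        (pow_le_pow_right₀ h i.2.le) (by positivity) ((norm_nonneg _).trans (ha i).le)
    simp only [Finset.sum_const, Finset.card_univ, Fintype.card_fin, nsmul_eq_mul] at e2
    have h3 : (1 : ℝ) ≤ ‖z‖ ^ d := one_le_pow₀ h
    have h4 : ε ^ d ≤ 1 := pow_le_one₀ hε.le h1
    nlinarith

/-- The monic polynomial in the first variable with prescribed lower coefficients. -/
def monicPoly (d : ℕ) (c : ℕ → (κ → ℂ) → ℂ) (z : Option κ → ℂ) : ℂ :=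
  z none ^ d + ∑ i ∈ Finset.range d, c i (fun k => z (some k)) * z none ^ i

theorem isAn_monicPoly (d : ℕ) {c : ℕ → (κ → ℂ) → ℂ} (hc : ∀ i, IsAn (c i)) :
    IsAn (monicPoly d c) :=
  ((IsAn.coord none).pow d).add (IsAn.sum _ fun i _ => ((hc i).reindex some).mul
    ((IsAn.coord none).pow i))

theorem polyLike_monicPoly (d : ℕ) {c : ℕ → (κ → ℂ) → ℂ} (hc : ∀ i, IsAn (c i))
    (hc0 : ∀ i, c i 0 = 0) : PolyLike (monicPoly d c) := by
  refine ⟨isAn_monicPoly d hc, d, ?_⟩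
  choose δ hδ hc' using fun i : Fin d => (hc i).defAt.of_le
  obtain ⟨θ, hθ, hθ'⟩ : ∃ θ > 0, ∀ i, θ ≤ δ i := by
    rcases isEmpty_or_nonempty (Fin d) with h | h
    · exact ⟨1, one_pos, fun i => h.elim i⟩
    · obtain ⟨i, hi⟩ := Finite.exists_min δ
      exact ⟨δ i, hδ i, hi⟩
  obtain ⟨r, hr, h⟩ := TameC.exists_roots fun i : Fin d => hc' i θ hθ (hθ' i)
  have hroot : ∀ᶠ w : κ → ℂ in 𝓝 0, ∀ t, monicPoly d c (ocons t w) = ∏ i, (t - r i (recplx w)) := by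
    filter_upwards [ball_mem_nhds 0 hθ] with w hw t
    rw [← h]
    simp only [cplx_recplx, if_pos (mem_ball_zero_iff.1 hw)]
    rw [monicPoly, Finset.sum_range]
    rfl
  refine ⟨fun i w => r i (recplx w), fun i => ⟨1, one_pos, (TameC.ite
    (TPred.norm_lt TameC.cplx one_pos)
    (hr i) (TameC.const 0)).congr fun v => ?_⟩, fun i => ?_, hroot⟩
  · simp only [recplx_cplx]
  · rw [Metric.tendsto_nhds]
    intro ε hε
    obtain ⟨η, hη, hb⟩ := exists_root_bound d hε
    have h0 : ∀ᶠ w in 𝓝 0, ∀ i : Fin d, ‖c i w‖ < η := eventually_all.2 fun i => by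
      have := (hc i).continuousAt.tendsto
      rw [hc0] at this
      simpa using this.eventually (ball_mem_nhds 0 hη)
    filter_upwards [hroot, h0] with w h1 h2
    rw [dist_zero_right]
    refine hb (fun i => c i w) h2 _ ?_
    have := h1 (r i (recplx w))
    rw [Finset.prod_eq_zero (Finset.mem_univ i) (sub_self _), monicPoly, Finset.sum_range] at this
    exact this

theorem polyLike_sub_coord (k : κ) : PolyLike fun z : Option κ → ℂ => z none - z (some k) := by
  refine ⟨(IsAn.coord _).sub (IsAn.coord _), 1, fun _ w => w k, fun _ => DefAt.coord k, fun _ => ?_,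
    Eventually.of_forall fun w t => ?_⟩
  · exact (continuous_apply (A := fun _ : κ => ℂ) k).tendsto' _ _ rfl
  · simp [ocons]

theorem sum_pow_sub_sum_pow (d : ℕ) (C : ℕ → ℂ) (x t : ℂ) :
    ∑ k ∈ Finset.range (d + 1), C k * x ^ k - ∑ k ∈ Finset.range (d + 1), C k * t ^ k =
      (x - t) * ∑ j ∈ Finset.range d, t ^ j *
        ∑ k ∈ Finset.range (d + 1), if j < k then C k * x ^ (k - 1 - j) else 0 := by
  have : ∀ k ∈ Finset.range (d + 1), C k * x ^ k - C k * t ^ k =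
      (x - t) * ∑ j ∈ Finset.range d, t ^ j * if j < k then C k * x ^ (k - 1 - j) else 0 := by
    intro k hk
    have h1 : ∑ j ∈ Finset.range d, (t ^ j * if j < k then C k * x ^ (k - 1 - j) else 0) =
        ∑ j ∈ Finset.range k, C k * (t ^ j * x ^ (k - 1 - j)) := by
      have : Finset.range k = (Finset.range d).filter (· < k) := by
        ext j; simp at hk ⊢; omega
      rw [this, Finset.sum_filter]
      refine Finset.sum_congr rfl fun j _ => ?_
      split_ifs <;> ring
    rw [h1, ← Finset.mul_sum]
    have := geom_sum₂_mul t x k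
    linear_combination (C k) * this
  rw [← Finset.sum_sub_distrib, Finset.sum_congr rfl this, ← Finset.mul_sum, Finset.sum_comm]
  simp only [Finset.mul_sum]

theorem ocons_eta (z : Option κ → ℂ) : (ocons (z none) fun k => z (some k)) = z := by
  funext o; cases o <;> rfl

theorem tendsto_some : Tendsto (fun (z : Option κ → ℂ) k => z (some k)) (𝓝 0) (𝓝 0) :=
  (continuous_pi fun k => continuous_apply (A := fun _ : Option κ => ℂ) (some k)).tendsto' _ _ rfl

/-- Division by a monic polynomial whose lower coefficients vanish at the origin. -/
theorem division_monicPoly (d : ℕ) {c : ℕ → (κ → ℂ) → ℂ} (hc : ∀ i, IsAn (c i))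
    (hc0 : ∀ i, c i 0 = 0) {g : (Option κ → ℂ) → ℂ} (hg : IsAn g) :
    ∃ (Q : (Option κ → ℂ) → ℂ) (R : ℕ → (κ → ℂ) → ℂ), IsAn Q ∧ (∀ i, IsAn (R i)) ∧
      ∀ᶠ z in 𝓝 0, g z = Q z * monicPoly d c z +
        ∑ i ∈ Finset.range d, R i (fun k => z (some k)) * z none ^ i := by
  have hP := polyLike_monicPoly d hc hc0
  let C : ℕ → (κ → ℂ) → ℂ := fun k w => if k < d then c k w else 1
  have hCan : ∀ k, IsAn (C k) := fun k => by
    by_cases h : k < d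
    · simpa only [C, h, if_true] using hc k
    · simpa only [C, h, if_false] using IsAn.const 1
  have hPC : ∀ w t, monicPoly d c (ocons t w) = ∑ k ∈ Finset.range (d + 1), C k w * t ^ k := by
    intro w t
    rw [Finset.sum_range_succ, monicPoly, add_comm]
    congr 1
    · refine Finset.sum_congr rfl fun i hi => ?_
      simp only [C, Finset.mem_range.1 hi, if_true]; rfl
    · simp [C, ocons]
  let N : ℕ → (Option κ → ℂ) → ℂ := fun j z => g z * ∑ k ∈ Finset.range (d + 1),
    if j < k then C k (fun i => z (some i)) * z none ^ (k - 1 - j) else 0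
  have hN : ∀ j, IsAn (N j) := fun j => hg.mul (IsAn.sum _ fun k _ => by
    by_cases h : j < k
    · simpa only [h, if_true] using ((hCan k).reindex some).mul ((IsAn.coord none).pow _)
    · simpa only [h, if_false] using IsAn.const 0)
  have hP' : PolyLike fun z : Option (Option κ) → ℂ =>
      monicPoly d (fun i (w : Option κ → ℂ) => c i fun k => w (some k)) z * (z none - z (some none)) :=
    (polyLike_monicPoly d (fun i => (hc i).reindex some) fun i => hc0 i).mul
      (polyLike_sub_coord none)
  have hg' : IsAn fun z : Option (Option κ) → ℂ => g fun o => z (Option.map some o) :=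
    hg.reindex (Option.map some)
  obtain ⟨Q, hQ⟩ := hP'.exists_cInt hg'
  choose R hR using fun j => hP.exists_cInt (hN j)
  refine ⟨Q, R, hQ.isAn hP' hg', fun j => (hR j).isAn hP (hN j), ?_⟩
  have hhol : ∀ G : (Option κ → ℂ) → ℂ, IsAn G → ∀ᶠ ε in 𝓝[>] (0 : ℝ), HolOn G ε := by
    intro G hG
    obtain ⟨ε₁, h1, hG⟩ := hG.holOn
    filter_upwards [eventually_le_pos h1] with ε hε using hG.mono hε.2
  obtain ⟨ε, hε, h1, h2, h3, h4, h5⟩ := (eventually_mem_nhdsWithin.and (hQ.and ((eventually_all.2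
    fun j : Fin d => hR j).and ((hhol g hg).and ((eventually_all.2 fun j : Fin d =>
      hhol (N j) (hN j)).and (hhol _ hP.an)))))).exists
  have hε : 0 < ε := hε
  filter_upwards [h1, tendsto_some.eventually (eventually_all.2 h2),
    tendsto_some.eventually (hP.ne_zero hε), ball_mem_nhds 0 hε] with z h1 h2 hne hz
  rw [mem_ball_zero_iff] at hz
  obtain ⟨t, w, rfl⟩ : ∃ t w, z = ocons t w := ⟨_, _, (ocons_eta z).symm⟩
  have h2 : ∀ j : Fin d, R j w = (2 * Real.pi * I)⁻¹ * ∮ ζ in C(0, ε),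
    N j (ocons ζ w) / monicPoly d c (ocons ζ w) := h2
  have hne : ∀ ζ ∈ sphere (0 : ℂ) ε, monicPoly d c (ocons ζ w) ≠ 0 := fun ζ hζ =>
    hne ζ (mem_sphere_zero_iff_norm.1 hζ).ge
  obtain ⟨ht, hw⟩ := norm_ocons_lt.1 hz
  have hne' : ∀ ζ ∈ sphere (0 : ℂ) ε, ζ - t ≠ 0 := by
    intro ζ hζ h
    rw [sub_eq_zero] at h
    subst h
    exact ht.ne (mem_sphere_zero_iff_norm.1 hζ)
  have cauchy := cauchy_iterate_pd hε hw.le ht 0 (F := g) fun j hj => by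
    obtain rfl : j = 0 := by omega
    exact h3
  have cg := (h3.continuousOn_slice hε.le hw.le).mono sphere_subset_closedBall
  have cP := (h5.continuousOn_slice hε.le hw.le).mono sphere_subset_closedBall
  have cN := fun j => ((h4 j).continuousOn_slice hε.le hw.le).mono sphere_subset_closedBall
  have key : (∮ ζ in C(0, ε), g (ocons ζ w) / (ζ - t) ^ (0 + 1)) =
      monicPoly d c (ocons t w) * (∮ ζ in C(0, ε), g (ocons ζ w) /
        (monicPoly d c (ocons ζ w) * (ζ - t))) + ∑ j : Fin d, t ^ (j : ℕ) *
        ∮ ζ in C(0, ε), N j (ocons ζ w) / monicPoly d c (ocons ζ w) := by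
    simp only [← circleIntegral.integral_const_mul]
    have c1 : ContinuousOn (fun ζ => monicPoly d c (ocons t w) * (g (ocons ζ w) /
        (monicPoly d c (ocons ζ w) * (ζ - t)))) (sphere 0 ε) :=
      continuousOn_const.mul (cg.div (cP.mul (by fun_prop)) fun ζ hζ =>
        mul_ne_zero (hne ζ hζ) (hne' ζ hζ))
    have c2 : ∀ j : Fin d, ContinuousOn (fun ζ => t ^ (j : ℕ) *
        (N j (ocons ζ w) / monicPoly d c (ocons ζ w))) (sphere 0 ε) := fun j =>
      continuousOn_const.mul ((cN j).div cP hne)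
    rw [← circleIntegral.integral_fun_sum fun j _ => (c2 j).circleIntegrable hε.le,
      ← circleIntegral.integral_add (c1.circleIntegrable hε.le)
        ((continuousOn_finsetSum _ fun j _ => c2 j).circleIntegrable hε.le)]
    refine circleIntegral.integral_congr hε.le fun ζ hζ => ?_
    have e0 := sum_pow_sub_sum_pow d (fun k => C k w) ζ t
    rw [← hPC, ← hPC] at e0
    have e1 : ∑ j : Fin d, t ^ (j : ℕ) * (N j (ocons ζ w) / monicPoly d c (ocons ζ w)) =
        g (ocons ζ w) / monicPoly d c (ocons ζ w) * ∑ j ∈ Finset.range d, t ^ j *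
        ∑ k ∈ Finset.range (d + 1), if j < k then C k w * ζ ^ (k - 1 - j) else 0 := by
      rw [Finset.sum_range, Finset.mul_sum]
      refine Finset.sum_congr rfl fun j _ => ?_
      simp only [N]
      change _ * (_ * (∑ k ∈ Finset.range (d + 1), if (j : ℕ) < k then C k w * ζ ^ (k - 1 - j) else
        0) / _) = _
      ring
    simp only [e1, zero_add, pow_one]
    generalize ∑ j ∈ Finset.range d, t ^ j *
      (∑ k ∈ Finset.range (d + 1), if j < k then C k w * ζ ^ (k - 1 - j) else 0) = S at e0 ⊢
    have n1 := hne ζ hζ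
    have n2 := hne' ζ hζ
    field_simp
    linear_combination g (ocons ζ w) * e0
  have hQ' : Q (ocons t w) = (2 * Real.pi * I)⁻¹ * ∮ ζ in C(0, ε), g (ocons ζ w) /
        (monicPoly d c (ocons ζ w) * (ζ - t)) := by
    rw [h1]
    congr 1
    refine circleIntegral.integral_congr hε.le fun ζ _ => ?_
    have : (fun o => ocons ζ (ocons t w) (Option.map some o)) = ocons ζ w := by
      funext o; cases o <;> rfl
    simp only [this]
    rfl
  rw [cauchy] at key
  simp only [Function.iterate_zero, id, Nat.factorial_zero, Nat.cast_one, div_one] at key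
  have hpi : (2 * Real.pi * I : ℂ) ≠ 0 := by simp [Real.pi_ne_zero]
  rw [hQ', Finset.sum_range]
  change _ = _ + ∑ i : Fin d, R i w * t ^ (i : ℕ)
  simp only [h2]
  apply mul_left_cancel₀ hpi
  rw [key, mul_add, Finset.mul_sum]
  congr 1
  · field_simp
  · refine Finset.sum_congr rfl fun j _ => ?_
    field_simp

end WeierstrassDivision

section ImplicitFunctions

open Filter Topology

variable {κ ι : Type} [Fintype κ] [Fintype ι]

theorem IsAn.contDiffAt {F : (κ → ℂ) → ℂ} (hF : IsAn F) : ContDiffAt ℂ 1 F 0 := by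
  rw [contDiffAt_one_iff]
  have h : ∀ᶠ z in 𝓝 0, DifferentiableAt ℂ F z ∧ ∀ i, DifferentiableAt ℂ (_root_.pd i F) z :=
    hF.diff.and (eventually_all.2 fun i => (hF.pd i).diff)
  refine ⟨fun z => ∑ i, _root_.pd i F z • (ContinuousLinearMap.proj i : (κ → ℂ) →L[ℂ] ℂ), _, h,
    fun z hz => ContinuousAt.continuousWithinAt ?_, fun z hz => hasFDerivAt_sum_pd hz.1⟩
  exact tendsto_finsetSum _ fun i _ => (hz.2 i).continuousAt.smul continuousAt_const

/-- Definable solutions of holomorphic systems of differential equations. -/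
theorem IsAn.of_ode {y : ι → (κ → ℂ) → ℂ} (hd : ∀ i, DefAt (y i))
    (hy : ∀ i, ∀ᶠ x in 𝓝 0, DifferentiableAt ℂ (y i) x) (h0 : ∀ i, y i 0 = 0)
    {K : ι → κ → (κ ⊕ ι → ℂ) → ℂ} (hK : ∀ i k, IsAn (K i k))
    (h : ∀ i k, _root_.pd k (y i) =ᶠ[𝓝 0] fun x => K i k (Sum.elim x fun i => y i x)) (i : ι) :
    IsAn (y i) := by
  classical
  have hG : (fun x : κ → ℂ => (Sum.elim x fun i => y i x : κ ⊕ ι → ℂ)) =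
      fun x k => (Sum.elim (fun k x => x k) y : κ ⊕ ι → (κ → ℂ) → ℂ) k x := by
    funext x k; rcases k with k | k <;> rfl
  have hGx : ∀ x : κ → ℂ, (Sum.elim x fun i => y i x : κ ⊕ ι → ℂ) =
      fun k => (Sum.elim (fun k x => x k) y : κ ⊕ ι → (κ → ℂ) → ℂ) k x := fun x => congrFun hG x
  set G := (Sum.elim (fun k x => x k) y : κ ⊕ ι → (κ → ℂ) → ℂ) with hGdef
  have hGd : ∀ k, ∀ᶠ x in 𝓝 0, DifferentiableAt ℂ (G k) x := by
    rintro (k | k)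
    · exact (IsAn.coord k).diff
    · exact hy k
  have hGdef' : ∀ k, DefAt (G k) := by
    rintro (k | k)
    · exact DefAt.coord k
    · exact hd k
  have ht : Tendsto (fun z i => G i z) (𝓝 0) (𝓝 0) := by
    refine tendsto_pi_nhds.2 fun i => ?_
    have := (hGd i).self_of_nhds.continuousAt.tendsto
    have h1 : G i 0 = 0 := by
      rcases i with i | i
      · rfl
      · exact h0 i
    rwa [h1] at this
  refine IsAn.of_system (S := {f | ∃ H : (κ ⊕ ι → ℂ) → ℂ, IsAn H ∧ f = fun z => H fun i => G i z})
    ?_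
    ⟨fun z => z (Sum.inr i), IsAn.coord _, rfl⟩
  rintro _ ⟨H, hH, rfl⟩
  have hd' := (ht.eventually hH.diff).and (eventually_all.2 hGd)
  refine ⟨hH.defAt.comp hGdef' ht, ?_, fun k => ?_⟩
  · filter_upwards [hd'] with z hz
    exact hz.1.comp z (differentiableAt_pi.2 hz.2)
  · refine ⟨fun z => ((_root_.pd (Sum.inl k) H) + ∑ i, (_root_.pd (Sum.inr i) H) * K i k)
      fun i => G i z, Algebra.subset_adjoin (Or.inl ⟨_, ?_, rfl⟩), ?_⟩
    · have : IsAn fun z => _root_.pd (Sum.inl k) H z + ∑ i, _root_.pd (Sum.inr i) H z * K i k z :=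
        (hH.pd _).add (IsAn.sum _ fun i _ => (hH.pd _).mul (hK i k))
      convert this using 1
      funext z; simp
    filter_upwards [hd', eventually_all.2 fun i => h i k] with z hz hz2
    rw [pd_comp hz.1 hz.2, Fintype.sum_sum_type]
    simp only [Pi.add_apply, Finset.sum_apply, Pi.mul_apply]
    congr 1
    · rw [Finset.sum_eq_single k]
      · simp [hGdef, pd_coord]
      · intro j _ hj
        simp [hGdef, pd_coord, hj.symm]
      · simp
    · refine Finset.sum_congr rfl fun i _ => ?_
      rw [← hGx, ← hz2 i]
      rfl

theorem IsAn.det [DecidableEq ι] {M : (κ → ℂ) → Matrix ι ι ℂ} (hM : ∀ i j, IsAn fun z => M z i j) :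
    IsAn fun z => (M z).det := by
  simp only [Matrix.det_apply, Units.smul_def, zsmul_eq_mul]
  exact IsAn.sum _ fun σ _ => (IsAn.const _).mul (IsAn.prod _ fun i _ => hM _ _)

theorem IsAn.matrix_inv [DecidableEq ι] {M : (κ → ℂ) → Matrix ι ι ℂ}
    (hM : ∀ i j, IsAn fun z => M z i j) (h0 : (M 0).det ≠ 0) (i j : ι) :
    IsAn fun z => (M z)⁻¹ i j := by
  have h1 : IsAn fun z => (M z).adjugate i j := by
    simp only [Matrix.adjugate_apply]
    refine IsAn.det fun a b => ?_
    by_cases h : a = j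
    · simpa [Matrix.updateRow_apply, h] using IsAn.const _
    · simpa [Matrix.updateRow_apply, h] using hM a b
  simpa only [Matrix.inv_def, Ring.inverse_eq_inv', Matrix.smul_apply, smul_eq_mul] using
    ((IsAn.det hM).inv h0).mul h1

theorem IsAn.implicitFunction [DecidableEq ι] {H : ι → (κ ⊕ ι → ℂ) → ℂ} (hH : ∀ j, IsAn (H j))
    (h0 : ∀ j, H j 0 = 0)
    (hdet : (Matrix.of fun j i => _root_.pd (Sum.inr i) (H j) 0).det ≠ 0) :
    ∃ y : ι → (κ → ℂ) → ℂ, (∀ i, IsAn (y i)) ∧ (∀ i, y i 0 = 0) ∧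
      ∀ᶠ x in 𝓝 0, ∀ j, H j (Sum.elim x fun i => y i x) = 0 := by
  classical
  let L : (κ → ℂ) × (ι → ℂ) →L[ℂ] (κ ⊕ ι → ℂ) := ContinuousLinearMap.pi fun k =>
    Sum.elim (fun k => (ContinuousLinearMap.proj k).comp (ContinuousLinearMap.fst ℂ _ _))
      (fun k => (ContinuousLinearMap.proj k).comp (ContinuousLinearMap.snd ℂ _ _)) k
  have hL : ∀ p, L p = Sum.elim p.1 p.2 := fun p => by
    funext k; rcases k with k | k <;> rfl
  let f : (κ → ℂ) × (ι → ℂ) → (ι → ℂ) := fun p j => H j (L p)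
  have hf0 : f 0 = 0 := by
    funext j; simp [f, h0]
  have cdf : ContDiffAt ℂ 1 f 0 := contDiffAt_pi.2 fun j => by
    have h1 := (hH j).contDiffAt
    rw [← map_zero L] at h1
    exact h1.comp 0 L.contDiff.contDiffAt
  let M : (κ ⊕ ι → ℂ) → Matrix ι ι ℂ := fun z => Matrix.of fun j i => _root_.pd (Sum.inr i) (H j) z
  have hM : ∀ i j, IsAn fun z => M z i j := fun i j => (hH i).pd _
  have hfd : (fderiv ℂ f 0 ∘L .inr ℂ _ _) =
      LinearMap.toContinuousLinearMap (Matrix.toLin' (M 0)) := by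
    have h1 : HasFDerivAt f (ContinuousLinearMap.pi fun j => (∑ i, _root_.pd i (H j) 0 •
        (ContinuousLinearMap.proj i : (κ ⊕ ι → ℂ) →L[ℂ] ℂ)).comp L) 0 :=
      hasFDerivAt_pi.2 fun j => by
        have := hasFDerivAt_sum_pd (hH j).diff.self_of_nhds
        exact HasFDerivAt.comp (0 : (κ → ℂ) × (ι → ℂ)) (f := L) (by rwa [map_zero]) L.hasFDerivAt
    rw [h1.fderiv]
    ext v j
    simp [hL, M, Matrix.toLin'_apply, Matrix.mulVec, dotProduct]
  have if₂ : (fderiv ℂ f 0 ∘L .inr ℂ _ _).IsInvertible := by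
    rw [hfd]
    have hu : IsUnit (M 0).det := isUnit_iff_ne_zero.2 hdet
    refine ⟨(Matrix.toLin'OfInv (Matrix.nonsing_inv_mul _ hu)
      (Matrix.mul_nonsing_inv _ hu)).toContinuousLinearEquiv, ?_⟩
    refine ContinuousLinearMap.ext fun v => ?_
    change (Matrix.toLin'OfInv (Matrix.nonsing_inv_mul _ hu) (Matrix.mul_nonsing_inv _ hu)) v =
      Matrix.toLin' (M 0) v
    simp [Matrix.toLin'OfInv]
  set ψ := cdf.implicitFunction one_ne_zero if₂ with hψ
  have e0 : ψ 0 = 0 := cdf.implicitFunction_apply_self one_ne_zero if₂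
  have e1 : ∀ᶠ x in 𝓝 0, f (x, ψ x) = 0 := by
    have := cdf.eventually_apply_implicitFunction one_ne_zero if₂
    rwa [hf0] at this
  have e2 : ∀ᶠ v in 𝓝 0, f v = 0 ↔ ψ v.1 = v.2 := by
    have := cdf.eventually_apply_eq_iff_implicitFunction one_ne_zero if₂
    rwa [hf0] at this
  have e3 : ∀ᶠ x in 𝓝 0, DifferentiableAt ℂ ψ x := by
    have := (cdf.contDiffAt_implicitFunction one_ne_zero if₂).eventually (by simp)
    filter_upwards [this] with x hx using hx.differentiableAt (by simp)
  have e3' : ∀ i, ∀ᶠ x in 𝓝 0, DifferentiableAt ℂ (fun x => ψ x i) x := fun i => by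
    filter_upwards [e3] with x hx using differentiableAt_pi.1 hx i
  have ht : Tendsto ψ (𝓝 0) (𝓝 0) := by
    have := e3.self_of_nhds.continuousAt.tendsto
    rwa [e0] at this
  have hpair : Tendsto (fun x => Sum.elim x (ψ x) : (κ → ℂ) → κ ⊕ ι → ℂ) (𝓝 0) (𝓝 0) := by
    refine tendsto_pi_nhds.2 ?_
    rintro (k | k)
    · exact (continuous_apply (A := fun _ : κ => ℂ) k).tendsto' 0 0 rfl
    · exact tendsto_pi_nhds.1 ht k
  have hnorm : ∀ (x : κ → ℂ) (w : ι → ℂ) (δ : ℝ), 0 < δ → ‖x‖ < δ → ‖w‖ < δ →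
      ‖(Sum.elim x w : κ ⊕ ι → ℂ)‖ < δ := fun x w δ hδ h1 h2 => by
    rw [pi_norm_lt_iff hδ] at *
    rintro (k | k)
    · exact h1 k
    · exact h2 k
  have hdef : ∀ i, DefAt fun x => ψ x i := fun i => by
    obtain ⟨δ, hδ, h1⟩ := Metric.eventually_nhds_iff.1 e2
    choose ε hε h2 using fun j => (hH j).defAt.comp_tame
    obtain ⟨θ, hθ, h4⟩ : ∃ θ > 0, ∀ i, θ ≤ ε i := by
      rcases isEmpty_or_nonempty ι with h | h
      · exact ⟨1, one_pos, fun i => h.elim i⟩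
      · obtain ⟨i, hi⟩ := Finite.exists_min ε
        exact ⟨ε i, hε i, hi⟩
    obtain ⟨η, hη, h5⟩ := Metric.eventually_nhds_iff.1
      (ht.eventually (Metric.ball_mem_nhds 0 (lt_min hδ hθ)))
    have hmin := lt_min hδ hθ
    have hη' := lt_min hη hmin
    refine ⟨min η (min δ θ), hη', ?_⟩
    let g : (κ × Bool → ℝ) → ι → ℂ := fun v i => if ‖cplx v‖ < min η (min δ θ) then ψ
        (cplx v) i else 0
    refine (TameC.of_unique (h := g) (p := fun v y => (‖cplx v‖ < min η (min δ θ) ∧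
      ‖y‖ < min δ θ ∧ ∀ j, (if ‖(Sum.elim (cplx v) y : κ ⊕ ι → ℂ)‖ < min δ θ then
        H j (Sum.elim (cplx v) y) else 0) = 0) ∨ (¬ ‖cplx v‖ < min η (min δ θ) ∧ y = 0)) ?_ ?_ i)
    · have hx : ∀ k, TameC fun w : (κ × Bool) ⊕ (ι × Bool) → ℝ => cplx (w ∘ Sum.inl) k :=
        fun k => (TameC.cplx k).inl
      have hy : ∀ k, TameC fun w : (κ × Bool) ⊕ (ι × Bool) → ℝ => cplx (w ∘ Sum.inr) k :=
        fun k => TameC.inr k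
      have hxy : ∀ k, TameC fun w : (κ × Bool) ⊕ (ι × Bool) → ℝ =>
          (Sum.elim (cplx (w ∘ Sum.inl)) (cplx (w ∘ Sum.inr)) : κ ⊕ ι → ℂ) k := by
        rintro (k | k)
        · exact hx k
        · exact hy k
      refine TPred.or ((TPred.norm_lt hx hη').and ((TPred.norm_lt hy hmin).and
        (TPred.forall fun j => ?_))) ((TPred.norm_lt hx hη').not.and ?_)
      · exact (h2 j _ hmin ((min_le_right _ _).trans (h4 j)) hxy).eq (TameC.const 0)
      · simp only [funext_iff]
        exact TPred.forall fun j => (hy j).eq (TameC.const 0)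
    · intro v y
      by_cases hv : ‖cplx v‖ < min η (min δ θ)
      · have hψy : ‖ψ (cplx v)‖ < min δ θ := by
          simpa using h5 (y := cplx v) (by simpa using hv.trans_le (min_le_left _ _))
        have hg : g v = ψ (cplx v) := funext fun i => if_pos hv
        have key : ‖y‖ < min δ θ → ((∀ j, (if ‖(Sum.elim (cplx v) y : κ ⊕ ι → ℂ)‖ < min δ θ then
            H j (Sum.elim (cplx v) y) else 0) = 0) ↔ ψ (cplx v) = y) := fun hy => by
          have hv' := hv.trans_le (min_le_right _ _)
          have := @h1 (cplx v, y) (by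
            rw [dist_zero_right, Prod.norm_def]
            exact max_lt (hv'.trans_le (min_le_left _ _)) (hy.trans_le (min_le_left _ _)))
          rw [← this]
          simp only [if_pos (hnorm _ _ _ hmin hv' hy), f, hL, funext_iff, Pi.zero_apply]
        simp only [hv, not_true, false_and, or_false, true_and]
        constructor
        · rintro ⟨a, b⟩
          rw [hg, (key a).1 b]
        · intro h
          rw [hg] at h
          subst h
          exact ⟨hψy, (key hψy).2 rfl⟩
      · have hg : g v = 0 := funext fun i => if_neg hv
        simp [hv, hg]
  have hdetz : ∀ᶠ z in 𝓝 0, (M z).det ≠ 0 := (IsAn.det hM).continuousAt.eventually_ne hdet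
  refine ⟨fun i x => ψ x i, IsAn.of_ode hdef e3' (fun i => congrFun e0 i) (K := fun i k z =>
      -∑ j, (M z)⁻¹ i j * _root_.pd (Sum.inl k) (H j) z)
    (fun i k => (IsAn.sum _ fun j _ => (IsAn.matrix_inv hM hdet i j).mul ((hH j).pd _)).neg)
    fun i k => ?_, fun i => congrFun e0 i, ?_⟩
  · have h1 : ∀ᶠ x in 𝓝 0, ∀ j, _root_.pd k (fun x => H j (Sum.elim x (ψ x))) x = 0 := by
      refine eventually_all.2 fun j => ?_
      have h2 : (fun x => H j (Sum.elim x (ψ x))) =ᶠ[𝓝 0] fun _ => 0 := by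
        filter_upwards [e1] with x hx
        have := congrFun hx j
        simpa only [f, hL, Pi.zero_apply] using this
      filter_upwards [pd_congr h2 k] with x hx
      rw [hx]; simp [_root_.pd]
    filter_upwards [h1, e3, hpair.eventually hdetz,
      hpair.eventually (eventually_all.2 fun j => (hH j).diff)] with x hx h3 h4 h5
    have h6 : ∀ j, _root_.pd (Sum.inl k) (H j) (Sum.elim x (ψ x)) +
        ∑ i, M (Sum.elim x (ψ x)) j i * _root_.pd k (fun x => ψ x i) x = 0 := fun j => by
      rw [← hx j]
      have hGx : ∀ x : κ → ℂ, (Sum.elim x (ψ x) : κ ⊕ ι → ℂ) =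
          fun m => (Sum.elim (fun m x => x m) (fun i x => ψ x i) : κ ⊕ ι → (κ → ℂ) → ℂ) m x := by
        intro x; funext m; rcases m with m | m <;> rfl
      have hc := pd_comp (F := H j)
        (G := (Sum.elim (fun m x => x m) (fun i x => ψ x i) : κ ⊕ ι → (κ → ℂ) → ℂ)) (z := x)
        (by rw [← hGx]; exact h5 j) (by
          rintro (m | m)
          · exact (ContinuousLinearMap.proj m : (κ → ℂ) →L[ℂ] ℂ).differentiableAt
          · exact differentiableAt_pi.1 h3 m) k
      simp only [hGx]
      rw [hc, Fintype.sum_sum_type]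
      congr 1
      rw [Finset.sum_eq_single k]
      · simp [pd_coord]
      · intro j _ hj
        simp [pd_coord, hj.symm]
      · simp
    have h7 : (M (Sum.elim x (ψ x))).mulVec (fun i => _root_.pd k (fun x => ψ x i) x) =
        fun j => -_root_.pd (Sum.inl k) (H j) (Sum.elim x (ψ x)) := by
      funext j
      rw [eq_neg_iff_add_eq_zero, add_comm]
      exact h6 j
    have h8 := congrArg (fun u => ((M (Sum.elim x (ψ x)))⁻¹).mulVec u i) h7
    simp only [Matrix.mulVec_mulVec, Matrix.nonsing_inv_mul _ (isUnit_iff_ne_zero.2 h4),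
      Matrix.one_mulVec] at h8
    change _ = -∑ j, (M (Sum.elim x (ψ x)))⁻¹ i j * _
    rw [h8]
    simp [Matrix.mulVec, dotProduct]
  · filter_upwards [e1] with x hx j
    have := congrFun hx j
    simpa only [f, hL, Pi.zero_apply] using this

end ImplicitFunctions

section WeierstrassPreparation

open Filter Topology

variable {κ ι : Type} [Fintype κ] [Fintype ι]

theorem coeff_of_eventually_eq_pow_mul {d i : ℕ} (hi : i ≤ d) {a : ℕ → ℂ} {h : ℂ → ℂ}
    (hc : ContinuousAt h 0)
    (he : ∀ᶠ t in 𝓝[≠] 0, ∑ j ∈ Finset.range d, a j * t ^ j = t ^ i * h t) :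
    (∀ j < i, a j = 0) ∧ (i < d → a i = h 0) := by
  have lim0 : ∀ (d : ℕ) (a : ℕ → ℂ), 0 < d →
      Tendsto (fun t : ℂ => ∑ j ∈ Finset.range d, a j * t ^ j) (𝓝[≠] 0) (𝓝 (a 0)) := by
    intro d a hd
    have h1 : Continuous fun t : ℂ => ∑ j ∈ Finset.range d, a j * t ^ j := by fun_prop
    refine (h1.tendsto' 0 (a 0) ?_).mono_left nhdsWithin_le_nhds
    rw [Finset.sum_eq_single 0]
    · simp
    · intro j _ hj; simp [hj]
    · simp [hd]
  have hh : Tendsto h (𝓝[≠] 0) (𝓝 (h 0)) := hc.tendsto.mono_left nhdsWithin_le_nhds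
  induction i generalizing d a with
  | zero =>
    refine ⟨by simp, fun hd => ?_⟩
    refine tendsto_nhds_unique ((lim0 d a hd).congr' he) (by simpa using hh)
  | succ i ih =>
    obtain ⟨d, rfl⟩ : ∃ d', d = d' + 1 := ⟨d - 1, by omega⟩
    have h0 : a 0 = 0 := by
      refine tendsto_nhds_unique ((lim0 _ a (by omega)).congr' he) ?_
      have : Tendsto (fun t : ℂ => t ^ (i + 1)) (𝓝[≠] 0) (𝓝 0) :=
        ((continuous_pow (i + 1)).tendsto' 0 0 (by simp)).mono_left nhdsWithin_le_nhds
      simpa using this.mul hh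
    have := ih (d := d) (a := fun j => a (j + 1)) (by omega) (by
      filter_upwards [he, self_mem_nhdsWithin] with t ht ht0
      rw [Finset.sum_range_succ', h0] at ht
      have ht0 : t ≠ 0 := ht0
      apply mul_left_cancel₀ ht0
      rw [Finset.mul_sum, ← mul_assoc, ← pow_succ', ← ht, zero_mul, add_zero]
      exact Finset.sum_congr rfl fun j _ => by ring)
    refine ⟨fun j hj => ?_, fun hd => this.2 (by omega)⟩
    rcases j with _ | j
    · exact h0
    · exact this.1 j (by omega)

theorem hasDerivAt_line [DecidableEq κ] {F : (κ → ℂ) → ℂ} {z : κ → ℂ} (h : DifferentiableAt ℂ F z)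
    (i : κ) : HasDerivAt (fun s : ℂ => F (z + s • Pi.single i 1)) (pd i F z) 0 := by
  have := h.hasFDerivAt.hasLineDerivAt (Pi.single i 1)
  rw [HasLineDerivAt] at this
  refine this.congr_deriv ?_
  unfold pd
  congr!

theorem continuousAt_ocons_zero {F : (Option κ → ℂ) → ℂ} (hF : IsAn F) :
    ContinuousAt (fun t => F (ocons t 0)) 0 := by
  have h1 : Continuous fun t : ℂ => (ocons t 0 : Option κ → ℂ) :=
    continuous_ocons.comp (Continuous.prodMk continuous_const continuous_id)
  exact ContinuousAt.comp (f := fun t : ℂ => (ocons t 0 : Option κ → ℂ)) (x := 0)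
    (by rw [ocons_zero]; exact hF.continuousAt) h1.continuousAt

theorem tendsto_ocons_zero : Tendsto (fun t : ℂ => (ocons t 0 : Option κ → ℂ)) (𝓝 0) (𝓝 0) := by
  have h1 : Continuous fun t : ℂ => (ocons t 0 : Option κ → ℂ) :=
    continuous_ocons.comp (Continuous.prodMk continuous_const continuous_id)
  exact h1.tendsto' 0 0 ocons_zero

/-- The Weierstrass preparation theorem. -/
theorem weierstrass_preparation {f : (Option κ → ℂ) → ℂ} (hf : IsAn f) {d : ℕ} {u : ℂ → ℂ}
    (hu : ContinuousAt u 0) (hu0 : u 0 ≠ 0) (hfu : ∀ᶠ t in 𝓝 0, f (ocons t 0) = t ^ d * u t) :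
    ∃ (U : (Option κ → ℂ) → ℂ) (c : ℕ → (κ → ℂ) → ℂ), IsAn U ∧ U 0 ≠ 0 ∧ (∀ i, IsAn (c i)) ∧
      (∀ i, c i 0 = 0) ∧ ∀ᶠ z in 𝓝 0, f z = U z * monicPoly d c z := by
  classical
  let C : ℕ → (κ ⊕ Fin d → ℂ) → ℂ := fun i z => if h : i < d then z (Sum.inr ⟨i, h⟩) else 0
  have hC : ∀ i, IsAn (C i) := fun i => by
    by_cases h : i < d
    · simpa only [C, h, dif_pos] using IsAn.coord _
    · simpa only [C, h, dif_neg, not_false_eq_true] using IsAn.const 0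
  have hC0 : ∀ i, C i 0 = 0 := fun i => by simp [C]
  let f' : (Option (κ ⊕ Fin d) → ℂ) → ℂ := fun z => f fun k => z (k.map Sum.inl)
  have hf' : IsAn f' := hf.reindex _
  obtain ⟨Q, R, hQ, hR, hdiv⟩ := division_monicPoly d hC hC0 hf'
  have hf'0 : ∀ t (w : κ ⊕ Fin d → ℂ), (∀ k, w (Sum.inl k) = 0) → f' (ocons t w) = f (ocons t 0) :=
    fun t w hw => by
      simp only [f']
      congr 1
      funext k
      rcases k with _ | k
      · rfl
      · exact hw k
  have hev := tendsto_ocons_zero.eventually (eventually_eventually_nhds.2 hdiv)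
  have hP0 : ∀ t, monicPoly d C (ocons t 0) = t ^ d := fun t => by
    have : monicPoly d C (ocons t 0) = t ^ d + ∑ i ∈ Finset.range d, C i 0 * t ^ i := rfl
    rw [this]; simp [hC0]
  have key0 : ∀ᶠ t in 𝓝 0, ∑ j ∈ Finset.range d, R j 0 * t ^ j = t ^ d * (u t - Q (ocons t 0)) := by
    filter_upwards [hev, hfu] with t h1 h2
    have h3 := h1.self_of_nhds
    rw [hf'0 _ _ (fun _ => rfl), h2, hP0] at h3
    have h4 : ∑ i ∈ Finset.range d, R i (fun k => (ocons t 0 : Option (κ ⊕ Fin d) → ℂ) (some k)) *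
      (ocons t 0 : Option (κ ⊕ Fin d) → ℂ) none ^ i = ∑ j ∈ Finset.range d, R j 0 * t ^ j := rfl
    rw [h4] at h3
    linear_combination -h3
  have hR0 : ∀ j < d, R j 0 = 0 := (coeff_of_eventually_eq_pow_mul le_rfl
    (hu.sub (continuousAt_ocons_zero hQ)) (key0.filter_mono nhdsWithin_le_nhds)).1
  have hQ0 : Q 0 = u 0 := by
    have h1 : (fun t => u t - Q (ocons t 0)) =ᶠ[𝓝[≠] 0] fun _ => 0 := by
      filter_upwards [key0.filter_mono nhdsWithin_le_nhds, self_mem_nhdsWithin] with t h1 h2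
      have h2 : t ≠ 0 := h2
      rw [Finset.sum_eq_zero (fun j hj => by rw [hR0 j (Finset.mem_range.1 hj), zero_mul])] at h1
      exact (mul_eq_zero.1 h1.symm).resolve_left (pow_ne_zero _ h2)
    have h2 := ((hu.sub (continuousAt_ocons_zero hQ)).tendsto.mono_left
      (nhdsWithin_le_nhds (s := {0}ᶜ))).congr' h1
    have h3 := tendsto_nhds_unique tendsto_const_nhds h2
    change 0 = u 0 - Q (ocons 0 0) at h3
    rw [ocons_zero] at h3
    exact (sub_eq_zero.1 h3.symm).symm
  have keyd : ∀ i : Fin d, ∀ᶠ t in 𝓝 0, ∑ j ∈ Finset.range d, pd (Sum.inr i) (R j) 0 * t ^ j =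
      t ^ (i : ℕ) * (-Q (ocons t 0) -
        t ^ (d - i) * pd (some (Sum.inr i)) Q (ocons t 0)) := fun i => by
    filter_upwards [hev, tendsto_ocons_zero.eventually hQ.diff] with t h1 h2
    set v : κ ⊕ Fin d → ℂ := Pi.single (Sum.inr i) 1 with hv
    have hline : ∀ s : ℂ, (ocons t 0 : Option (κ ⊕ Fin d) → ℂ) + s • Pi.single (some (Sum.inr i)) 1 =
        ocons t (s • v) := fun s => by
      funext k
      rcases k with _ | k
      · simp [ocons]
      · simp [ocons, hv, Pi.single_apply]
    have d1 : HasDerivAt (fun s : ℂ => Q (ocons t (s • v)))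
        (pd (some (Sum.inr i)) Q (ocons t 0)) 0 := by
      have := hasDerivAt_line h2 (some (Sum.inr i))
      simpa only [hline] using this
    have d2 : ∀ j, HasDerivAt (fun s : ℂ => R j (s • v)) (pd (Sum.inr i) (R j) 0) 0 := fun j => by
      have := hasDerivAt_line (hR j).diff.self_of_nhds (Sum.inr i)
      simpa only [zero_add] using this
    have hP : ∀ s : ℂ, monicPoly d C (ocons t (s • v)) = t ^ d + s * t ^ (i : ℕ) := fun s => by
      have : monicPoly d C (ocons t (s • v)) = t ^ d + ∑ i ∈ Finset.range d, C i (s • v) * t ^ i :=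
          rfl
      rw [this, Finset.sum_eq_single (i : ℕ)]
      · simp [C, hv]
      · intro j hj hji
        have : (⟨j, Finset.mem_range.1 hj⟩ : Fin d) ≠ i := fun h => hji (by rw [← h])
        simp [C, Finset.mem_range.1 hj, hv, this]
      · simp
    have d3 : HasDerivAt (fun s : ℂ => monicPoly d C (ocons t (s • v))) (t ^ (i : ℕ)) 0 := by
      simp only [hP]
      simpa using ((hasDerivAt_id (0 : ℂ)).mul_const (t ^ (i : ℕ))).const_add (t ^ d)
    have d4 := (d1.mul d3).add (HasDerivAt.fun_sum (u := Finset.range d)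
      fun j _ => (d2 j).mul_const (t ^ j))
    have hcont : Tendsto (fun s : ℂ => (ocons t (s • v) : Option (κ ⊕ Fin d) → ℂ)) (𝓝 0)
        (𝓝 (ocons t 0)) := by
      have h1 : Continuous fun s : ℂ => (ocons t (s • v) : Option (κ ⊕ Fin d) → ℂ) :=
        continuous_ocons.comp (Continuous.prodMk (by fun_prop) continuous_const)
      exact h1.tendsto' _ _ (by simp)
    have d5 : HasDerivAt (fun _ : ℂ => f (ocons t 0)) _ 0 := d4.congr_of_eventuallyEq (by
      filter_upwards [hcont.eventually h1] with s hs
      rw [hf'0 _ _ (by intro k; simp [hv])] at hs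
      exact hs)
    have h6 := d5.unique (hasDerivAt_const _ _)
    simp only [zero_smul, hP0] at h6
    have h7 : t ^ d = t ^ (i : ℕ) * t ^ (d - i) := by rw [← pow_add]; congr 1; omega
    rw [h7] at h6
    linear_combination h6
  have hcQ : ∀ i : Fin d, ContinuousAt (fun t => -Q (ocons t 0) -
      t ^ (d - i) * pd (some (Sum.inr i)) Q (ocons t 0)) 0 := fun i =>
    (continuousAt_ocons_zero hQ).neg.sub
      ((continuous_pow _).continuousAt.mul (continuousAt_ocons_zero (hQ.pd _)))
  have hcoef := fun i : Fin d => coeff_of_eventually_eq_pow_mul i.2.le (hcQ i)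
    ((keyd i).filter_mono nhdsWithin_le_nhds)
  have hdet : (Matrix.of fun j i => pd (Sum.inr i) (R (j : Fin d)) 0).det ≠ 0 := by
    rw [Matrix.det_of_isLowerTriangular]
    · refine Finset.prod_ne_zero_iff.2 fun i _ => ?_
      rw [Matrix.of_apply, (hcoef i).2 i.2]
      have : d - i ≠ 0 := by omega
      simpa [ocons_zero, this, hQ0] using hu0
    · intro j i hij
      exact (hcoef i).1 j (by simpa using hij)
  obtain ⟨y, hy, hy0, hyR⟩ := IsAn.implicitFunction (fun j : Fin d => hR j) (fun j => hR0 j j.2)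
      hdet
  let G : Option (κ ⊕ Fin d) → (Option κ → ℂ) → ℂ := fun k z =>
    k.elim (z none) (Sum.elim (fun k => z (some k)) fun i => y i fun k => z (some k))
  have hG : ∀ k, IsAn (G k) := by
    rintro (_ | k | i)
    · exact IsAn.coord _
    · exact IsAn.coord _
    · exact (hy i).reindex _
  have hG0 : ∀ k, G k 0 = 0 := by
    rintro (_ | k | i)
    · rfl
    · rfl
    · exact hy0 i
  refine ⟨fun z => Q fun k => G k z, fun i w => if h : i < d then y ⟨i, h⟩ w else 0, hQ.comp hG hG0,
    ?_, fun i => ?_, fun i => ?_, ?_⟩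
  · have : (fun k => G k 0) = 0 := funext hG0
    change Q (fun k => G k 0) ≠ 0
    rw [this, hQ0]; exact hu0
  · by_cases h : i < d
    · simpa only [h, dif_pos] using hy _
    · simpa only [h, dif_neg, not_false_eq_true] using IsAn.const 0
  · simp [hy0]
  · filter_upwards [(IsAn.tendsto_zero hG hG0).eventually hdiv, tendsto_some.eventually hyR]
      with z h1 h2
    have h3 : f' (fun k => G k z) = f z := by
      simp only [f']
      congr 1
      funext k
      rcases k with _ | k <;> rfl
    rw [← h3, h1, Finset.sum_eq_zero, add_zero]
    · rfl
    · intro i hi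
      have : R i (fun k => G (some k) z) = 0 := by
        refine Eq.trans ?_ (h2 ⟨i, Finset.mem_range.1 hi⟩)
        congr 1
      rw [this, zero_mul]

/-- The Weierstrass division theorem. -/
theorem weierstrass_division {f : (Option κ → ℂ) → ℂ} (hf : IsAn f) {d : ℕ} {u : ℂ → ℂ}
    (hu : ContinuousAt u 0) (hu0 : u 0 ≠ 0) (hfu : ∀ᶠ t in 𝓝 0, f (ocons t 0) = t ^ d * u t)
    {g : (Option κ → ℂ) → ℂ} (hg : IsAn g) :
    ∃ (Q : (Option κ → ℂ) → ℂ) (R : ℕ → (κ → ℂ) → ℂ), IsAn Q ∧ (∀ i, IsAn (R i)) ∧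
      ∀ᶠ z in 𝓝 0, g z = Q z * f z +
        ∑ i ∈ Finset.range d, R i (fun k => z (some k)) * z none ^ i := by
  obtain ⟨U, c, hU, hU0, hc, hc0, h1⟩ := weierstrass_preparation hf hu hu0 hfu
  obtain ⟨Q, R, hQ, hR, h2⟩ := division_monicPoly d hc hc0 hg
  refine ⟨fun z => Q z * (U z)⁻¹, R, hQ.mul (hU.inv hU0), hR, ?_⟩
  filter_upwards [h1, h2, hU.continuousAt.eventually_ne hU0] with z h1 h2 h3
  rw [h2, h1]
  field_simp

end WeierstrassPreparation

section GermRing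

open Filter Topology

variable {κ ι : Type} [Fintype κ] [Fintype ι]

variable (κ) in
/-- The ideal of functions vanishing near the origin. -/
def nullIdeal : Ideal (anAlg κ) where
  carrier := {F | F.1 =ᶠ[𝓝 0] 0}
  add_mem' := fun {F G} hF hG => by
    filter_upwards [hF, hG] with z h1 h2
    change F.1 z + G.1 z = 0
    rw [h1, h2]; simp
  zero_mem' := EventuallyEq.rfl
  smul_mem' := fun c F hF => by
    filter_upwards [hF] with z h1
    change c.1 z * F.1 z = 0
    rw [h1]; simp

variable (κ) in
/-- The ring of germs of definable holomorphic functions. -/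
def AnGerm : Type := anAlg κ ⧸ nullIdeal κ

instance : CommRing (AnGerm κ) := inferInstanceAs (CommRing (anAlg κ ⧸ nullIdeal κ))

/-- The germ of a function. -/
def AnGerm.mk (F : (κ → ℂ) → ℂ) (hF : IsAn F) : AnGerm κ :=
  (Ideal.Quotient.mk (nullIdeal κ) ⟨F, mem_anAlg.2 hF⟩ : anAlg κ ⧸ nullIdeal κ)

theorem AnGerm.exists_mk (x : AnGerm κ) : ∃ F hF, x = AnGerm.mk F hF := by
  obtain ⟨⟨F, hF⟩, rfl⟩ := Ideal.Quotient.mk_surjective x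
  exact ⟨F, mem_anAlg.1 hF, rfl⟩

theorem AnGerm.mk_eq_mk {F G : (κ → ℂ) → ℂ} {hF : IsAn F} {hG : IsAn G} :
    AnGerm.mk F hF = AnGerm.mk G hG ↔ F =ᶠ[𝓝 0] G := by
  refine (Ideal.Quotient.eq (I := nullIdeal κ)).trans ?_
  change (F - G) =ᶠ[𝓝 0] 0 ↔ _
  exact ⟨fun h => by filter_upwards [h] with z hz; exact sub_eq_zero.1 hz,
    fun h => by filter_upwards [h] with z hz; exact sub_eq_zero.2 hz⟩

theorem AnGerm.mk_add {F G : (κ → ℂ) → ℂ} (hF : IsAn F) (hG : IsAn G) :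
    AnGerm.mk F hF + AnGerm.mk G hG = AnGerm.mk _ (hF.add hG) := rfl

theorem AnGerm.mk_mul {F G : (κ → ℂ) → ℂ} (hF : IsAn F) (hG : IsAn G) :
    AnGerm.mk F hF * AnGerm.mk G hG = AnGerm.mk _ (hF.mul hG) := rfl

theorem AnGerm.zero_eq : (0 : AnGerm κ) = AnGerm.mk (fun _ => 0) (IsAn.const 0) := rfl

theorem AnGerm.one_eq : (1 : AnGerm κ) = AnGerm.mk (fun _ => 1) (IsAn.const 1) := rfl

theorem AnGerm.mk_sum {τ : Type*} (s : Finset τ) {F : τ → (κ → ℂ) → ℂ} (hF : ∀ i, IsAn (F i)) :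
    ∑ i ∈ s, AnGerm.mk (F i) (hF i) = AnGerm.mk _ (IsAn.sum s fun i _ => hF i) := by
  classical
  induction s using Finset.induction_on with
  | empty => rw [Finset.sum_empty, AnGerm.zero_eq, AnGerm.mk_eq_mk]; simp
  | insert a s ha ih =>
    rw [Finset.sum_insert ha, ih, AnGerm.mk_add, AnGerm.mk_eq_mk]
    simp [Finset.sum_insert ha]

theorem AnGerm.isUnit_mk {F : (κ → ℂ) → ℂ} {hF : IsAn F} :
    IsUnit (AnGerm.mk F hF) ↔ F 0 ≠ 0 := by
  constructor
  · intro h h0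
    obtain ⟨x, hx⟩ := h.exists_right_inv
    obtain ⟨G, hG, rfl⟩ := x.exists_mk
    rw [AnGerm.mk_mul, AnGerm.one_eq, AnGerm.mk_eq_mk] at hx
    have := hx.self_of_nhds
    simp [h0] at this
  · intro h
    refine IsUnit.of_mul_eq_one (AnGerm.mk _ (hF.inv h)) ?_
    rw [AnGerm.mk_mul, AnGerm.one_eq, AnGerm.mk_eq_mk]
    filter_upwards [hF.continuousAt.eventually_ne h] with z hz
    exact mul_inv_cancel₀ hz

instance : Nontrivial (AnGerm κ) := ⟨0, 1, fun h => by
  rw [AnGerm.zero_eq, AnGerm.one_eq, AnGerm.mk_eq_mk] at h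
  exact zero_ne_one h.self_of_nhds⟩

instance : IsLocalRing (AnGerm κ) := IsLocalRing.of_nonunits_add fun a b ha hb => by
  obtain ⟨F, hF, rfl⟩ := a.exists_mk
  obtain ⟨G, hG, rfl⟩ := b.exists_mk
  rw [mem_nonunits_iff, AnGerm.isUnit_mk, not_not] at ha hb
  rw [AnGerm.mk_add, mem_nonunits_iff, AnGerm.isUnit_mk, not_not, ha, hb, add_zero]

/-- Substitution of germs. -/
def AnGerm.comp (G : ι → (κ → ℂ) → ℂ) (hG : ∀ i, IsAn (G i)) (h0 : ∀ i, G i 0 = 0) :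
    AnGerm ι →+* AnGerm κ :=
  Ideal.Quotient.lift (nullIdeal ι)
    ((Ideal.Quotient.mk (nullIdeal κ)).comp
      { toFun := fun F => ⟨fun z => F.1 fun i => G i z,
          mem_anAlg.2 ((mem_anAlg.1 F.2).comp hG h0)⟩
        map_one' := rfl
        map_mul' := fun _ _ => rfl
        map_zero' := rfl
        map_add' := fun _ _ => rfl })
    fun F hF => Ideal.Quotient.eq_zero_iff_mem.2 ((IsAn.tendsto_zero hG h0).eventually hF)

theorem AnGerm.comp_mk (G : ι → (κ → ℂ) → ℂ) (hG : ∀ i, IsAn (G i)) (h0 : ∀ i, G i 0 = 0)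
    {F : (ι → ℂ) → ℂ} (hF : IsAn F) :
    AnGerm.comp G hG h0 (AnGerm.mk F hF) = AnGerm.mk _ (hF.comp hG h0) := rfl

/-- A nonzero germ is regular along some line transversal to a coordinate hyperplane. -/
theorem exists_regular_direction {F : (Option κ → ℂ) → ℂ} (hF : IsAn F)
    (hne : ¬ F =ᶠ[𝓝 0] fun _ => 0) : ∃ (v : κ → ℂ) (d : ℕ) (u : ℂ → ℂ), ContinuousAt u 0 ∧ u 0 ≠ 0 ∧
      ∀ᶠ t in 𝓝 0, F (ocons t fun k => v k * t) = t ^ d * u t := by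
  obtain ⟨ε, hε, hd⟩ := Metric.eventually_nhds_iff_ball.1 hF.diff
  obtain ⟨p, hp, hpne⟩ : ∃ p ∈ Metric.ball (0 : Option κ → ℂ) ε, F p ≠ 0 := by
    by_contra! h
    refine hne ?_
    filter_upwards [Metric.ball_mem_nhds _ hε] with p hp using h p hp
  obtain ⟨p, hp, hpne, hp0⟩ : ∃ p ∈ Metric.ball (0 : Option κ → ℂ) ε, F p ≠ 0 ∧ p none ≠ 0 := by
    have h1 : ∀ᶠ t in 𝓝 (p none), ocons t (fun k => p (some k)) ∈ Metric.ball (0 : Option κ → ℂ) ε ∧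
        F (ocons t fun k => p (some k)) ≠ 0 := by
      have hc : Tendsto (fun t : ℂ => (ocons t fun k => p (some k) : Option κ → ℂ)) (𝓝 (p none))
          (𝓝 p) := by
        have h1 : Continuous fun t : ℂ => (ocons t fun k => p (some k) : Option κ → ℂ) :=
          continuous_ocons.comp (Continuous.prodMk continuous_const continuous_id)
        have h2 := h1.tendsto (p none)
        rwa [ocons_eta p] at h2
      exact hc.eventually (p := fun q => q ∈ Metric.ball (0 : Option κ → ℂ) ε ∧ F q ≠ 0)
        ((Metric.isOpen_ball.eventually_mem hp).and
        ((hd p hp).continuousAt.eventually_ne hpne))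
    have h2 : ∃ᶠ t in 𝓝 (p none), t ≠ 0 := by
      by_cases h : p none = 0
      · rw [h]
        exact (eventually_mem_nhdsWithin (a := (0 : ℂ)) (s := {0}ᶜ)).frequently.filter_mono
          nhdsWithin_le_nhds
      · exact (eventually_ne_nhds h).frequently
    obtain ⟨t, ht, ht1, ht2⟩ := (h2.and_eventually h1).exists
    exact ⟨ocons t (fun k => p (some k)), ht1, ht2, by simpa [ocons] using ht⟩
  let v : κ → ℂ := fun k => p (some k) / p none
  have hline : ∀ t : ℂ, (ocons t fun k => v k * t : Option κ → ℂ) = (t / p none) • p := fun t => by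
    funext k
    rcases k with _ | k
    · simp [ocons, hp0]
    · simp [ocons, v]; ring
  let U : Set ℂ := {t | ‖t‖ < ε * ‖p none‖ / ‖p‖}
  have hpn : 0 < ‖p none‖ := norm_pos_iff.2 hp0
  have hpp : 0 < ‖p‖ := hpn.trans_le (norm_le_pi_norm p none)
  have hUball : U = Metric.ball 0 (ε * ‖p none‖ / ‖p‖) := by ext; simp [U]
  have hmaps : ∀ t ∈ U, (t / p none) • p ∈ Metric.ball (0 : Option κ → ℂ) ε := fun t ht => by
    rw [mem_ball_zero_iff, norm_smul, norm_div, div_mul_eq_mul_div, div_lt_iff₀ hpn,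
      ← lt_div_iff₀ hpp]
    exact ht
  have hdiff : DifferentiableOn ℂ (fun t => F ((t / p none) • p)) U := fun t ht => by
    have h1 : DifferentiableAt ℂ (fun t : ℂ => (t / p none) • p) t := by fun_prop
    have h2 : DifferentiableAt ℂ F ((fun t : ℂ => (t / p none) • p) t) := hd _ (hmaps t ht)
    exact (h2.comp t h1).differentiableWithinAt
  have han := hdiff.analyticOnNhd (by rw [hUball]; exact Metric.isOpen_ball)
  have h0U : (0 : ℂ) ∈ U := by
    change ‖(0 : ℂ)‖ < _
    rw [norm_zero]; positivity
  have hpU : p none ∈ U := by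
    change ‖p none‖ < _
    rw [lt_div_iff₀ hpp, mul_comm]
    exact mul_lt_mul_of_pos_right (by simpa using hp) hpn
  have hnz : ¬ ∀ᶠ t in 𝓝 0, F ((t / p none) • p) = 0 := fun h => by
    have := han.eqOn_zero_of_preconnected_of_eventuallyEq_zero
      (by rw [hUball]; exact (convex_ball _ _).isPreconnected) h0U h hpU
    simp only [div_self hp0, one_smul] at this
    exact hpne this
  obtain ⟨n, g, hg, hg0, h⟩ := (han 0 h0U).exists_eventuallyEq_pow_smul_nonzero_iff.2 hnz
  refine ⟨v, n, g, hg.continuousAt, hg0, ?_⟩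
  filter_upwards [h] with t ht
  rw [hline, ht, sub_zero, smul_eq_mul]

theorem AnGerm.fg_of_regular [IsNoetherianRing (AnGerm κ)] {f : (Option κ → ℂ) → ℂ} (hf : IsAn f)
    {d : ℕ} {u : ℂ → ℂ} (hu : ContinuousAt u 0) (hu0 : u 0 ≠ 0)
    (hfu : ∀ᶠ t in 𝓝 0, f (ocons t 0) = t ^ d * u t) {I : Ideal (AnGerm (Option κ))}
    (hI : AnGerm.mk f hf ∈ I) : I.FG := by
  classical
  let ρ : AnGerm κ →+* AnGerm (Option κ) :=
    AnGerm.comp (fun k z => z (some k)) (fun k => IsAn.coord _) fun _ => rfl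
  let Z : AnGerm (Option κ) := AnGerm.mk _ (IsAn.coord none)
  let L : (Fin d → AnGerm κ) →ₛₗ[ρ] AnGerm (Option κ) :=
    { toFun := fun r => ∑ i, ρ (r i) * Z ^ (i : ℕ)
      map_add' := fun r s => by simp [add_mul, Finset.sum_add_distrib]
      map_smul' := fun c r => by simp [Finset.mul_sum, mul_assoc] }
  obtain ⟨s, hs⟩ := IsNoetherian.noetherian (Submodule.comap L I)
  refine ⟨insert (AnGerm.mk f hf) (s.image L), ?_⟩
  apply le_antisymm
  · rw [Ideal.span_le]
    intro x hx
    simp only [Finset.coe_insert, Finset.coe_image, Set.mem_insert_iff, Set.mem_image] at hx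
    rcases hx with rfl | ⟨r, hr, rfl⟩
    · exact hI
    · have : r ∈ Submodule.comap L I := by rw [← hs]; exact Submodule.subset_span hr
      exact this
  · intro g hg
    obtain ⟨G, hG, rfl⟩ := g.exists_mk
    obtain ⟨Q, R, hQ, hR, h⟩ := weierstrass_division hf hu hu0 hfu hG
    have e1 : AnGerm.mk G hG = AnGerm.mk Q hQ * AnGerm.mk f hf +
        L fun i => AnGerm.mk (R i) (hR i) := by
      have : L (fun i => AnGerm.mk (R i) (hR i)) = ∑ i : Fin d, AnGerm.mk
          (fun z : Option κ → ℂ => R i (fun k => z (some k)) * z none ^ (i : ℕ))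
          (((hR i).reindex some).mul ((IsAn.coord none).pow _)) := rfl
      rw [this, AnGerm.mk_sum, AnGerm.mk_mul, AnGerm.mk_add, AnGerm.mk_eq_mk]
      filter_upwards [h] with z hz
      rw [hz, Finset.sum_range]
    have e2 : (fun i : Fin d => AnGerm.mk (R i) (hR i)) ∈ Submodule.comap L I := by
      change L _ ∈ I
      rw [← sub_eq_iff_eq_add'.2 e1]
      exact I.sub_mem hg (I.mul_mem_left _ hI)
    have e3 : ∀ r ∈ Submodule.comap L I,
        L r ∈ Ideal.span ((insert (AnGerm.mk f hf) (s.image L) : Finset _) :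
          Set (AnGerm (Option κ))) := by
      intro r hr
      rw [← hs] at hr
      induction hr using Submodule.span_induction with
      | mem x hx => exact Ideal.subset_span (by
          simp only [Finset.coe_insert, Finset.coe_image]
          exact Or.inr ⟨x, hx, rfl⟩)
      | zero => rw [map_zero]; exact zero_mem _
      | add x y _ _ h1 h2 => rw [map_add]; exact add_mem h1 h2
      | smul c x _ h1 => rw [map_smulₛₗ]; exact Ideal.mul_mem_left _ _ h1
    rw [e1]
    exact add_mem (Ideal.mul_mem_left _ _ (Ideal.subset_span (by simp))) (e3 _ e2)

theorem isNoetherianRing_anGerm_option [IsNoetherianRing (AnGerm κ)] :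
    IsNoetherianRing (AnGerm (Option κ)) := by
  rw [isNoetherianRing_iff_ideal_fg]
  intro I
  by_cases hI : I = ⊥
  · rw [hI]; exact Submodule.fg_bot
  obtain ⟨x, hx, hx0⟩ := Submodule.exists_mem_ne_zero_of_ne_bot hI
  obtain ⟨F, hF, rfl⟩ := x.exists_mk
  rw [Ne, AnGerm.zero_eq, AnGerm.mk_eq_mk] at hx0
  obtain ⟨v, d, u, hu, hu0, hfu⟩ := exists_regular_direction hF hx0
  let G : (κ → ℂ) → Option κ → (Option κ → ℂ) → ℂ := fun v k z =>
    k.elim (z none) fun k => z (some k) + v k * z none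
  have hG : ∀ v k, IsAn (G v k) := by
    rintro v (_ | k)
    · exact IsAn.coord _
    · exact (IsAn.coord _).add ((IsAn.const _).mul (IsAn.coord _))
  have hG0 : ∀ v k, G v k 0 = 0 := by
    rintro v (_ | k) <;> simp [G]
  have h1 : (Ideal.map (AnGerm.comp (G v) (hG v) (hG0 v)) I).FG := by
    refine AnGerm.fg_of_regular (d := d) (hF.comp (hG v) (hG0 v)) hu hu0 ?_
      (Ideal.mem_map_of_mem (AnGerm.comp (G v) (hG v) (hG0 v)) hx)
    filter_upwards [hfu] with t ht
    rw [← ht]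
    congr 1
    funext k
    rcases k with _ | k <;> simp [G, ocons]
  have h2 := h1.map (AnGerm.comp (G (-v)) (hG (-v)) (hG0 (-v)))
  have h3 : (AnGerm.comp (G (-v)) (hG (-v)) (hG0 (-v))).comp (AnGerm.comp (G v) (hG v) (hG0 v)) =
      RingHom.id _ := by
    refine RingHom.ext fun x => ?_
    obtain ⟨F, hF, rfl⟩ := x.exists_mk
    rw [RingHom.comp_apply, AnGerm.comp_mk, AnGerm.comp_mk, RingHom.id_apply, AnGerm.mk_eq_mk]
    refine Eventually.of_forall fun z => ?_
    change F (fun i => G v i fun i => G (-v) i z) = F z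
    congr 1
    funext k
    rcases k with _ | k <;> simp [G]
  rwa [Ideal.map_map, h3, Ideal.map_id] at h2

/-- Rückert's basis theorem. -/
instance isNoetherianRing_anGerm (κ : Type) [Fintype κ] : IsNoetherianRing (AnGerm κ) := by
  suffices H : ∀ (α : Type) [Finite α], ∀ [Fintype α], IsNoetherianRing (AnGerm α) from H κ
  intro α _
  induction α using Finite.induction_empty_option with
  | of_equiv e ih =>
    rename_i α β
    intro _
    have := Fintype.ofEquiv β e.symm
    have := ih
    refine isNoetherianRing_of_surjective (AnGerm α) (AnGerm β)
      (AnGerm.comp (fun k z => z (e k)) (fun k => IsAn.coord _) fun _ => rfl) fun x => ?_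
    obtain ⟨F, hF, rfl⟩ := x.exists_mk
    refine ⟨AnGerm.mk _ (hF.reindex e.symm), ?_⟩
    rw [AnGerm.comp_mk, AnGerm.mk_eq_mk]
    refine Eventually.of_forall fun z => ?_
    simp
  | h_empty =>
    intro _
    rw [isNoetherianRing_iff_ideal_fg]
    intro I
    by_cases hI : I = ⊥
    · rw [hI]; exact Submodule.fg_bot
    obtain ⟨x, hx, hx0⟩ := Submodule.exists_mem_ne_zero_of_ne_bot hI
    obtain ⟨F, hF, rfl⟩ := x.exists_mk
    have : IsUnit (AnGerm.mk F hF) := by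
      rw [AnGerm.isUnit_mk]
      intro h
      refine hx0 ?_
      rw [AnGerm.zero_eq, AnGerm.mk_eq_mk]
      exact Eventually.of_forall fun z => by rw [Subsingleton.elim z 0, h]
    rw [I.eq_top_of_isUnit_mem hx this]
    exact ⟨{1}, by simp⟩
  | h_option ih =>
    rename_i α hα
    intro i
    have := @ih hα
    have := isNoetherianRing_anGerm_option (κ := α)
    convert this

end GermRing

section Expansion

open Filter Topology

variable {κ ι : Type} [Fintype κ] [Fintype ι]

theorem IsAn.exists_divX {F : (Option κ → ℂ) → ℂ} (hF : IsAn F) :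
    ∃ (Q : (Option κ → ℂ) → ℂ) (R : (κ → ℂ) → ℂ), IsAn Q ∧ IsAn R ∧
      ∀ᶠ z in 𝓝 0, F z = R (fun k => z (some k)) + z none * Q z := by
  obtain ⟨Q, R, hQ, hR, h⟩ := division_monicPoly 1 (c := fun _ _ => 0) (fun _ => IsAn.const 0)
    (fun _ => rfl) hF
  refine ⟨Q, R 0, hQ, hR 0, ?_⟩
  filter_upwards [h] with z hz
  rw [hz]
  simp [monicPoly]
  ring

/-- Expansion along a coordinate with finitely many coefficients dominating all others. -/
theorem IsAn.exists_finite_expansion {F : (Option κ → ℂ) → ℂ} (hF : IsAn F) :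
    ∃ (d : ℕ) (a : ℕ → (κ → ℂ) → ℂ) (H : ℕ → (Option κ → ℂ) → ℂ), (∀ j, IsAn (a j)) ∧
      (∀ j, IsAn (H j)) ∧ ∀ᶠ z in 𝓝 0, F z = ∑ j ∈ Finset.range d,
        a j (fun k => z (some k)) * (z none ^ j + z none ^ d * H j z) := by
  classical
  have step : ∀ G : {G : (Option κ → ℂ) → ℂ // IsAn G}, ∃ (Q : {G : (Option κ → ℂ) → ℂ // IsAn G})
      (R : {G : (κ → ℂ) → ℂ // IsAn G}),
      ∀ᶠ z in 𝓝 0, G.1 z = R.1 (fun k => z (some k)) + z none * Q.1 z := fun G => by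
    obtain ⟨Q, R, hQ, hR, h⟩ := G.2.exists_divX
    exact ⟨⟨Q, hQ⟩, ⟨R, hR⟩, h⟩
  choose Q R hQR using step
  let Fs : ℕ → {G : (Option κ → ℂ) → ℂ // IsAn G} := fun n => Q^[n] ⟨F, hF⟩
  have hFs : ∀ n, Fs (n + 1) = Q (Fs n) := fun n => Function.iterate_succ_apply' Q n _
  let r : ℕ → (κ → ℂ) → ℂ := fun n => (R (Fs n)).1
  have hr : ∀ n, IsAn (r n) := fun n => (R (Fs n)).2
  have hrs : ∀ n, IsAn fun z : Option κ → ℂ => r n fun k => z (some k) := fun n =>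
      (hr n).reindex some
  let ρ : ℕ → AnGerm (Option κ) := fun n => AnGerm.mk _ (hrs n)
  let Z : AnGerm (Option κ) := AnGerm.mk _ (IsAn.coord none)
  let φ : ℕ → AnGerm (Option κ) := fun n => AnGerm.mk _ (Fs n).2
  have hφ : ∀ n, φ n = ρ n + Z * φ (n + 1) := fun n => by
    simp only [φ, ρ, Z]
    rw [AnGerm.mk_mul, AnGerm.mk_add, AnGerm.mk_eq_mk]
    filter_upwards [hQR (Fs n)] with z hz
    rw [hz, hFs]
  have hφN : ∀ n N, φ n = ∑ j ∈ Finset.range N, ρ (n + j) * Z ^ j + Z ^ N * φ (n + N) := by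
    intro n N
    induction N with
    | zero => simp
    | succ N ih =>
      rw [ih, hφ (n + N), Finset.sum_range_succ, add_assoc n N 1]
      generalize ∑ j ∈ Finset.range N, ρ (n + j) * Z ^ j = A
      ring
  let I : ℕ →o Ideal (AnGerm (Option κ)) :=
    { toFun := fun n => Ideal.span (Set.range fun j : Fin n => ρ j)
      monotone' := fun m n h => Ideal.span_mono (by
        rintro _ ⟨j, rfl⟩
        exact ⟨⟨j, j.2.trans_le h⟩, rfl⟩) }
  obtain ⟨d, hd⟩ := monotone_stabilizes_iff_noetherian.2 (inferInstance : IsNoetherian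
    (AnGerm (Option κ)) (AnGerm (Option κ))) I
  have hρ : ∀ j, ρ j ∈ I d := fun j => by
    rcases le_total d (j + 1) with h | h
    · rw [hd _ h]; exact Ideal.subset_span ⟨⟨j, j.lt_succ_self⟩, rfl⟩
    · exact Ideal.subset_span ⟨⟨j, h⟩, rfl⟩
  have hZ : Ideal.span {Z} ≠ ⊤ := by
    rw [Ne, Ideal.span_singleton_eq_top, AnGerm.isUnit_mk]
    simp
  have hφd : φ d ∈ I d := by
    have h1 := Ideal.iInf_pow_smul_eq_bot_of_isLocalRing (M := AnGerm (Option κ) ⧸ I d) _ hZ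
    rw [← Ideal.Quotient.eq_zero_iff_mem, ← Submodule.mem_bot (AnGerm (Option κ)), ← h1,
      Submodule.mem_iInf]
    intro N
    have h2 : Ideal.Quotient.mk (I d) (φ d) = Z ^ N • Ideal.Quotient.mk (I d) (φ (d + N)) := by
      change _ = Ideal.Quotient.mk (I d) (Z ^ N * φ (d + N))
      rw [Ideal.Quotient.eq, hφN d N, add_sub_cancel_right]
      exact Ideal.sum_mem _ fun j _ => Ideal.mul_mem_right _ _ (hρ _)
    rw [h2]
    exact Submodule.smul_mem_smul (Ideal.pow_mem_pow (Ideal.mem_span_singleton_self _) _)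
      Submodule.mem_top
  obtain ⟨c, hc⟩ := Ideal.mem_span_range_iff_exists_fun.1 hφd
  choose H hH hcH using fun j => (c j).exists_mk
  let H' : ℕ → (Option κ → ℂ) → ℂ := fun j => if h : j < d then H ⟨j, h⟩ else fun _ => 0
  have hH' : ∀ j, IsAn (H' j) := fun j => by
    by_cases h : j < d
    · simp only [H', h, dif_pos]; exact hH _
    · simp only [H', h, dif_neg, not_false_iff]; exact IsAn.const 0
  refine ⟨d, r, H', hr, hH', ?_⟩
  have key : φ 0 = ∑ j ∈ Finset.range d, ρ j * (Z ^ j + Z ^ d * AnGerm.mk _ (hH' j)) := by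
    rw [hφN 0 d, zero_add, ← hc, Finset.mul_sum, Finset.sum_range, Finset.sum_range,
      ← Finset.sum_add_distrib]
    refine Finset.sum_congr rfl fun j _ => ?_
    have : c j = AnGerm.mk _ (hH' j) := by
      rw [hcH, AnGerm.mk_eq_mk]
      simp [H']
    rw [this, zero_add]
    ring
  have key2 : ∑ j ∈ Finset.range d, ρ j * (Z ^ j + Z ^ d * AnGerm.mk _ (hH' j)) =
      AnGerm.mk _ (IsAn.sum (Finset.range d) fun j _ => (hrs j).mul
        (((IsAn.coord none).pow j).add (((IsAn.coord none).pow d).mul (hH' j)))) := by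
    rw [← AnGerm.mk_sum _ fun j => (hrs j).mul
      (((IsAn.coord none).pow j).add (((IsAn.coord none).pow d).mul (hH' j)))]
    rfl
  exact AnGerm.mk_eq_mk.1 (key.trans key2)

/-- A function of `u` and `w` is linear in `u` over functions of `u + w` and `u * w`. -/
theorem IsAn.exists_symmetric_split {F : (Option (Option κ) → ℂ) → ℂ} (hF : IsAn F) :
    ∃ P Q : (Option (Option κ) → ℂ) → ℂ, IsAn P ∧ IsAn Q ∧ ∀ᶠ z : Option (Option κ) → ℂ in 𝓝 0,
      F z = P (ocons (z none + z (some none)) (ocons (z none * z (some none))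
          fun k => z (some (some k)))) +
        z none * Q (ocons (z none + z (some none)) (ocons (z none * z (some none))
          fun k => z (some (some k)))) := by
  let c : ℕ → (Option (Option κ) → ℂ) → ℂ := fun i => match i with
    | 0 => fun w => w (some none)
    | 1 => fun w => -w none
    | _ => fun _ => 0
  have hc : ∀ i, IsAn (c i) := fun i => match i with
    | 0 => IsAn.coord _
    | 1 => (IsAn.coord _).neg
    | (n + 2) => IsAn.const 0
  have hc0 : ∀ i, c i 0 = 0 := fun i => match i with
    | 0 => rfl
    | 1 => by simp [c]
    | (n + 2) => rfl
  let G : Option (Option κ) → (Option (Option (Option κ)) → ℂ) → ℂ := fun o z => match o with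
    | none => z none
    | some none => z (some none) - z none
    | some (some k) => z (some (some (some k)))
  have hG : ∀ o, IsAn (G o) := fun o => match o with
    | none => IsAn.coord _
    | some none => (IsAn.coord _).sub (IsAn.coord _)
    | some (some k) => IsAn.coord _
  have hG0 : ∀ o, G o 0 = 0 := fun o => match o with
    | none => rfl
    | some none => by simp [G]
    | some (some k) => rfl
  obtain ⟨q, R, -, hR, h⟩ := division_monicPoly 2 hc hc0 (hF.comp hG hG0)
  refine ⟨R 0, R 1, hR 0, hR 1, ?_⟩
  let S : Option (Option (Option κ)) → (Option (Option κ) → ℂ) → ℂ := fun o z =>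
    ocons (z none) (ocons (z none + z (some none)) (ocons (z none * z (some none))
          fun k => z (some (some k)))) o
  have hS : ∀ o, IsAn (S o) := fun o => match o with
    | none => IsAn.coord _
    | some none => (IsAn.coord _).add (IsAn.coord _)
    | some (some none) => (IsAn.coord _).mul (IsAn.coord _)
    | some (some (some k)) => IsAn.coord _
  have hS0 : ∀ o, S o 0 = 0 := fun o => match o with
    | none => rfl
    | some none => by simp [S, ocons]
    | some (some none) => by simp [S, ocons]
    | some (some (some k)) => rfl
  filter_upwards [(IsAn.tendsto_zero hS hS0).eventually h] with z hz
  have e1 : (fun i => G i fun o => S o z) = z := by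
    funext o
    rcases o with _ | _ | k <;> simp [G, S, ocons]
  have e2 : monicPoly 2 c (fun o => S o z) = 0 := by
    simp [monicPoly, Finset.sum_range_succ, c, S, ocons]
    ring
  rw [e1, e2, mul_zero, zero_add, Finset.sum_range_succ, Finset.sum_range_one] at hz
  rw [hz]
  simp only [pow_zero, mul_one, pow_one, S]
  rw [mul_comm (R 1 _)]
  rfl

theorem norm_conj_pi (z : κ → ℂ) : ‖fun k => (starRingEnd ℂ) (z k)‖ = ‖z‖ := norm_star z

theorem tendsto_conj_zero : Tendsto (fun z : κ → ℂ => fun k => (starRingEnd ℂ) (z k)) (𝓝 0) (𝓝 0) := by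
  have : Continuous fun z : κ → ℂ => fun k => (starRingEnd ℂ) (z k) := by fun_prop
  exact this.tendsto' _ _ (by ext; simp)

/-- Reflection of holomorphic functions by complex conjugation. -/
theorem IsAn.conj_conj {F : (κ → ℂ) → ℂ} (hF : IsAn F) :
    IsAn fun z => (starRingEnd ℂ) (F fun k => (starRingEnd ℂ) (z k)) := by
  refine ⟨{G | ∃ F, IsAn F ∧ G = fun z => (starRingEnd ℂ) (F fun k => (starRingEnd ℂ) (z k))}, ?_,
    F, hF, rfl⟩
  rintro _ ⟨F, hF, rfl⟩
  have hder : ∀ z : κ → ℂ, DifferentiableAt ℂ F (fun k => (starRingEnd ℂ) (z k)) →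
      HasFDerivAt (fun z => (starRingEnd ℂ) (F fun k => (starRingEnd ℂ) (z k)))
        (∑ i, (starRingEnd ℂ) (_root_.pd i F fun k => (starRingEnd ℂ) (z k)) •
          (ContinuousLinearMap.proj i : (κ → ℂ) →L[ℂ] ℂ)) z := by
    intro z hz
    have h1 := (hasFDerivAt_sum_pd hz).isLittleO
    rw [hasFDerivAt_iff_isLittleO]
    have h2 : Tendsto (fun y : κ → ℂ => fun k => (starRingEnd ℂ) (y k)) (𝓝 z)
        (𝓝 fun k => (starRingEnd ℂ) (z k)) := by
      have : Continuous fun z : κ → ℂ => fun k => (starRingEnd ℂ) (z k) := by fun_prop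
      exact this.tendsto _
    have h3 := h1.comp_tendsto h2
    refine Asymptotics.IsLittleO.of_norm_norm (h3.norm_norm.congr (fun y => ?_) fun y => ?_)
    · rw [Function.comp_apply, ← norm_star]
      congr 1
      simp
    · rw [Function.comp_apply, ← norm_conj_pi (y - z)]
      congr 1
      funext k
      simp
  refine ⟨?_, ?_, fun i => ?_⟩
  · obtain ⟨ε, hε, h⟩ := hF.defAt.comp_tame
    refine ⟨ε, hε, (h ε hε le_rfl fun k => (TameC.cplx k).conj).conj.congr fun v => ?_⟩
    rw [norm_conj_pi fun k => cplx v k]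
    split_ifs
    · rfl
    · rw [map_zero]
  · filter_upwards [tendsto_conj_zero.eventually hF.diff] with z hz
    exact (hder z hz).differentiableAt
  · refine ⟨_, ⟨_, hF.pd i, rfl⟩, ?_⟩
    filter_upwards [tendsto_conj_zero.eventually hF.diff] with z hz
    exact pd_eq_of_hasFDerivAt (hder z hz) i

end Expansion

section GoodFields

open Filter Topology

variable {α : Type}

/-- Fields of germs along a filter with roots of elements and closed under analytic functions. -/
structure PreGood (l : Filter (α → ℝ)) (C : Set ((α → ℝ) → ℂ)) : Prop where
  neBot : l.NeBot
  const : ∀ c : ℂ, (fun _ => c) ∈ C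
  add : ∀ {f g}, f ∈ C → g ∈ C → (fun x => f x + g x) ∈ C
  mul : ∀ {f g}, f ∈ C → g ∈ C → (fun x => f x * g x) ∈ C
  inv : ∀ {f}, f ∈ C → (fun x => (f x)⁻¹) ∈ C
  conj : ∀ {f}, f ∈ C → (fun x => (starRingEnd ℂ) (f x)) ∈ C
  congr : ∀ {f g}, f ∈ C → f =ᶠ[l] g → g ∈ C
  zero_or : ∀ {f}, f ∈ C → (∀ᶠ x in l, f x = 0) ∨ ∀ᶠ x in l, f x ≠ 0
  lim_or : ∀ {f}, f ∈ C → (∃ c, Tendsto f l (𝓝 c)) ∨ ∃ c, Tendsto (fun x => (f x)⁻¹) l (𝓝 c)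
  nthRoot : ∀ {n : ℕ} {f}, 0 < n → f ∈ C → ∃ z ∈ C, ∀ᶠ x in l, z x ^ n = f x
  an : ∀ {κ : Type} [Fintype κ] {F : (κ → ℂ) → ℂ}, IsAn F → ∀ {e : κ → (α → ℝ) → ℂ},
    (∀ k, e k ∈ C) → (∀ k, Tendsto (e k) l (𝓝 0)) → (fun x => F fun k => e k x) ∈ C
  tame : ∀ {f}, f ∈ C → ∃ g, TameC g ∧ f =ᶠ[l] g

/-- Algebraically closed fields of germs along a filter, closed under analytic functions. -/
structure Good (l : Filter (α → ℝ)) (C : Set ((α → ℝ) → ℂ)) : Prop extends PreGood l C where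
  root : ∀ {n : ℕ} {a : Fin n → (α → ℝ) → ℂ}, 0 < n → (∀ i, a i ∈ C) →
    ∃ z ∈ C, ∀ᶠ x in l, z x ^ n + ∑ i, a i x * z x ^ (i : ℕ) = 0

theorem tendsto_zero_of_root {β : Type*} {l : Filter β} {n : ℕ} {a : Fin n → β → ℂ} {z : β → ℂ}
    (ha : ∀ i, Tendsto (a i) l (𝓝 0)) (h : ∀ᶠ x in l, z x ^ n + ∑ i, a i x * z x ^ (i : ℕ) = 0) :
    Tendsto z l (𝓝 0) := by
  rw [Metric.tendsto_nhds]
  intro ε hε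
  obtain ⟨η, hη, hb⟩ := exists_root_bound n hε
  filter_upwards [h, eventually_all.2 fun i => (ha i).eventually (Metric.ball_mem_nhds 0 hη)]
    with x h1 h2
  simpa using hb _ (fun i => by simpa using h2 i) _ h1

theorem shift_pow_sum {n : ℕ} (a : Fin n → ℂ) (s y : ℂ) :
    (y + s) ^ n + ∑ k, a k * (y + s) ^ (k : ℕ) = y ^ n + ∑ i : Fin n,
      ((n.choose i : ℂ) * s ^ (n - i) + ∑ k : Fin n, a k * ((k : ℕ).choose i * s ^ ((k : ℕ) - i))) *
        y ^ (i : ℕ) := by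
  have h : ∀ k ≤ n, (y + s) ^ k = (if k = n then y ^ n else 0) +
      ∑ i : Fin n, (k.choose i * s ^ (k - i)) * y ^ (i : ℕ) := by
    intro k hk
    rw [add_pow, Fin.sum_univ_eq_sum_range (fun i => (k.choose i * s ^ (k - i)) * y ^ i)]
    rcases hk.eq_or_lt with rfl | hk
    · rw [Finset.sum_range_succ, if_pos rfl, add_comm]
      simp only [Nat.sub_self, pow_zero, mul_one, Nat.choose_self, Nat.cast_one]
      congr 1
      exact Finset.sum_congr rfl fun i _ => by ring
    · rw [if_neg hk.ne, zero_add, Finset.sum_subset (Finset.range_mono hk)]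
      · exact Finset.sum_congr rfl fun i _ => by ring
      · intro i _ hi
        rw [Nat.choose_eq_zero_of_lt (by simpa using hi)]
        simp
  rw [h n le_rfl, if_pos rfl]
  have h2 : ∑ k : Fin n, a k * (y + s) ^ (k : ℕ) =
      ∑ i : Fin n, (∑ k : Fin n, a k * ((k : ℕ).choose i * s ^ ((k : ℕ) - i))) * y ^ (i : ℕ) := by
    simp only [Finset.sum_mul]
    rw [Finset.sum_comm]
    refine Finset.sum_congr rfl fun k _ => ?_
    rw [h k k.2.le, if_neg k.2.ne, zero_add, Finset.mul_sum]
    exact Finset.sum_congr rfl fun i _ => by ring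
  rw [h2, add_assoc, ← Finset.sum_add_distrib]
  congr 1
  exact Finset.sum_congr rfl fun i _ => by ring

namespace PreGood

variable {l : Filter (α → ℝ)} {C : Set ((α → ℝ) → ℂ)} (hC : PreGood l C) {f g : (α → ℝ) → ℂ}
include hC

theorem neg (hf : f ∈ C) : (fun x => -f x) ∈ C :=
  hC.congr (hC.mul (hC.const (-1)) hf) (Eventually.of_forall fun x => by ring)

theorem sub (hf : f ∈ C) (hg : g ∈ C) : (fun x => f x - g x) ∈ C :=
  hC.congr (hC.add hf (hC.neg hg)) (Eventually.of_forall fun x => by ring)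

theorem div (hf : f ∈ C) (hg : g ∈ C) : (fun x => f x / g x) ∈ C :=
  hC.congr (hC.mul hf (hC.inv hg)) (Eventually.of_forall fun x => (div_eq_mul_inv _ _).symm)

theorem pow (hf : f ∈ C) (n : ℕ) : (fun x => f x ^ n) ∈ C := by
  induction n with
  | zero => simpa using hC.const 1
  | succ n ih => simpa only [pow_succ] using hC.mul ih hf

theorem sum {τ : Type*} {F : τ → (α → ℝ) → ℂ} (s : Finset τ) (hF : ∀ i ∈ s, F i ∈ C) :
    (fun x => ∑ i ∈ s, F i x) ∈ C := by
  classical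
  induction s using Finset.induction_on with
  | empty => simpa using hC.const 0
  | insert a s ha ih =>
    simp only [Finset.sum_insert ha]
    exact hC.add (hF a (by simp)) (ih fun i hi => hF i (by simp [hi]))

/-- Dichotomy between convergence and divergence to infinity. -/
theorem lim_or_inv_zero (hf : f ∈ C) :
    (∃ c, Tendsto f l (𝓝 c)) ∨ Tendsto (fun x => (f x)⁻¹) l (𝓝 0) := by
  rcases hC.lim_or hf with h | ⟨c, h⟩
  · exact Or.inl h
  · by_cases hc : c = 0
    · exact Or.inr (hc ▸ h)
    · exact Or.inl ⟨c⁻¹, by simpa using h.inv₀ hc⟩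

theorem re_mem (hf : f ∈ C) : (fun x => ((f x).re : ℂ)) ∈ C :=
  hC.congr (hC.mul (hC.const 2⁻¹) (hC.add hf (hC.conj hf))) (Eventually.of_forall fun x => by
    dsimp only; rw [Complex.add_conj]; push_cast; ring)

theorem im_mem (hf : f ∈ C) : (fun x => ((f x).im : ℂ)) ∈ C :=
  hC.congr (hC.mul (hC.const (2 * I)⁻¹) (hC.sub hf (hC.conj hf))) (Eventually.of_forall fun x => by
    dsimp only; rw [Complex.sub_conj]; field_simp; push_cast; ring)

/-- Among finitely many elements, not all zero, one dominates all others. -/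
theorem exists_dominant {n : ℕ} {a : Fin n → (α → ℝ) → ℂ} (ha : ∀ i, a i ∈ C) :
    (∀ i, ∀ᶠ x in l, a i x = 0) ∨ ∃ j, (∀ᶠ x in l, a j x ≠ 0) ∧
      ∀ i, ∃ c, Tendsto (fun x => a i x / a j x) l (𝓝 c) := by
  induction n with
  | zero => exact Or.inl fun i => i.elim0
  | succ n ih =>
    rcases hC.zero_or (ha (Fin.last n)) with h0 | h0
    · rcases ih (fun i => ha i.castSucc) with h | ⟨j, hj, h⟩
      · exact Or.inl (Fin.lastCases h0 h)
      · refine Or.inr ⟨j.castSucc, hj, Fin.lastCases ⟨0, ?_⟩ h⟩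
        refine tendsto_const_nhds.congr' ?_
        filter_upwards [h0] with x hx
        rw [hx, zero_div]
    · right
      rcases ih (fun i => ha i.castSucc) with h | ⟨j, hj, h⟩
      · refine ⟨Fin.last n, h0, Fin.lastCases ⟨1, ?_⟩ fun i => ⟨0, ?_⟩⟩
        · refine tendsto_const_nhds.congr' ?_
          filter_upwards [h0] with x hx
          rw [div_self hx]
        · refine tendsto_const_nhds.congr' ?_
          filter_upwards [h i] with x hx
          rw [hx, zero_div]
      · rcases hC.lim_or (hC.div (ha (Fin.last n)) (ha j.castSucc)) with hl | ⟨c, hc⟩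
        · exact ⟨j.castSucc, hj, Fin.lastCases hl h⟩
        · refine ⟨Fin.last n, h0, Fin.lastCases ⟨1, ?_⟩ fun i => ?_⟩
          · refine tendsto_const_nhds.congr' ?_
            filter_upwards [h0] with x hx
            rw [div_self hx]
          · obtain ⟨d, hd⟩ := h i
            refine ⟨d * c, (hd.mul hc).congr' ?_⟩
            filter_upwards [hj, h0] with x h1 h2
            field_simp

open Polynomial in
omit hC in
/-- A monic polynomial without subleading term, different from `X ^ n`, has a root of multiplicity
less than `n`. -/
theorem exists_root_small_mult {n : ℕ} (hn : 0 < n) (L : Fin n → ℂ)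
    (h1 : L ⟨n - 1, by omega⟩ = 0) (h2 : ∃ j, L j ≠ 0) :
    ∃ (r : ℂ) (p : ℕ) (q : ℂ[X]), 0 < p ∧ p < n ∧ q.eval r ≠ 0 ∧
      ∀ t, (t + r) ^ n + ∑ i, L i * (t + r) ^ (i : ℕ) = t ^ p * q.eval (t + r) := by
  let P : ℂ[X] := X ^ n + ∑ i : Fin n, Polynomial.C (L i) * X ^ (i : ℕ)
  have hdeg : (∑ i : Fin n, Polynomial.C (L i) * X ^ (i : ℕ)).degree < (n : WithBot ℕ) :=
    degree_sum_fin_lt L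
  have hPm : P.Monic := monic_X_pow_add hdeg
  have hPd : P.natDegree = n := by
    have : P.degree = n := by
      rw [degree_add_eq_left_of_degree_lt (by rwa [degree_X_pow]), degree_X_pow]
    exact natDegree_eq_of_degree_eq_some this
  have hPe : ∀ z, P.eval z = z ^ n + ∑ i, L i * z ^ (i : ℕ) := by
    intro z
    simp [P, eval_finsetSum]
  have hPc : ∀ j : Fin n, P.coeff j = L j := by
    intro j
    simp only [P, coeff_add, coeff_X_pow, finsetSum_coeff, coeff_C_mul]
    rw [if_neg j.2.ne, zero_add, Finset.sum_eq_single j]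
    · simp
    · intro i _ hi
      rw [if_neg (fun h => hi (Fin.ext h.symm)), mul_zero]
    · simp
  obtain ⟨r, hr⟩ := IsAlgClosed.exists_root P (by
    rw [degree_eq_natDegree hPm.ne_zero, hPd]; exact_mod_cast hn.ne')
  obtain ⟨q, hq, hqr⟩ := Polynomial.exists_eq_pow_rootMultiplicity_mul_and_not_dvd P hPm.ne_zero r
  have hp0 := (rootMultiplicity_pos hPm.ne_zero).2 hr
  refine ⟨r, P.rootMultiplicity r, q, hp0, ?_, ?_, ?_⟩
  · by_contra hlt
    rw [not_lt] at hlt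
    have hle := natDegree_le_of_dvd (pow_rootMultiplicity_dvd P r) hPm.ne_zero
    rw [natDegree_pow, natDegree_X_sub_C, mul_one] at hle
    have hpn : P.rootMultiplicity r = n := by
      rw [hPd] at hle; omega
    rw [hpn] at hq
    have hqm : q.Monic := by
      rw [hq] at hPm
      exact (((monic_X_sub_C r).pow n).of_mul_monic_left) hPm
    have hq1 : q = 1 := by
      have := congrArg natDegree hq
      rw [((monic_X_sub_C r).pow n).natDegree_mul hqm, hPd, natDegree_pow, natDegree_X_sub_C] at this
      exact hqm.natDegree_eq_zero.1 (by omega)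
    rw [hq1, mul_one] at hq
    have hr0 : r = 0 := by
      have h3 := congrArg nextCoeff hq
      rw [((monic_X_sub_C r)).nextCoeff_pow, nextCoeff_X_sub_C,
        nextCoeff_of_natDegree_pos (by omega), hPd, hPc ⟨n - 1, by omega⟩, h1] at h3
      simpa [hn.ne'] using h3
    obtain ⟨j, hj⟩ := h2
    apply hj
    rw [← hPc j, hq, hr0, map_zero, sub_zero, coeff_X_pow, if_neg j.2.ne]
  · intro h
    exact hqr (dvd_iff_isRoot.2 h)
  · intro t
    rw [← hPe]
    conv_lhs => rw [hq]
    simp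

theorem exists_root {n : ℕ} {a : Fin n → (α → ℝ) → ℂ} (hn : 0 < n) (ha : ∀ i, a i ∈ C) :
    ∃ z ∈ C, ∀ᶠ x in l, z x ^ n + ∑ i, a i x * z x ^ (i : ℕ) = 0 := by
  induction n using Nat.strong_induction_on with
  | _ n ih =>
  let s : (α → ℝ) → ℂ := fun x => -(a ⟨n - 1, by omega⟩ x) / n
  have hs : s ∈ C := hC.div (hC.neg (ha _)) (hC.const n)
  let b : Fin n → (α → ℝ) → ℂ := fun i x => (n.choose i : ℂ) * s x ^ (n - i) +
    ∑ k : Fin n, a k x * ((k : ℕ).choose i * s x ^ ((k : ℕ) - i))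
  have hb : ∀ i, b i ∈ C := fun i => hC.add (hC.mul (hC.const _) (hC.pow hs _))
    (hC.sum _ fun k _ => hC.mul (ha k) (hC.mul (hC.const _) (hC.pow hs _)))
  suffices h : ∃ y ∈ C, ∀ᶠ x in l, y x ^ n + ∑ i, b i x * y x ^ (i : ℕ) = 0 by
    obtain ⟨y, hy, h⟩ := h
    refine ⟨_, hC.add hy hs, ?_⟩
    filter_upwards [h] with x hx
    rw [shift_pow_sum]
    exact hx
  have hbn : ∀ x, b ⟨n - 1, by omega⟩ x = 0 := by
    intro x
    have h1 : n - (n - 1) = 1 := by omega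
    have h2 : n.choose (n - 1) = n := by
      rw [← Nat.choose_symm (by omega), h1, Nat.choose_one_right]
    simp only [b, h1, h2, pow_one]
    rw [Finset.sum_eq_single ⟨n - 1, by omega⟩]
    · have : (n : ℂ) ≠ 0 := by exact_mod_cast hn.ne'
      simp only [Nat.choose_self, Nat.cast_one, Nat.sub_self, pow_zero, mul_one, s]
      field_simp
      ring
    · intro k _ hk
      have : (k : ℕ) < n - 1 := lt_of_le_of_ne (by omega) fun h => hk (Fin.ext h)
      rw [Nat.choose_eq_zero_of_lt this]
      simp
    · simp
  have hr := fun i : Fin n => hC.nthRoot (n := n - i) (by omega) (hb i)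
  choose lam hlam hlamb using hr
  rcases hC.exists_dominant hlam with h0 | ⟨j, hj, hlim⟩
  · refine ⟨fun _ => 0, hC.const 0, ?_⟩
    filter_upwards [eventually_all.2 h0, eventually_all.2 hlamb] with x h1 h2
    rw [zero_pow hn.ne', zero_add]
    refine Finset.sum_eq_zero fun i _ => ?_
    rw [← h2 i, h1 i, zero_pow (by omega), zero_mul]
  choose ℓ hℓ using hlim
  have := hC.neBot
  have hℓj : ℓ j = 1 := by
    refine tendsto_nhds_unique (hℓ j) (tendsto_const_nhds.congr' ?_)
    filter_upwards [hj] with x hx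
    rw [div_self hx]
  let L : Fin n → ℂ := fun i => ℓ i ^ (n - i)
  have hLn : L ⟨n - 1, by omega⟩ = 0 := by
    have : Tendsto (fun x => (lam ⟨n - 1, by omega⟩ x / lam j x) ^ (n - (n - 1))) l
        (𝓝 (L ⟨n - 1, by omega⟩)) := (hℓ _).pow _
    refine tendsto_nhds_unique this (tendsto_const_nhds.congr' ?_)
    filter_upwards [hlamb ⟨n - 1, by omega⟩] with x hx
    rw [div_pow, hx, hbn, zero_div]
  obtain ⟨r, p, q, hp0, hpn, hqr, hfac⟩ := exists_root_small_mult hn L hLn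
    ⟨j, by simp only [L, hℓj, one_pow]; exact one_ne_zero⟩
  let G : (Option (Fin n) → ℂ) → ℂ := fun z => (z none + r) ^ n +
    ∑ i : Fin n, (L i + z (some i)) * (z none + r) ^ (i : ℕ)
  have hG : IsAn G := (((IsAn.coord _).add (IsAn.const r)).pow n).add
    (IsAn.sum _ fun i _ => ((IsAn.const _).add (IsAn.coord _)).mul
      (((IsAn.coord _).add (IsAn.const r)).pow _))
  obtain ⟨U, m, hU, hU0, hm, hm0, hprep⟩ := weierstrass_preparation hG (d := p)
    (u := fun t => q.eval (t + r)) (by fun_prop) (by simpa using hqr)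
    (Eventually.of_forall fun t => by simpa [G, ocons] using hfac t)
  let c : Fin n → (α → ℝ) → ℂ := fun i x => b i x / lam j x ^ (n - (i : ℕ)) - L i
  have hc : ∀ i, c i ∈ C := fun i => hC.sub (hC.div (hb i) (hC.pow (hlam j) _)) (hC.const _)
  have hc0 : ∀ i, Tendsto (c i) l (𝓝 0) := by
    intro i
    have h := ((hℓ i).pow (n - (i : ℕ))).sub_const (L i)
    rw [sub_self] at h
    refine h.congr' ?_
    filter_upwards [hlamb i] with x hx
    simp only [c, div_pow, hx]
  have hct : Tendsto (fun x k => c k x) l (𝓝 0) := tendsto_pi_nhds.2 hc0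
  obtain ⟨ζ, hζ, hroot⟩ := ih p hpn (a := fun i x => m i fun k => c k x) hp0
    fun i => hC.an (hm i) hc hc0
  have hζ0 : Tendsto ζ l (𝓝 0) := by
    refine tendsto_zero_of_root (fun i => ?_) hroot
    have := (hm i).continuousAt.tendsto.comp hct
    rwa [hm0] at this
  refine ⟨fun x => lam j x * (ζ x + r), hC.mul (hlam j) (hC.add hζ (hC.const r)), ?_⟩
  have hz : Tendsto (fun x => (ocons (ζ x) fun k => c k x : Option (Fin n) → ℂ)) l (𝓝 0) :=
    tendsto_pi_nhds.2 fun o => by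
      rcases o with _ | k
      · exact hζ0
      · exact hc0 k
  filter_upwards [hz.eventually hprep, hroot, hj] with x h1 h2 h3
  have h4 : (ζ x + r) ^ n + ∑ i : Fin n, b i x / lam j x ^ (n - (i : ℕ)) * (ζ x + r) ^ (i : ℕ) =
      0 := by
    have h5 : G (ocons (ζ x) fun k => c k x) = 0 := by
      rw [h1, monicPoly, Finset.sum_range]
      simp only [ocons, Option.elim_none, Option.elim_some]
      rw [h2, mul_zero]
    rw [← h5]
    simp [G, ocons, c]
  have h6 : (lam j x * (ζ x + r)) ^ n + ∑ i, b i x * (lam j x * (ζ x + r)) ^ (i : ℕ) =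
      lam j x ^ n * ((ζ x + r) ^ n +
        ∑ i : Fin n, b i x / lam j x ^ (n - (i : ℕ)) * (ζ x + r) ^ (i : ℕ)) := by
    rw [mul_add (lam j x ^ n), mul_pow, Finset.mul_sum]
    congr 1
    refine Finset.sum_congr rfl fun i _ => ?_
    rw [show lam j x ^ n = lam j x ^ (n - (i : ℕ)) * lam j x ^ (i : ℕ) by
      rw [← pow_add]; congr 1; omega, mul_pow]
    field_simp
  rw [h6, h4, mul_zero]

theorem good : Good l C := ⟨hC, fun hn ha => hC.exists_root hn ha⟩

end PreGood

namespace Good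

variable {l : Filter (α → ℝ)} {C : Set ((α → ℝ) → ℂ)} (hC : Good l C) {f g : (α → ℝ) → ℂ}
include hC

theorem real_zero_or {f : (α → ℝ) → ℝ} (hf : (fun x => (f x : ℂ)) ∈ C) :
    (∀ᶠ x in l, f x = 0) ∨ ∀ᶠ x in l, f x ≠ 0 := by
  simpa using hC.zero_or hf

/-- Real elements have a definite sign. -/
theorem sign {f : (α → ℝ) → ℝ} (hf : (fun x => (f x : ℂ)) ∈ C) :
    (∀ᶠ x in l, f x = 0) ∨ (∀ᶠ x in l, 0 < f x) ∨ ∀ᶠ x in l, f x < 0 := by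
  rcases hC.real_zero_or hf with h | h
  · exact Or.inl h
  right
  obtain ⟨h', hh', hroot⟩ := hC.root (n := 2) (a := ![fun x => -(f x : ℂ), fun _ => 0]) two_pos
    (by intro i; fin_cases i; exacts [hC.neg hf, hC.const 0])
  simp only [Fin.sum_univ_two, Matrix.cons_val_zero, Matrix.cons_val_one, zero_mul, add_zero,
    Fin.coe_ofNat_eq_mod, Nat.zero_mod, pow_zero, mul_one] at hroot
  rcases hC.real_zero_or (hC.re_mem hh') with h1 | h1
  · right
    filter_upwards [h, hroot, h1] with x k1 k2 k3
    have := congrArg Complex.re k2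
    simp [pow_two, k3] at this
    refine lt_of_le_of_ne ?_ k1
    nlinarith [mul_self_nonneg (h' x).im]
  · left
    filter_upwards [h, hroot, h1] with x k1 k2 k3
    have e1 := congrArg Complex.re k2
    have e2 := congrArg Complex.im k2
    simp [pow_two] at e1 e2
    have e3 : (h' x).im = 0 := by
      have : (h' x).re * (h' x).im = 0 := by linarith
      exact (mul_eq_zero.1 this).resolve_left k3
    refine lt_of_le_of_ne ?_ k1.symm
    rw [e3] at e1
    nlinarith [mul_self_nonneg (h' x).re]

/-- Absolute values of elements. -/
theorem norm_mem (hf : f ∈ C) : (fun x => (‖f x‖ : ℂ)) ∈ C := by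
  obtain ⟨h, hh, hroot⟩ := hC.root (n := 2)
    (a := ![fun x => -(f x * (starRingEnd ℂ) (f x)), fun _ => 0]) two_pos
    (by intro i; fin_cases i; exacts [hC.neg (hC.mul hf (hC.conj hf)), hC.const 0])
  simp only [Fin.sum_univ_two, Matrix.cons_val_zero, Matrix.cons_val_one, zero_mul, add_zero,
    Fin.coe_ofNat_eq_mod, Nat.zero_mod, pow_zero, mul_one] at hroot
  have key : ∀ᶠ x in l, ‖f x‖ = |(h x).re| := by
    filter_upwards [hroot] with x hx
    rw [Complex.mul_conj, Complex.normSq_eq_norm_sq, ← sub_eq_add_neg, sub_eq_zero] at hx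
    have e1 := congrArg Complex.re hx
    have e2 := congrArg Complex.im hx
    simp only [pow_two, Complex.mul_re, Complex.mul_im, Complex.ofReal_re,
      Complex.ofReal_im] at e1 e2
    have e3 : (h x).im = 0 := by
      have e4 : (h x).re * (h x).im = 0 := by linarith
      rcases mul_eq_zero.1 e4 with h0 | h0
      · rw [h0] at e1
        nlinarith [mul_self_nonneg (h x).im, mul_self_nonneg ‖f x‖]
      · exact h0
    rw [← abs_of_nonneg (norm_nonneg (f x)), ← sq_eq_sq_iff_abs_eq_abs]
    nlinarith
  rcases hC.sign (hC.re_mem hh) with h1 | h1 | h1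
  · refine hC.congr (hC.const 0) ?_
    filter_upwards [key, h1] with x k1 k2
    rw [k1, k2]; simp
  · refine hC.congr (hC.re_mem hh) ?_
    filter_upwards [key, h1] with x k1 k2
    rw [k1, abs_of_pos k2]
  · refine hC.congr (hC.neg (hC.re_mem hh)) ?_
    filter_upwards [key, h1] with x k1 k2
    rw [k1, abs_of_neg k2]; simp

/-- Monic polynomials split. -/
theorem splits {n : ℕ} {a : Fin n → (α → ℝ) → ℂ} (ha : ∀ i, a i ∈ C) :
    ∃ r : Fin n → (α → ℝ) → ℂ, (∀ i, r i ∈ C) ∧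
      ∀ᶠ x in l, ∀ z, z ^ n + ∑ i, a i x * z ^ (i : ℕ) = ∏ i, (z - r i x) := by
  induction n with
  | zero => exact ⟨fun i => i.elim0, fun i => i.elim0, Eventually.of_forall fun x z => by simp⟩
  | succ n ih =>
    obtain ⟨r, hr, hroot⟩ := hC.root n.succ_pos ha
    let b : Fin n → (α → ℝ) → ℂ := fun i x => r x ^ (n - i) +
      ∑ k : Fin (n + 1), if (i : ℕ) < k then a k x * r x ^ ((k : ℕ) - 1 - i) else 0
    have hb : ∀ i, b i ∈ C := fun i => hC.add (hC.pow hr _) (hC.sum _ fun k _ => by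
      by_cases h : (i : ℕ) < k
      · simpa only [if_pos h] using hC.mul (ha k) (hC.pow hr _)
      · simpa only [if_neg h] using hC.const 0)
    obtain ⟨s, hs, hprod⟩ := ih hb
    refine ⟨Fin.cons r s, Fin.cases hr hs, ?_⟩
    filter_upwards [hroot, hprod] with x h1 h2 z
    rw [Fin.prod_univ_succ]
    simp only [Fin.cons_zero, Fin.cons_succ]
    rw [← h2 z]
    have e1 : z ^ (n + 1) - r x ^ (n + 1) = (z - r x) * (z ^ n + ∑ i : Fin n, r x ^ (n - i) * z ^
        (i : ℕ)) := by
      rw [← geom_sum₂_mul, Finset.sum_range_succ, mul_comm, ← Fin.sum_univ_eq_sum_range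
        (fun i => z ^ i * r x ^ (n + 1 - 1 - i))]
      simp [mul_comm, add_comm]
    have e2 : ∀ k : Fin (n + 1), z ^ (k : ℕ) - r x ^ (k : ℕ) =
        (z - r x) * ∑ i : Fin n, (if (i : ℕ) < k then r x ^ ((k : ℕ) - 1 - i) else 0) * z ^
          (i : ℕ) := by
      intro k
      rw [← geom_sum₂_mul, mul_comm, Fin.sum_univ_eq_sum_range
        (fun i => (if i < (k : ℕ) then r x ^ ((k : ℕ) - 1 - i) else 0) * z ^ i)]
      congr 1
      rw [← Finset.sum_subset (Finset.range_mono (Nat.lt_succ_iff.1 k.2))]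
      · refine Finset.sum_congr rfl fun i hi => ?_
        rw [if_pos (Finset.mem_range.1 hi), mul_comm]
      · intro i _ hi
        rw [if_neg (by simpa using hi), zero_mul]
    have e3 : ∑ i : Fin n, b i x * z ^ (i : ℕ) = ∑ i : Fin n, r x ^ (n - i) * z ^ (i : ℕ) +
        ∑ k : Fin (n + 1), a k x * ∑ i : Fin n,
          (if (i : ℕ) < k then r x ^ ((k : ℕ) - 1 - i) else 0) * z ^ (i : ℕ) := by
      simp only [b, add_mul, Finset.sum_add_distrib, Finset.sum_mul, Finset.mul_sum]
      rw [Finset.sum_comm (γ := Fin (n + 1))]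
      congr 1
      refine Finset.sum_congr rfl fun k _ => Finset.sum_congr rfl fun i _ => ?_
      split_ifs <;> ring
    have e4 : (z - r x) * ∑ k : Fin (n + 1), a k x * ∑ i : Fin n,
          (if (i : ℕ) < k then r x ^ ((k : ℕ) - 1 - i) else 0) * z ^ (i : ℕ) =
        ∑ k : Fin (n + 1), a k x * z ^ (k : ℕ) - ∑ k : Fin (n + 1), a k x * r x ^ (k : ℕ) := by
      rw [Finset.mul_sum, ← Finset.sum_sub_distrib]
      refine Finset.sum_congr rfl fun k _ => ?_
      rw [← mul_sub, e2 k]; ring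
    rw [e3, ← add_assoc, mul_add, ← e1, e4]
    have hr : r x ^ (n + 1) + ∑ i, a i x * r x ^ (i : ℕ) = 0 := h1
    linear_combination hr

/-- Preparation of a function with coefficients in the field in one further variable. -/
theorem preparation {κ : Type} [Fintype κ] {F : (Option κ → ℂ) → ℂ} (hF : IsAn F)
    {e : κ → (α → ℝ) → ℂ} (he : ∀ k, e k ∈ C) (he0 : ∀ k, Tendsto (e k) l (𝓝 0)) :
    (∃ ε > 0, ∀ᶠ x in l, ∀ Z : ℂ, ‖Z‖ < ε → F (ocons Z fun k => e k x) = 0) ∨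
    ∃ a ∈ C, (∀ᶠ x in l, a x ≠ 0) ∧ ∃ (n : ℕ) (ζ : Fin n → (α → ℝ) → ℂ), (∀ i, ζ i ∈ C) ∧
      (∀ i, Tendsto (ζ i) l (𝓝 0)) ∧ ∃ (κ' : Type) (_ : Fintype κ') (e' : κ' → (α → ℝ) → ℂ),
      (∀ k, e' k ∈ C) ∧ (∀ k, Tendsto (e' k) l (𝓝 0)) ∧ ∃ U : (Option κ' → ℂ) → ℂ, IsAn U ∧
      U 0 ≠ 0 ∧ ∃ ε > 0, ∀ᶠ x in l, ∀ Z : ℂ, ‖Z‖ < ε → F (ocons Z fun k => e k x) =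
        a x * (∏ i, (Z - ζ i x)) * U (ocons Z fun k => e' k x) := by
  obtain ⟨d, a, H, ha, hH, hexp⟩ := hF.exists_finite_expansion
  have het : Tendsto (fun x k => e k x) l (𝓝 0) := tendsto_pi_nhds.2 he0
  -- evaluation of eventual identities
  have hev : ∀ {ι : Type} [Fintype ι] {p : (Option ι → ℂ) → Prop} {c : ι → (α → ℝ) → ℂ},
      (∀ᶠ z in 𝓝 0, p z) → (∀ k, Tendsto (c k) l (𝓝 0)) →
      ∃ ε > 0, ∀ᶠ x in l, ∀ Z : ℂ, ‖Z‖ < ε → p (ocons Z fun k => c k x) := by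
    intro ι _ p c hp hc
    obtain ⟨ε, hε, h⟩ := Metric.eventually_nhds_iff.1 hp
    refine ⟨ε, hε, ?_⟩
    have hct : Tendsto (fun x k => c k x) l (𝓝 0) := tendsto_pi_nhds.2 hc
    filter_upwards [hct.eventually (Metric.ball_mem_nhds 0 hε)] with x hx Z hZ
    exact h (by rw [dist_zero_right, norm_ocons_lt]; exact ⟨hZ, by simpa using hx⟩)
  obtain ⟨ε, hε, hexp'⟩ := hev hexp he0
  let A : Fin d → (α → ℝ) → ℂ := fun j x => a j fun k => e k x
  have hA : ∀ j, A j ∈ C := fun j => hC.an (ha j) he he0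
  rcases hC.exists_dominant hA with h0 | ⟨j₀, hj₀, hlim⟩
  · left
    refine ⟨ε, hε, ?_⟩
    filter_upwards [hexp', eventually_all.2 h0] with x h1 h2 Z hZ
    rw [h1 Z hZ, Finset.sum_range]
    exact Finset.sum_eq_zero fun j _ => by
      have : a j (fun k => e k x) = 0 := h2 j
      simp [ocons, this]
  right
  choose L hL using hlim
  have hL1 : L j₀ = 1 := by
    have := hC.neBot
    refine tendsto_nhds_unique (hL j₀) (tendsto_const_nhds.congr' ?_)
    filter_upwards [hj₀] with x hx
    rw [div_self hx]
  let G : (Option (κ ⊕ Fin d) → ℂ) → ℂ := fun z => ∑ j : Fin d, (L j + z (some (Sum.inr j))) *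
    (z none ^ (j : ℕ) + z none ^ d * H j fun o => z (o.map Sum.inl))
  have hG : IsAn G := IsAn.sum _ fun j _ => ((IsAn.const _).add (IsAn.coord _)).mul
    (((IsAn.coord _).pow _).add (((IsAn.coord _).pow _).mul ((hH j).reindex (Option.map Sum.inl))))
  let c : κ ⊕ Fin d → (α → ℝ) → ℂ := Sum.elim e fun j x => A j x / A j₀ x - L j
  have hc : ∀ k, c k ∈ C := by
    rintro (k | j)
    · exact he k
    · exact hC.sub (hC.div (hA _) (hA _)) (hC.const _)
  have hc0 : ∀ k, Tendsto (c k) l (𝓝 0) := by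
    rintro (k | j)
    · exact he0 k
    · have h := (hL j).sub_const (L j)
      rw [sub_self] at h
      exact h
  obtain ⟨p, hp, hpmin⟩ : ∃ p : Fin d, L p ≠ 0 ∧ ∀ j < p, L j = 0 := by
    have hne : (Finset.univ.filter fun j => L j ≠ 0).Nonempty :=
      ⟨j₀, by simp [hL1]⟩
    refine ⟨_, (Finset.mem_filter.1 (Finset.min'_mem _ hne)).2, fun j hj => ?_⟩
    by_contra h
    exact absurd (Finset.min'_le _ j (by simp [h])) (not_le.2 hj)
  let u : ℂ → ℂ := fun t => ∑ j : Fin d, if (p : ℕ) ≤ j then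
    L j * (t ^ ((j : ℕ) - p) + t ^ (d - p) * H j (ocons t 0)) else 0
  have hHc : ∀ j, ContinuousAt (fun t : ℂ => H j (ocons t 0)) 0 := fun j => by
    have h := (hH j).continuousAt.tendsto.comp tendsto_ocons_zero
    change Tendsto _ _ (𝓝 (H j (ocons 0 0)))
    rw [ocons_zero]
    exact h
  have hu : ContinuousAt u 0 := by
    refine tendsto_finsetSum _ fun j _ => ?_
    by_cases h : (p : ℕ) ≤ j
    · simp only [if_pos h]
      have h1 : ContinuousAt (fun t : ℂ => L j * (t ^ ((j : ℕ) - p) + t ^ (d - p) * H j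
          (ocons t 0))) 0 :=
        continuousAt_const.mul ((continuousAt_id.pow _).add ((continuousAt_id.pow _).mul (hHc j)))
      exact h1
    · simp only [if_neg h]; exact tendsto_const_nhds
  have hu0 : u 0 = L p := by
    have hdp : d - (p : ℕ) ≠ 0 := by omega
    simp only [u, zero_pow hdp, zero_mul, add_zero]
    rw [Finset.sum_eq_single p]
    · simp
    · intro j _ hj
      by_cases h : (p : ℕ) ≤ j
      · have : (j : ℕ) - p ≠ 0 := by
          have : (j : ℕ) ≠ p := fun h => hj (Fin.ext h)
          omega
        rw [if_pos h, zero_pow this, mul_zero]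
      · rw [if_neg h]
    · simp
  have hGu : ∀ t, G (ocons t 0) = t ^ (p : ℕ) * u t := by
    intro t
    simp only [G, u, Finset.mul_sum]
    refine Finset.sum_congr rfl fun j _ => ?_
    have e1 : (fun o : Option κ => (ocons t 0 : Option (κ ⊕ Fin d) → ℂ) (o.map Sum.inl)) =
        ocons t 0 := by
      funext o; rcases o with _ | o <;> rfl
    rw [e1]
    simp only [ocons, Option.elim_none, Option.elim_some, Pi.zero_apply, add_zero]
    by_cases h : (p : ℕ) ≤ j
    · rw [if_pos h]
      have e2 : t ^ (j : ℕ) = t ^ (p : ℕ) * t ^ ((j : ℕ) - p) := by rw [← pow_add]; congr 1; omega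
      have e3 : t ^ d = t ^ (p : ℕ) * t ^ (d - p) := by rw [← pow_add]; congr 1; omega
      rw [e2, e3]; ring
    · rw [if_neg h, hpmin j (by simpa using h)]; ring
  obtain ⟨U, m, hU, hU0, hm, hm0, hprep⟩ := weierstrass_preparation hG (d := p) hu (by rwa [hu0])
    (Eventually.of_forall hGu)
  obtain ⟨δ, hδ, hprep'⟩ := hev hprep hc0
  have hmC : ∀ i : Fin p, (fun x => m i fun k => c k x) ∈ C := fun i => hC.an (hm i) hc hc0
  obtain ⟨ζ, hζ, hsplit⟩ := hC.splits hmC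
  have hct : Tendsto (fun x k => c k x) l (𝓝 0) := tendsto_pi_nhds.2 hc0
  refine ⟨A j₀, hA _, hj₀, p, ζ, hζ, fun i => ?_, κ ⊕ Fin d, inferInstance, c, hc, hc0, U, hU, hU0,
    min ε δ, lt_min hε hδ, ?_⟩
  · refine tendsto_zero_of_root (a := fun i x => m i fun k => c k x) (fun j => ?_) ?_ (n := p)
    · have := (hm j).continuousAt.tendsto.comp hct
      rwa [hm0] at this
    · filter_upwards [hsplit] with x hx
      rw [hx]
      exact Finset.prod_eq_zero (Finset.mem_univ i) (sub_self _)
  · filter_upwards [hexp', hprep', hsplit, hj₀] with x h1 h2 h3 h4 Z hZ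
    have k1 := h2 Z (hZ.trans_le (min_le_right _ _))
    have k2 : F (ocons Z fun k => e k x) = A j₀ x * G (ocons Z fun k => c k x) := by
      rw [h1 Z (hZ.trans_le (min_le_left _ _)), Finset.sum_range, Finset.mul_sum]
      refine Finset.sum_congr rfl fun j _ => ?_
      have e1 : (fun o : Option κ => (ocons Z fun k => c k x : Option (κ ⊕ Fin d) → ℂ)
          (o.map Sum.inl)) = ocons Z fun k => e k x := by
        funext o; rcases o with _ | o <;> rfl
      rw [e1]
      have e2 : A j₀ x * (L j + (ocons Z fun k => c k x : Option (κ ⊕ Fin d) → ℂ)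
          (some (Sum.inr j))) = a j fun k => e k x := by
        change A j₀ x * (L j + (A j x / A j₀ x - L j)) = A j x
        field_simp
        ring
      rw [← mul_assoc, e2]
      rfl
    rw [k2, k1, ← h3 Z, monicPoly, Finset.sum_range]
    simp only [ocons, Option.elim_none, Option.elim_some]
    ring

end Good

end GoodFields

section Elementary

open Filter Topology

theorem Tame.log {α : Type} {f : (α → ℝ) → ℝ} (hf : Tame f) : Tame fun x => Real.log (f x) := by
  refine Tame.of_unique_one (p := fun x w => (f x = 0 ∧ w = 0) ∨
    (¬ f x = 0 ∧ Real.exp w * Real.exp w = f x * f x)) ?_ ?_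
  · have h1 := hf.reindex (Sum.inl : α → α ⊕ Unit)
    have h2 : Tame fun y : α ⊕ Unit → ℝ => y (Sum.inr ()) := Tame.proj _
    exact ((TPred.eq h1 (Tame.const 0)).and (TPred.eq h2 (Tame.const 0))).or
      ((TPred.eq h1 (Tame.const 0)).not.and (TPred.eq (h2.exp.mul h2.exp) (h1.mul h1)))
  · intro x w
    by_cases h : f x = 0
    · simp [h]
    · simp only [h, false_and, not_false_eq_true, true_and, false_or]
      rw [mul_self_eq_mul_self_iff, ← abs_eq_abs, abs_of_pos (Real.exp_pos w)]
      constructor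
      · intro h1
        rw [← Real.log_abs, ← h1, Real.log_exp]
      · rintro rfl
        rw [Real.exp_log_eq_abs h]

theorem isAn_exp {κ : Type} [Fintype κ] (k : κ) : IsAn fun z : κ → ℂ => Complex.exp (z k) := by
  have hd : ∀ z : κ → ℂ, HasFDerivAt (fun z : κ → ℂ => Complex.exp (z k))
      (Complex.exp (z k) • (ContinuousLinearMap.proj k : (κ → ℂ) →L[ℂ] ℂ)) z := fun z =>
    (hasFDerivAt_apply k z).cexp
  refine IsAn.of_system (S := {fun z : κ → ℂ => Complex.exp (z k)}) ?_ rfl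
  rintro G rfl
  refine ⟨⟨1, one_pos, ?_⟩, Eventually.of_forall fun z => (hd z).differentiableAt, fun i => ?_⟩
  · have hp := TPred.norm_lt (κ := κ) TameC.cplx one_pos
    have h := TameC.cplx (κ := κ) k
    refine (TameC.ite hp (TameC.mk' (h.1.exp.mul h.2.cosR) (h.1.exp.mul h.2.sinR))
      (TameC.const 0)).congr fun v => ?_
    by_cases hv : ‖cplx v‖ < 1
    · simp only [if_pos hv]
      have h1 : |(cplx v k).im| < 1 :=
        (Complex.abs_im_le_norm _).trans_lt ((norm_le_pi_norm _ k).trans_lt hv)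
      have h2 : -Real.pi ≤ (cplx v k).im ∧ (cplx v k).im ≤ Real.pi := by
        have := abs_lt.1 h1
        constructor <;> linarith [Real.pi_gt_three]
      rw [if_pos h2, if_pos h2]
      apply Complex.ext
      · rw [Complex.exp_re]
      · rw [Complex.exp_im]
    · simp only [if_neg hv]
  · classical
    have hm : (fun z : κ → ℂ => Complex.exp (z k)) ∈ Algebra.adjoin ℂ
        (({fun z : κ → ℂ => Complex.exp (z k)} : Set ((κ → ℂ) → ℂ)) ∪ {F | IsAn F}) :=
      Algebra.subset_adjoin (Set.mem_union_left _ (Set.mem_singleton _))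
    refine ⟨(if i = k then (1 : ℂ) else 0) • (fun z : κ → ℂ => Complex.exp (z k)),
      Subalgebra.smul_mem _ hm _, Eventually.of_forall fun z => ?_⟩
    simp only [pd, (hd z).fderiv]
    by_cases h : i = k
    · subst h; simp
    · simp [h]

/-- The logarithm near one. -/
theorem exists_isAn_log : ∃ ψ : (Unit → ℂ) → ℂ, IsAn ψ ∧ ψ 0 = 0 ∧
    ∀ᶠ z in 𝓝 0, Complex.exp (ψ z) = 1 + z () := by
  let H : (Unit ⊕ Unit → ℂ) → ℂ := fun z => Complex.exp (z (Sum.inr ())) - (1 + z (Sum.inl ()))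
  have hH : IsAn H := (isAn_exp _).sub ((IsAn.const 1).add (IsAn.coord _))
  obtain ⟨y, hy, hy0, h⟩ := IsAn.implicitFunction (ι := Unit) (H := fun _ => H) (fun _ => hH)
    (fun _ => by simp [H]) (by
      have hd : HasFDerivAt H (Complex.exp ((0 : Unit ⊕ Unit → ℂ) (Sum.inr ())) •
          (ContinuousLinearMap.proj (Sum.inr ()) : (Unit ⊕ Unit → ℂ) →L[ℂ] ℂ) -
          (ContinuousLinearMap.proj (Sum.inl ()) : (Unit ⊕ Unit → ℂ) →L[ℂ] ℂ)) 0 :=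
        (hasFDerivAt_apply _ _).cexp.sub ((hasFDerivAt_apply _ _).const_add 1)
      simp [pd, hd.fderiv])
  refine ⟨y (), hy (), hy0 (), ?_⟩
  filter_upwards [h] with z hz
  have := hz ()
  simp only [H, Sum.elim_inl, Sum.elim_inr, sub_eq_zero] at this
  exact this

end Elementary

section Generators

open Filter Topology

variable {α : Type}

/-- Germs which are analytic functions of a set of infinitesimals. -/
def GenRing (l : Filter (α → ℝ)) (E : Set ((α → ℝ) → ℂ)) : Set ((α → ℝ) → ℂ) :=
  {f | ∃ (κ : Type) (_ : Fintype κ) (F : (κ → ℂ) → ℂ) (e : κ → (α → ℝ) → ℂ), IsAn F ∧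
    (∀ k, e k ∈ E) ∧ ∀ᶠ x in l, f x = F fun k => e k x}

/-- Products of a monomial and an analytic unit, together with zero. -/
def GenField (l : Filter (α → ℝ)) (E M : Set ((α → ℝ) → ℂ)) : Set ((α → ℝ) → ℂ) :=
  {f | (∀ᶠ x in l, f x = 0) ∨ ∃ m ∈ M, ∃ g ∈ GenRing l E, ∃ c ≠ 0, Tendsto g l (𝓝 c) ∧
    ∀ᶠ x in l, f x = m x * g x}

/-- Infinitesimals and monomials. -/
structure PreGen (l : Filter (α → ℝ)) (E M : Set ((α → ℝ) → ℂ)) : Prop where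
  neBot : l.NeBot
  zero : ∀ {e}, e ∈ E → Tendsto e l (𝓝 0)
  conj : ∀ {e}, e ∈ E → (fun x => (starRingEnd ℂ) (e x)) ∈ E
  tame : ∀ {e}, e ∈ E → ∃ g, TameC g ∧ e =ᶠ[l] g
  one : (fun _ => 1) ∈ M
  mmul : ∀ {m n}, m ∈ M → n ∈ M → (fun x => m x * n x) ∈ M
  minv : ∀ {m}, m ∈ M → (fun x => (m x)⁻¹) ∈ M
  mconj : ∀ {m}, m ∈ M → (fun x => (starRingEnd ℂ) (m x)) ∈ M
  mne : ∀ {m}, m ∈ M → ∀ᶠ x in l, m x ≠ 0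
  mroot : ∀ {n : ℕ} {m}, 0 < n → m ∈ M → ∃ r ∈ M, ∀ᶠ x in l, r x ^ n = m x
  mtame : ∀ {m}, m ∈ M → ∃ g, TameC g ∧ m =ᶠ[l] g
  mlim : ∀ {m}, m ∈ M → (∃ c : ℂ, (fun x => m x - c) ∈ E) ∨ ∃ c : ℂ, (fun x => (m x)⁻¹ - c) ∈ E

/-- Infinitesimals and monomials generating a field of germs. -/
structure Gen (l : Filter (α → ℝ)) (E M : Set ((α → ℝ) → ℂ)) : Prop extends PreGen l E M where
  factor : ∀ {κ : Type} [Fintype κ] {F : (κ → ℂ) → ℂ} {e : κ → (α → ℝ) → ℂ}, IsAn F →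
    (∀ k, e k ∈ E) → (fun x => F fun k => e k x) ∈ GenField l E M

namespace PreGen

variable {l : Filter (α → ℝ)} {E M : Set ((α → ℝ) → ℂ)} (h : PreGen l E M) {f g : (α → ℝ) → ℂ}

theorem congr (hf : f ∈ GenRing l E) (hfg : ∀ᶠ x in l, g x = f x) : g ∈ GenRing l E := by
  obtain ⟨κ, _, F, e, hF, he, hf⟩ := hf
  exact ⟨κ, _, F, e, hF, he, by filter_upwards [hf, hfg] with x h1 h2 using h2.trans h1⟩

include h

theorem tendsto_pi {κ : Type} [Fintype κ] {e : κ → (α → ℝ) → ℂ} (he : ∀ k, e k ∈ E) :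
    Tendsto (fun x k => e k x) l (𝓝 0) := tendsto_pi_nhds.2 fun k => h.zero (he k)

theorem lim {κ : Type} [Fintype κ] {F : (κ → ℂ) → ℂ} {e : κ → (α → ℝ) → ℂ} (hF : IsAn F)
    (he : ∀ k, e k ∈ E) (hf : ∀ᶠ x in l, f x = F fun k => e k x) : Tendsto f l (𝓝 (F 0)) :=
  (hF.continuousAt.tendsto.comp (h.tendsto_pi he)).congr' (hf.mono fun _ hx => hx.symm)

theorem exists_lim (hf : f ∈ GenRing l E) : ∃ c, Tendsto f l (𝓝 c) := by
  obtain ⟨κ, _, F, e, hF, he, hf⟩ := hf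
  exact ⟨_, h.lim hF he hf⟩

theorem an {ι : Type} [Fintype ι] {G : (ι → ℂ) → ℂ} (hG : IsAn G) {f : ι → (α → ℝ) → ℂ} {c : ι → ℂ}
    (hf : ∀ i, f i ∈ GenRing l E) (hc : ∀ i, Tendsto (f i) l (𝓝 (c i))) :
    (fun x => G fun i => f i x - c i) ∈ GenRing l E := by
  have := h.neBot
  choose κ hκ F e hF he hf using hf
  have hc' : ∀ i, F i 0 = c i := fun i => tendsto_nhds_unique (h.lim (hF i) (he i) (hf i)) (hc i)
  refine ⟨Σ i, κ i, inferInstance, fun z => G fun i => F i (fun k => z ⟨i, k⟩) - c i,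
    fun p => e p.1 p.2, ?_, fun p => he p.1 p.2, ?_⟩
  · exact hG.comp (fun i => ((hF i).reindex (Sigma.mk i)).sub (IsAn.const (c i)))
      fun i => sub_eq_zero.2 (hc' i)
  · filter_upwards [eventually_all.2 hf] with x hx
    simp only [hx]

omit h in
theorem const (c : ℂ) : (fun _ => c) ∈ GenRing l E :=
  ⟨Empty, inferInstance, fun _ => c, fun k => k.elim, IsAn.const c, fun k => k.elim,
    Eventually.of_forall fun _ => rfl⟩

omit h in
theorem of_mem (hf : f ∈ E) : f ∈ GenRing l E :=
  ⟨Unit, inferInstance, fun z => z (), fun _ => f, IsAn.coord _, fun _ => hf,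
    Eventually.of_forall fun _ => rfl⟩

theorem add (hf : f ∈ GenRing l E) (hg : g ∈ GenRing l E) : (fun x => f x + g x) ∈ GenRing l E := by
  obtain ⟨a, ha⟩ := h.exists_lim hf
  obtain ⟨b, hb⟩ := h.exists_lim hg
  refine congr (h.an (ι := Bool) (f := fun t => bif t then f else g)
    (c := fun t => bif t then a else b)
    (((IsAn.coord true).add (IsAn.coord false)).add (IsAn.const (a + b))) ?_ ?_) ?_
  · rintro (_ | _) <;> assumption
  · rintro (_ | _) <;> assumption
  · exact Eventually.of_forall fun x => by simp; ring

theorem mul (hf : f ∈ GenRing l E) (hg : g ∈ GenRing l E) : (fun x => f x * g x) ∈ GenRing l E := by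
  obtain ⟨a, ha⟩ := h.exists_lim hf
  obtain ⟨b, hb⟩ := h.exists_lim hg
  refine congr (h.an (ι := Bool) (f := fun t => bif t then f else g)
    (c := fun t => bif t then a else b)
    (((IsAn.coord true).add (IsAn.const a)).mul ((IsAn.coord false).add (IsAn.const b))) ?_ ?_) ?_
  · rintro (_ | _) <;> assumption
  · rintro (_ | _) <;> assumption
  · exact Eventually.of_forall fun x => by simp

theorem inv {c : ℂ} (hf : f ∈ GenRing l E) (hc : Tendsto f l (𝓝 c)) (hc0 : c ≠ 0) :
    (fun x => (f x)⁻¹) ∈ GenRing l E := by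
  refine congr (h.an (ι := Unit) (f := fun _ => f) (c := fun _ => c)
    (((IsAn.coord ()).add (IsAn.const c)).inv (by simpa using hc0)) (fun _ => hf) fun _ => hc) ?_
  exact Eventually.of_forall fun x => by simp

theorem gconj (hf : f ∈ GenRing l E) : (fun x => (starRingEnd ℂ) (f x)) ∈ GenRing l E := by
  obtain ⟨κ, _, F, e, hF, he, hf⟩ := hf
  refine ⟨κ, _, _, fun k x => (starRingEnd ℂ) (e k x), hF.conj_conj, fun k => h.conj (he k), ?_⟩
  filter_upwards [hf] with x hx
  simp [hx]

/-- The logarithm of a unit. -/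
theorem exists_log {c : ℂ} (hf : f ∈ GenRing l E) (hc : Tendsto f l (𝓝 c)) (hc0 : c ≠ 0) :
    ∃ g ∈ GenRing l E, ∀ᶠ x in l, Complex.exp (g x) = f x := by
  obtain ⟨ψ, hψ, hψ0, hexp⟩ := exists_isAn_log
  have h1 : (fun x => f x * c⁻¹) ∈ GenRing l E := h.mul hf (const _)
  have h2 : Tendsto (fun x => f x * c⁻¹) l (𝓝 1) := by
    simpa [hc0] using hc.mul_const c⁻¹
  refine ⟨_, h.add (h.an (ι := Unit) hψ (fun _ => h1) (c := fun _ => 1) fun _ => h2)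
    (const (Complex.log c)), ?_⟩
  have h3 : Tendsto (fun x => (fun _ => f x * c⁻¹ - 1 : Unit → ℂ)) l (𝓝 0) :=
    tendsto_pi_nhds.2 fun _ => by simpa using h2.sub_const 1
  filter_upwards [h3.eventually hexp] with x hx
  rw [Complex.exp_add, hx, Complex.exp_log hc0]
  field_simp
  ring

theorem unit_root {c : ℂ} (hf : f ∈ GenRing l E) (hc : Tendsto f l (𝓝 c)) (hc0 : c ≠ 0) {n : ℕ}
    (hn : 0 < n) : ∃ g ∈ GenRing l E, (∃ d ≠ 0, Tendsto g l (𝓝 d)) ∧ ∀ᶠ x in l, g x ^ n = f x := by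
  obtain ⟨L, hL, hexp⟩ := h.exists_log hf hc hc0
  have h1 := h.mul hL (const (n : ℂ)⁻¹)
  obtain ⟨d, hd⟩ := h.exists_lim h1
  refine ⟨fun x => Complex.exp (L x * (n : ℂ)⁻¹), ?_, ⟨Complex.exp d, Complex.exp_ne_zero _,
    hd.cexp⟩, ?_⟩
  · refine congr (h.an (ι := Unit) (f := fun _ x => L x * (n : ℂ)⁻¹) (c := fun _ => d)
      ((isAn_exp ()).mul (IsAn.const (Complex.exp d))) (fun _ => h1) fun _ => hd) ?_
    exact Eventually.of_forall fun x => by rw [← Complex.exp_add, sub_add_cancel]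
  · filter_upwards [hexp] with x hx
    have : (n : ℂ) ≠ 0 := by exact_mod_cast hn.ne'
    rw [← Complex.exp_nat_mul, ← hx]
    congr 1
    field_simp

theorem gtame (hf : f ∈ GenRing l E) : ∃ g, TameC g ∧ f =ᶠ[l] g := by
  obtain ⟨κ, _, F, e, hF, he, hf⟩ := hf
  choose r hr her using fun k => h.tame (he k)
  obtain ⟨ε, hε, hd⟩ := hF.defAt.comp_tame
  refine ⟨_, hd ε hε le_rfl hr, ?_⟩
  filter_upwards [hf, eventually_all.2 her, (h.tendsto_pi he).eventually
    (Metric.ball_mem_nhds 0 hε)]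
    with x h1 h2 h3
  have h4 : (fun k => e k x) = fun k => r k x := funext h2
  rw [h4] at h1 h3
  rw [if_pos (by simpa using h3), h1]

omit h in
theorem fcongr (hf : f ∈ GenField l E M) (hfg : f =ᶠ[l] g) : g ∈ GenField l E M := by
  rcases hf with hf | ⟨m, hm, u, hu, c, hc, hl, hf⟩
  · exact Or.inl (by filter_upwards [hf, hfg] with x h1 h2 using h2.symm.trans h1)
  · exact Or.inr ⟨m, hm, u, hu, c, hc, hl,
      by filter_upwards [hf, hfg] with x h1 h2 using h2.symm.trans h1⟩

theorem mul_mem_field {m : (α → ℝ) → ℂ} (hm : m ∈ M) (hf : f ∈ GenField l E M) :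
    (fun x => m x * f x) ∈ GenField l E M := by
  rcases hf with hf | ⟨n, hn, u, hu, c, hc, hl, hf⟩
  · exact Or.inl (by filter_upwards [hf] with x h1; rw [h1, mul_zero])
  · exact Or.inr ⟨_, h.mmul hm hn, u, hu, c, hc, hl,
      by filter_upwards [hf] with x h1; rw [h1, mul_assoc]⟩

theorem ring_or_inv {m : (α → ℝ) → ℂ} (hm : m ∈ M) :
    m ∈ GenRing l E ∨ (fun x => (m x)⁻¹) ∈ GenRing l E := by
  rcases h.mlim hm with ⟨c, hc⟩ | ⟨c, hc⟩
  · exact Or.inl (congr (h.add (of_mem hc) (const c)) (Eventually.of_forall fun x => by ring))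
  · exact Or.inr (congr (h.add (of_mem hc) (const c)) (Eventually.of_forall fun x => by ring))

theorem field_inv (hf : f ∈ GenField l E M) : (fun x => (f x)⁻¹) ∈ GenField l E M := by
  rcases hf with h0 | ⟨m, hm, u, hu, c, hc, hl, hf⟩
  · exact Or.inl (by filter_upwards [h0] with x hx; rw [hx, inv_zero])
  · refine Or.inr ⟨_, h.minv hm, _, h.inv hu hl hc, c⁻¹, inv_ne_zero hc, hl.inv₀ hc, ?_⟩
    filter_upwards [hf] with x hx
    rw [hx, mul_inv]

theorem field_mul (hf : f ∈ GenField l E M) (hg : g ∈ GenField l E M) :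
    (fun x => f x * g x) ∈ GenField l E M := by
  rcases hf with h0 | ⟨m, hm, u, hu, c, hc, hl, hf⟩
  · exact Or.inl (by filter_upwards [h0] with x hx; rw [hx, zero_mul])
  rcases hg with h0 | ⟨n, hn, v, hv, d, hd, hl', hg⟩
  · exact Or.inl (by filter_upwards [h0] with x hx; rw [hx, mul_zero])
  refine Or.inr ⟨_, h.mmul hm hn, _, h.mul hu hv, _, mul_ne_zero hc hd, hl.mul hl', ?_⟩
  filter_upwards [hf, hg] with x h1 h2
  rw [h1, h2]; ring

theorem field_of_unit {c : ℂ} (hf : f ∈ GenRing l E) (hc : Tendsto f l (𝓝 c)) (hc0 : c ≠ 0) :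
    f ∈ GenField l E M :=
  Or.inr ⟨_, h.one, f, hf, c, hc0, hc, Eventually.of_forall fun x => (one_mul _).symm⟩

theorem field_of_monomial {m : (α → ℝ) → ℂ} (hm : m ∈ M) : m ∈ GenField l E M :=
  Or.inr ⟨m, hm, _, const 1, 1, one_ne_zero, tendsto_const_nhds,
    Eventually.of_forall fun x => (mul_one _).symm⟩

theorem field_prod {τ : Type*} {F : τ → (α → ℝ) → ℂ} (s : Finset τ)
    (hF : ∀ i ∈ s, F i ∈ GenField l E M) : (fun x => ∏ i ∈ s, F i x) ∈ GenField l E M := by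
  classical
  induction s using Finset.induction_on with
  | empty => simpa using h.field_of_monomial h.one
  | insert a s ha ih =>
    simp only [Finset.prod_insert ha]
    exact h.field_mul (hF a (by simp)) (ih fun i hi => hF i (by simp [hi]))

end PreGen

namespace Gen

open PreGen

variable {l : Filter (α → ℝ)} {E M : Set ((α → ℝ) → ℂ)} (h : Gen l E M) {f g : (α → ℝ) → ℂ}
include h

theorem field_of_ring (hf : f ∈ GenRing l E) : f ∈ GenField l E M := by
  obtain ⟨κ, _, F, e, hF, he, hf⟩ := hf
  exact fcongr (h.factor hF he) (hf.mono fun _ hx => hx.symm)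

theorem field_add_aux {m n : (α → ℝ) → ℂ} (hm : m ∈ M)
    (hmn : (fun x => n x * (m x)⁻¹) ∈ GenRing l E) (hf : f ∈ GenRing l E) (hg : g ∈ GenRing l E) :
    (fun x => m x * f x + n x * g x) ∈ GenField l E M := by
  refine fcongr (h.mul_mem_field hm (h.field_of_ring (h.add hf (h.mul hmn hg)))) ?_
  filter_upwards [h.mne hm] with x hx
  field_simp

theorem field_add (hf : f ∈ GenField l E M) (hg : g ∈ GenField l E M) :
    (fun x => f x + g x) ∈ GenField l E M := by
  rcases hf with h0 | ⟨m, hm, u, hu, c, hc, hl, hf⟩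
  · exact fcongr hg (by filter_upwards [h0] with x hx; rw [hx, zero_add])
  rcases hg with h0 | ⟨n, hn, v, hv, d, hd, hl', hg⟩
  · exact Or.inr ⟨m, hm, u, hu, c, hc, hl, by filter_upwards [hf, h0] with x h1 h2; rw [h1, h2, add_zero]⟩
  rcases h.ring_or_inv (h.mmul hn (h.minv hm)) with h1 | h1
  · refine fcongr (h.field_add_aux hm h1 hu hv) ?_
    filter_upwards [hf, hg] with x h1 h2
    rw [h1, h2]
  · have h2 : (fun x => m x * (n x)⁻¹) ∈ GenRing l E := congr h1 (Eventually.of_forall fun x => by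
      rw [mul_inv, inv_inv, mul_comm])
    refine fcongr (h.field_add_aux hn h2 hv hu) ?_
    filter_upwards [hf, hg] with x h1 h2
    rw [h1, h2, add_comm]

theorem ring_of_field_of_tendsto {a : ℂ} (hf : f ∈ GenField l E M) (ha : Tendsto f l (𝓝 a)) :
    f ∈ GenRing l E := by
  have := h.neBot
  rcases hf with h0 | ⟨m, hm, u, hu, c, hc, hl, hf⟩
  · exact congr (const 0) h0
  rcases h.ring_or_inv hm with h1 | h1
  · exact congr (h.mul h1 hu) hf
  · obtain ⟨ν, hν⟩ := h.exists_lim h1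
    have hν0 : ν ≠ 0 := by
      rintro rfl
      apply hc
      refine tendsto_nhds_unique hl ?_
      have := hν.mul ha
      rw [zero_mul] at this
      refine this.congr' ?_
      filter_upwards [hf, h.mne hm] with x h1 h2
      rw [h1]; field_simp
    have h2 := h.inv h1 hν hν0
    simp only [inv_inv] at h2
    exact congr (h.mul h2 hu) hf

theorem preGood : PreGood l (GenField l E M) where
  neBot := h.neBot
  const c := h.field_of_ring (const c)
  add := h.field_add
  mul := h.field_mul
  inv := h.field_inv
  conj {f} hf := by
    rcases hf with h0 | ⟨m, hm, u, hu, c, hc, hl, hf⟩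
    · exact Or.inl (by filter_upwards [h0] with x hx; rw [hx, map_zero])
    refine Or.inr ⟨_, h.mconj hm, _, h.gconj hu, (starRingEnd ℂ) c, by simpa using hc,
      (Complex.continuous_conj.tendsto c).comp hl, ?_⟩
    filter_upwards [hf] with x h1
    rw [h1, map_mul]
  congr := fcongr
  zero_or {f} hf := by
    rcases hf with h0 | ⟨m, hm, u, hu, c, hc, hl, hf⟩
    · exact Or.inl h0
    · right
      filter_upwards [hf, h.mne hm, hl.eventually_ne hc] with x h1 h2 h3
      rw [h1]; exact mul_ne_zero h2 h3
  lim_or {f} hf := by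
    rcases hf with h0 | ⟨m, hm, u, hu, c, hc, hl, hf⟩
    · exact Or.inl ⟨0, tendsto_const_nhds.congr' (h0.mono fun _ hx => hx.symm)⟩
    rcases h.ring_or_inv hm with h1 | h1
    · obtain ⟨a, ha⟩ := h.exists_lim h1
      exact Or.inl ⟨_, (ha.mul hl).congr' (hf.mono fun _ hx => hx.symm)⟩
    · obtain ⟨a, ha⟩ := h.exists_lim h1
      refine Or.inr ⟨_, (ha.mul (hl.inv₀ hc)).congr' ?_⟩
      filter_upwards [hf] with x hx
      rw [hx, mul_inv]
  nthRoot {n f} hn hf := by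
    rcases hf with h0 | ⟨m, hm, u, hu, c, hc, hl, hf⟩
    · exact ⟨fun _ => 0, h.field_of_ring (const 0), by
        filter_upwards [h0] with x hx; rw [hx, zero_pow hn.ne']⟩
    obtain ⟨r, hr, hrm⟩ := h.mroot hn hm
    obtain ⟨v, hv, ⟨d, hd, hvd⟩, hvu⟩ := h.unit_root hu hl hc hn
    refine ⟨fun x => r x * v x, Or.inr ⟨r, hr, v, hv, d, hd, hvd, Eventually.of_forall fun _ =>
      rfl⟩, ?_⟩
    filter_upwards [hf, hrm, hvu] with x h1 h2 h3
    rw [mul_pow, h2, h3, h1]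
  an {κ _ F} hF e he he0 := by
    have := h.an hF (fun k => h.ring_of_field_of_tendsto (he k) (he0 k)) he0
    simp only [sub_zero] at this
    exact h.field_of_ring this
  tame {f} hf := by
    rcases hf with h0 | ⟨m, hm, u, hu, c, hc, hl, hf⟩
    · exact ⟨fun _ => 0, TameC.const 0, h0⟩
    obtain ⟨m', hm', h1⟩ := h.mtame hm
    obtain ⟨u', hu', h2⟩ := h.gtame hu
    refine ⟨_, hm'.mul hu', ?_⟩
    filter_upwards [hf, h1, h2] with x k1 k2 k3
    rw [k1, k2, k3]

theorem good : Good l (GenField l E M) := h.preGood.good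

/-- Logarithms of absolute values reduce to monomials. -/
theorem log_norm {f : (α → ℝ) → ℂ} (hf : f ∈ GenField l E M) (hf0 : ¬ ∀ᶠ x in l, f x = 0) :
    ∃ m ∈ M, ∃ g ∈ GenField l E M, ∃ c, Tendsto g l (𝓝 c) ∧
      ∀ᶠ x in l, ((Real.log ‖f x‖ : ℝ) : ℂ) = ((Real.log ‖m x‖ : ℝ) : ℂ) + g x := by
  rcases hf with h0 | ⟨m, hm, u, hu, c, hc, hl, hf⟩
  · exact absurd h0 hf0
  obtain ⟨L, hL, hexp⟩ := h.exists_log hu hl hc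
  have h1 := h.good.re_mem (h.field_of_ring hL)
  obtain ⟨d, hd⟩ := h.exists_lim hL
  refine ⟨m, hm, _, h1, ((d.re : ℝ) : ℂ),
    ((Complex.continuous_ofReal.comp Complex.continuous_re).tendsto d).comp hd, ?_⟩
  filter_upwards [hf, hexp, h.mne hm] with x k1 k2 k3
  rw [k1, norm_mul, ← k2, Complex.norm_exp,
    Real.log_mul (norm_ne_zero_iff.2 k3) (Real.exp_ne_zero _), Real.log_exp]
  push_cast
  rfl

end Gen

end Generators

section Immediate

open Filter Topology

variable {α : Type}

theorem Good.exists_dominant_fintype {l : Filter (α → ℝ)} {C : Set ((α → ℝ) → ℂ)} (hC : Good l C)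
    {κ : Type} [Fintype κ] {a : κ → (α → ℝ) → ℂ} (ha : ∀ i, a i ∈ C) :
    (∀ i, ∀ᶠ x in l, a i x = 0) ∨ ∃ j, (∀ᶠ x in l, a j x ≠ 0) ∧
      ∀ i, ∃ c, Tendsto (fun x => a i x / a j x) l (𝓝 c) := by
  let σ := Fintype.equivFin κ
  rcases hC.exists_dominant (fun i => ha (σ.symm i)) with h | ⟨j, hj, h⟩
  · exact Or.inl fun i => by simpa using h (σ i)
  · exact Or.inr ⟨σ.symm j, hj, fun i => by simpa using h (σ i)⟩

/-- A real germ approximated by a field without best approximation. -/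
structure ImmediateOver (l : Filter (α → ℝ)) (C : Set ((α → ℝ) → ℂ)) (b : (α → ℝ) → ℝ) :
    Prop where
  tame : ∃ g, Tame g ∧ b =ᶠ[l] g
  ne : ∀ {c : (α → ℝ) → ℝ}, (fun x => (c x : ℂ)) ∈ C → ∀ᶠ x in l, b x ≠ c x
  approx : ∀ {c : (α → ℝ) → ℝ}, (fun x => (c x : ℂ)) ∈ C → ∃ c' : (α → ℝ) → ℝ,
    (fun x => (c' x : ℂ)) ∈ C ∧ Tendsto (fun x => (b x - c' x) / (b x - c x)) l (𝓝 0)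

/-- The infinitesimals generating an immediate extension. -/
def affInf (l : Filter (α → ℝ)) (C : Set ((α → ℝ) → ℂ)) (b : (α → ℝ) → ℝ) : Set ((α → ℝ) → ℂ) :=
  {e | Tendsto e l (𝓝 0) ∧ ∃ p ∈ C, ∃ q ∈ C, ∀ᶠ x in l, e x = p x + q x * b x}

/-- The nonvanishing elements of a field of germs. -/
def nonvan (l : Filter (α → ℝ)) (C : Set ((α → ℝ) → ℂ)) : Set ((α → ℝ) → ℂ) :=
  {m | m ∈ C ∧ ∀ᶠ x in l, m x ≠ 0}

theorem Good.nonvan_root {l : Filter (α → ℝ)} {C : Set ((α → ℝ) → ℂ)} (hC : Good l C) {n : ℕ}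
    {m : (α → ℝ) → ℂ} (hn : 0 < n) (hm : m ∈ nonvan l C) :
    ∃ r ∈ nonvan l C, ∀ᶠ x in l, r x ^ n = m x := by
  obtain ⟨r, hr, h⟩ := hC.nthRoot hn hm.1
  refine ⟨r, ⟨hr, ?_⟩, h⟩
  filter_upwards [h, hm.2] with x h1 h2 h3
  exact h2 (by rw [← h1, h3, zero_pow hn.ne'])

variable {l : Filter (α → ℝ)} {C : Set ((α → ℝ) → ℂ)} {b : (α → ℝ) → ℝ}

theorem Good.mem_affInf (hC : Good l C) {e : (α → ℝ) → ℂ} (he : e ∈ C) (h0 : Tendsto e l (𝓝 0)) :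
    e ∈ affInf l C b :=
  ⟨h0, e, he, _, hC.const 0, Eventually.of_forall fun x => by simp⟩

theorem ImmediateOver.preGen (hC : Good l C) (hb : ImmediateOver l C b) :
    PreGen l (affInf l C b) (nonvan l C) where
  neBot := hC.neBot
  zero he := he.1
  conj {e} he := by
    obtain ⟨h0, p, hp, q, hq, h⟩ := he
    refine ⟨?_, _, hC.conj hp, _, hC.conj hq, ?_⟩
    · have h := (Complex.continuous_conj.tendsto 0).comp h0
      rw [map_zero] at h
      exact h
    · filter_upwards [h] with x hx
      rw [hx]; simp
  tame {e} he := by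
    obtain ⟨h0, p, hp, q, hq, h⟩ := he
    obtain ⟨p', hp', h1⟩ := hC.tame hp
    obtain ⟨q', hq', h2⟩ := hC.tame hq
    obtain ⟨g, hg, h3⟩ := hb.tame
    refine ⟨_, hp'.add (hq'.mul (TameC.ofReal hg)), ?_⟩
    filter_upwards [h, h1, h2, h3] with x k k1 k2 k3
    rw [k, k1, k2, k3]
  one := ⟨hC.const 1, Eventually.of_forall fun _ => one_ne_zero⟩
  mmul hm hn := ⟨hC.mul hm.1 hn.1,
    by filter_upwards [hm.2, hn.2] with x h1 h2 using mul_ne_zero h1 h2⟩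
  minv hm := ⟨hC.inv hm.1, by filter_upwards [hm.2] with x h1 using inv_ne_zero h1⟩
  mconj hm := ⟨hC.conj hm.1, by filter_upwards [hm.2] with x h1; simpa using h1⟩
  mne hm := hm.2
  mroot hn hm := hC.nonvan_root hn hm
  mtame hm := hC.tame hm.1
  mlim {m} hm := by
    rcases hC.lim_or hm.1 with ⟨c, hc⟩ | ⟨c, hc⟩
    · exact Or.inl ⟨c, hC.mem_affInf (hC.sub hm.1 (hC.const c)) (by simpa using hc.sub_const c)⟩
    · exact Or.inr ⟨c, hC.mem_affInf (hC.sub (hC.inv hm.1) (hC.const c))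
        (by simpa using hc.sub_const c)⟩

theorem ImmediateOver.sub_mem (hC : Good l C) (hb : ImmediateOver l C b) {c : (α → ℝ) → ℂ}
    (hc : c ∈ C) : (fun x => (b x : ℂ) - c x) ∈ GenField l (affInf l C b) (nonvan l C) := by
  have hpg := hb.preGen hC
  obtain ⟨c', hc', hlim⟩ := hb.approx (hC.re_mem hc)
  have hne := hb.ne (hC.re_mem hc)
  have h1 : Tendsto (fun x => ((b x : ℂ) - c' x) / (b x - c x)) l (𝓝 0) := by
    rw [tendsto_zero_iff_norm_tendsto_zero] at hlim ⊢
    refine squeeze_zero' (Eventually.of_forall fun _ => norm_nonneg _) ?_ hlim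
    filter_upwards [hne] with x hx
    rw [norm_div, norm_div, ← Complex.ofReal_sub, Complex.norm_real]
    have h2 : ‖b x - (c x).re‖ ≤ ‖(b x : ℂ) - c x‖ := by
      have := Complex.abs_re_le_norm ((b x : ℂ) - c x)
      simpa using this
    have h3 : 0 < ‖b x - (c x).re‖ := norm_pos_iff.2 (sub_ne_zero.2 hx)
    gcongr
  have hne' : ∀ᶠ x in l, (b x : ℂ) - c x ≠ 0 := by
    filter_upwards [hne] with x hx h
    apply hx
    have := congrArg Complex.re h
    simpa [sub_eq_zero] using this
  have h2 : Tendsto (fun x => ((c' x : ℂ) - c x) / (b x - c x)) l (𝓝 1) := by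
    have := h1.const_sub 1
    rw [sub_zero] at this
    refine this.congr' ?_
    filter_upwards [hne'] with x hx
    field_simp
    ring
  have h3 : ∀ᶠ x in l, (c' x : ℂ) - c x ≠ 0 := by
    filter_upwards [h2.eventually_ne one_ne_zero] with x hx h
    exact hx (by rw [h, zero_div])
  have hd := hC.sub hc' hc
  have h4 : (fun x => ((b x : ℂ) - c' x) / (c' x - c x)) ∈ affInf l C b := by
    refine ⟨?_, _, hC.neg (hC.div hc' hd), _, hC.inv hd, Eventually.of_forall fun x => by
      rw [div_eq_mul_inv]; ring⟩
    have := h1.mul (h2.inv₀ one_ne_zero)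
    rw [zero_mul] at this
    refine this.congr' ?_
    filter_upwards [hne', h3] with x k1 k2
    field_simp
  refine Or.inr ⟨_, ⟨hd, h3⟩, _, hpg.add (PreGen.const 1) (PreGen.of_mem h4), 1, one_ne_zero, ?_,
    ?_⟩
  · simpa using h4.1.const_add 1
  · filter_upwards [h3] with x hx
    field_simp
    ring

theorem ImmediateOver.gen (hC : Good l C) (hb : ImmediateOver l C b) :
    Gen l (affInf l C b) (nonvan l C) where
  toPreGen := hb.preGen hC
  factor {κ _ F e} hF he := by
    have hpg := hb.preGen hC
    choose he0 p hp q hq hpq using he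
    have hCmem : ∀ f ∈ C, f ∈ GenField l (affInf l C b) (nonvan l C) := fun f hf => by
      rcases hC.zero_or hf with h | h
      · exact Or.inl h
      · exact hpg.field_of_monomial ⟨hf, h⟩
    rcases hC.exists_dominant_fintype hq with hq0 | ⟨j, hj, hlim⟩
    · have heC : ∀ k, e k ∈ C := fun k => hC.congr (hp k) (by
        filter_upwards [hpq k, hq0 k] with x h1 h2
        rw [h1, h2, zero_mul, add_zero])
      exact hCmem _ (hC.an hF heC he0)
    choose L hL using hlim
    let G : (Option (κ ⊕ κ) → ℂ) → ℂ := fun z => F fun k =>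
      z (some (Sum.inl k)) + (L k + z (some (Sum.inr k))) * z none
    have hG : IsAn G := hF.comp (fun k => (IsAn.coord _).add
      (((IsAn.const (L k)).add (IsAn.coord _)).mul (IsAn.coord _))) fun k => by simp
    let e' : κ ⊕ κ → (α → ℝ) → ℂ := Sum.elim (fun k x => p k x - q k x / q j x * p j x)
      fun k x => q k x / q j x - L k
    have he'C : ∀ k, e' k ∈ C := by
      rintro (k | k)
      · exact hC.sub (hp k) (hC.mul (hC.div (hq k) (hq j)) (hp j))
      · exact hC.sub (hC.div (hq k) (hq j)) (hC.const _)
    have he'0 : ∀ k, Tendsto (e' k) l (𝓝 0) := by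
      rintro (k | k)
      · have h1 := (he0 k).sub ((hL k).mul (he0 j))
        rw [mul_zero, sub_zero] at h1
        refine h1.congr' ?_
        filter_upwards [hpq k, hpq j, hj] with x k1 k2 k3
        simp only [e', Sum.elim_inl]
        rw [k1, k2]
        field_simp
        ring
      · have h1 := (hL k).sub_const (L k)
        rw [sub_self] at h1
        exact h1
    have hFG : ∀ᶠ x in l, F (fun k => e k x) = G (ocons (e j x) fun k => e' k x) := by
      filter_upwards [eventually_all.2 hpq, hj] with x k1 k2
      simp only [G]
      congr 1
      funext k
      simp only [ocons, Option.elim_none, Option.elim_some, e', Sum.elim_inl, Sum.elim_inr]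
      rw [k1 k, k1 j]
      field_simp
      ring
    rcases hC.preparation hG he'C he'0 with ⟨ε, hε, h⟩ | ⟨a, ha, ha0, n, ζ, hζ, -, κ', _, e'',
      he''C,
      he''0, U, hU, hU0, ε, hε, h⟩
    · left
      filter_upwards [hFG, h, (he0 j).eventually (Metric.ball_mem_nhds 0 hε)] with x k1 k2 k3
      rw [k1, k2 _ (by simpa using k3)]
    · have hUmem : (fun x => U (ocons (e j x) fun k => e'' k x)) ∈
          GenField l (affInf l C b) (nonvan l C) := by
        let d : Option κ' → (α → ℝ) → ℂ := fun o => o.elim (e j) e''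
        have hd : ∀ o, d o ∈ affInf l C b := by
          rintro (_ | k)
          · exact ⟨he0 j, p j, hp j, q j, hq j, hpq j⟩
          · exact hC.mem_affInf (he''C k) (he''0 k)
        have hdx : ∀ x, (ocons (e j x) fun k => e'' k x) = fun o => d o x := by
          intro x; funext o; rcases o with _ | k <;> rfl
        simp only [hdx]
        have hev : ∀ᶠ x in l, U (fun o => d o x) = U fun o => d o x := Eventually.of_forall fun _ =>
            rfl
        exact hpg.field_of_unit ⟨_, inferInstance, U, d, hU, hd, hev⟩ (hpg.lim hU hd hev) hU0
      have hroot : ∀ i, (fun x => e j x - ζ i x) ∈ GenField l (affInf l C b) (nonvan l C) := by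
        intro i
        have hc : (fun x => (ζ i x - p j x) / q j x) ∈ C := hC.div (hC.sub (hζ i) (hp j)) (hq j)
        refine PreGen.fcongr (hpg.mul_mem_field ⟨hq j, hj⟩ (hb.sub_mem hC hc)) ?_
        filter_upwards [hpq j, hj] with x k1 k2
        rw [k1]
        field_simp
        ring
      refine PreGen.fcongr (hpg.field_mul (hpg.field_mul (hCmem a ha)
        (hpg.field_prod Finset.univ fun i _ => hroot i)) hUmem) ?_
      filter_upwards [hFG, h, (he0 j).eventually (Metric.ball_mem_nhds 0 hε)] with x k1 k2 k3
      rw [k1, k2 _ (by simpa using k3)]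

end Immediate

section Fresh

open Filter Topology

variable {α : Type}

/-- A positive germ whose size differs from those of all elements of a field. -/
structure FreshOver (l : Filter (α → ℝ)) (C : Set ((α → ℝ) → ℂ)) (b : (α → ℝ) → ℝ) : Prop where
  tame : ∃ g, Tame g ∧ b =ᶠ[l] g
  pos : ∀ᶠ x in l, 0 < b x
  lim_or : ∀ {m : (α → ℝ) → ℂ}, m ∈ C → (∀ᶠ x in l, m x ≠ 0) →
    Tendsto (fun x => b x / ‖m x‖) l (𝓝 0) ∨ Tendsto (fun x => ‖m x‖ / b x) l (𝓝 0)

/-- Rational powers of a real germ. -/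
def qpow (b : (α → ℝ) → ℝ) (q : ℚ) (x : α → ℝ) : ℂ := ((b x ^ (q : ℝ) : ℝ) : ℂ)

section qpow

variable {b : (α → ℝ) → ℝ} {x : α → ℝ}

theorem qpow_zero : qpow b 0 x = 1 := by simp [qpow]

theorem qpow_one : qpow b 1 x = b x := by simp [qpow]

theorem qpow_add (hx : 0 < b x) (q r : ℚ) : qpow b (q + r) x = qpow b q x * qpow b r x := by
  simp only [qpow]
  rw [← Complex.ofReal_mul, ← Real.rpow_add hx]
  push_cast; rfl

theorem qpow_neg (hx : 0 < b x) (q : ℚ) : qpow b (-q) x = (qpow b q x)⁻¹ := by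
  simp only [qpow]
  rw [← Complex.ofReal_inv, ← Real.rpow_neg hx.le]
  push_cast; rfl

theorem qpow_pow (hx : 0 < b x) (q : ℚ) (n : ℕ) : qpow b q x ^ n = qpow b (q * n) x := by
  simp only [qpow]
  rw [← Complex.ofReal_pow, ← Real.rpow_natCast, ← Real.rpow_mul hx.le]
  push_cast; rfl

theorem qpow_ne_zero (hx : 0 < b x) (q : ℚ) : qpow b q x ≠ 0 :=
  Complex.ofReal_ne_zero.2 (Real.rpow_pos_of_pos hx _).ne'

theorem norm_qpow (hx : 0 < b x) (q : ℚ) : ‖qpow b q x‖ = b x ^ (q : ℝ) := by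
  rw [qpow, Complex.norm_real, Real.norm_of_nonneg (Real.rpow_pos_of_pos hx _).le]

theorem conj_qpow (q : ℚ) : (starRingEnd ℂ) (qpow b q x) = qpow b q x := Complex.conj_ofReal _

end qpow

/-- The infinitesimals generating a fresh extension. -/
def powInf (l : Filter (α → ℝ)) (C : Set ((α → ℝ) → ℂ)) (b : (α → ℝ) → ℝ) : Set ((α → ℝ) → ℂ) :=
  {e | Tendsto e l (𝓝 0) ∧ ∃ a ∈ C, ∃ q : ℚ, ∀ᶠ x in l, e x = a x * qpow b q x}

/-- The monomials generating a fresh extension. -/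
def powMon (l : Filter (α → ℝ)) (C : Set ((α → ℝ) → ℂ)) (b : (α → ℝ) → ℝ) : Set ((α → ℝ) → ℂ) :=
  {m | ∃ a ∈ nonvan l C, ∃ q : ℚ, ∀ᶠ x in l, m x = a x * qpow b q x}

theorem tendsto_zero_of_pow {l : Filter (α → ℝ)} {f : (α → ℝ) → ℂ} {n : ℕ} (hn : n ≠ 0)
    (h : Tendsto (fun x => f x ^ n) l (𝓝 0)) : Tendsto f l (𝓝 0) := by
  rw [tendsto_zero_iff_norm_tendsto_zero] at h ⊢
  have h2 := (Real.continuousAt_rpow_const 0 (n : ℝ)⁻¹ (Or.inr (by positivity))).tendsto.comp h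
  rw [Real.zero_rpow (by positivity)] at h2
  refine h2.congr fun x => ?_
  simp only [Function.comp, norm_pow]
  exact Real.pow_rpow_inv_natCast (norm_nonneg _) hn

variable {l : Filter (α → ℝ)} {C : Set ((α → ℝ) → ℂ)} {b : (α → ℝ) → ℝ}

theorem Good.mem_powInf (hC : Good l C) {e : (α → ℝ) → ℂ} (he : e ∈ C) (h0 : Tendsto e l (𝓝 0)) :
    e ∈ powInf l C b :=
  ⟨h0, e, he, 0, Eventually.of_forall fun x => by rw [qpow_zero, mul_one]⟩

theorem FreshOver.tendsto_pow_pos (hC : Good l C) (hb : FreshOver l C b) {a : (α → ℝ) → ℂ}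
    (ha : a ∈ nonvan l C) {q : ℚ} (hq : 0 < q) :
    Tendsto (fun x => a x * qpow b q x) l (𝓝 0) ∨
      Tendsto (fun x => (a x * qpow b q x)⁻¹) l (𝓝 0) := by
  have hn : 0 < q.num.natAbs := Int.natAbs_pos.2 (Rat.num_ne_zero.2 hq.ne')
  obtain ⟨m, hm, h⟩ := hC.nonvan_root hn (m := fun x => (a x ^ q.den)⁻¹)
    ⟨hC.inv (hC.pow ha.1 _), by filter_upwards [ha.2] with x hx; exact inv_ne_zero (pow_ne_zero _ hx)⟩
  have hqr : (0 : ℝ) < q := by exact_mod_cast hq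
  have hqe : (q : ℝ) = (q.num.natAbs : ℝ) * (q.den : ℝ)⁻¹ := by
    have h1 : ((q.num.natAbs : ℤ) : ℝ) = (q.num : ℝ) := by
      rw [Int.natAbs_of_nonneg (Rat.num_pos.2 hq).le]
    rw [← Int.cast_natCast q.num.natAbs, h1, ← div_eq_mul_inv]
    exact_mod_cast (Rat.num_div_den q).symm
  have hnorm : ∀ᶠ x in l, ‖a x * qpow b q x‖ = (b x / ‖m x‖) ^ (q : ℝ) := by
    filter_upwards [h, hb.pos, hm.2, ha.2] with x h1 h2 h3 h4
    have h5 : ‖m x‖ ^ (q : ℝ) = ‖a x‖⁻¹ := by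
      rw [hqe, Real.rpow_mul (norm_nonneg _), Real.rpow_natCast, ← norm_pow, h1, norm_inv, norm_pow,
        ← inv_pow, Real.pow_rpow_inv_natCast (inv_nonneg.2 (norm_nonneg _)) q.den_ne_zero]
    rw [norm_mul, norm_qpow h2, Real.div_rpow h2.le (norm_nonneg _), h5, div_inv_eq_mul, mul_comm]
  have hc := (Real.continuousAt_rpow_const 0 (q : ℝ) (Or.inr hqr.le)).tendsto
  rw [Real.zero_rpow hqr.ne'] at hc
  rcases hb.lim_or hm.1 hm.2 with h1 | h1
  · left
    rw [tendsto_zero_iff_norm_tendsto_zero]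
    exact (hc.comp h1).congr' (hnorm.mono fun x hx => hx.symm)
  · right
    rw [tendsto_zero_iff_norm_tendsto_zero]
    refine (hc.comp h1).congr' ?_
    filter_upwards [hnorm, hb.pos] with x h2 h3
    rw [norm_inv, h2, Function.comp, ← inv_div, Real.inv_rpow (by positivity)]

theorem FreshOver.tendsto_pow (hC : Good l C) (hb : FreshOver l C b) {a : (α → ℝ) → ℂ}
    (ha : a ∈ nonvan l C) {q : ℚ} (hq : q ≠ 0) :
    Tendsto (fun x => a x * qpow b q x) l (𝓝 0) ∨
      Tendsto (fun x => (a x * qpow b q x)⁻¹) l (𝓝 0) := by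
  rcases lt_or_gt_of_ne hq with h | h
  · have ha' : (fun x => (a x)⁻¹) ∈ nonvan l C :=
      ⟨hC.inv ha.1, by filter_upwards [ha.2] with x hx using inv_ne_zero hx⟩
    have hev : ∀ᶠ x in l, (a x)⁻¹ * qpow b (-q) x = (a x * qpow b q x)⁻¹ := by
      filter_upwards [hb.pos] with x hx
      rw [qpow_neg hx, mul_inv]
    rcases hb.tendsto_pow_pos hC ha' (neg_pos.2 h) with h1 | h1
    · exact Or.inr (h1.congr' hev)
    · exact Or.inl (h1.congr' (by filter_upwards [hev] with x hx; rw [hx, inv_inv]))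
  · exact hb.tendsto_pow_pos hC ha h

theorem FreshOver.qpow_tame (hb : FreshOver l C b) (q : ℚ) :
    ∃ g, TameC g ∧ qpow b q =ᶠ[l] g := by
  obtain ⟨g, hg, h⟩ := hb.tame
  refine ⟨_, TameC.ofReal ((hg.log.mul (Tame.const (q : ℝ))).exp), ?_⟩
  filter_upwards [h, hb.pos] with x h1 h2
  rw [qpow, Real.rpow_def_of_pos h2, h1]

theorem FreshOver.preGen (hC : Good l C) (hb : FreshOver l C b) :
    PreGen l (powInf l C b) (powMon l C b) where
  neBot := hC.neBot
  zero he := he.1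
  conj {e} he := by
    obtain ⟨h0, a, ha, q, h⟩ := he
    refine ⟨?_, _, hC.conj ha, q, ?_⟩
    · have h := (Complex.continuous_conj.tendsto 0).comp h0
      rw [map_zero] at h
      exact h
    · filter_upwards [h] with x hx
      rw [hx, map_mul, conj_qpow]
  tame {e} he := by
    obtain ⟨h0, a, ha, q, h⟩ := he
    obtain ⟨a', ha', h1⟩ := hC.tame ha
    obtain ⟨g, hg, h2⟩ := hb.qpow_tame q
    refine ⟨_, ha'.mul hg, ?_⟩
    filter_upwards [h, h1, h2] with x k1 k2 k3
    rw [k1, k2, k3]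
  one := ⟨_, ⟨hC.const 1, Eventually.of_forall fun _ => one_ne_zero⟩, 0,
    Eventually.of_forall fun x => by rw [qpow_zero, mul_one]⟩
  mmul {m n} hm hn := by
    obtain ⟨a, ha, q, h⟩ := hm
    obtain ⟨a', ha', r, h'⟩ := hn
    refine ⟨_, ⟨hC.mul ha.1 ha'.1, by
      filter_upwards [ha.2, ha'.2] with x h1 h2 using mul_ne_zero h1 h2⟩, q + r, ?_⟩
    filter_upwards [h, h', hb.pos] with x h1 h2 h3
    rw [h1, h2, qpow_add h3]; ring
  minv {m} hm := by
    obtain ⟨a, ha, q, h⟩ := hm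
    refine ⟨_, ⟨hC.inv ha.1, by filter_upwards [ha.2] with x h1 using inv_ne_zero h1⟩, -q, ?_⟩
    filter_upwards [h, hb.pos] with x h1 h3
    rw [h1, qpow_neg h3, mul_inv]
  mconj {m} hm := by
    obtain ⟨a, ha, q, h⟩ := hm
    refine ⟨_, ⟨hC.conj ha.1, by filter_upwards [ha.2] with x h1; simpa using h1⟩, q, ?_⟩
    filter_upwards [h] with x h1
    rw [h1, map_mul, conj_qpow]
  mne {m} hm := by
    obtain ⟨a, ha, q, h⟩ := hm
    filter_upwards [h, ha.2, hb.pos] with x h1 h2 h3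
    rw [h1]
    exact mul_ne_zero h2 (qpow_ne_zero h3 q)
  mroot {n m} hn hm := by
    obtain ⟨a, ha, q, h⟩ := hm
    obtain ⟨r, hr, hrn⟩ := hC.nonvan_root hn ha
    refine ⟨_, ⟨r, hr, q / n, Eventually.of_forall fun x => rfl⟩, ?_⟩
    filter_upwards [h, hrn, hb.pos] with x h1 h2 h3
    have : (n : ℚ) ≠ 0 := by positivity
    rw [mul_pow, h2, h1, qpow_pow h3, div_mul_cancel₀ _ this]
  mtame {m} hm := by
    obtain ⟨a, ha, q, h⟩ := hm
    obtain ⟨a', ha', h1⟩ := hC.tame ha.1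
    obtain ⟨g, hg, h2⟩ := hb.qpow_tame q
    refine ⟨_, ha'.mul hg, ?_⟩
    filter_upwards [h, h1, h2] with x k1 k2 k3
    rw [k1, k2, k3]
  mlim {m} hm := by
    obtain ⟨a, ha, q, h⟩ := hm
    by_cases hq : q = 0
    · subst hq
      have hev : m =ᶠ[l] a := by
        filter_upwards [h] with x hx
        rw [hx, qpow_zero, mul_one]
      have hmC := hC.congr ha.1 hev.symm
      rcases hC.lim_or hmC with ⟨c, hc⟩ | ⟨c, hc⟩
      · exact Or.inl ⟨c, hC.mem_powInf (hC.sub hmC (hC.const c)) (by simpa using hc.sub_const c)⟩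
      · exact Or.inr ⟨c, hC.mem_powInf (hC.sub (hC.inv hmC) (hC.const c))
          (by simpa using hc.sub_const c)⟩
    · rcases hb.tendsto_pow hC ha hq with h1 | h1
      · refine Or.inl ⟨0, ?_, a, ha.1, q, by simpa using h⟩
        simpa using h1.congr' (h.mono fun _ hx => hx.symm)
      · refine Or.inr ⟨0, ?_, _, hC.inv ha.1, -q, ?_⟩
        · simpa using h1.congr' (h.mono fun _ hx => by rw [hx])
        · filter_upwards [h, hb.pos] with x h1 h3
          rw [h1, qpow_neg h3, mul_inv, sub_zero]

/-- A nonzero element of the fresh extension together with its exponent. -/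
def HasExp (l : Filter (α → ℝ)) (C : Set ((α → ℝ) → ℂ)) (b : (α → ℝ) → ℝ) (f : (α → ℝ) → ℂ)
    (q : ℚ) : Prop :=
  ∃ a ∈ nonvan l C, ∃ g ∈ GenRing l (powInf l C b), ∃ c ≠ 0, Tendsto g l (𝓝 c) ∧
    ∀ᶠ x in l, f x = a x * qpow b q x * g x

namespace HasExp

variable {f g : (α → ℝ) → ℂ} {q r : ℚ}

theorem mem (h : HasExp l C b f q) : f ∈ GenField l (powInf l C b) (powMon l C b) := by
  obtain ⟨a, ha, g, hg, c, hc, hl, h⟩ := h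
  exact Or.inr ⟨_, ⟨a, ha, q, Eventually.of_forall fun _ => rfl⟩, g, hg, c, hc, hl, h⟩

theorem zero_or (hf : f ∈ GenField l (powInf l C b) (powMon l C b)) :
    (∀ᶠ x in l, f x = 0) ∨ ∃ q, HasExp l C b f q := by
  rcases hf with h | ⟨m, ⟨a, ha, q, hm⟩, g, hg, c, hc, hl, h⟩
  · exact Or.inl h
  · refine Or.inr ⟨q, a, ha, g, hg, c, hc, hl, ?_⟩
    filter_upwards [h, hm] with x h1 h2
    rw [h1, h2]

theorem ne_zero (hb : FreshOver l C b) (h : HasExp l C b f q) : ∀ᶠ x in l, f x ≠ 0 := by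
  obtain ⟨a, ha, g, hg, c, hc, hl, h⟩ := h
  filter_upwards [h, ha.2, hl.eventually_ne hc, hb.pos] with x h1 h2 h3 h4
  rw [h1]
  exact mul_ne_zero (mul_ne_zero h2 (qpow_ne_zero h4 q)) h3

theorem mul_qpow (hC : Good l C) (hb : FreshOver l C b) {a : (α → ℝ) → ℂ} (ha : a ∈ nonvan l C)
    (h : HasExp l C b f q) (r : ℚ) : HasExp l C b (fun x => a x * qpow b r x * f x) (r + q) := by
  obtain ⟨a', ha', g, hg, c, hc, hl, h⟩ := h
  refine ⟨_, ⟨hC.mul ha.1 ha'.1, by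
      filter_upwards [ha.2, ha'.2] with x h1 h2 using mul_ne_zero h1 h2⟩, g, hg, c, hc, hl, ?_⟩
  filter_upwards [h, hb.pos] with x h1 h2
  rw [h1, qpow_add h2]; ring

theorem of_qpow {a : (α → ℝ) → ℂ} (ha : a ∈ nonvan l C) : HasExp l C b (fun x => a x * qpow b q x) q :=
  ⟨a, ha, _, PreGen.const 1, 1, one_ne_zero, tendsto_const_nhds,
    Eventually.of_forall fun x => (mul_one _).symm⟩

theorem add_aux (hC : Good l C) (hb : FreshOver l C b) {a a' : (α → ℝ) → ℂ} (ha : a ∈ nonvan l C)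
    (ha' : a' ∈ nonvan l C) {u v : (α → ℝ) → ℂ} (hu : u ∈ GenRing l (powInf l C b))
    (hv : v ∈ GenRing l (powInf l C b)) {c : ℂ} (hc : c ≠ 0) (hl : Tendsto u l (𝓝 c))
    (h0 : Tendsto (fun x => a' x / a x * qpow b (r - q) x) l (𝓝 0)) :
    HasExp l C b (fun x => a x * qpow b q x * u x + a' x * qpow b r x * v x) q := by
  have hpg := hb.preGen hC
  obtain ⟨d, hd⟩ := hpg.exists_lim hv
  refine ⟨a, ha, _, hpg.add hu (hpg.mul (PreGen.of_mem ⟨h0, _, hC.div ha'.1 ha.1, r - q,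
    Eventually.of_forall fun _ => rfl⟩) hv), c + 0 * d, by simpa using hc, hl.add (h0.mul hd), ?_⟩
  filter_upwards [hb.pos, ha.2] with x h1 h2
  have h3 := qpow_add h1 q (r - q)
  rw [add_sub_cancel] at h3
  rw [h3]
  field_simp

theorem add (hC : Good l C) (hb : FreshOver l C b) (hf : HasExp l C b f q) (hg : HasExp l C b g r)
    (hqr : q ≠ r) : ∃ s, HasExp l C b (fun x => f x + g x) s := by
  obtain ⟨a, ha, u, hu, c, hc, hl, h⟩ := hf
  obtain ⟨a', ha', v, hv, c', hc', hl', h'⟩ := hg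
  have key : ∀ {a a' : (α → ℝ) → ℂ}, a ∈ nonvan l C → a' ∈ nonvan l C →
      (fun x => a' x / a x) ∈ nonvan l C := fun ha ha' => ⟨hC.div ha'.1 ha.1, by
    filter_upwards [ha.2, ha'.2] with x h1 h2 using div_ne_zero h2 h1⟩
  rcases hb.tendsto_pow hC (key ha ha') (sub_ne_zero.2 hqr.symm) with h0 | h0
  · obtain ⟨a'', h1, g', h2, d, h3, h4, h5⟩ := add_aux hC hb ha ha' hu hv hc hl h0
    refine ⟨q, a'', h1, g', h2, d, h3, h4, ?_⟩
    filter_upwards [h, h', h5] with x k1 k2 k3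
    rw [k1, k2, k3]
  · have h0' : Tendsto (fun x => a x / a' x * qpow b (q - r) x) l (𝓝 0) := by
      refine h0.congr' ?_
      filter_upwards [hb.pos] with x hx
      rw [← neg_sub r q, qpow_neg hx, mul_inv, inv_div]
    obtain ⟨a'', h1, g', h2, d, h3, h4, h5⟩ := add_aux hC hb ha' ha hv hu hc' hl' h0'
    refine ⟨r, a'', h1, g', h2, d, h3, h4, ?_⟩
    filter_upwards [h, h', h5] with x k1 k2 k3
    rw [k1, k2, ← k3, add_comm]

end HasExp

theorem FreshOver.qpow_mem (hC : Good l C) {a : (α → ℝ) → ℂ} (ha : a ∈ C) (q : ℚ) :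
    (fun x => a x * qpow b q x) ∈ GenField l (powInf l C b) (powMon l C b) := by
  rcases hC.zero_or ha with h | h
  · exact Or.inl (by filter_upwards [h] with x hx; rw [hx, zero_mul])
  · exact (HasExp.of_qpow ⟨ha, h⟩).mem

theorem FreshOver.qpow_add_mem (hC : Good l C) (hb : FreshOver l C b) {a a' : (α → ℝ) → ℂ}
    (ha : a ∈ C) (ha' : a' ∈ C) {q r : ℚ} (hqr : q ≠ r) :
    (fun x => a x * qpow b q x + a' x * qpow b r x) ∈
      GenField l (powInf l C b) (powMon l C b) := by
  rcases hC.zero_or ha with h | h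
  · refine PreGen.fcongr (qpow_mem hC ha' r) ?_
    filter_upwards [h] with x hx
    rw [hx, zero_mul, zero_add]
  rcases hC.zero_or ha' with h' | h'
  · refine PreGen.fcongr (qpow_mem hC ha q) ?_
    filter_upwards [h'] with x hx
    rw [hx, zero_mul, add_zero]
  obtain ⟨s, hs⟩ := HasExp.add hC hb (HasExp.of_qpow (q := q) ⟨ha, h⟩)
    (HasExp.of_qpow (q := r) ⟨ha', h'⟩) hqr
  exact hs.mem

/-- Laurent polynomials of degree one in a rational power factor. -/
theorem FreshOver.laurent_mem (hC : Good l C) (hb : FreshOver l C b) {A B ζ : (α → ℝ) → ℂ}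
    (hA : A ∈ C) (hB : B ∈ C) (hζ : ζ ∈ C) {q : ℚ} (hq : q ≠ 0) :
    (fun x => A x * qpow b q x + B x * qpow b (-q) x - ζ x) ∈
      GenField l (powInf l C b) (powMon l C b) := by
  have hpg := hb.preGen hC
  rcases hC.zero_or hA with h | h
  · refine PreGen.fcongr (hb.qpow_add_mem hC hB (hC.neg hζ) (neg_ne_zero.2 hq)) ?_
    filter_upwards [h] with x hx
    rw [hx, qpow_zero]; ring
  obtain ⟨r, hr, hroot⟩ := hC.splits (a := ![fun x => B x / A x, fun x => -(ζ x / A x)])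
    (fun i => by
      fin_cases i
      · exact hC.div hB hA
      · exact hC.neg (hC.div hζ hA))
  have hlin : ∀ i, (fun x => qpow b q x - r i x) ∈ GenField l (powInf l C b) (powMon l C b) := by
    intro i
    refine PreGen.fcongr (hb.qpow_add_mem hC (hC.const 1) (hC.neg (hr i)) hq) ?_
    refine Eventually.of_forall fun x => ?_
    simp only [qpow_zero]; ring
  refine PreGen.fcongr (hpg.field_mul (qpow_mem hC hA (-q)) (hpg.field_mul (hlin 0) (hlin 1))) ?_
  filter_upwards [h, hroot, hb.pos] with x h1 h2 h3
  have h4 := h2 (qpow b q x)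
  simp only [Fin.sum_univ_two, Fin.prod_univ_two, Matrix.cons_val_zero, Matrix.cons_val_one,
    Fin.val_zero, Fin.val_one, pow_zero, pow_one, mul_one] at h4
  rw [← h4, qpow_neg h3]
  have h5 := qpow_ne_zero h3 q
  field_simp
  ring

end Fresh

section FreshFactor

open Filter Topology

variable {α : Type} {l : Filter (α → ℝ)} {C : Set ((α → ℝ) → ℂ)} {b : (α → ℝ) → ℝ}

theorem FreshOver.mem_field (hC : Good l C) {f : (α → ℝ) → ℂ} (hf : f ∈ C) :
    f ∈ GenField l (powInf l C b) (powMon l C b) := by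
  refine PreGen.fcongr (FreshOver.qpow_mem hC hf 0) (Eventually.of_forall fun x => ?_)
  simp only [qpow_zero, mul_one]

/-- Factoring an analytic function of a Laurent polynomial of degree one. -/
theorem FreshOver.factor_sum (hC : Good l C) (hb : FreshOver l C b) {A B : (α → ℝ) → ℂ}
    (hA : A ∈ C) (hB : B ∈ C) {q : ℚ} (hq : q ≠ 0)
    (hu : Tendsto (fun x => A x * qpow b q x) l (𝓝 0))
    (hw : Tendsto (fun x => B x * qpow b (-q) x) l (𝓝 0)) {κ : Type} [Fintype κ]
    {P : (Option κ → ℂ) → ℂ} (hP : IsAn P) {e : κ → (α → ℝ) → ℂ} (he : ∀ k, e k ∈ C)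
    (he0 : ∀ k, Tendsto (e k) l (𝓝 0)) :
    (fun x => P (ocons (A x * qpow b q x + B x * qpow b (-q) x) fun k => e k x)) ∈
      GenField l (powInf l C b) (powMon l C b) := by
  have hpg := hb.preGen hC
  have ht : Tendsto (fun x => A x * qpow b q x + B x * qpow b (-q) x) l (𝓝 0) := by
    simpa using hu.add hw
  rcases hC.preparation hP he he0 with ⟨ε, hε, h⟩ | ⟨a, ha, ha0, n, ζ, hζ, -, κ', _, e', he'C,
    he'0, U, hU, hU0, ε, hε, h⟩
  · left
    filter_upwards [h, ht.eventually (Metric.ball_mem_nhds 0 hε)] with x k2 k3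
    exact k2 _ (by simpa using k3)
  · have hUmem : (fun x => U (ocons (A x * qpow b q x + B x * qpow b (-q) x) fun k => e' k x)) ∈
        GenField l (powInf l C b) (powMon l C b) := by
      let d : Option (Option κ') → (α → ℝ) → ℂ := fun o => o.elim (fun x => A x * qpow b q x)
        fun o => o.elim (fun x => B x * qpow b (-q) x) e'
      have hd : ∀ o, d o ∈ powInf l C b := by
        rintro (_ | _ | k)
        · exact ⟨hu, A, hA, q, Eventually.of_forall fun _ => rfl⟩
        · exact ⟨hw, B, hB, -q, Eventually.of_forall fun _ => rfl⟩
        · exact hC.mem_powInf (he'C k) (he'0 k)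
      have hU' : IsAn fun z : Option (Option κ') → ℂ =>
          U fun o => o.elim (z none + z (some none)) fun k => z (some (some k)) :=
        hU.comp (fun o => match o with
          | none => (IsAn.coord none).add (IsAn.coord (some none))
          | some k => IsAn.coord (some (some k))) fun o => by cases o <;> simp
      have hev : ∀ᶠ x in l, U (ocons (A x * qpow b q x + B x * qpow b (-q) x) fun k => e' k x) =
          (fun z : Option (Option κ') → ℂ =>
            U fun o => o.elim (z none + z (some none)) fun k => z (some (some k))) fun o => d o x :=
        Eventually.of_forall fun _ => rfl
      refine hpg.field_of_unit ⟨_, inferInstance, _, d, hU', hd, hev⟩ (hpg.lim hU' hd hev) ?_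
      convert hU0 using 2
      funext o
      cases o <;> simp
    refine PreGen.fcongr (hpg.field_mul (hpg.field_mul (FreshOver.mem_field hC ha)
      (hpg.field_prod Finset.univ fun i _ => hb.laurent_mem hC hA hB (hζ i) hq)) hUmem) ?_
    filter_upwards [h, ht.eventually (Metric.ball_mem_nhds 0 hε)] with x k2 k3
    exact (k2 _ (by simpa using k3)).symm

/-- Factoring an analytic function of a monomial and its inverse. -/
theorem FreshOver.factor_two (hC : Good l C) (hb : FreshOver l C b) {A B : (α → ℝ) → ℂ}
    (hA : A ∈ C) (hB : B ∈ C) {q : ℚ} (hq : q ≠ 0)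
    (hu : Tendsto (fun x => A x * qpow b q x) l (𝓝 0))
    (hw : Tendsto (fun x => B x * qpow b (-q) x) l (𝓝 0)) {κ : Type} [Fintype κ]
    {F : (Option (Option κ) → ℂ) → ℂ} (hF : IsAn F) {e : κ → (α → ℝ) → ℂ} (he : ∀ k, e k ∈ C)
    (he0 : ∀ k, Tendsto (e k) l (𝓝 0)) :
    (fun x => F (ocons (A x * qpow b q x) (ocons (B x * qpow b (-q) x) fun k => e k x))) ∈
      GenField l (powInf l C b) (powMon l C b) := by
  have hpg := hb.preGen hC
  obtain ⟨P, Q, hP, hQ, hsplit⟩ := hF.exists_symmetric_split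
  let e' : Option κ → (α → ℝ) → ℂ := fun o => o.elim (fun x => A x * B x) e
  have he' : ∀ o, e' o ∈ C := by
    rintro (_ | k)
    · exact hC.mul hA hB
    · exact he k
  have huw : ∀ᶠ x in l, A x * qpow b q x * (B x * qpow b (-q) x) = A x * B x := by
    filter_upwards [hb.pos] with x hx
    have := qpow_ne_zero hx q
    rw [qpow_neg hx]
    field_simp
  have he'0 : ∀ o, Tendsto (e' o) l (𝓝 0) := by
    rintro (_ | k)
    · have h := hu.mul hw
      rw [mul_zero] at h
      exact h.congr' huw
    · exact he0 k
  have hp := hb.factor_sum hC hA hB hq hu hw hP he' he'0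
  have hq' := hb.factor_sum hC hA hB hq hu hw hQ he' he'0
  set p := fun x => P (ocons (A x * qpow b q x + B x * qpow b (-q) x) fun k => e' k x) with hpdef
  set r := fun x => Q (ocons (A x * qpow b q x + B x * qpow b (-q) x) fun k => e' k x) with hrdef
  have heval : ∀ᶠ x in l, F (ocons (A x * qpow b q x) (ocons (B x * qpow b (-q) x) fun k => e k x)) =
      p x + A x * qpow b q x * r x := by
    have ht : Tendsto (fun x => ocons (A x * qpow b q x) (ocons (B x * qpow b (-q) x) fun k =>
        e k x))
        l (𝓝 0) := by
      refine tendsto_pi_nhds.2 fun o => ?_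
      rcases o with _ | _ | k
      · exact hu
      · exact hw
      · exact he0 k
    filter_upwards [ht.eventually hsplit, huw] with x h1 h2
    rw [h1]
    simp only [ocons, Option.elim_none, Option.elim_some, h2]
    have : (fun o => e' o x) = fun o : Option κ => o.elim (A x * B x) fun k => e k x := by
      funext o; cases o <;> rfl
    simp only [hpdef, hrdef, this]
    rfl
  refine PreGen.fcongr (f := fun x => p x + A x * qpow b q x * r x) ?_ (heval.mono fun x hx =>
    hx.symm)
  rcases hC.zero_or hA with hA0 | hA0
  · refine PreGen.fcongr hp ?_
    filter_upwards [hA0] with x hx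
    rw [hx]; ring
  rcases HasExp.zero_or hp with h0 | ⟨s, hs⟩
  · refine PreGen.fcongr (hpg.field_mul (FreshOver.qpow_mem hC hA q) hq') ?_
    filter_upwards [h0] with x hx
    rw [hx, zero_add]
  rcases HasExp.zero_or hq' with h0 | ⟨t, ht⟩
  · refine PreGen.fcongr hp ?_
    filter_upwards [h0] with x hx
    rw [hx, mul_zero, add_zero]
  have hur := ht.mul_qpow hC hb ⟨hA, hA0⟩ q
  by_cases hst : s = q + t
  swap
  · obtain ⟨_, h⟩ := hs.add hC hb hur hst
    exact h.mem
  -- the conjugate under exchanging the two monomials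
  have hN : (fun x => p x * p x + (A x * qpow b q x + B x * qpow b (-q) x) * (p x * r x) +
      A x * B x * (r x * r x)) ∈ GenField l (powInf l C b) (powMon l C b) :=
    hb.factor_sum hC hA hB hq hu hw (P := fun z => P z * P z + z none * (P z * Q z) +
      z (some none) * (Q z * Q z)) (((hP.mul hP).add ((IsAn.coord _).mul (hP.mul hQ))).add
        ((IsAn.coord _).mul (hQ.mul hQ))) he' he'0
  have hbar : ∃ s', HasExp l C b (fun x => p x + B x * qpow b (-q) x * r x) s' := by
    rcases hC.zero_or hB with hB0 | hB0
    · obtain ⟨a, ha, g, hg, c, hc, hl, h⟩ := hs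
      refine ⟨s, a, ha, g, hg, c, hc, hl, ?_⟩
      filter_upwards [hB0, h] with x hx h1
      rw [hx, h1]; ring
    · refine hs.add hC hb (ht.mul_qpow hC hb ⟨hB, hB0⟩ (-q)) ?_
      rw [hst]
      intro h
      exact hq (by linarith)
  obtain ⟨s', hs'⟩ := hbar
  refine PreGen.fcongr (hpg.field_mul hN (hpg.field_inv hs'.mem)) ?_
  filter_upwards [hs'.ne_zero hb, huw] with x h1 h2
  rw [← div_eq_mul_inv, div_eq_iff h1, ← h2]
  ring

/-- Common factor of finitely many infinitesimal multiples of a germ. -/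
theorem Good.exists_common_factor (hC : Good l C) {κ : Type} [Fintype κ] {a : κ → (α → ℝ) → ℂ}
    (ha : ∀ k, a k ∈ C) {w : (α → ℝ) → ℂ} (hw : ∀ k, Tendsto (fun x => a k x * w x) l (𝓝 0)) :
    ∃ A ∈ C, Tendsto (fun x => A x * w x) l (𝓝 0) ∧ ∃ (L : κ → ℂ) (e : κ → (α → ℝ) → ℂ),
      (∀ k, e k ∈ C) ∧ (∀ k, Tendsto (e k) l (𝓝 0)) ∧ ∀ k, ∀ᶠ x in l, a k x = (L k + e k x) * A x := by
  rcases hC.exists_dominant_fintype ha with h | ⟨j, hj, h⟩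
  · refine ⟨_, hC.const 0, ?_, 0, fun _ _ => 0, fun _ => hC.const 0, fun _ => tendsto_const_nhds,
      ?_⟩
    · simpa using tendsto_const_nhds
    · intro k
      filter_upwards [h k] with x hx
      rw [hx]; simp
  · choose L hL using h
    refine ⟨a j, ha j, hw j, L, fun k x => a k x / a j x - L k,
      fun k => hC.sub (hC.div (ha k) (ha j)) (hC.const _), fun k => ?_, fun k => ?_⟩
    · simpa using (hL k).sub_const (L k)
    · filter_upwards [hj] with x hx
      field_simp
      ring

theorem exists_common_den {κ : Type} [Fintype κ] (q : κ → ℚ) :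
    ∃ (N : ℕ) (r : κ → ℤ), 0 < N ∧ ∀ k, q k = r k / N := by
  classical
  refine ⟨∏ k, (q k).den, fun k => (q k).num * ∏ i ∈ Finset.univ.erase k, ((q i).den : ℤ),
    Finset.prod_pos fun k _ => (q k).den_pos, fun k => ?_⟩
  have h1 := Finset.mul_prod_erase Finset.univ (fun i => ((q i).den : ℚ)) (Finset.mem_univ k)
  push_cast
  rw [← h1]
  have h2 : ((q k).den : ℚ) ≠ 0 := by exact_mod_cast (q k).den_ne_zero
  have h3 : (∏ i ∈ Finset.univ.erase k, ((q i).den : ℚ)) ≠ 0 :=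
    Finset.prod_ne_zero_iff.2 fun i _ => by exact_mod_cast (q i).den_ne_zero
  rw [mul_div_mul_right _ _ h3, Rat.num_div_den]

theorem FreshOver.gen (hC : Good l C) (hb : FreshOver l C b) :
    Gen l (powInf l C b) (powMon l C b) where
  toPreGen := hb.preGen hC
  factor {κ _ F e} hF he := by
    choose he0 a ha q hae using he
    obtain ⟨N, r, hN, hq⟩ := exists_common_den q
    have hN' : (N : ℚ) ≠ 0 := by positivity
    have hroot : ∀ k, ∃ c ∈ C, r k ≠ 0 → ∀ᶠ x in l, c x ^ (r k).natAbs = a k x := fun k => by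
      by_cases h : r k = 0
      · exact ⟨a k, ha k, fun h' => absurd h h'⟩
      · obtain ⟨c, hc, h1⟩ := hC.nthRoot (Int.natAbs_pos.2 h) (ha k)
        exact ⟨c, hc, fun _ => h1⟩
    choose c hc hca using hroot
    have hpos : ∀ k, 0 < r k → ∀ᶠ x in l, e k x = (c k x * qpow b (N : ℚ)⁻¹ x) ^ (r k).natAbs := by
      intro k hk
      filter_upwards [hae k, hca k hk.ne', hb.pos] with x h1 h2 h3
      rw [h1, mul_pow, h2, qpow_pow h3, hq k, div_eq_inv_mul]
      congr 2
      have h4 : (((r k).natAbs : ℤ) : ℚ) = r k := by rw [Int.natAbs_of_nonneg hk.le]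
      rw [← h4]; simp
    have hneg : ∀ k, r k < 0 → ∀ᶠ x in l, e k x = (c k x * qpow b (-(N : ℚ)⁻¹) x) ^ (r k).natAbs := by
      intro k hk
      filter_upwards [hae k, hca k hk.ne, hb.pos] with x h1 h2 h3
      rw [h1, mul_pow, h2, qpow_pow h3, hq k, div_eq_inv_mul]
      congr 2
      have h4 : (((r k).natAbs : ℤ) : ℚ) = -r k := by rw [Int.ofNat_natAbs_of_nonpos hk.le]; simp
      have h5 : (r k : ℚ) = -(((r k).natAbs : ℤ) : ℚ) := by rw [h4, neg_neg]
      rw [h5]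
      simp
    have hcomm : ∀ (p : κ → Prop) (t : ℚ), (∀ k, p k → r k ≠ 0 ∧
        ∀ᶠ x in l, e k x = (c k x * qpow b t x) ^ (r k).natAbs) →
        ∃ A ∈ C, Tendsto (fun x => A x * qpow b t x) l (𝓝 0) ∧ ∃ (L : κ → ℂ) (d : κ → (α → ℝ) → ℂ),
        (∀ k, d k ∈ C) ∧ (∀ k, Tendsto (d k) l (𝓝 0)) ∧
        ∀ k, p k → ∀ᶠ x in l, e k x = ((L k + d k x) * (A x * qpow b t x)) ^ (r k).natAbs := by
      classical
      intro p t hp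
      obtain ⟨A, hA, h0, L, d, hd, hd0, h⟩ := hC.exists_common_factor
        (a := fun k => if p k then c k else fun _ => 0) (w := qpow b t)
        (fun k => by
          by_cases hk : p k
          · simpa [hk] using hc k
          · simpa [hk] using hC.const 0)
        (fun k => by
          by_cases hk : p k
          · simp only [if_pos hk]
            refine tendsto_zero_of_pow (Int.natAbs_ne_zero.2 (hp k hk).1) ?_
            exact (he0 k).congr' (hp k hk).2
          · simpa [if_neg hk] using tendsto_const_nhds)
      refine ⟨A, hA, h0, L, d, hd, hd0, fun k hk => ?_⟩
      filter_upwards [h k, (hp k hk).2] with x h1 h2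
      rw [if_pos hk] at h1
      rw [h2, h1, mul_assoc]
    obtain ⟨A, hA, hA0, L, d, hd, hd0, hAe⟩ := hcomm (fun k => 0 < r k) _ fun k hk =>
        ⟨hk.ne', hpos k hk⟩
    obtain ⟨B, hB, hB0, L', d', hd', hd'0, hBe⟩ := hcomm (fun k => r k < 0) _
      fun k hk => ⟨hk.ne, hneg k hk⟩
    let G : (Option (Option (κ ⊕ κ ⊕ κ)) → ℂ) → ℂ := fun z => F fun k =>
      if 0 < r k then ((L k + z (some (some (Sum.inr (Sum.inl k))))) * z none) ^ (r k).natAbs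
      else if r k < 0 then
        ((L' k + z (some (some (Sum.inr (Sum.inr k))))) * z (some none)) ^ (r k).natAbs
      else z (some (some (Sum.inl k)))
    have hG : IsAn G := by
      refine hF.comp (G := fun k z => if 0 < r k then
        ((L k + z (some (some (Sum.inr (Sum.inl k))))) * z none) ^ (r k).natAbs
      else if r k < 0 then
        ((L' k + z (some (some (Sum.inr (Sum.inr k))))) * z (some none)) ^ (r k).natAbs
      else z (some (some (Sum.inl k)))) (fun k => ?_) fun k => ?_
      · by_cases h1 : 0 < r k
        · simp only [if_pos h1]
          exact (((IsAn.const _).add (IsAn.coord _)).mul (IsAn.coord _)).pow _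
        · by_cases h2 : r k < 0
          · simp only [if_neg h1, if_pos h2]
            exact (((IsAn.const _).add (IsAn.coord _)).mul (IsAn.coord _)).pow _
          · simp only [if_neg h1, if_neg h2]
            exact IsAn.coord _
      · by_cases h1 : 0 < r k
        · simp [h1.ne']
        · by_cases h2 : r k < 0
          · simp [h2.ne]
          · simp [if_neg h1, if_neg h2]
    let e' : κ ⊕ κ ⊕ κ → (α → ℝ) → ℂ :=
      Sum.elim (fun k => if r k = 0 then e k else fun _ => 0) (Sum.elim d d')
    have he' : ∀ i, e' i ∈ C := by
      rintro (k | k | k)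
      · by_cases hk : r k = 0
        · simp only [e', Sum.elim_inl, if_pos hk]
          refine hC.congr (ha k) ?_
          filter_upwards [hae k] with x hx
          rw [hx, hq k, hk, Int.cast_zero, zero_div, qpow_zero, mul_one]
        · simp only [e', Sum.elim_inl, if_neg hk]
          exact hC.const 0
      · exact hd k
      · exact hd' k
    have he'0 : ∀ i, Tendsto (e' i) l (𝓝 0) := by
      rintro (k | k | k)
      · by_cases hk : r k = 0
        · simp only [e', Sum.elim_inl, if_pos hk]
          exact he0 k
        · simp only [e', Sum.elim_inl, if_neg hk]
          exact tendsto_const_nhds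
      · exact hd0 k
      · exact hd'0 k
    refine PreGen.fcongr (hb.factor_two hC hA hB (inv_ne_zero hN') hA0 hB0 hG he' he'0) ?_
    have hall : ∀ k, ∀ᶠ x in l, (if 0 < r k then
        ((L k + d k x) * (A x * qpow b (N : ℚ)⁻¹ x)) ^ (r k).natAbs
      else if r k < 0 then ((L' k + d' k x) * (B x * qpow b (-(N : ℚ)⁻¹) x)) ^ (r k).natAbs
      else e' (Sum.inl k) x) = e k x := by
      intro k
      rcases lt_trichotomy (r k) 0 with h | h | h
      · filter_upwards [hBe k h] with x hx
        rw [if_neg h.not_gt, if_pos h, hx]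
      · refine Eventually.of_forall fun x => ?_
        rw [if_neg h.not_gt, if_neg h.not_lt]
        simp only [e', Sum.elim_inl, if_pos h]
      · filter_upwards [hAe k h] with x hx
        rw [if_pos h, hx]
    filter_upwards [eventually_all.2 hall] with x hx
    exact congrArg F (funext hx)

end FreshFactor

section LogGood

open Filter Topology

variable {α : Type}

/-- Good fields closed under logarithms. -/
structure LogGood (l : Filter (α → ℝ)) (C : Set ((α → ℝ) → ℂ)) : Prop extends Good l C where
  log : ∀ {f}, f ∈ C → (fun x => ((Real.log ‖f x‖ : ℝ) : ℂ)) ∈ C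

/-- Good fields closed under logarithms and exponentials. -/
structure ExpLogGood (l : Filter (α → ℝ)) (C : Set ((α → ℝ) → ℂ)) : Prop extends LogGood l C where
  exp : ∀ {f : (α → ℝ) → ℝ}, (fun x => (f x : ℂ)) ∈ C → (fun x => ((Real.exp (f x) : ℝ) : ℂ)) ∈ C

variable {l : Filter (α → ℝ)} {C : Set ((α → ℝ) → ℂ)} {b : (α → ℝ) → ℝ}

theorem Good.sUnion {c : Set (Set ((α → ℝ) → ℂ))} (hne : c.Nonempty)
    (hdir : DirectedOn (· ⊆ ·) c) (hc : ∀ s ∈ c, Good l s) : Good l (⋃₀ c) := by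
  have hfin : ∀ {κ : Type} [Fintype κ] {e : κ → (α → ℝ) → ℂ}, (∀ k, e k ∈ ⋃₀ c) →
      ∃ s ∈ c, ∀ k, e k ∈ s := by
    intro κ _ e he
    obtain ⟨s, hs, h⟩ := hdir.exists_mem_subset_of_finite_of_subset_sUnion hne
      (Set.finite_range e) (Set.range_subset_iff.2 he)
    exact ⟨s, hs, fun k => h (Set.mem_range_self k)⟩
  have htwo : ∀ {f g : (α → ℝ) → ℂ}, f ∈ ⋃₀ c → g ∈ ⋃₀ c → ∃ s ∈ c, f ∈ s ∧ g ∈ s := by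
    rintro f g ⟨s, hs, hf⟩ ⟨t, ht, hg⟩
    obtain ⟨u, hu, h1, h2⟩ := hdir s hs t ht
    exact ⟨u, hu, h1 hf, h2 hg⟩
  refine PreGood.good ⟨?_, ?_, ?_, ?_, ?_, ?_, ?_, ?_, ?_, ?_, ?_, ?_⟩
  · obtain ⟨s, hs⟩ := hne
    exact (hc s hs).neBot
  · obtain ⟨s, hs⟩ := hne
    exact fun a => ⟨s, hs, (hc s hs).const a⟩
  · intro f g hf hg
    obtain ⟨s, hs, h1, h2⟩ := htwo hf hg
    exact ⟨s, hs, (hc s hs).add h1 h2⟩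
  · intro f g hf hg
    obtain ⟨s, hs, h1, h2⟩ := htwo hf hg
    exact ⟨s, hs, (hc s hs).mul h1 h2⟩
  · rintro f ⟨s, hs, hf⟩
    exact ⟨s, hs, (hc s hs).inv hf⟩
  · rintro f ⟨s, hs, hf⟩
    exact ⟨s, hs, (hc s hs).conj hf⟩
  · rintro f g ⟨s, hs, hf⟩ hfg
    exact ⟨s, hs, (hc s hs).congr hf hfg⟩
  · rintro f ⟨s, hs, hf⟩
    exact (hc s hs).zero_or hf
  · rintro f ⟨s, hs, hf⟩
    exact (hc s hs).lim_or hf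
  · rintro n f hn ⟨s, hs, hf⟩
    obtain ⟨z, hz, h⟩ := (hc s hs).nthRoot hn hf
    exact ⟨z, ⟨s, hs, hz⟩, h⟩
  · intro κ _ F hF e he he0
    obtain ⟨s, hs, h⟩ := hfin he
    exact ⟨s, hs, (hc s hs).an hF h he0⟩
  · rintro f ⟨s, hs, hf⟩
    exact (hc s hs).tame hf

theorem LogGood.sUnion {c : Set (Set ((α → ℝ) → ℂ))} (hne : c.Nonempty)
    (hdir : DirectedOn (· ⊆ ·) c) (hc : ∀ s ∈ c, LogGood l s) : LogGood l (⋃₀ c) where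
  toGood := Good.sUnion hne hdir fun s hs => (hc s hs).toGood
  log := by
    rintro f ⟨s, hs, hf⟩
    exact ⟨s, hs, (hc s hs).log hf⟩

theorem Good.congr_real (hC : Good l C) {f g : (α → ℝ) → ℝ} (hf : (fun x => (f x : ℂ)) ∈ C)
    (hfg : f =ᶠ[l] g) : (fun x => (g x : ℂ)) ∈ C :=
  hC.congr hf (by filter_upwards [hfg] with x hx; rw [hx])

theorem Good.real_add (hC : Good l C) {f g : (α → ℝ) → ℝ} (hf : (fun x => (f x : ℂ)) ∈ C)
    (hg : (fun x => (g x : ℂ)) ∈ C) : (fun x => ((f x + g x : ℝ) : ℂ)) ∈ C := by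
  simpa using hC.add hf hg

theorem Good.real_sub (hC : Good l C) {f g : (α → ℝ) → ℝ} (hf : (fun x => (f x : ℂ)) ∈ C)
    (hg : (fun x => (g x : ℂ)) ∈ C) : (fun x => ((f x - g x : ℝ) : ℂ)) ∈ C := by
  simpa using hC.sub hf hg

theorem Good.real_mul (hC : Good l C) {f g : (α → ℝ) → ℝ} (hf : (fun x => (f x : ℂ)) ∈ C)
    (hg : (fun x => (g x : ℂ)) ∈ C) : (fun x => ((f x * g x : ℝ) : ℂ)) ∈ C := by
  simpa using hC.mul hf hg

theorem Good.real_const (hC : Good l C) (r : ℝ) : (fun _ => ((r : ℝ) : ℂ)) ∈ C := hC.const r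

theorem Good.real_trichotomy (hC : Good l C) {f : (α → ℝ) → ℝ} (hf : (fun x => (f x : ℂ)) ∈ C) :
    (∃ r : ℝ, Tendsto f l (𝓝 r)) ∨ Tendsto f l atTop ∨ Tendsto f l atBot := by
  rcases hC.lim_or_inv_zero hf with ⟨c, hc⟩ | h
  · refine Or.inl ⟨c.re, ?_⟩
    have h := (Complex.continuous_re.tendsto c).comp hc
    exact h
  · have h1 : Tendsto (fun x => (f x)⁻¹) l (𝓝 0) := by
      have h := (Complex.continuous_re.tendsto 0).comp
        (h.congr fun x => (Complex.ofReal_inv (f x)).symm)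
      exact h
    rcases hC.sign hf with h0 | h0 | h0
    · exact Or.inl ⟨0, tendsto_const_nhds.congr' (h0.mono fun x hx => hx.symm)⟩
    · right; left
      have h2 : Tendsto (fun x => (f x)⁻¹) l (𝓝[>] 0) :=
        tendsto_nhdsWithin_iff.2 ⟨h1, h0.mono fun x hx => inv_pos.2 hx⟩
      exact (tendsto_inv_nhdsGT_zero.comp h2).congr fun x => inv_inv _
    · right; right
      have h2 : Tendsto (fun x => (f x)⁻¹) l (𝓝[<] 0) :=
        tendsto_nhdsWithin_iff.2 ⟨h1, h0.mono fun x hx => inv_lt_zero.2 hx⟩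
      exact (tendsto_inv_nhdsLT_zero.comp h2).congr fun x => inv_inv _

/-- Exponentials of bounded elements. -/
theorem Good.exp_mem_of_tendsto (hC : Good l C) {f : (α → ℝ) → ℂ} {c : ℂ} (hf : f ∈ C)
    (hc : Tendsto f l (𝓝 c)) : (fun x => Complex.exp (f x)) ∈ C := by
  have h := hC.an (isAn_exp ()) (e := fun _ x => f x - c) (fun _ => hC.sub hf (hC.const c))
    fun _ => by simpa using hc.sub_const c
  refine hC.congr (hC.mul h (hC.const (Complex.exp c))) (Eventually.of_forall fun x => ?_)
  simp only
  rw [← Complex.exp_add, sub_add_cancel]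

theorem LogGood.fresh_exp (hC : LogGood l C) {c : (α → ℝ) → ℝ} (hc : (fun x => (c x : ℂ)) ∈ C)
    (hexp : (fun x => ((Real.exp (c x) : ℝ) : ℂ)) ∉ C) : FreshOver l C fun x => Real.exp (c x) where
  tame := by
    obtain ⟨g, hg, h⟩ := hC.tame hc
    refine ⟨_, hg.1.exp, ?_⟩
    filter_upwards [h] with x hx
    rw [← hx, Complex.ofReal_re]
  pos := Eventually.of_forall fun x => Real.exp_pos _
  lim_or {m} hm hm0 := by
    have hd := hC.real_sub hc (hC.log hm)
    have hev : ∀ᶠ x in l, Real.exp (c x - Real.log ‖m x‖) = Real.exp (c x) / ‖m x‖ := by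
      filter_upwards [hm0] with x hx
      rw [Real.exp_sub, Real.exp_log (norm_pos_iff.2 hx)]
    rcases hC.real_trichotomy hd with ⟨r, hr⟩ | h | h
    · exfalso
      apply hexp
      have h1 : Tendsto (fun x => ((c x - Real.log ‖m x‖ : ℝ) : ℂ)) l (𝓝 (r : ℂ)) :=
        (Complex.continuous_ofReal.tendsto r).comp hr
      refine hC.congr (hC.mul (hC.exp_mem_of_tendsto hd h1) (hC.norm_mem hm)) ?_
      filter_upwards [hev, hm0] with x h2 h3
      rw [← Complex.ofReal_exp, h2, ← Complex.ofReal_mul, div_mul_cancel₀ _ (norm_ne_zero_iff.2 h3)]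
    · right
      refine (Real.tendsto_exp_neg_atTop_nhds_zero.comp h).congr' ?_
      filter_upwards [hev] with x hx
      rw [Function.comp, Real.exp_neg, hx, inv_div]
    · left
      exact (Real.tendsto_exp_atBot.comp h).congr' hev

/-- Logarithms in a fresh extension. -/
theorem FreshOver.log_norm (hC : Good l C) (hb : FreshOver l C b) {f : (α → ℝ) → ℂ}
    (hf : f ∈ GenField l (powInf l C b) (powMon l C b)) (hf0 : ¬ ∀ᶠ x in l, f x = 0) :
    ∃ a ∈ nonvan l C, ∃ q : ℚ, ∃ g ∈ GenField l (powInf l C b) (powMon l C b), ∃ c,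
      Tendsto g l (𝓝 c) ∧ ∀ᶠ x in l, ((Real.log ‖f x‖ : ℝ) : ℂ) =
        ((Real.log ‖a x‖ : ℝ) : ℂ) + (q : ℂ) * ((Real.log (b x) : ℝ) : ℂ) + g x := by
  obtain ⟨m, ⟨a, ha, q, hm⟩, g, hg, c, hc, h⟩ := (hb.gen hC).log_norm hf hf0
  refine ⟨a, ha, q, g, hg, c, hc, ?_⟩
  filter_upwards [h, hm, ha.2, hb.pos] with x h1 h2 h3 h4
  rw [h1, h2, norm_mul, norm_qpow h4, Real.log_mul (norm_ne_zero_iff.2 h3)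
    (Real.rpow_pos_of_pos h4 _).ne', Real.log_rpow h4]
  push_cast
  ring

theorem FreshOver.logGood (hC : LogGood l C) (hb : FreshOver l C b)
    (hlog : (fun x => ((Real.log (b x) : ℝ) : ℂ)) ∈ C) :
    LogGood l (GenField l (powInf l C b) (powMon l C b)) where
  toGood := (hb.gen hC.toGood).good
  log {f} hf := by
    have hG := (hb.gen hC.toGood).good
    by_cases hf0 : ∀ᶠ x in l, f x = 0
    · refine hG.congr (hG.const 0) ?_
      filter_upwards [hf0] with x hx
      simp [hx]
    · obtain ⟨a, ha, q, g, hg, -, -, h⟩ := hb.log_norm hC.toGood hf hf0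
      refine hG.congr (hG.add (mem_field hC.toGood
        (hC.add (hC.log ha.1) (hC.mul (hC.const (q : ℂ)) hlog))) hg) ?_
      filter_upwards [h] with x hx using hx.symm

theorem FreshOver.mem_gen (hC : Good l C) : (fun x => (b x : ℂ)) ∈
    GenField l (powInf l C b) (powMon l C b) := by
  refine PreGen.fcongr (qpow_mem hC (hC.const 1) 1) (Eventually.of_forall fun x => ?_)
  simp only [qpow_one, one_mul]

theorem LogGood.exists_expLogGood (hC : LogGood l C) : ∃ D, C ⊆ D ∧ ExpLogGood l D := by
  obtain ⟨D, hCD, hD⟩ := zorn_subset_nonempty {D | C ⊆ D ∧ LogGood l D} (fun c hc hch hne =>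
    ⟨⋃₀ c, ⟨hne.elim fun s hs => (hc hs).1.trans (Set.subset_sUnion_of_mem hs),
      LogGood.sUnion hne hch.directedOn fun s hs => (hc hs).2⟩, fun s hs =>
      Set.subset_sUnion_of_mem hs⟩) C ⟨subset_rfl, hC⟩
  · refine ⟨D, hCD, ⟨hD.prop.2, fun {f} hf => ?_⟩⟩
    by_contra hexp
    have hfr := hD.prop.2.fresh_exp hf hexp
    have hD' := hfr.logGood hD.prop.2 (by simpa using hf)
    have hsub : D ⊆ GenField l (powInf l D fun x => Real.exp (f x))
        (powMon l D fun x => Real.exp (f x)) := fun f hf => FreshOver.mem_field hD.prop.2.toGood hf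
    have := hD.eq_of_subset ⟨hCD.trans hsub, hD'⟩ hsub
    apply hexp
    have hmem : (fun x => ((Real.exp (f x) : ℝ) : ℂ)) ∈ GenField l (powInf l D fun x =>
        Real.exp (f x))
        (powMon l D fun x => Real.exp (f x)) := FreshOver.mem_gen hD.prop.2.toGood
    rwa [← this] at hmem

theorem ImmediateOver.logGood (hC : LogGood l C) (hb : ImmediateOver l C b) :
    LogGood l (GenField l (affInf l C b) (nonvan l C)) where
  toGood := (hb.gen hC.toGood).good
  log {f} hf := by
    have hG := (hb.gen hC.toGood).good
    by_cases hf0 : ∀ᶠ x in l, f x = 0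
    · refine hG.congr (hG.const 0) ?_
      filter_upwards [hf0] with x hx
      simp [hx]
    · obtain ⟨m, hm, g, hg, -, -, h⟩ := (hb.gen hC.toGood).log_norm hf hf0
      have hlm : (fun x => ((Real.log ‖m x‖ : ℝ) : ℂ)) ∈ GenField l (affInf l C b) (nonvan l C) := by
        have h1 := hC.log hm.1
        rcases hC.zero_or h1 with h2 | h2
        · exact Or.inl h2
        · exact (hb.preGen hC.toGood).field_of_monomial ⟨h1, h2⟩
      refine hG.congr (hG.add hlm hg) ?_
      filter_upwards [h] with x hx using hx.symm

/-- A tame germ comparable to all elements of a field. -/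
structure Decided (l : Filter (α → ℝ)) (C : Set ((α → ℝ) → ℂ)) (b : (α → ℝ) → ℝ) : Prop where
  tame : ∃ g, Tame g ∧ b =ᶠ[l] g
  cmp : ∀ {c : (α → ℝ) → ℝ}, (fun x => (c x : ℂ)) ∈ C →
    (∀ᶠ x in l, b x < c x) ∨ (∀ᶠ x in l, b x = c x) ∨ ∀ᶠ x in l, c x < b x

theorem Decided.tendsto_or (hC : Good l C) {ρ : (α → ℝ) → ℝ} (hρ : ∀ᶠ x in l, 0 < ρ x)
    (h : ∀ r : ℝ, 0 < r → (∀ᶠ x in l, ρ x < r) ∨ ∀ᶠ x in l, r ≤ ρ x) :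
    Tendsto ρ l (𝓝 0) ∨ Tendsto (fun x => (ρ x)⁻¹) l (𝓝 0) ∨ ∃ r > 0, Tendsto ρ l (𝓝 r) := by
  have := hC.neBot
  by_cases h1 : ∀ r : ℝ, 0 < r → ∀ᶠ x in l, ρ x < r
  · left
    refine tendsto_order.2 ⟨fun a ha => ?_, h1⟩
    filter_upwards [hρ] with x hx using ha.trans hx
  simp only [not_forall, exists_prop] at h1
  obtain ⟨r₀, hr₀, h1⟩ := h1
  have h1 := (h r₀ hr₀).resolve_left h1
  by_cases h2 : ∀ r : ℝ, 0 < r → ∀ᶠ x in l, r ≤ ρ x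
  · right; left
    refine tendsto_order.2 ⟨fun a ha => ?_, fun a ha => ?_⟩
    · filter_upwards [hρ] with x hx using ha.trans (inv_pos.2 hx)
    · filter_upwards [h2 (2 * a⁻¹) (by positivity), hρ] with x hx hx'
      rw [inv_lt_comm₀ hx' ha]
      have : 0 < a⁻¹ := inv_pos.2 ha
      linarith
  simp only [not_forall, exists_prop] at h2
  obtain ⟨r₁, hr₁, h2⟩ := h2
  have h2 := (h r₁ hr₁).resolve_right h2
  right; right
  let S : Set ℝ := {r | 0 < r ∧ ∀ᶠ x in l, ρ x < r}
  have hlb : ∀ r ∈ S, r₀ ≤ r := by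
    rintro r ⟨-, hr⟩
    obtain ⟨x, hx, hx'⟩ := (hr.and h1).exists
    linarith
  have hne : S.Nonempty := ⟨r₁, hr₁, h2⟩
  have hinf : r₀ ≤ sInf S := le_csInf hne hlb
  refine ⟨sInf S, hr₀.trans_le hinf, tendsto_order.2 ⟨fun a ha => ?_, fun a ha => ?_⟩⟩
  · obtain ⟨a', ha1, ha2⟩ := exists_between (max_lt ha (hr₀.trans_le hinf))
    have hpos : 0 < a' := (le_max_right _ _).trans_lt ha1
    rcases h a' hpos with h3 | h3
    · exact absurd (csInf_le ⟨r₀, hlb⟩ ⟨hpos, h3⟩) (not_le.2 ha2)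
    · filter_upwards [h3] with x hx using ((le_max_left _ _).trans_lt ha1).trans_le hx
  · obtain ⟨s, hs, hsa⟩ := (csInf_lt_iff ⟨r₀, hlb⟩ hne).1 ha
    filter_upwards [hs.2] with x hx using hx.trans hsa

/-- The three kinds of simple extension. -/
theorem Decided.trichotomy (hC : Good l C) (hb : Decided l C b) :
    (fun x => (b x : ℂ)) ∈ C ∨ ImmediateOver l C b ∨
      ∃ c : (α → ℝ) → ℝ, (fun x => (c x : ℂ)) ∈ C ∧ FreshOver l C fun x => |b x - c x| := by
  by_cases h1 : ∃ c : (α → ℝ) → ℝ, (fun x => (c x : ℂ)) ∈ C ∧ ∀ᶠ x in l, b x = c x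
  · obtain ⟨c, hc, h⟩ := h1
    exact Or.inl (hC.congr_real hc (h.mono fun x hx => hx.symm))
  simp only [not_exists, not_and] at h1
  have hlt : ∀ {c : (α → ℝ) → ℝ}, (fun x => (c x : ℂ)) ∈ C →
      (∀ᶠ x in l, b x < c x) ∨ ∀ᶠ x in l, c x < b x := fun hc => by
    rcases hb.cmp hc with h | h | h
    · exact Or.inl h
    · exact absurd h (h1 _ hc)
    · exact Or.inr h
  have hne : ∀ {c : (α → ℝ) → ℝ}, (fun x => (c x : ℂ)) ∈ C → ∀ᶠ x in l, b x ≠ c x := fun hc => by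
    rcases hlt hc with h | h
    · filter_upwards [h] with x hx using hx.ne
    · filter_upwards [h] with x hx using hx.ne'
  right
  by_cases h2 : ∀ {c : (α → ℝ) → ℝ}, (fun x => (c x : ℂ)) ∈ C → ∃ c' : (α → ℝ) → ℝ,
      (fun x => (c' x : ℂ)) ∈ C ∧ Tendsto (fun x => (b x - c' x) / (b x - c x)) l (𝓝 0)
  · exact Or.inl ⟨hb.tame, hne, h2⟩
  right
  simp only [not_forall, not_exists, not_and, exists_prop] at h2
  obtain ⟨c, hc, h2⟩ := h2
  have hpos : ∀ᶠ x in l, 0 < |b x - c x| := by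
    filter_upwards [hne hc] with x hx using abs_pos.2 (sub_ne_zero.2 hx)
  obtain ⟨s, hs, hsgn⟩ : ∃ s : ℝ, (s = 1 ∨ s = -1) ∧ ∀ᶠ x in l, |b x - c x| = s * (b x - c x) := by
    rcases hlt hc with h | h
    · exact ⟨-1, Or.inr rfl, by
        filter_upwards [h] with x hx; rw [abs_of_neg (by linarith)]; ring⟩
    · exact ⟨1, Or.inl rfl, by
        filter_upwards [h] with x hx; rw [abs_of_pos (by linarith)]; ring⟩
  have hss : s * s = 1 := by rcases hs with rfl | rfl <;> norm_num
  refine ⟨c, hc, ?_, hpos, ?_⟩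
  · obtain ⟨g, hg, h⟩ := hb.tame
    obtain ⟨c', hc', h'⟩ := hC.tame hc
    refine ⟨_, (Tame.const s).mul (hg.sub hc'.1), ?_⟩
    filter_upwards [hsgn, h, h'] with x k1 k2 k3
    rw [k1, k2, ← k3, Complex.ofReal_re]
  intro m hm hm0
  have hmr := hC.norm_mem hm
  have hcm : ∀ r : ℝ, (fun x => ((c x + s * r * ‖m x‖ : ℝ) : ℂ)) ∈ C := fun r =>
    hC.real_add hc (hC.real_mul (hC.real_const (s * r)) hmr)
  rcases Decided.tendsto_or hC (ρ := fun x => |b x - c x| / ‖m x‖)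
    (by filter_upwards [hpos, hm0] with x k1 k2 using div_pos k1 (norm_pos_iff.2 k2))
    (fun r hr => by
      have h3 := hlt (hcm r)
      rcases hs with rfl | rfl
      · refine h3.imp (fun h3 => ?_) fun h3 => ?_ <;>
          filter_upwards [h3, hsgn, hm0] with x k1 k2 k3 <;>
          have k4 := norm_pos_iff.2 k3
        · rw [k2, div_lt_iff₀ k4]; linarith
        · rw [k2, le_div_iff₀ k4]; linarith
      · refine h3.symm.imp (fun h3 => ?_) fun h3 => ?_ <;>
          filter_upwards [h3, hsgn, hm0] with x k1 k2 k3 <;>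
          have k4 := norm_pos_iff.2 k3
        · rw [k2, div_lt_iff₀ k4]; linarith
        · rw [k2, le_div_iff₀ k4]; linarith) with h | h | ⟨r, hr, h⟩
  · exact Or.inl h
  · exact Or.inr (h.congr fun x => inv_div _ _)
  · exfalso
    apply h2 _ (hcm r)
    have h3 := (h.inv₀ hr.ne').const_mul r |>.const_sub 1
    rw [mul_inv_cancel₀ hr.ne', sub_self] at h3
    refine h3.congr' ?_
    filter_upwards [hsgn, hpos, hm0] with x k1 k2 k3
    have k4 := (norm_pos_iff.2 k3).ne'
    have k5 : b x - c x ≠ 0 := abs_pos.1 k2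
    have hs0 : s ≠ 0 := by rintro rfl; norm_num at hss
    rw [k1]
    field_simp
    linear_combination (r * ‖m x‖) * hss

end LogGood

section Tower

open Filter Topology Asymptotics

variable {α : Type}

theorem GenField.mono {l : Filter (α → ℝ)} {E E' M M' : Set ((α → ℝ) → ℂ)} (hE : E ⊆ E')
    (hM : M ⊆ M') : GenField l E M ⊆ GenField l E' M' := by
  rintro f (h | ⟨m, hm, g, ⟨κ, i, F, e, hF, he, hg⟩, h⟩)
  · exact Or.inl h
  · exact Or.inr ⟨m, hM hm, g, ⟨κ, i, F, e, hF, fun k => hE (he k), hg⟩, h⟩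

/-- Successive fresh extensions. -/
def tower (l : Filter (α → ℝ)) (M : Set ((α → ℝ) → ℂ)) (b : ℕ → (α → ℝ) → ℝ) :
    ℕ → ℕ → Set ((α → ℝ) → ℂ)
  | _, 0 => M
  | i, n + 1 => GenField l (powInf l (tower l M b (i + 1) n) (b i))
      (powMon l (tower l M b (i + 1) n) (b i))

/-- Iterated logarithms of distances to a field. -/
structure LogSeq (l : Filter (α → ℝ)) (M : Set ((α → ℝ) → ℂ)) (β c b : ℕ → (α → ℝ) → ℝ) :
    Prop where
  decided : ∀ i, Decided l M (β i)
  mem : ∀ i, (fun x => (c i x : ℂ)) ∈ M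
  abs_eq : ∀ i x, b i x = |β i x - c i x|
  fresh : ∀ i, FreshOver l M (b i)
  log_eq : ∀ i x, β (i + 1) x = Real.log (b i x)

variable {l : Filter (α → ℝ)} {M : Set ((α → ℝ) → ℂ)} {β c b : ℕ → (α → ℝ) → ℝ}

theorem FreshOver.real_or (hM : Good l M) {b m : (α → ℝ) → ℝ} (hb : FreshOver l M b)
    (hm : (fun x => (m x : ℂ)) ∈ M) (h0 : ∀ᶠ x in l, m x ≠ 0) :
    Tendsto (fun x => b x / |m x|) l (𝓝 0) ∨ Tendsto (fun x => |m x| / b x) l (𝓝 0) := by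
  simpa using hb.lim_or hm (by simpa using h0)

namespace LogSeq

theorem tendsto_atTop (hM : ExpLogGood l M) (h : LogSeq l M β c b) (i : ℕ) :
    Tendsto (b (i + 1)) l atTop := by
  have := hM.neBot
  rcases (h.fresh (i + 1)).real_or hM.toGood (hM.real_const 1) (Eventually.of_forall fun _ =>
    one_ne_zero)
    with h1 | h1
  · exfalso
    have h2 : Tendsto (fun x => β (i + 1) x - c (i + 1) x) l (𝓝 0) := by
      rw [tendsto_zero_iff_abs_tendsto_zero]
      refine h1.congr fun x => ?_
      rw [abs_one, div_one, h.abs_eq]; rfl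
    have h3 : Tendsto (fun x => b i x / |Real.exp (c (i + 1) x)|) l (𝓝 1) := by
      have := (Real.continuous_exp.tendsto 0).comp h2
      rw [Real.exp_zero] at this
      refine this.congr' ?_
      filter_upwards [(h.fresh i).pos] with x hx
      rw [Function.comp, Real.exp_sub, h.log_eq, Real.exp_log hx, abs_of_pos (Real.exp_pos _)]
    rcases (h.fresh i).real_or hM.toGood (hM.exp (h.mem (i + 1)))
      (Eventually.of_forall fun _ => (Real.exp_pos _).ne') with h4 | h4
    · exact one_ne_zero (tendsto_nhds_unique h3 h4)
    · have h5 := h3.inv₀ one_ne_zero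
      rw [inv_one] at h5
      exact one_ne_zero (tendsto_nhds_unique (h5.congr fun x => inv_div _ _) h4)
  · have h2 : Tendsto (fun x => (b (i + 1) x)⁻¹) l (𝓝[>] 0) := tendsto_nhdsWithin_iff.2
      ⟨h1.congr fun x => by rw [abs_one, one_div],
        (h.fresh (i + 1)).pos.mono fun x hx => inv_pos.2 hx⟩
    exact (tendsto_inv_nhdsGT_zero.comp h2).congr fun x => inv_inv _

theorem le_abs_sub (hM : ExpLogGood l M) (h : LogSeq l M β c b) (i : ℕ) {m : (α → ℝ) → ℝ}
    (hm : (fun x => (m x : ℂ)) ∈ M) : ∀ᶠ x in l, b i x / 2 ≤ |β i x - m x| := by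
  have hd := hM.real_sub (h.mem i) hm
  rcases hM.real_zero_or hd with h0 | h0
  · filter_upwards [h0, (h.fresh i).pos] with x h1 h2
    rw [← sub_eq_zero.1 h1, ← h.abs_eq]
    linarith
  have key : ∀ x, b i x = |β i x - m x - (c i x - m x)| := fun x => by
    rw [h.abs_eq]; congr 1; ring
  rcases (h.fresh i).real_or hM.toGood hd h0 with h1 | h1
  · filter_upwards [h1.eventually_lt_const (show (0 : ℝ) < 1 / 2 by norm_num), h0] with x h2 h3
    rw [div_lt_iff₀ (abs_pos.2 h3)] at h2
    have h4 := abs_sub_abs_le_abs_sub (c i x - m x) (β i x - m x)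
    rw [abs_sub_comm (c i x - m x), ← key] at h4
    have h5 := abs_nonneg (β i x - m x)
    have h6 := abs_nonneg (c i x - m x)
    linarith
  · filter_upwards [h1.eventually_lt_const (show (0 : ℝ) < 1 / 2 by norm_num), (h.fresh i).pos]
      with x h2 h3
    rw [div_lt_iff₀ h3] at h2
    have h4 := abs_sub (β i x - m x) (c i x - m x)
    rw [← key] at h4
    linarith

theorem isLittleO (hM : ExpLogGood l M) (h : LogSeq l M β c b) (i : ℕ) :
    b (i + 2) =o[l] b (i + 1) := by
  have h1 : (fun x => Real.log (b (i + 1) x)) =o[l] b (i + 1) :=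
    Real.isLittleO_log_id_atTop.comp_tendsto (h.tendsto_atTop hM i)
  refine IsBigO.trans_isLittleO ?_ h1
  refine IsBigO.of_bound 2 ?_
  filter_upwards [h.le_abs_sub hM (i + 2) (hM.real_const 0), (h.fresh (i + 2)).pos] with x h2 h3
  rw [sub_zero, h.log_eq] at h2
  rw [Real.norm_eq_abs, Real.norm_eq_abs, abs_of_pos h3]
  linarith

theorem fresh_tower (hM : ExpLogGood l M) (h : LogSeq l M β c b) (i : ℕ) {C : Set ((α → ℝ) → ℂ)}
    (hC : Good l C)
    (hlog : ∀ f ∈ nonvan l C, ∃ m : (α → ℝ) → ℝ, (fun x => (m x : ℂ)) ∈ M ∧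
      (fun x => ((Real.log ‖f x‖ - m x : ℝ) : ℂ)) =O[l] b (i + 2)) : FreshOver l C (b i) where
  tame := (h.fresh i).tame
  pos := (h.fresh i).pos
  lim_or {f} hf hf0 := by
    have := hM.neBot
    obtain ⟨m, hm, hfm⟩ := hlog f ⟨hf, hf0⟩
    have hlim := h.tendsto_atTop hM i
    have hev : ∀ᶠ x in l, Real.exp (β (i + 1) x - Real.log ‖f x‖) = b i x / ‖f x‖ := by
      filter_upwards [hf0, (h.fresh i).pos] with x h1 h2
      rw [Real.exp_sub, h.log_eq, Real.exp_log h2, Real.exp_log (norm_pos_iff.2 h1)]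
    have hbd : ∀ᶠ x in l, |Real.log ‖f x‖ - m x| ≤ b (i + 1) x / 4 := by
      have h1 := (hfm.trans_isLittleO (h.isLittleO hM i)).def (show (0 : ℝ) < 1 / 4 by norm_num)
      filter_upwards [h1, (h.fresh (i + 1)).pos] with x h2 h3
      rw [Complex.norm_real, Real.norm_eq_abs, Real.norm_eq_abs, abs_of_pos h3] at h2
      linarith
    have hlow := h.le_abs_sub hM (i + 1) hm
    have hquot : Tendsto (fun x => b (i + 1) x / 4) l atTop := hlim.atTop_div_const (by norm_num)
    rcases (h.decided (i + 1)).cmp hm with h1 | h1 | h1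
    · left
      have h2 : Tendsto (fun x => β (i + 1) x - Real.log ‖f x‖) l atBot := by
        refine tendsto_atBot_mono' l ?_ (tendsto_neg_atTop_atBot.comp hquot)
        filter_upwards [h1, hbd, hlow] with x k1 k2 k3
        rw [abs_of_neg (by linarith)] at k3
        have := (abs_le.1 k2).1
        simp only [Function.comp]
        linarith
      exact (Real.tendsto_exp_atBot.comp h2).congr' hev
    · exfalso
      obtain ⟨x, k1, k2, k3⟩ := (h1.and (hlow.and (h.fresh (i + 1)).pos)).exists
      rw [k1, sub_self, abs_zero] at k2
      linarith
    · right
      have h2 : Tendsto (fun x => β (i + 1) x - Real.log ‖f x‖) l atTop := by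
        refine tendsto_atTop_mono' l ?_ hquot
        filter_upwards [h1, hbd, hlow] with x k1 k2 k3
        rw [abs_of_pos (by linarith)] at k3
        have := (abs_le.1 k2).2
        linarith
      refine (Real.tendsto_exp_neg_atTop_nhds_zero.comp h2).congr' ?_
      filter_upwards [hev] with x hx
      rw [Function.comp, Real.exp_neg, hx, inv_div]

theorem tower_good (hM : ExpLogGood l M) (h : LogSeq l M β c b) (n : ℕ) : ∀ i,
    Good l (tower l M b i n) ∧ ∀ f ∈ nonvan l (tower l M b i n), ∃ m : (α → ℝ) → ℝ,
      (fun x => (m x : ℂ)) ∈ M ∧ (fun x => ((Real.log ‖f x‖ - m x : ℝ) : ℂ)) =O[l] b (i + 1) := by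
  have := hM.neBot
  induction n with
  | zero =>
    refine fun i => ⟨hM.toGood, fun f hf => ⟨_, hM.log hf.1, ?_⟩⟩
    simp only [sub_self, Complex.ofReal_zero]
    exact isBigO_zero _ _
  | succ n ih =>
    intro i
    obtain ⟨hC, hlog⟩ := ih (i + 1)
    have hfr := h.fresh_tower hM i hC hlog
    refine ⟨(hfr.gen hC).good, fun f hf => ?_⟩
    have hf0 : ¬ ∀ᶠ x in l, f x = 0 := fun h0 => by
      obtain ⟨x, h1, h2⟩ := (h0.and hf.2).exists
      exact h2 h1
    obtain ⟨a, ha, q, g, -, d, hg, hev⟩ := hfr.log_norm hC hf.1 hf0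
    obtain ⟨m, hm, ham⟩ := hlog a ha
    refine ⟨fun x => m x + q * c (i + 1) x, hM.real_add hm (hM.real_mul (hM.real_const q)
      (h.mem (i + 1))), ?_⟩
    have h1 : (fun x => ((Real.log ‖f x‖ - (m x + q * c (i + 1) x) : ℝ) : ℂ)) =ᶠ[l]
        fun x => ((Real.log ‖a x‖ - m x : ℝ) : ℂ) +
          ((q : ℝ) : ℂ) * ((β (i + 1) x - c (i + 1) x : ℝ) : ℂ) + g x := by
      filter_upwards [hev] with x hx
      rw [Complex.ofReal_sub, hx, h.log_eq]
      push_cast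
      ring
    refine h1.trans_isBigO ?_
    refine ((ham.trans (h.isLittleO hM i).isBigO).add ?_).add ?_
    · refine IsBigO.of_bound ‖((q : ℝ) : ℂ)‖ (Eventually.of_forall fun x => ?_)
      rw [norm_mul, Complex.norm_real (β (i + 1) x - _), h.abs_eq, norm_abs_eq_norm]
    · refine (hg.isBigO_one ℝ).trans (IsLittleO.isBigO ?_)
      exact (isLittleO_one_left_iff ℝ).2 (tendsto_norm_atTop_atTop.comp (h.tendsto_atTop hM i))

theorem fresh_tower' (hM : ExpLogGood l M) (h : LogSeq l M β c b) (i n : ℕ) :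
    FreshOver l (tower l M b (i + 1) n) (b i) :=
  h.fresh_tower hM i (h.tower_good hM n (i + 1)).1 (h.tower_good hM n (i + 1)).2

theorem tower_mono (hM : ExpLogGood l M) (h : LogSeq l M β c b) (n : ℕ) : ∀ i,
    tower l M b i n ⊆ tower l M b i (n + 1) := by
  induction n with
  | zero => exact fun i f hf => FreshOver.mem_field hM.toGood hf
  | succ n ih =>
    intro i
    refine GenField.mono ?_ ?_
    · rintro e ⟨h0, a, ha, q, he⟩
      exact ⟨h0, a, ih (i + 1) ha, q, he⟩
    · rintro m ⟨a, ⟨ha, ha0⟩, q, hm⟩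
      exact ⟨a, ⟨ih (i + 1) ha, ha0⟩, q, hm⟩

theorem subset_tower (hM : ExpLogGood l M) (h : LogSeq l M β c b) (i n : ℕ) :
    M ⊆ tower l M b i n := by
  induction n with
  | zero => exact subset_rfl
  | succ n ih => exact ih.trans (h.tower_mono hM n i)

theorem tower_up (hM : ExpLogGood l M) (h : LogSeq l M β c b) (i n : ℕ) :
    tower l M b (i + 1) n ⊆ tower l M b i (n + 1) :=
  fun _ hf => FreshOver.mem_field (h.tower_good hM n (i + 1)).1 hf

theorem mem_of_dist {C : Set ((α → ℝ) → ℂ)} (hC : Good l C) (hMC : M ⊆ C) (h : LogSeq l M β c b)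
    (i : ℕ) (hb : (fun x => (b i x : ℂ)) ∈ C) : (fun x => (β i x : ℂ)) ∈ C := by
  have hc := hMC (h.mem i)
  rcases (h.decided i).cmp (h.mem i) with h1 | h1 | h1
  · refine hC.congr_real (hC.real_sub hc hb) ?_
    filter_upwards [h1] with x hx
    rw [h.abs_eq, abs_of_neg (by linarith)]; ring
  · exact hC.congr_real hc (by filter_upwards [h1] with x hx using hx.symm)
  · refine hC.congr_real (hC.real_add hc hb) ?_
    filter_upwards [h1] with x hx
    rw [h.abs_eq, abs_of_pos (by linarith)]; ring

theorem log_mem (hM : ExpLogGood l M) (h : LogSeq l M β c b) (n : ℕ) : ∀ i, ∀ f ∈ tower l M b i n,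
    (fun x => ((Real.log ‖f x‖ : ℝ) : ℂ)) ∈ tower l M b i (n + 1) := by
  induction n with
  | zero => exact fun i f hf => h.tower_mono hM 0 i (hM.log hf)
  | succ n ih =>
    intro i f hf
    have hC := (h.tower_good hM n (i + 1)).1
    have hG := (h.tower_good hM (n + 2) i).1
    by_cases hf0 : ∀ᶠ x in l, f x = 0
    · refine hG.congr (hG.const 0) ?_
      filter_upwards [hf0] with x hx
      simp [hx]
    obtain ⟨a, ha, q, g, hg, d, -, hev⟩ := (h.fresh_tower' hM i n).log_norm hC hf hf0
    have h1 := h.tower_up hM i (n + 1) (ih (i + 1) a ha.1)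
    have h2 : (fun x => ((Real.log (b i x) : ℝ) : ℂ)) ∈ tower l M b (i + 1) (n + 1) := by
      have h3 := h.mem_of_dist (h.tower_good hM (n + 1) (i + 1)).1 (h.subset_tower hM _ _) (i + 1)
        (FreshOver.mem_gen (h.tower_good hM n (i + 2)).1)
      simpa only [h.log_eq] using h3
    refine hG.congr (hG.add (hG.add h1 (hG.mul (hG.const (q : ℂ)) (h.tower_up hM i (n + 1) h2)))
      (h.tower_mono hM (n + 1) i hg)) ?_
    filter_upwards [hev] with x hx using hx.symm

theorem exists_logGood (hM : ExpLogGood l M) (h : LogSeq l M β c b) :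
    ∃ D, M ⊆ D ∧ LogGood l D ∧ (fun x => (β 0 x : ℂ)) ∈ D := by
  have hmono : Monotone fun n => tower l M b 0 n :=
    monotone_nat_of_le_succ fun n => h.tower_mono hM n 0
  have hgood : Good l (⋃₀ Set.range fun n => tower l M b 0 n) :=
    Good.sUnion (Set.range_nonempty _) (by
      rintro _ ⟨m, rfl⟩ _ ⟨n, rfl⟩
      exact ⟨_, ⟨max m n, rfl⟩, hmono (le_max_left _ _),
        hmono (le_max_right _ _)⟩) (by
      rintro _ ⟨n, rfl⟩
      exact (h.tower_good hM n 0).1)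
  have hsub : ∀ n, tower l M b 0 n ⊆ ⋃₀ Set.range fun n => tower l M b 0 n :=
    fun n => Set.subset_sUnion_of_mem ⟨n, rfl⟩
  refine ⟨_, (h.subset_tower hM 0 0).trans (hsub 0), ⟨hgood, ?_⟩, ?_⟩
  · rintro f ⟨_, ⟨n, rfl⟩, hf⟩
    exact hsub (n + 1) (h.log_mem hM n 0 f hf)
  · exact h.mem_of_dist hgood ((h.subset_tower hM 0 0).trans (hsub 0)) 0
      (hsub 1 (FreshOver.mem_gen hM.toGood))

end LogSeq

/-- Adjoining a decided germ to a good field closed under exponentials and logarithms. -/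
theorem Decided.exists_expLogGood (hM : ExpLogGood l M) {b : (α → ℝ) → ℝ} (hb : Decided l M b) :
    ∃ D, M ⊆ D ∧ ExpLogGood l D ∧ (fun x => (b x : ℂ)) ∈ D := by
  by_contra hcon
  let X := {β : (α → ℝ) → ℝ // Decided l M β ∧
    ¬ ∃ D, M ⊆ D ∧ ExpLogGood l D ∧ (fun x => (β x : ℂ)) ∈ D}
  have hstep : ∀ β : X, ∃ (c : (α → ℝ) → ℝ) (β' : X), (fun x => (c x : ℂ)) ∈ M ∧
      (FreshOver l M fun x => |β.1 x - c x|) ∧ ∀ x, β'.1 x = Real.log |β.1 x - c x| := by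
    rintro ⟨β, hβ, hn⟩
    rcases hβ.trichotomy hM.toGood with h | h | ⟨c, hc, hfr⟩
    · exact absurd ⟨M, subset_rfl, hM, h⟩ hn
    · exfalso
      obtain ⟨D, hD, hD'⟩ := (h.logGood hM.toLogGood).exists_expLogGood
      have hCmem : M ⊆ GenField l (affInf l M β) (nonvan l M) := fun f hf => by
        rcases hM.zero_or hf with h0 | h0
        · exact Or.inl h0
        · exact (h.preGen hM.toGood).field_of_monomial ⟨hf, h0⟩
      refine hn ⟨D, hCmem.trans hD, hD', hD ?_⟩
      have := h.sub_mem hM.toGood (hM.const 0)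
      simpa using this
    · refine ⟨c, ⟨fun x => Real.log |β x - c x|, ⟨?_, ?_⟩, ?_⟩, hc, hfr, fun x => rfl⟩
      · obtain ⟨g, hg, h⟩ := hfr.tame
        refine ⟨_, hg.log, ?_⟩
        filter_upwards [h] with x hx
        rw [hx]
      · intro d hd
        have hexp := hM.exp hd
        have hpos := hfr.pos
        have hlt : ∀ x, 0 < |β x - c x| →
            ((Real.log |β x - c x| < d x ↔ |β x - c x| < Real.exp (d x)) ∧
            (Real.log |β x - c x| = d x ↔ |β x - c x| = Real.exp (d x)) ∧
            (d x < Real.log |β x - c x| ↔ Real.exp (d x) < |β x - c x|)) := fun x hx =>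
          ⟨Real.log_lt_iff_lt_exp hx, ⟨fun h => by rw [← h, Real.exp_log hx], fun h => by
            rw [h, Real.log_exp]⟩, Real.lt_log_iff_exp_lt hx⟩
        have hcmp : (∀ᶠ x in l, |β x - c x| < Real.exp (d x)) ∨
            (∀ᶠ x in l, |β x - c x| = Real.exp (d x)) ∨
            ∀ᶠ x in l, Real.exp (d x) < |β x - c x| := by
          rcases hβ.cmp hc with h1 | h1 | h1
          · rcases hβ.cmp (hM.real_sub hc hexp) with h2 | h2 | h2
            · right; right
              filter_upwards [h1, h2] with x k1 k2
              rw [abs_of_neg (by linarith)]; linarith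
            · right; left
              filter_upwards [h1, h2] with x k1 k2
              rw [abs_of_neg (by linarith)]; linarith
            · left
              filter_upwards [h1, h2] with x k1 k2
              rw [abs_of_neg (by linarith)]; linarith
          · left
            filter_upwards [h1] with x k1
            rw [k1, sub_self, abs_zero]
            exact Real.exp_pos _
          · rcases hβ.cmp (hM.real_add hc hexp) with h2 | h2 | h2
            · left
              filter_upwards [h1, h2] with x k1 k2
              rw [abs_of_pos (by linarith)]; linarith
            · right; left
              filter_upwards [h1, h2] with x k1 k2
              rw [abs_of_pos (by linarith)]; linarith
            · right; right
              filter_upwards [h1, h2] with x k1 k2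
              rw [abs_of_pos (by linarith)]; linarith
        refine hcmp.imp (fun h => ?_) (Or.imp (fun h => ?_) fun h => ?_) <;>
          filter_upwards [h, hpos] with x k1 k2
        · exact (hlt x k2).1.2 k1
        · exact (hlt x k2).2.1.2 k1
        · exact (hlt x k2).2.2.2 k1
      · rintro ⟨D, hMD, hD, hmem⟩
        refine hn ⟨D, hMD, hD, ?_⟩
        have habs : (fun x => ((|β x - c x| : ℝ) : ℂ)) ∈ D :=
          hD.congr_real (hD.exp hmem) (by
            filter_upwards [hfr.pos] with x hx
            exact Real.exp_log hx)
        rcases hβ.cmp hc with h1 | h1 | h1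
        · refine hD.congr_real (hD.real_sub (hMD hc) habs) ?_
          filter_upwards [h1] with x hx
          rw [abs_of_neg (by linarith)]; ring
        · exact hD.congr_real (hMD hc) (by filter_upwards [h1] with x hx using hx.symm)
        · refine hD.congr_real (hD.real_add (hMD hc) habs) ?_
          filter_upwards [h1] with x hx
          rw [abs_of_pos (by linarith)]; ring
  choose c next hc hfr hnext using hstep
  let β : ℕ → X := fun n => Nat.rec ⟨b, hb, hcon⟩ (fun _ β => next β) n
  have hseq : LogSeq l M (fun i => (β i).1) (fun i => c (β i)) fun i x => |(β i).1 x - c (β i) x| :=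
    ⟨fun i => (β i).2.1, fun i => hc _, fun i x => rfl, fun i => hfr _, fun i x => hnext (β i) x⟩
  obtain ⟨D, hMD, hD, hmem⟩ := hseq.exists_logGood hM
  obtain ⟨D', hDD, hD'⟩ := hD.exists_expLogGood
  exact hcon ⟨D', hMD.trans hDD, hD', hDD hmem⟩

end Tower

/-! ### Ramanujan's differential equations -/

section Ramanujan

open UpperHalfPlane hiding I
open Filter Derivative ModularForm EisensteinSeries
open scoped Topology Manifold MatrixGroups

theorem tendsto_atImInfty_of_hasSum {f : ℍ → ℂ} {c : ℕ → ℂ} (hd : MDiff f)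
    (hf : ∀ τ : ℍ, HasSum (fun m => c m • Function.Periodic.qParam 1 τ ^ m) (f τ)) :
    Tendsto f atImInfty (𝓝 (c 0)) := by
  have hb := isBoundedAtImInfty_of_hasSum_qExpansion one_pos hf
  have hper : Function.Periodic (f ∘ ofComplex) (1 : ℝ) := by
    intro z
    by_cases hz : 0 < z.im
    · have hz' : 0 < (z + ((1 : ℝ) : ℂ)).im := by simpa using hz
      simp only [Function.comp_apply, ofComplex_apply_of_im_pos hz, ofComplex_apply_of_im_pos hz']
      refine (hf _).unique ?_
      convert hf ⟨z, hz⟩ using 3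
      simp [Function.Periodic.qParam, mul_add, Complex.exp_add]
    · have hz' : ¬ 0 < (z + ((1 : ℝ) : ℂ)).im := by simpa using hz
      simp only [Function.comp_apply, ofComplex_apply_of_im_nonpos (not_lt.1 hz),
        ofComplex_apply_of_im_nonpos (not_lt.1 hz')]
  have ha := analyticAt_cuspFunction_zero one_pos hper hd hb
  have h0 := (hasFPowerSeriesOnBall_cuspFunction one_pos ha hf).coeff_zero (fun _ => 0)
  have h1 := ha.continuousAt.tendsto.comp (qParam_tendsto_atImInfty one_pos)
  rw [← h0] at h1
  have h2 : (cuspFunction 1 f ∘ fun τ : ℍ => Function.Periodic.qParam 1 τ) = f := by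
    funext τ
    exact eq_cuspFunction τ one_ne_zero hper
  rw [h2] at h1
  simpa [FormalMultilinearSeries.ofScalars] using h1

theorem tendsto_E2 : Tendsto E2 atImInfty (𝓝 1) := by
  have := tendsto_atImInfty_of_hasSum E2_mdifferentiable fun τ => by
    simpa only [Function.Periodic.qParam, ofReal_one, div_one] using hasSum_qExpansion_E2 (z := τ)
  simpa using this

theorem tendsto_E {k : ℕ} (hk : 3 ≤ k) (hk2 : Even k) : Tendsto (E hk) atImInfty (𝓝 1) := by
  have := tendsto_atImInfty_of_hasSum (ModularFormClass.holo (E hk)) fun τ =>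
    ModularForm.hasSum_qExpansion (E hk) one_pos one_mem_strictPeriods_SL τ
  rwa [E_qExpansion_coeff_zero hk hk2] at this

theorem tendsto_normalizedDeriv {f : ℍ → ℂ} (hf : MDiff f) {c : ℂ}
    (h : Tendsto f atImInfty (𝓝 c)) : Tendsto (D f) atImInfty (𝓝 0) := by
  rw [Metric.tendsto_nhds] at h ⊢
  intro ε hε
  obtain ⟨A, hA⟩ := (atImInfty_mem _).1 (h (ε / 2) (half_pos hε))
  refine (atImInfty_mem _).2 ⟨max A 0 + 2, fun z hz => ?_⟩
  have hsub : ∀ w ∈ Metric.closedBall (z : ℂ) 1, 0 < w.im ∧ A ≤ w.im := by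
    intro w hw
    have h1 := (abs_im_le_norm (w - z)).trans (by simpa [dist_eq_norm] using hw)
    rw [sub_im, abs_le] at h1
    have h2 : (z : ℂ).im = z.im := rfl
    constructor
    · linarith [le_max_right A 0]
    · linarith [le_max_left A 0]
  have hdiff : DifferentiableOn ℂ (fun w => (f ∘ ofComplex) w - c) (Metric.closedBall (z : ℂ) 1) :=
    ((UpperHalfPlane.mdifferentiable_iff.1 hf).mono fun w hw => (hsub w hw).1).sub_const c
  have key := norm_deriv_le_of_forall_mem_sphere_norm_le (C := ε / 2) one_pos
    (hdiff.diffContOnCl_ball subset_rfl) fun w hw => by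
      have hw' := hsub w (Metric.sphere_subset_closedBall hw)
      have := hA ⟨w, hw'.1⟩ hw'.2
      simp only [Set.mem_ofPred_eq, dist_eq_norm] at this
      simpa only [Function.comp_apply, ofComplex_apply_of_im_pos hw'.1] using this.le
  rw [deriv_sub_const, div_one] at key
  simp only [Set.mem_ofPred_eq, dist_zero_right, normalizedDerivOfComplex, norm_mul, norm_inv]
  have h2 : (1 : ℝ) ≤ ‖(2 : ℂ)‖ * ‖(Real.pi : ℂ)‖ * ‖I‖ := by
    simp only [Complex.norm_ofNat, norm_real, norm_I, mul_one, Real.norm_eq_abs,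
      abs_of_pos Real.pi_pos]
    linarith [Real.pi_gt_three]
  have h3 := inv_le_one_of_one_le₀ h2
  nlinarith [norm_nonneg (deriv (f ∘ ofComplex) z)]

theorem exists_modularForm {f : ℍ → ℂ} {k : ℤ} (hf : MDiff f) (hs : ∀ γ : SL(2, ℤ), f ∣[k] γ = f)
    {c : ℂ} (h : Tendsto f atImInfty (𝓝 c)) : ∃ F : ModularForm 𝒮ℒ k, ⇑F = f :=
  ⟨{  toFun := f
      slash_action_eq' := by
        rintro _ ⟨γ, rfl⟩
        exact hs γ
      holo' := hf
      bdd_at_cusps' := fun hc => by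
        rw [Subgroup.IsArithmetic.isCusp_iff_isCusp_SL2Z] at hc
        rw [OnePoint.isBoundedAt_iff_forall_SL2Z hc]
        intro γ _
        rw [hs]
        exact h.isBigO_one ℝ }, rfl⟩

theorem exists_eq_smul {f : ℍ → ℂ} {k : ℕ} (hf : MDiff f)
    (hs : ∀ γ : SL(2, ℤ), f ∣[(k : ℤ)] γ = f) {c : ℂ} (h : Tendsto f atImInfty (𝓝 c))
    (hr : Module.rank ℂ (ModularForm 𝒮ℒ k) = 1) (G : ModularForm 𝒮ℒ k)
    (hG : Tendsto G atImInfty (𝓝 1)) : ∀ z, f z = c * G z := by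
  obtain ⟨F, hF⟩ := exists_modularForm hf hs h
  have hG0 : G ≠ 0 := by
    rintro rfl
    exact one_ne_zero (tendsto_nhds_unique hG (tendsto_const_nhds (x := (0 : ℂ))))
  obtain ⟨d, hd⟩ := (finrank_eq_one_iff_of_nonzero' G hG0).1
    (Module.rank_eq_one_iff_finrank_eq_one.1 hr) F
  have hd' : ∀ z, f z = d * G z := fun z => by
    rw [← hF, ← hd]; rfl
  have h2 : Tendsto f atImInfty (𝓝 (d * 1)) := (hG.const_mul d).congr fun z => (hd' z).symm
  rw [tendsto_nhds_unique h h2, mul_one]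
  exact hd'

theorem slash_E {k : ℕ} (hk : 3 ≤ k) (γ : SL(2, ℤ)) : (E hk : ℍ → ℂ) ∣[(k : ℤ)] γ = E hk :=
  SlashInvariantFormClass.slash_action_eq (E hk) _ ⟨γ, rfl⟩

theorem D_E4 (z : ℍ) : D E₄ z = (E2 z * E₄ z - E₆ z) / 3 := by
  have hE := ModularFormClass.holo E₄
  have h4 := tendsto_E (k := 4) (by norm_num) ⟨2, rfl⟩
  have := exists_eq_smul (k := 6) (f := serreDerivative (4 : ℤ) E₄)
    (serreDerivative_mdifferentiable _ hE)
    (fun γ => serreDerivative_slash_invariant hE (slash_E _ γ))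
    ((tendsto_normalizedDeriv hE h4).sub ((tendsto_E2.const_mul _).mul h4))
    levelOne_weight_six_rank_one E₆ (tendsto_E (by norm_num) ⟨3, rfl⟩) z
  simp only [serreDerivative_apply] at this
  push_cast at this
  linear_combination this

theorem D_E6 (z : ℍ) : D E₆ z = (E2 z * E₆ z - E₄ z ^ 2) / 2 := by
  have hE := ModularFormClass.holo E₆
  have h4 := tendsto_E (k := 4) (by norm_num) ⟨2, rfl⟩
  have h6 := tendsto_E (k := 6) (by norm_num) ⟨3, rfl⟩
  have := exists_eq_smul (k := 8) (f := serreDerivative (6 : ℤ) E₆)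
    (serreDerivative_mdifferentiable _ hE)
    (fun γ => serreDerivative_slash_invariant hE (slash_E _ γ))
    ((tendsto_normalizedDeriv hE h6).sub ((tendsto_E2.const_mul _).mul h6))
    (by rw [dimension_level_one 8 ⟨4, rfl⟩]; norm_num [Nat.ModEq]) (E₄.mul E₄)
    (by
      have h := h4.mul h4
      rwa [one_mul] at h) z
  simp only [serreDerivative_apply] at this
  have h2 : (E₄.mul E₄) z = E₄ z * E₄ z := rfl
  rw [h2] at this
  push_cast at this
  linear_combination this

theorem D_E2 (z : ℍ) : D E2 z = (E2 z ^ 2 - E₄ z) / 12 := by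
  have hE := E2_mdifferentiable
  have hsq : MDiff (fun w => E2 w * E2 w) := hE.mul hE
  have hs : ∀ γ : SL(2, ℤ), (fun w => D E2 w - 12⁻¹ * (E2 w * E2 w)) ∣[(4 : ℤ)] γ =
      fun w => D E2 w - 12⁻¹ * (E2 w * E2 w) := by
    intro γ
    have hpi : (Real.pi : ℂ) ≠ 0 := ofReal_ne_zero.2 Real.pi_ne_zero
    have hsl : E2 ∣[(2 : ℤ)] γ = fun w : ℍ => E2 w -
        6 * I / Real.pi * ((γ 1 0 : ℂ) * denom γ w ^ (-1 : ℤ)) := by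
      rw [E2_slash_action]
      funext w
      simp only [Pi.sub_apply, Pi.smul_apply, smul_eq_mul, D2, riemannZeta_two, zpow_neg_one]
      field_simp
    have hdu : ∀ w : ℍ, HasDerivAt (fun z => (γ 1 0 : ℂ) * denom γ z ^ (-1 : ℤ))
        (-((γ 1 0 : ℂ) * denom γ w ^ (-1 : ℤ)) ^ 2) w := fun w => by
      have h := (hasDerivAt_denom_zpow γ (-1) w).const_mul (γ 1 0 : ℂ)
      refine h.congr_deriv ?_
      have hz := denom_ne_zero γ w
      norm_num
      field_simp
    have hD : ∀ w : ℍ, D (E2 ∣[(2 : ℤ)] γ) w = D E2 w +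
        3 / Real.pi ^ 2 * ((γ 1 0 : ℂ) * denom γ w ^ (-1 : ℤ)) ^ 2 := by
      intro w
      have h1 : HasDerivAt (E2 ∘ ofComplex) (deriv (E2 ∘ ofComplex) w) w :=
        (mdifferentiableAt_iff.1 (hE w)).hasDerivAt
      have h2 : ((E2 ∣[(2 : ℤ)] γ) ∘ ofComplex) =ᶠ[𝓝 ↑w] fun z => (E2 ∘ ofComplex) z -
          6 * I / Real.pi * ((γ 1 0 : ℂ) * denom γ z ^ (-1 : ℤ)) := by
        filter_upwards [isOpen_upperHalfPlaneSet.mem_nhds w.im_pos] with z hz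
        rw [hsl]
        simp only [Function.comp_apply, ofComplex_apply_of_im_pos hz]
      rw [normalizedDerivOfComplex, ((h1.sub ((hdu w).const_mul _)).congr_of_eventuallyEq h2).deriv,
        normalizedDerivOfComplex]
      generalize (γ 1 0 : ℂ) * denom γ w ^ (-1 : ℤ) = u
      field_simp
      ring
    funext w
    have h1 := congrFun (normalizedDerivOfComplex_SL_slash (k := 2) hE (γ := γ)) w
    rw [hD, hsl] at h1
    have h2 := congrFun hsl w
    simp only [ModularForm.SL_slash_apply, Pi.sub_apply] at h1 h2 ⊢
    have h3 : (denom γ w) ^ (-4 : ℤ) = denom γ w ^ (-2 : ℤ) * denom γ w ^ (-2 : ℤ) := by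
      rw [← zpow_add₀ (denom_ne_zero γ w)]; norm_num
    rw [div_eq_mul_inv (γ 1 0 : ℂ), ← zpow_neg_one (denom γ w)] at h1
    rw [h3]
    have h5 : (2 : ℤ) + 2 = 4 := rfl
    rw [h5, h3] at h1
    generalize (γ 1 0 : ℂ) * denom γ w ^ (-1 : ℤ) = u at h1 h2
    generalize denom γ w ^ (-2 : ℤ) = d at h1 h2 ⊢
    have h6 : (2 * (Real.pi : ℂ) * I)⁻¹ = -I / (2 * Real.pi) := by
      rw [mul_inv, inv_I]; field_simp
    rw [h6] at h1
    push_cast at h1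
    have h7 : (E2 (γ • w) * d) ^ 2 = (E2 w - 6 * I / ↑Real.pi * u) ^ 2 := by rw [h2]
    field_simp at h1 h7 ⊢
    apply mul_left_cancel₀ (pow_ne_zero 2 hpi)
    linear_combination (-12) * h1 - h7 + (36 * u ^ 2) * I_sq
  have := exists_eq_smul (k := 4) (f := fun w => D E2 w - 12⁻¹ * (E2 w * E2 w))
    ((normalizedDerivOfComplex_mdifferentiable hE).sub (mdifferentiable_const.mul hsq)) hs
    ((tendsto_normalizedDeriv hE tendsto_E2).sub ((tendsto_E2.mul tendsto_E2).const_mul _))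
    levelOne_weight_four_rank_one E₄ (tendsto_E (by norm_num) ⟨2, rfl⟩) z
  linear_combination this

end Ramanujan

/-! ### The modular function and its derivatives -/

section ModularFunction

open UpperHalfPlane hiding I
open Filter Derivative ModularForm EisensteinSeries
open scoped Topology Manifold MatrixGroups

theorem Eis_eq {k : ℕ} (hk : 3 ≤ k) (z : ℍ) : Eis k z = E hk z := by
  have h0 : riemannZeta k ≠ 0 := riemannZeta_ne_zero_of_one_lt_re (by norm_cast; omega)
  have hz : zetaC k = riemannZeta k := by
    have h : 1 < ((k : ℕ) : ℂ).re := by norm_cast; omega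
    rw [zeta_eq_tsum_one_div_nat_add_one_cpow h]
    simp only [Complex.cpow_natCast, zetaC]
  have hs := tsum_eisSummand_eq_riemannZeta_mul_eisensteinSeries hk z
  rw [← (finTwoArrowEquiv ℤ).symm.tsum_eq] at hs
  have h2 : E hk z = 1 / 2 * eisensteinSeries (N := 1) 0 k z := rfl
  have h3 : ∀ p : ℤ × ℤ, (if p = (0, 0) then 0 else 1 / ((p.1 : ℂ) * z + (p.2 : ℂ)) ^ k) =
      eisSummand k ((finTwoArrowEquiv ℤ).symm p) z := by
    rintro ⟨a, b⟩
    simp only [eisSummand, finTwoArrowEquiv_symm_apply, Matrix.cons_val_zero, Matrix.cons_val_one,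
      zpow_neg, zpow_natCast, one_div]
    split_ifs with h
    · obtain ⟨rfl, rfl⟩ := Prod.mk.inj h
      simp [show k ≠ 0 by omega]
    · rfl
  rw [Eis, tsum_congr h3, hs, h2, hz]
  field_simp

/-- The Eisenstein series as functions on the complex plane. -/
def e4 : ℂ → ℂ := E₄ ∘ ofComplex
/-- The Eisenstein series of weight six. -/
def e6 : ℂ → ℂ := E₆ ∘ ofComplex
/-- The quasimodular Eisenstein series of weight two. -/
def e2 : ℂ → ℂ := E2 ∘ ofComplex
/-- The inverse of the discriminant, up to a constant. -/
def eΔ (z : ℂ) : ℂ := (e4 z ^ 3 - e6 z ^ 2)⁻¹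

theorem disc_eq (z : ℍ) : e4 z ^ 3 - e6 z ^ 2 = 1728 * discriminant z := by
  rw [discriminant_eq_E₄_cube_sub_E₆_sq]
  simp only [e4, e6, Function.comp_apply, ofComplex_apply]
  ring

theorem disc_ne_zero {z : ℂ} (hz : 0 < z.im) : e4 z ^ 3 - e6 z ^ 2 ≠ 0 := by
  rw [show z = ((⟨z, hz⟩ : ℍ) : ℂ) from rfl, disc_eq]
  exact mul_ne_zero (by norm_num) (discriminant_ne_zero _)

theorem Jmod_eq {z : ℂ} (hz : 0 < z.im) : Jmod z = e4 z ^ 3 * eΔ z := by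
  have h := ofComplex_apply (⟨z, hz⟩ : ℍ)
  have h4 := Eis_eq (k := 4) (by norm_num) ⟨z, hz⟩
  have h6 := Eis_eq (k := 6) (by norm_num) ⟨z, hz⟩
  change ofComplex z = _ at h
  simp only [Jmod, eΔ, e4, e6, Function.comp_apply, h, div_eq_mul_inv]
  change Eis 4 z = _ at h4
  change Eis 6 z = _ at h6
  rw [h4, h6]

theorem hasDerivAt_of_D {F : ℍ → ℂ} (hF : MDiff F) {z : ℂ} (hz : 0 < z.im) {c : ℂ}
    (hc : D F ⟨z, hz⟩ = c) : HasDerivAt (F ∘ ofComplex) (2 * Real.pi * I * c) z := by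
  have h1 : HasDerivAt (F ∘ ofComplex) (deriv (F ∘ ofComplex) z) z :=
    (mdifferentiableAt_iff.1 (hF ⟨z, hz⟩)).hasDerivAt
  refine h1.congr_deriv ?_
  rw [← hc, normalizedDerivOfComplex, ← mul_assoc, mul_inv_cancel₀ two_pi_I_ne_zero, one_mul]

theorem hasDerivAt_e4 {z : ℂ} (hz : 0 < z.im) :
    HasDerivAt e4 (2 * Real.pi * I * ((e2 z * e4 z - e6 z) / 3)) z :=
  hasDerivAt_of_D (ModularFormClass.holo E₄) hz (by
    rw [D_E4]; simp only [e2, e4, e6, Function.comp_apply, ofComplex_apply_of_im_pos hz])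

theorem hasDerivAt_e6 {z : ℂ} (hz : 0 < z.im) :
    HasDerivAt e6 (2 * Real.pi * I * ((e2 z * e6 z - e4 z ^ 2) / 2)) z :=
  hasDerivAt_of_D (ModularFormClass.holo E₆) hz (by
    rw [D_E6]; simp only [e2, e4, e6, Function.comp_apply, ofComplex_apply_of_im_pos hz])

theorem hasDerivAt_e2 {z : ℂ} (hz : 0 < z.im) :
    HasDerivAt e2 (2 * Real.pi * I * ((e2 z ^ 2 - e4 z) / 12)) z :=
  hasDerivAt_of_D E2_mdifferentiable hz (by
    rw [D_E2]; simp only [e2, e4, Function.comp_apply, ofComplex_apply_of_im_pos hz])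

theorem hasDerivAt_eΔ {z : ℂ} (hz : 0 < z.im) :
    HasDerivAt eΔ (2 * Real.pi * I * (-e2 z * eΔ z)) z := by
  refine (((hasDerivAt_e4 hz).pow 3).sub ((hasDerivAt_e6 hz).pow 2)).inv (disc_ne_zero hz)
    |>.congr_deriv ?_
  have h0 := disc_ne_zero hz
  simp only [eΔ]
  simp only [Pi.sub_apply, Pi.pow_apply]
  rw [div_eq_iff (pow_ne_zero 2 h0)]
  field_simp
  push_cast
  ring

/-- The differential ring generated by the Eisenstein series and the inverse discriminant. -/
def modAlg : Subalgebra ℂ (ℂ → ℂ) := Algebra.adjoin ℂ {e2, e4, e6, eΔ}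

theorem e2_mem : e2 ∈ modAlg := Algebra.subset_adjoin (by simp)
theorem e4_mem : e4 ∈ modAlg := Algebra.subset_adjoin (by simp)
theorem e6_mem : e6 ∈ modAlg := Algebra.subset_adjoin (by simp)
theorem eΔ_mem : eΔ ∈ modAlg := Algebra.subset_adjoin (by simp)

theorem modAlg_deriv {f : ℂ → ℂ} (hf : f ∈ modAlg) :
    ∃ g ∈ modAlg, ∀ z : ℂ, 0 < z.im → HasDerivAt f (g z) z := by
  induction hf using Algebra.adjoin_induction with
  | mem f hf =>
    rcases hf with rfl | rfl | rfl | rfl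
    · exact ⟨_, (modAlg.smul_mem (modAlg.smul_mem (modAlg.sub_mem (modAlg.pow_mem e2_mem 2)
        e4_mem) 12⁻¹) (2 * Real.pi * I)), fun z hz => (hasDerivAt_e2 hz).congr_deriv (by
          simp only [Pi.smul_apply, Pi.sub_apply, Pi.pow_apply, smul_eq_mul]; ring)⟩
    · exact ⟨_, (modAlg.smul_mem (modAlg.smul_mem (modAlg.sub_mem (modAlg.mul_mem e2_mem e4_mem)
        e6_mem) 3⁻¹) (2 * Real.pi * I)), fun z hz => (hasDerivAt_e4 hz).congr_deriv (by
          simp only [Pi.smul_apply, Pi.sub_apply, Pi.mul_apply, smul_eq_mul]; ring)⟩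
    · exact ⟨_, (modAlg.smul_mem (modAlg.smul_mem (modAlg.sub_mem (modAlg.mul_mem e2_mem e6_mem)
        (modAlg.pow_mem e4_mem 2)) 2⁻¹) (2 * Real.pi * I)), fun z hz =>
          (hasDerivAt_e6 hz).congr_deriv (by
          simp only [Pi.smul_apply, Pi.sub_apply, Pi.mul_apply, Pi.pow_apply, smul_eq_mul]; ring)⟩
    · exact ⟨_, (modAlg.smul_mem (modAlg.mul_mem e2_mem eΔ_mem) (-(2 * Real.pi * I))),
        fun z hz => (hasDerivAt_eΔ hz).congr_deriv (by
          simp only [Pi.smul_apply, Pi.mul_apply, smul_eq_mul]; ring)⟩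
  | algebraMap c => exact ⟨0, modAlg.zero_mem, fun z _ => hasDerivAt_const z c⟩
  | add f g _ _ hf hg =>
    obtain ⟨f', hf', h1⟩ := hf
    obtain ⟨g', hg', h2⟩ := hg
    exact ⟨_, modAlg.add_mem hf' hg', fun z hz => (h1 z hz).add (h2 z hz)⟩
  | mul f g hf0 hg0 hf hg =>
    obtain ⟨f', hf', h1⟩ := hf
    obtain ⟨g', hg', h2⟩ := hg
    exact ⟨_, modAlg.add_mem (modAlg.mul_mem hf' hg0) (modAlg.mul_mem hf0 hg'),
      fun z hz => (h1 z hz).mul (h2 z hz)⟩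

theorem isOpen_im_pos : IsOpen {z : ℂ | 0 < z.im} := isOpen_lt continuous_const continuous_im

theorem iteratedDeriv_Jmod_mem (k : ℕ) :
    ∃ g ∈ modAlg, ∀ z : ℂ, 0 < z.im → iteratedDeriv k Jmod z = g z := by
  induction k with
  | zero => exact ⟨_, modAlg.mul_mem (modAlg.pow_mem e4_mem 3) eΔ_mem, fun z hz => Jmod_eq hz⟩
  | succ k ih =>
    obtain ⟨g, hg, h⟩ := ih
    obtain ⟨g', hg', h'⟩ := modAlg_deriv hg
    refine ⟨g', hg', fun z hz => ?_⟩
    rw [iteratedDeriv_succ]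
    exact ((h' z hz).congr_of_eventuallyEq
      (by filter_upwards [isOpen_im_pos.mem_nhds hz] with w hw using h w hw)).deriv

theorem hasDerivAt_iteratedDeriv_Jmod (k : ℕ) {z : ℂ} (hz : 0 < z.im) :
    HasDerivAt (iteratedDeriv k Jmod) (iteratedDeriv (k + 1) Jmod z) z := by
  obtain ⟨g, hg, h⟩ := iteratedDeriv_Jmod_mem k
  obtain ⟨g', hg', h'⟩ := modAlg_deriv hg
  have h1 := (h' z hz).congr_of_eventuallyEq (f₁ := iteratedDeriv k Jmod)
      (by filter_upwards [isOpen_im_pos.mem_nhds hz] with w hw using h w hw)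
  rw [iteratedDeriv_succ]
  exact h1.differentiableAt.hasDerivAt

theorem deriv_Jmod {z : ℂ} (hz : 0 < z.im) :
    iteratedDeriv 1 Jmod z = 2 * Real.pi * I * (-(e4 z ^ 2 * e6 z * eΔ z)) := by
  rw [iteratedDeriv_one]
  refine HasDerivAt.deriv ?_
  refine ((((hasDerivAt_e4 hz).pow 3).mul (hasDerivAt_eΔ hz)).congr_of_eventuallyEq
    (f₁ := Jmod) ?_).congr_deriv ?_
  · filter_upwards [isOpen_im_pos.mem_nhds hz] with w hw using Jmod_eq hw
  · simp; ring

theorem deriv2_Jmod {z : ℂ} (hz : 0 < z.im) :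
    iteratedDeriv 2 Jmod z = (2 * Real.pi * I) ^ 2 * (-eΔ z * (e2 z * e4 z ^ 2 * e6 z / 6 -
      2 / 3 * e4 z * e6 z ^ 2 - e4 z ^ 4 / 2)) := by
  rw [iteratedDeriv_succ]
  refine HasDerivAt.deriv ?_
  refine ((((((hasDerivAt_e4 hz).pow 2).mul (hasDerivAt_e6 hz)).mul
    (hasDerivAt_eΔ hz)).neg.const_mul
    (2 * Real.pi * I : ℂ)).congr_of_eventuallyEq (f₁ := iteratedDeriv 1 Jmod) ?_).congr_deriv ?_
  · filter_upwards [isOpen_im_pos.mem_nhds hz] with w hw using deriv_Jmod hw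
  · simp; ring

theorem tendsto_e4 : Tendsto e4 (comap im atTop) (𝓝 1) :=
  ((tendsto_E (k := 4) (by norm_num) ⟨2, rfl⟩).comp tendsto_comap_im_ofComplex)

theorem tendsto_e6 : Tendsto e6 (comap im atTop) (𝓝 1) :=
  ((tendsto_E (k := 6) (by norm_num) ⟨3, rfl⟩).comp tendsto_comap_im_ofComplex)

theorem eventually_ne_zero_of_modAlg {f : ℂ → ℂ} (hf : f ∈ modAlg)
    (hl : Tendsto f (comap im atTop) (𝓝 1)) {p : ℂ} (hp : 0 < p.im) : ∀ᶠ z in 𝓝[≠] p, f z ≠ 0 := by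
  have ha : AnalyticOnNhd ℂ f {z : ℂ | 0 < z.im} := by
    refine DifferentiableOn.analyticOnNhd (fun z hz => ?_) isOpen_im_pos
    obtain ⟨g, -, hg⟩ := modAlg_deriv hf
    exact (hg z hz).differentiableAt.differentiableWithinAt
  rcases (ha p hp).eventually_eq_zero_or_eventually_ne_zero with h | h
  · exfalso
    have h0 := ha.eqOn_zero_of_preconnected_of_eventuallyEq_zero
      (convex_halfSpace_im_gt 0).isPreconnected hp h
    have h1 : Tendsto (fun y : ℝ => f (y * I)) atTop (𝓝 1) :=
      hl.comp (tendsto_comap_iff.2 (tendsto_id.congr fun y => by simp))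
    have h2 : Tendsto (fun y : ℝ => f (y * I)) atTop (𝓝 0) :=
      tendsto_const_nhds.congr' (by
        filter_upwards [eventually_gt_atTop 0] with y hy
        exact (h0 (by simpa using hy)).symm)
    exact one_ne_zero (tendsto_nhds_unique h1 h2)
  · exact h

end ModularFunction

/-! ### Definability of the modular function beyond the fundamental strip -/

section ModularDefinability

open UpperHalfPlane hiding I
open Filter ModularForm
open scoped Topology MatrixGroups

theorem Jmod_smul (γ : SL(2, ℤ)) (z : ℍ) : Jmod (γ • z : ℍ) = Jmod z := by
  have key : ∀ {k : ℕ} (hk : 3 ≤ k), Eis k (γ • z : ℍ) = denom γ z ^ k * Eis k z := fun {k} hk => by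
    have h := congrFun (slash_E hk γ) z
    rw [SL_slash_apply] at h
    rw [Eis_eq hk, Eis_eq hk, ← h, zpow_neg, zpow_natCast]
    field_simp [denom_ne_zero γ z]
  have hd : denom γ z ^ 12 ≠ 0 := pow_ne_zero _ (denom_ne_zero γ z)
  rw [Jmod, Jmod, key (by norm_num), key (by norm_num), ← mul_div_mul_left _ (Eis 4 z ^ 3 - _) hd]
  congr 1 <;> ring

theorem Jmod_inv {z : ℂ} (hz : 0 < z.im) : Jmod (-z⁻¹) = Jmod z := by
  have h := Jmod_smul ModularGroup.S ⟨z, hz⟩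
  rw [modular_S_smul] at h
  rw [← inv_neg]
  exact h

theorem iteratedDeriv_Jmod_add_one (k : ℕ) {z : ℂ} (hz : 0 < z.im) :
    iteratedDeriv k Jmod (z + 1) = iteratedDeriv k Jmod z := by
  rw [← congrFun (iteratedDeriv_comp_add_const k Jmod 1) z]
  refine (Filter.EventuallyEq.iteratedDeriv ?_ k).eq_of_nhds
  filter_upwards [isOpen_im_pos.mem_nhds hz] with w hw
  have h := Jmod_smul ModularGroup.T ⟨w, hw⟩
  rw [modular_T_smul, coe_vadd, ofReal_one, add_comm] at h
  exact h

theorem im_neg_inv_pos {z : ℂ} (hz : 0 < z.im) : 0 < (-z⁻¹).im := by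
  have h : z ≠ 0 := by rintro rfl; simp at hz
  rw [neg_im, inv_im, neg_div, neg_neg]
  exact div_pos hz (normSq_pos.2 h)

theorem hasDerivAt_neg_inv {z : ℂ} (hz : z ≠ 0) :
    HasDerivAt (fun z : ℂ => -z⁻¹) ((z ^ 2)⁻¹) z :=
  (hasDerivAt_inv hz).neg.congr_deriv (neg_neg _)

theorem iteratedDeriv_Jmod_inv {z : ℂ} (hz : 0 < z.im) :
    iteratedDeriv 1 Jmod z = iteratedDeriv 1 Jmod (-z⁻¹) * (z ^ 2)⁻¹ := by
  have h0 : z ≠ 0 := by rintro rfl; simp at hz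
  have h1 : HasDerivAt (fun z => Jmod (-z⁻¹)) (iteratedDeriv 1 Jmod (-z⁻¹) * (z ^ 2)⁻¹) z :=
    HasDerivAt.comp (h₂ := Jmod) z (hasDerivAt_iteratedDeriv_Jmod 0 (im_neg_inv_pos hz))
      (hasDerivAt_neg_inv h0)
  refine (hasDerivAt_iteratedDeriv_Jmod 0 hz).unique (h1.congr_of_eventuallyEq ?_)
  filter_upwards [isOpen_im_pos.mem_nhds hz] with w hw using (Jmod_inv hw).symm

theorem iteratedDeriv_two_Jmod_inv {z : ℂ} (hz : 0 < z.im) :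
    iteratedDeriv 2 Jmod z = iteratedDeriv 2 Jmod (-z⁻¹) * (z ^ 2)⁻¹ * (z ^ 2)⁻¹ -
      2 * iteratedDeriv 1 Jmod (-z⁻¹) * (z ^ 2)⁻¹ * z⁻¹ := by
  have h0 : z ≠ 0 := by rintro rfl; simp at hz
  have h1 : HasDerivAt (fun z => iteratedDeriv 1 Jmod (-z⁻¹))
      (iteratedDeriv 2 Jmod (-z⁻¹) * (z ^ 2)⁻¹) z :=
    HasDerivAt.comp (h₂ := iteratedDeriv 1 Jmod) z
      (hasDerivAt_iteratedDeriv_Jmod 1 (im_neg_inv_pos hz)) (hasDerivAt_neg_inv h0)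
  have h2 := h1.mul ((hasDerivAt_pow 2 z).inv (pow_ne_zero 2 h0))
  refine (hasDerivAt_iteratedDeriv_Jmod 1 hz).unique ((h2.congr_of_eventuallyEq ?_).congr_deriv ?_)
  · filter_upwards [isOpen_im_pos.mem_nhds hz] with w hw using iteratedDeriv_Jmod_inv hw
  · simp only [Pi.inv_apply]
    field_simp
    push_cast
    ring

/-- Tame functions of one complex variable. -/
def TameF (f : ℂ → ℂ) : Prop :=
  ∀ ⦃α : Type⦄ ⦃g : (α → ℝ) → ℂ⦄, TameC g → TameC fun x => f (g x)

/-- Tame sets of complex numbers. -/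
def TameS (s : Set ℂ) : Prop :=
  ∀ ⦃α : Type⦄ ⦃g : (α → ℝ) → ℂ⦄, TameC g → TPred fun x => g x ∈ s

open scoped Classical in
theorem TameF.ite {s : Set ℂ} {f g : ℂ → ℂ} (hs : TameS s) (hf : TameF f) (hg : TameF g) :
    TameF fun z => if z ∈ s then f z else g z :=
  fun _ _ h => TameC.ite (hs h) (hf h) (hg h)

theorem TameF.congr {f g : ℂ → ℂ} (hf : TameF f) (h : ∀ z, g z = f z) : TameF g :=
  fun _ _ hg => (hf hg).congr fun _ => h _

theorem TameF.const (c : ℂ) : TameF fun _ => c := fun _ _ _ => TameC.const c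

theorem TPred.abs_le {α : Type} {f : (α → ℝ) → ℝ} (hf : Tame f) (r : ℝ) :
    TPred fun x => |f x| ≤ r :=
  ((TPred.le hf.neg (Tame.const r)).and (TPred.le hf (Tame.const r))).congr fun _ => by
    rw [_root_.abs_le]
    exact and_congr_left' neg_le

/-- The domain of the function symbols for the modular function. -/
def strip : Set ℂ := {z | |z.re| ≤ 1 / 2 ∧ Real.sqrt 3 / 2 ≤ z.im}

theorem tameS_re_im (r s : ℝ) : TameS {z | |z.re| ≤ r ∧ s ≤ z.im} := fun _ _ hg =>
  (TPred.abs_le hg.1 r).and (TPred.le (Tame.const s) hg.2)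

theorem tameS_re_im' (r s : ℝ) : TameS {z | |z.re| ≤ r ∧ s < z.im} := fun _ _ hg =>
  (TPred.abs_le hg.1 r).and (TPred.lt (Tame.const s) hg.2)

/-- The derivatives of the modular function up to order two are tame on the set `s`. -/
def JTame (s : Set ℂ) : Prop := TameS s ∧ (∀ z ∈ s, 0 < z.im) ∧
  ∀ k : ℕ, k < 3 → TameF (s.indicator (iteratedDeriv k Jmod))

theorem jTame_strip : JTame strip := by
  classical
  refine ⟨tameS_re_im _ _, fun z hz => lt_of_lt_of_le (by positivity) hz.2, fun k hk α g hg => ?_⟩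
  refine (TameC.mk' (hg.1.Jre hg.2 ⟨k, hk⟩) (hg.1.Jim hg.2 ⟨k, hk⟩)).congr fun x => ?_
  rw [Set.indicator_apply, Complex.re_add_im]
  by_cases h : |(g x).re| ≤ 1 / 2 ∧ Real.sqrt 3 / 2 ≤ (g x).im
  · rw [if_pos h, if_pos h, if_pos (show g x ∈ strip from h)]
  · rw [if_neg h, if_neg h, if_neg (show g x ∉ strip from h)]
    rfl

theorem JTame.shift {s t : Set ℂ} (hs : JTame s) (ht : TameS t)
    (h : ∀ z ∈ t, 0 < z.im ∧ (z ∈ s ∨ z + 1 ∈ s ∨ z - 1 ∈ s)) : JTame t := by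
  classical
  refine ⟨ht, fun z hz => (h z hz).1, fun k hk => ?_⟩
  have h1 : ∀ c : ℂ, TameF fun z => s.indicator (iteratedDeriv k Jmod) (z + c) :=
    fun c α g hg => hs.2.2 k hk (hg.add (TameC.const c))
  have h2 : ∀ c : ℂ, TameS {z | z + c ∈ s} := fun c α g hg => hs.1 (hg.add (TameC.const c))
  refine ((h1 0).ite (h2 0) ((h1 1).ite (h2 1) (h1 (-1)))).ite ht (TameF.const 0) |>.congr
    fun z => ?_
  rw [Set.indicator_apply]
  by_cases hz : z ∈ t
  · rw [if_pos hz, if_pos hz]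
    obtain ⟨hi, hc⟩ := h z hz
    have e1 := iteratedDeriv_Jmod_add_one k hi
    have e2 := iteratedDeriv_Jmod_add_one k (z := z - 1) (by simpa using hi)
    simp only [Set.mem_ofPred_eq, add_zero]
    by_cases h3 : z ∈ s
    · rw [if_pos (by simpa using h3), Set.indicator_of_mem h3]
    rw [if_neg (by simpa using h3)]
    by_cases h4 : z + 1 ∈ s
    · rw [if_pos (by simpa using h4), Set.indicator_of_mem h4, e1]
    · rw [if_neg (by simpa using h4), ← sub_eq_add_neg,
        Set.indicator_of_mem ((hc.resolve_left h3).resolve_left h4), ← e2, sub_add_cancel]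
  · rw [if_neg hz, if_neg hz]

theorem JTame.inversion {s t : Set ℂ} (hs : JTame s) (ht : TameS t)
    (h : ∀ z ∈ t, 0 < z.im ∧ (z ∈ s ∨ -z⁻¹ ∈ s)) : JTame t := by
  classical
  refine ⟨ht, fun z hz => (h z hz).1, fun k hk => ?_⟩
  have h1 : ∀ k < 3, TameF fun z => s.indicator (iteratedDeriv k Jmod) (-z⁻¹) :=
    fun k hk α g hg => hs.2.2 k hk hg.inv.neg
  have h2 : ∀ n : ℕ, TameF fun z => (z ^ n)⁻¹ := fun n α g hg => (hg.pow n).inv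
  have key : ∃ F, TameF F ∧ ∀ z : ℂ, 0 < z.im → -z⁻¹ ∈ s → iteratedDeriv k Jmod z = F z := by
    interval_cases k
    · exact ⟨_, h1 0 (by norm_num), fun z hz hs => by
        rw [Set.indicator_of_mem hs]; exact (Jmod_inv hz).symm⟩
    · exact ⟨fun z => s.indicator (iteratedDeriv 1 Jmod) (-z⁻¹) * (z ^ 2)⁻¹,
        fun α g hg => (h1 1 (by norm_num) hg).mul (h2 2 hg), fun z hz hs => by
        simp only [Set.indicator_of_mem hs]; exact iteratedDeriv_Jmod_inv hz⟩
    · exact ⟨fun z => s.indicator (iteratedDeriv 2 Jmod) (-z⁻¹) * (z ^ 2)⁻¹ * (z ^ 2)⁻¹ -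
        2 * s.indicator (iteratedDeriv 1 Jmod) (-z⁻¹) * (z ^ 2)⁻¹ * z⁻¹,
        fun α g hg => (((h1 2 (by norm_num) hg).mul (h2 2 hg)).mul (h2 2 hg)).sub
        ((((TameC.const 2).mul (h1 1 (by norm_num) hg)).mul (h2 2 hg)).mul hg.inv), fun z hz hs => by
        simp only [Set.indicator_of_mem hs]; exact iteratedDeriv_two_Jmod_inv hz⟩
  obtain ⟨F, hF, hF2⟩ := key
  refine ((hs.2.2 k hk).ite hs.1 hF).ite ht (TameF.const 0) |>.congr fun z => ?_
  rw [Set.indicator_apply]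
  by_cases hz : z ∈ t
  · rw [if_pos hz, if_pos hz]
    obtain ⟨hi, hc⟩ := h z hz
    by_cases h3 : z ∈ s
    · rw [if_pos h3, Set.indicator_of_mem h3]
    · rw [if_neg h3, hF2 z hi (hc.resolve_left h3)]
  · rw [if_neg hz, if_neg hz]

theorem jTame_wide : JTame {z | |z.re| ≤ 1 ∧ 1 / 2 < z.im} := by
  have hs : 0 < Real.sqrt 3 / 2 := by positivity
  have h1 : JTame {z | |z.re| ≤ 3 / 2 ∧ Real.sqrt 3 / 2 ≤ z.im} := by
    refine jTame_strip.shift (tameS_re_im _ _) fun z hz => ⟨hs.trans_le hz.2, ?_⟩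
    have hz1 := abs_le.1 hz.1
    simp only [strip, Set.mem_ofPred_eq, add_re, sub_re, one_re, add_im, sub_im, one_im, add_zero,
      sub_zero, hz.2, and_true, abs_le]
    by_cases h1 : z.re < -(1 / 2)
    · exact .inr (.inl ⟨by linarith, by linarith⟩)
    by_cases h2 : 1 / 2 < z.re
    · exact .inr (.inr ⟨by linarith, by linarith⟩)
    · exact .inl ⟨by linarith, by linarith⟩
  have h2 : JTame {z | |z.re| ≤ 1 / 2 ∧ 1 / 2 < z.im} := by
    refine h1.inversion (tameS_re_im' _ _) fun z hz => ⟨by linarith [hz.2], ?_⟩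
    have hz1 := abs_le.1 hz.1
    have hz2 := hz.2
    by_cases h3 : Real.sqrt 3 / 2 ≤ z.im
    · exact .inl ⟨by linarith [hz.1], h3⟩
    right
    have h4 : 0 < z.re * z.re + z.im * z.im := by nlinarith
    have h5 := Real.sq_sqrt (show (0 : ℝ) ≤ 3 by norm_num)
    simp only [Set.mem_ofPred_eq, neg_re, neg_im, inv_re, inv_im, normSq_apply]
    rw [abs_neg, abs_div, abs_of_pos h4, div_le_iff₀ h4, ← neg_div, neg_neg, le_div_iff₀ h4]
    push Not at h3
    constructor
    · nlinarith [hz.1, sq_abs z.re, abs_nonneg z.re]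
    · have h6 : Real.sqrt 3 / 2 < 1 := by nlinarith
      have h7 := mul_pos hs (mul_pos (sub_pos.2 h3) (show 0 < z.im - Real.sqrt 3 / 2 / 3 by
          linarith))
      have h8 : z.re * z.re ≤ 1 / 4 := by nlinarith
      nlinarith [mul_le_mul_of_nonneg_left h8 hs.le]
  refine h2.shift (tameS_re_im' _ _) fun z hz => ⟨by linarith [hz.2], ?_⟩
  have hz1 := abs_le.1 hz.1
  have hz2 := hz.2
  simp only [Set.mem_ofPred_eq, add_re, sub_re, one_re, add_im, sub_im, one_im, add_zero,
    sub_zero, hz2, and_true, abs_le]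
  by_cases h1 : z.re < -(1 / 2)
  · exact .inr (.inl ⟨by linarith, by linarith⟩)
  by_cases h2 : 1 / 2 < z.re
  · exact .inr (.inr ⟨by linarith, by linarith⟩)
  · exact .inl ⟨by linarith, by linarith⟩

end ModularDefinability

/-! ### Definability of the germs of the modular function -/

section ModularGerms

open Filter
open scoped Topology

/-- The points of a wide strip at which the modular function is not ramified. -/
def wide : Set ℂ := {z | |z.re| ≤ 1 ∧ 1 / 2 < z.im}

/-- The points of a wide strip at which the modular function is not ramified. -/
def unram : Set ℂ := {z | z ∈ wide ∧ e4 z ≠ 0 ∧ e6 z ≠ 0}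

theorem im_pos_of_wide {z : ℂ} (hz : z ∈ wide) : 0 < z.im := by linarith [hz.2]

theorem tameS_unram : TameS unram := by
  intro α g hg
  have hJ : TameC fun x => wide.indicator (iteratedDeriv 0 Jmod) (g x) :=
    jTame_wide.2.2 0 (by norm_num) hg
  refine ((jTame_wide.1 hg).and ((hJ.eq (TameC.const 0)).not.and
    (hJ.eq (TameC.const 1)).not)).congr fun x => and_congr_right fun hx => ?_
  have hi := im_pos_of_wide hx
  have h0 := disc_ne_zero hi
  rw [Set.indicator_of_mem hx, iteratedDeriv_zero, Jmod_eq hi, eΔ, ← div_eq_mul_inv,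
    div_eq_zero_iff,
    or_iff_left h0, div_eq_one_iff_eq h0]
  exact and_congr (not_congr (by simp)) (not_congr (by
    rw [eq_comm (b := e4 (g x) ^ 3 - _), sub_eq_self]; simp))

theorem tameF_modAlg {f : ℂ → ℂ} (hf : f ∈ modAlg) : TameF (unram.indicator f) := by
  classical
  have hJ : ∀ k < 3, TameF (wide.indicator (iteratedDeriv k Jmod)) := jTame_wide.2.2
  have hk : (2 * Real.pi * I : ℂ) ≠ 0 := two_pi_I_ne_zero
  have key : ∀ {F G : ℂ → ℂ}, TameF F → (∀ z ∈ unram, G z = F z) → TameF (unram.indicator G) :=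
    fun {F G} hF h => (hF.ite tameS_unram (TameF.const 0)).congr fun z => by
      rw [Set.indicator_apply]
      by_cases hz : z ∈ unram
      · rw [if_pos hz, if_pos hz, h z hz]
      · rw [if_neg hz, if_neg hz]
  have h4 : TameF (unram.indicator e4) := by
    refine key (F := fun z => wide.indicator (iteratedDeriv 1 Jmod) z ^ 2 /
      ((2 * Real.pi * I) ^ 2 * (wide.indicator (iteratedDeriv 0 Jmod) z *
        (wide.indicator (iteratedDeriv 0 Jmod) z - 1)))) (fun α g hg =>
        ((hJ 1 (by norm_num) hg).pow 2).div ((TameC.const _).mul ((hJ 0 (by norm_num) hg).mul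
          ((hJ 0 (by norm_num) hg).sub (TameC.const 1))))) fun z hz => ?_
    have hi := im_pos_of_wide hz.1
    have h0 := disc_ne_zero hi
    have h4 := hz.2.1
    have h6 := hz.2.2
    have e1 : e4 z ^ 3 * (e4 z ^ 3 - e6 z ^ 2)⁻¹ - 1 = e6 z ^ 2 * (e4 z ^ 3 - e6 z ^ 2)⁻¹ := by
      field_simp; ring
    rw [Set.indicator_of_mem hz.1, Set.indicator_of_mem hz.1, deriv_Jmod hi, iteratedDeriv_zero,
      Jmod_eq hi, eΔ, e1]
    generalize 2 * (Real.pi : ℂ) * I = c at hk ⊢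
    field_simp
  have h6 : TameF (unram.indicator e6) := by
    refine key (F := fun z => -unram.indicator e4 z * wide.indicator (iteratedDeriv 1 Jmod) z /
      (2 * Real.pi * I * wide.indicator (iteratedDeriv 0 Jmod) z)) (fun α g hg =>
        ((h4 hg).neg.mul (hJ 1 (by norm_num) hg)).div ((TameC.const _).mul (hJ 0 (by norm_num) hg)))
        fun z hz => ?_
    have hi := im_pos_of_wide hz.1
    have h0 := disc_ne_zero hi
    rw [Set.indicator_of_mem hz, Set.indicator_of_mem hz.1, Set.indicator_of_mem hz.1,
      deriv_Jmod hi, iteratedDeriv_zero, Jmod_eq hi, eΔ]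
    obtain ⟨-, h4, h6⟩ := hz
    generalize 2 * (Real.pi : ℂ) * I = c at hk ⊢
    field_simp
  have hΔ : TameF (unram.indicator eΔ) := by
    refine key (F := fun z => (unram.indicator e4 z ^ 3 - unram.indicator e6 z ^ 2)⁻¹)
      (fun α g hg => (((h4 hg).pow 3).sub ((h6 hg).pow 2)).inv) fun z hz => ?_
    rw [Set.indicator_of_mem hz, Set.indicator_of_mem hz, eΔ]
  have h2 : TameF (unram.indicator e2) := by
    refine key (F := fun z => 6 * (-wide.indicator (iteratedDeriv 2 Jmod) z /
      ((2 * Real.pi * I) ^ 2 * unram.indicator eΔ z) + 2 / 3 * unram.indicator e4 z *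
        unram.indicator e6 z ^ 2 + unram.indicator e4 z ^ 4 / 2) / (unram.indicator e4 z ^ 2 *
          unram.indicator e6 z)) (fun α g hg => ((TameC.const 6).mul
        ((((hJ 2 (by norm_num) hg).neg.div ((TameC.const _).mul (hΔ hg))).add
          (((TameC.const _).mul (h4 hg)).mul ((h6 hg).pow 2))).add
            (((h4 hg).pow 4).div (TameC.const 2)))).div (((h4 hg).pow 2).mul (h6 hg)))
        fun z hz => ?_
    have hi := im_pos_of_wide hz.1
    have h0 : eΔ z ≠ 0 := inv_ne_zero (disc_ne_zero hi)
    rw [Set.indicator_of_mem hz, Set.indicator_of_mem hz, Set.indicator_of_mem hz,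
      Set.indicator_of_mem hz.1, deriv2_Jmod hi]
    obtain ⟨-, h4, h6⟩ := hz
    generalize 2 * (Real.pi : ℂ) * I = c at hk ⊢
    field_simp
    ring
  induction hf using Algebra.adjoin_induction with
  | mem f hf => rcases hf with rfl | rfl | rfl | rfl <;> assumption
  | algebraMap c => exact key (TameF.const c) fun z _ => rfl
  | add f g _ _ hf hg =>
    rw [Set.indicator_add']
    exact fun α g' hg' => (hf hg').add (hg hg')
  | mul f g _ _ hf hg =>
    rw [show f * g = fun z => f z * g z from rfl, Set.indicator_mul]
    exact fun α g' hg' => (hf hg').mul (hg hg')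

theorem isAn_iteratedDeriv {f : ℂ → ℂ} (hf : AnalyticAt ℂ f 0)
    (h : ∀ k, ∃ F, TameF F ∧ ∀ᶠ z in 𝓝[≠] 0, iteratedDeriv k f z = F z) (k : ℕ) :
    IsAn fun z : Unit → ℂ => iteratedDeriv k f (z ()) := by
  classical
  have ha : ∀ k, AnalyticAt ℂ (iteratedDeriv k f) 0 := fun k => by
    induction k with
    | zero => simpa using hf
    | succ k ih => rw [iteratedDeriv_succ]; exact ih.deriv
  have hp : Tendsto (fun z : Unit → ℂ => z ()) (𝓝 0) (𝓝 0) := by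
    have h := (continuous_apply ()).tendsto (0 : Unit → ℂ)
    exact h
  have hd : ∀ k, ∀ᶠ z : Unit → ℂ in 𝓝 0, HasFDerivAt (fun z : Unit → ℂ => iteratedDeriv k f (z ()))
      (iteratedDeriv (k + 1) f (z ()) • (ContinuousLinearMap.proj () : (Unit → ℂ) →L[ℂ] ℂ)) z := by
    intro k
    filter_upwards [hp.eventually (ha k).eventually_analyticAt] with z hz
    rw [iteratedDeriv_succ]
    exact HasDerivAt.comp_hasFDerivAt (f := fun z : Unit → ℂ => z ()) z
      hz.differentiableAt.hasDerivAt (hasFDerivAt_apply () z)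
  refine ⟨Set.range fun k => fun z : Unit → ℂ => iteratedDeriv k f (z ()), ?_, ⟨k, rfl⟩⟩
  rintro _ ⟨k, rfl⟩
  refine ⟨?_, (hd k).mono fun z hz => hz.differentiableAt, fun i => ⟨_, ⟨k + 1, rfl⟩, ?_⟩⟩
  · obtain ⟨F, hF, h⟩ := h k
    obtain ⟨ε, hε, h⟩ := Metric.eventually_nhds_iff.1 (eventually_nhdsWithin_iff.1 h)
    refine ⟨ε, hε, (TameC.ite (TPred.norm_lt TameC.cplx hε) (TameC.ite
      ((TameC.cplx ()).eq (TameC.const 0)) (TameC.const (iteratedDeriv k f 0)) (hF (TameC.cplx ())))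
      (TameC.const 0)).congr fun v => ?_⟩
    by_cases hv : ‖cplx v‖ < ε
    · rw [if_pos hv, if_pos hv]
      by_cases h0 : cplx v () = 0
      · rw [if_pos h0, ← h0]
      · rw [if_neg h0]
        exact h (by simpa using (norm_le_pi_norm (cplx v) ()).trans_lt hv) h0
    · rw [if_neg hv, if_neg hv]
  · filter_upwards [hd k] with z hz
    simp only [_root_.pd, hz.fderiv]
    simp

theorem isAn_Jmod {p : ℂ} (hp : p ∈ strip) (k : ℕ) :
    IsAn fun z : Unit → ℂ => iteratedDeriv k Jmod (z () + p) := by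
  have hp0 : Real.sqrt 3 / 2 ≤ p.im := hp.2
  have hw : ∀ᶠ z in 𝓝 p, z ∈ wide := by
    have hr : ∀ᶠ z : ℂ in 𝓝 p, |z.re| < 1 :=
      (continuous_abs.comp continuous_re).continuousAt.eventually_lt continuousAt_const
        (show |p.re| < 1 by linarith [hp.1])
    have hi : ∀ᶠ z : ℂ in 𝓝 p, 1 / 2 < z.im := by
      refine continuousAt_const.eventually_lt continuous_im.continuousAt ?_
      have : (1 : ℝ) < Real.sqrt 3 := by
        rw [Real.lt_sqrt] <;> norm_num
      linarith
    filter_upwards [hr, hi] with z h1 h2 using ⟨h1.le, h2⟩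
  have hpi : 0 < p.im := im_pos_of_wide hw.self_of_nhds
  have hu : ∀ᶠ z in 𝓝[≠] p, z ∈ unram := by
    filter_upwards [hw.filter_mono nhdsWithin_le_nhds,
      eventually_ne_zero_of_modAlg e4_mem tendsto_e4 hpi,
      eventually_ne_zero_of_modAlg e6_mem tendsto_e6 hpi] with z h1 h2 h3 using ⟨h1, h2, h3⟩
  have ht : Tendsto (fun z : ℂ => z + p) (𝓝 0) (𝓝 p) := by
    have h : Continuous fun z : ℂ => z + p := by fun_prop
    simpa using h.tendsto 0
  have hJ : AnalyticAt ℂ Jmod p := by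
    refine (DifferentiableOn.analyticOnNhd (fun z hz => ?_) isOpen_im_pos) p hpi
    have h := hasDerivAt_iteratedDeriv_Jmod 0 hz
    rw [iteratedDeriv_zero] at h
    exact h.differentiableAt.differentiableWithinAt
  have e : ∀ k z, iteratedDeriv k (fun z => Jmod (z + p)) z = iteratedDeriv k Jmod (z + p) :=
    fun k z => congrFun (iteratedDeriv_comp_add_const k Jmod p) z
  have := isAn_iteratedDeriv (f := fun z => Jmod (z + p)) (AnalyticAt.comp' (by simpa using hJ)
    (by fun_prop)) (fun k => ?_) k
  · simpa only [e] using this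
  obtain ⟨g, hg, h⟩ := iteratedDeriv_Jmod_mem k
  refine ⟨fun z => unram.indicator g (z + p), fun α g' hg' =>
    tameF_modAlg hg (hg'.add (TameC.const p)), ?_⟩
  have ht' : Tendsto (fun z : ℂ => z + p) (𝓝[≠] 0) (𝓝[≠] p) :=
    tendsto_nhdsWithin_iff.2 ⟨ht.mono_left nhdsWithin_le_nhds, by
      filter_upwards [self_mem_nhdsWithin] with z hz
      simpa using hz⟩
  filter_upwards [ht'.eventually hu] with z hz
  rw [e, Set.indicator_of_mem hz, h _ (im_pos_of_wide hz.1)]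

end ModularGerms

/-! ### The modular function at the cusp -/

section ModularCusp

open Filter
open Function.Periodic
open scoped Topology

theorem TameC.log {α : Type} {g : (α → ℝ) → ℂ} (hg : TameC g) : TameC fun x => Complex.log (g x) := by
  have hn : ∀ z : ℂ, z ≠ 0 → Real.exp (Real.log (Complex.normSq z) / 2) = ‖z‖ := fun z hz => by
    rw [Complex.normSq_eq_norm_sq, Real.log_pow, Nat.cast_ofNat, mul_div_cancel_left₀ _ two_ne_zero,
      Real.exp_log (norm_pos_iff.2 hz)]
  have h1 : Tame fun x => Complex.arg (g x) := by
    have hr : ∀ {β : Type} {g : (β → ℝ) → ℂ}, TameC g →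
        Tame fun x => Real.exp (Real.log (Complex.normSq (g x)) / 2) := fun {β g} hg =>
      ((hg.normSq.log.mul (Tame.const 2⁻¹)).exp).congr fun x => by rw [div_eq_mul_inv]
    have hθ : Tame fun y : α ⊕ Unit → ℝ => y (Sum.inr ()) := Tame.proj _
    refine Tame.of_unique_one (p := fun x θ => (g x = 0 ∧ θ = 0) ∨ (g x ≠ 0 ∧ (-Real.pi < θ ∧
      θ ≤ Real.pi) ∧ Real.exp (Real.log (Complex.normSq (g x)) / 2) *
        (if -Real.pi ≤ θ ∧ θ ≤ Real.pi then Real.cos θ else 0) = (g x).re ∧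
      Real.exp (Real.log (Complex.normSq (g x)) / 2) *
        (if -Real.pi ≤ θ ∧ θ ≤ Real.pi then Real.sin θ else 0) = (g x).im))
      (((hg.inl.eq (TameC.const 0)).and (TPred.eq hθ (Tame.const 0))).or
        ((hg.inl.eq (TameC.const 0)).not.and (((TPred.lt (Tame.const _) hθ).and
          (TPred.le hθ (Tame.const _))).and ((TPred.eq ((hr hg.inl).mul hθ.cosR) hg.inl.1).and
            (TPred.eq ((hr hg.inl).mul hθ.sinR) hg.inl.2))))) fun x θ => ?_
    by_cases h0 : g x = 0
    · simp [h0]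
    simp only [h0, false_and, false_or, not_false_eq_true, true_and, ne_eq, hn _ h0]
    constructor
    · rintro ⟨h1, h2, h3⟩
      rw [if_pos ⟨h1.1.le, h1.2⟩] at h2 h3
      rw [← arg_mul_cos_add_sin_mul_I (norm_pos_iff.2 h0) h1]
      congr 1
      apply Complex.ext
      · simpa [Complex.cos_ofReal_re, Complex.sin_ofReal_im] using h2
      · simpa [Complex.sin_ofReal_re] using h3
    · rintro rfl
      have h := arg_mem_Ioc (g x)
      refine ⟨h, ?_, ?_⟩ <;> rw [if_pos ⟨h.1.le, h.2⟩]
      · exact norm_mul_cos_arg _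
      · exact norm_mul_sin_arg _
  refine (TameC.mk' (hg.normSq.log.mul (Tame.const 2⁻¹)) h1).congr fun x => Complex.ext ?_ ?_
  · rw [log_re, Complex.normSq_eq_norm_sq, Real.log_pow]
    push_cast
    ring
  · rw [log_im]

theorem tendsto_invQParam : Tendsto (invQParam 1) (𝓝[≠] 0) (comap im atTop) :=
  invQParam_tendsto one_pos

theorem hasDerivAt_qParam (z : ℂ) :
    HasDerivAt (qParam 1) (2 * Real.pi * I * qParam 1 z) z := by
  have h : HasDerivAt (fun z : ℂ => 2 * Real.pi * I * z / (1 : ℝ)) (2 * Real.pi * I) z :=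
    (((hasDerivAt_id z).const_mul (2 * Real.pi * I : ℂ)).div_const ((1 : ℝ) : ℂ)).congr_deriv
      (by simp)
  exact h.cexp.congr_deriv (mul_comm _ _)

open scoped Classical in
/-- The modular function multiplied by the parameter at the cusp. -/
def qJ (z : ℂ) : ℂ := if 0 < z.im then qParam 1 z * Jmod z else 0

/-- The expansion of the modular function at the cusp, multiplied by the parameter. -/
def Jcusp : ℂ → ℂ := cuspFunction 1 qJ

theorem periodic_qJ : Function.Periodic qJ (1 : ℝ) := fun z => by
  have hq : qParam 1 (z + 1) = qParam 1 z := by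
    rw [qParam, qParam, ← Complex.exp_periodic (2 * Real.pi * I * z / (1 : ℝ))]
    congr 1
    simp
    ring
  rw [ofReal_one]
  by_cases hz : 0 < z.im
  · rw [qJ, qJ, if_pos (by simpa using hz), if_pos hz, hq]
    have := iteratedDeriv_Jmod_add_one 0 hz
    rw [iteratedDeriv_zero] at this
    rw [this]
  · rw [qJ, qJ, if_neg (by simpa using hz), if_neg hz]

theorem Jcusp_qParam {z : ℂ} (hz : 0 < z.im) : Jcusp (qParam 1 z) = qParam 1 z * Jmod z := by
  rw [Jcusp, eq_cuspFunction one_ne_zero periodic_qJ, qJ, if_pos hz]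

theorem differentiableAt_qJ {z : ℂ} (hz : 0 < z.im) : DifferentiableAt ℂ qJ z := by
  have h := hasDerivAt_iteratedDeriv_Jmod 0 hz
  rw [iteratedDeriv_zero] at h
  refine ((hasDerivAt_qParam z).mul h).differentiableAt.congr_of_eventuallyEq ?_
  filter_upwards [isOpen_im_pos.mem_nhds hz] with w hw
  rw [qJ, if_pos hw]
  rfl

theorem eventually_im_pos : ∀ᶠ z in comap im atTop, 0 < z.im :=
  tendsto_comap.eventually (eventually_gt_atTop 0)

theorem bounded_qJ : BoundedAtFilter (comap im atTop) qJ := by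
  have h1 := ((ModularForm.exp_isBigO_discriminant.comp_tendsto
    UpperHalfPlane.tendsto_comap_im_ofComplex).const_mul_right (c := 1728) (by norm_num))
  obtain ⟨c, hc⟩ := h1.bound
  have h2 := (tendsto_e4.pow 3).norm.eventually_le_const (show ‖(1 : ℂ) ^ 3‖ < 2 by norm_num)
  refine Asymptotics.IsBigO.of_bound (c * 2) ?_
  filter_upwards [eventually_im_pos, hc, h2] with z hz hc h2
  have hd := UpperHalfPlane.ofComplex_apply_of_im_pos hz
  have h3 := disc_eq ⟨z, hz⟩
  simp only [Function.comp_apply, hd, ← h3] at hc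
  have h4 := disc_ne_zero hz
  rw [qJ, if_pos hz, Jmod_eq hz, eΔ, norm_mul, norm_mul, norm_inv, norm_qParam]
  simp only [Pi.one_apply, norm_one, mul_one]
  have h5 : Real.exp (-2 * Real.pi * z.im / 1) ≤ c * ‖e4 z ^ 3 - e6 z ^ 2‖ := by
    rw [div_one]
    exact (le_abs_self _).trans hc
  have h6 := (Real.exp_pos _).le.trans h5
  calc _ ≤ c * ‖e4 z ^ 3 - e6 z ^ 2‖ * (2 * ‖e4 z ^ 3 - e6 z ^ 2‖⁻¹) := by gcongr
    _ = c * 2 := by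
      have := norm_ne_zero_iff.2 h4
      field_simp

theorem analyticOnNhd_Jcusp : AnalyticOnNhd ℂ Jcusp (Metric.ball 0 1) := by
  refine DifferentiableOn.analyticOnNhd (fun q hq => ?_) Metric.isOpen_ball
  refine DifferentiableAt.differentiableWithinAt ?_
  by_cases h0 : q = 0
  · subst h0
    exact differentiableAt_cuspFunction_zero one_pos periodic_qJ
      (eventually_im_pos.mono fun z hz => differentiableAt_qJ hz) bounded_qJ
  · have h1 := qParam_right_inv one_ne_zero h0
    rw [← h1]
    refine differentiableAt_cuspFunction one_ne_zero periodic_qJ (differentiableAt_qJ ?_)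
    rw [← norm_qParam_lt_iff one_pos, h1]
    simpa using hq

theorem hasDerivAt_Jcusp_qParam (k : ℕ) {z : ℂ} (hz : 0 < z.im) :
    HasDerivAt (fun z => iteratedDeriv k Jcusp (qParam 1 z))
      (iteratedDeriv (k + 1) Jcusp (qParam 1 z) * (2 * Real.pi * I * qParam 1 z)) z := by
  have ha : ∀ k, AnalyticOnNhd ℂ (iteratedDeriv k Jcusp) (Metric.ball 0 1) := fun k => by
    induction k with
    | zero => simpa using analyticOnNhd_Jcusp
    | succ k ih => rw [iteratedDeriv_succ]; exact ih.deriv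
  have hq : qParam 1 z ∈ Metric.ball (0 : ℂ) 1 := by simpa using norm_qParam_lt_one one_pos hz
  rw [iteratedDeriv_succ]
  exact (ha k _ hq).differentiableAt.hasDerivAt.comp z (hasDerivAt_qParam z)

theorem iteratedDeriv_Jcusp (k : ℕ) : ∃ m : ℕ, ∃ a ∈ modAlg, ∀ z : ℂ, 0 < z.im →
    iteratedDeriv k Jcusp (qParam 1 z) = qParam 1 z * (qParam 1 z)⁻¹ ^ m * a z := by
  have hκ : (2 * Real.pi * I : ℂ) ≠ 0 := two_pi_I_ne_zero
  induction k with
  | zero =>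
    obtain ⟨a, ha, h⟩ := iteratedDeriv_Jmod_mem 0
    refine ⟨0, a, ha, fun z hz => ?_⟩
    rw [← h z hz, iteratedDeriv_zero, iteratedDeriv_zero, Jcusp_qParam hz, pow_zero, mul_one]
  | succ k ih =>
    obtain ⟨m, a, ha, h⟩ := ih
    obtain ⟨b, hb, h'⟩ := modAlg_deriv ha
    refine ⟨m + 1, _, modAlg.add_mem (modAlg.smul_mem ha (1 - m))
      (modAlg.smul_mem hb (2 * Real.pi * I)⁻¹), fun z hz => ?_⟩
    have hq := qParam_ne_zero (h := 1) z
    have h1 := (((hasDerivAt_qParam z).mul (((hasDerivAt_qParam z).inv hq).pow m)).mul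
      (h' z hz)).congr_of_eventuallyEq (f₁ := fun z => iteratedDeriv k Jcusp (qParam 1 z))
      (by filter_upwards [isOpen_im_pos.mem_nhds hz] with w hw using h w hw)
    have h2 := (hasDerivAt_Jcusp_qParam k hz).unique h1
    refine mul_right_cancel₀ (mul_ne_zero hκ hq) (h2.trans ?_)
    simp only [Pi.add_apply, Pi.smul_apply, smul_eq_mul, Pi.inv_apply, Pi.mul_apply, Pi.pow_apply]
    generalize qParam 1 z = q at hq
    generalize 2 * (Real.pi : ℂ) * I = κ at hκ
    rcases m with _ | m
    · simp
      field_simp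
    · have h3 : q * q⁻¹ = 1 := mul_inv_cancel₀ hq
      have h4 : κ * κ⁻¹ = 1 := mul_inv_cancel₀ hκ
      rw [Nat.add_sub_cancel, div_eq_mul_inv, ← inv_pow]
      generalize q⁻¹ = u at h3
      generalize κ⁻¹ = v at h4
      push_cast
      linear_combination (-κ * a z * u ^ m * q * u - u ^ m * b z * q * u * κ * v) * h3 -
        u ^ m * b z * q * u * h4

theorem isAn_Jcusp (k : ℕ) : IsAn fun z : Unit → ℂ => iteratedDeriv k Jcusp (z ()) := by
  refine isAn_iteratedDeriv (analyticOnNhd_Jcusp 0 (by simp)) (fun k => ?_) k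
  obtain ⟨m, a, ha, h⟩ := iteratedDeriv_Jcusp k
  refine ⟨fun q => q * q⁻¹ ^ m * unram.indicator a (invQParam 1 q), fun α g hg =>
    (hg.mul (hg.inv.pow m)).mul (tameF_modAlg ha ((TameC.const _).mul hg.log)), ?_⟩
  have h1 : ∀ᶠ z : ℂ in comap im atTop, 1 / 2 < z.im ∧ e4 z ≠ 0 ∧ e6 z ≠ 0 :=
    (tendsto_comap.eventually (eventually_gt_atTop (1 / 2))).and
      ((tendsto_e4.eventually_ne one_ne_zero).and (tendsto_e6.eventually_ne one_ne_zero))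
  filter_upwards [tendsto_invQParam.eventually h1, self_mem_nhdsWithin] with q hq h0
  have h2 : invQParam 1 q ∈ unram := by
    refine ⟨⟨?_, hq.1⟩, hq.2⟩
    have h3 : (invQParam 1 q).re = arg q / (2 * Real.pi) := by
      rw [invQParam, ofReal_one, show (1 : ℂ) / (2 * Real.pi * I) * Complex.log q =
        ((1 / (2 * Real.pi) : ℝ) : ℂ) * (-I * Complex.log q) by
          push_cast; field_simp; simp, re_ofReal_mul]
      simp [log_im]
      ring
    rw [h3, abs_div, abs_of_pos Real.two_pi_pos, div_le_one Real.two_pi_pos]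
    linarith [abs_arg_le_pi q, Real.pi_pos]
  have h4 := h _ (im_pos_of_wide h2.1)
  rw [qParam_right_inv one_ne_zero h0] at h4
  rw [Set.indicator_of_mem h2, h4]

theorem Jmod_eq_Jcusp {z : ℂ} (hz : 0 < z.im) : Jmod z = (qParam 1 z)⁻¹ * Jcusp (qParam 1 z) := by
  rw [Jcusp_qParam hz, inv_mul_cancel_left₀ (qParam_ne_zero z)]

theorem deriv_Jmod_eq_Jcusp {z : ℂ} (hz : 0 < z.im) : iteratedDeriv 1 Jmod z =
    2 * Real.pi * I * (iteratedDeriv 1 Jcusp (qParam 1 z) -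
      (qParam 1 z)⁻¹ * Jcusp (qParam 1 z)) := by
  have hq := qParam_ne_zero (h := 1) z
  have h := hasDerivAt_Jcusp_qParam 0 hz
  have h1 := ((hasDerivAt_qParam z).inv hq).mul h
  have h2 := hasDerivAt_iteratedDeriv_Jmod 0 hz
  simp only [iteratedDeriv_zero, zero_add] at h1 h2
  have h3 := h2.unique (h1.congr_of_eventuallyEq (by
    filter_upwards [isOpen_im_pos.mem_nhds hz] with w hw using Jmod_eq_Jcusp hw))
  rw [h3, Pi.inv_apply]
  field_simp
  ring

theorem deriv2_Jmod_eq_Jcusp {z : ℂ} (hz : 0 < z.im) : iteratedDeriv 2 Jmod z =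
    (2 * Real.pi * I) ^ 2 * (qParam 1 z * iteratedDeriv 2 Jcusp (qParam 1 z) -
      iteratedDeriv 1 Jcusp (qParam 1 z) + (qParam 1 z)⁻¹ * Jcusp (qParam 1 z)) := by
  have hq := qParam_ne_zero (h := 1) z
  have h0 := hasDerivAt_Jcusp_qParam 0 hz
  have h1 := ((hasDerivAt_Jcusp_qParam 1 hz).sub
    (((hasDerivAt_qParam z).inv hq).mul h0)).const_mul (2 * Real.pi * I)
  have h2 := hasDerivAt_iteratedDeriv_Jmod 1 hz
  simp only [iteratedDeriv_zero, zero_add, one_add_one_eq_two] at h1 h2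
  have h3 := h2.unique (h1.congr_of_eventuallyEq (by
    filter_upwards [isOpen_im_pos.mem_nhds hz] with w hw using deriv_Jmod_eq_Jcusp hw))
  rw [h3, Pi.inv_apply]
  field_simp
  ring

end ModularCusp

/-! ### Quantifier-free formulas over good fields -/

section QuantifierFree

open Filter FirstOrder.Language
open scoped Topology

variable {α : Type} {l : Filter (α → ℝ)} {C : Set ((α → ℝ) → ℂ)}

namespace ExpLogGood

theorem jmod_mem (hC : ExpLogGood l C) {f g : (α → ℝ) → ℝ} (hf : (fun x => (f x : ℂ)) ∈ C)
    (hg : (fun x => (g x : ℂ)) ∈ C) (h : ∀ᶠ x in l, |f x| ≤ 1 / 2 ∧ Real.sqrt 3 / 2 ≤ g x)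
    (k : Fin 3) : (fun x => iteratedDeriv k Jmod (f x + g x * I)) ∈ C := by
  have := hC.neBot
  have hz : (fun x => (f x + g x * I : ℂ)) ∈ C := hC.add hf (hC.mul hg (hC.const I))
  have him : ∀ x, (f x + g x * I : ℂ).im = g x := fun x => by simp
  obtain ⟨p₁, h1⟩ : ∃ r, Tendsto f l (𝓝 r) := by
    rcases hC.real_trichotomy hf with h1 | h1 | h1
    · exact h1
    · obtain ⟨x, hx⟩ := (h.and (h1.eventually (eventually_gt_atTop (1 / 2)))).exists
      exact absurd (abs_le.1 hx.1.1).2 hx.2.not_ge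
    · obtain ⟨x, hx⟩ := (h.and (h1.eventually (eventually_lt_atBot (-(1 / 2))))).exists
      exact absurd (abs_le.1 hx.1.1).1 hx.2.not_ge
  rcases hC.real_trichotomy hg with ⟨p₂, h2⟩ | h2 | h2
  · have hp : (p₁ + p₂ * I : ℂ) ∈ strip := by
      constructor
      · simpa using le_of_tendsto h1.abs (h.mono fun x hx => hx.1)
      · simpa using ge_of_tendsto h2 (h.mono fun x hx => hx.2)
    have h3 : Tendsto (fun x => (f x + g x * I : ℂ)) l (𝓝 (p₁ + p₂ * I)) :=
      ((continuous_ofReal.tendsto _).comp h1).add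
        (((continuous_ofReal.tendsto _).comp h2).mul_const I)
    have h4 := hC.an (isAn_Jmod hp k) (e := fun _ x => (f x + g x * I : ℂ) - (p₁ + p₂ * I))
      (fun _ => hC.sub hz (hC.const _)) fun _ => by simpa using h3.sub_const (p₁ + p₂ * I : ℂ)
    simpa using h4
  · have h3 : Tendsto (fun x => (f x + g x * I : ℂ)) l (comap im atTop) :=
      tendsto_comap_iff.2 (h2.congr fun x => (him x).symm)
    have hq0 := (Function.Periodic.qParam_tendsto one_pos).comp h3
    have hq : (fun x => Function.Periodic.qParam 1 (f x + g x * I : ℂ)) ∈ C := by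
      have h4 := hC.exp_mem_of_tendsto (hC.mul (hC.const (2 * Real.pi * I)) hf)
        (((continuous_ofReal.tendsto _).comp h1).const_mul _)
      have h5 := hC.exp (hC.real_mul (hC.real_const (-2 * Real.pi)) hg)
      refine hC.congr (hC.mul h4 h5) (Eventually.of_forall fun x => ?_)
      simp only [ofReal_exp, ← Complex.exp_add, Function.Periodic.qParam]
      congr 1
      push_cast
      linear_combination (-2 * Real.pi * g x) * I_sq
    have hH : ∀ k, (fun x => iteratedDeriv k Jcusp
        (Function.Periodic.qParam 1 (f x + g x * I : ℂ))) ∈ C := fun k =>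
      hC.an (isAn_Jcusp k) (fun _ => hq) fun _ => hq0.mono_right nhdsWithin_le_nhds
    have hpos : ∀ᶠ x in l, 0 < (f x + g x * I : ℂ).im := by
      simpa only [him] using h2.eventually (eventually_gt_atTop 0)
    have h0 := hC.mul (hC.inv hq) (hH 0)
    have hc := hC.const (2 * Real.pi * I)
    simp only [iteratedDeriv_zero] at h0
    fin_cases k
    · refine hC.congr h0 (hpos.mono fun x hx => ?_)
      simp [Jmod_eq_Jcusp hx]
    · exact hC.congr (hC.mul hc (hC.sub (hH 1) h0))
        (hpos.mono fun x hx => (deriv_Jmod_eq_Jcusp hx).symm)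
    · exact hC.congr (hC.mul (hC.pow hc 2) (hC.add (hC.sub (hC.mul hq (hH 2)) (hH 1)) h0))
        (hpos.mono fun x hx => (deriv2_Jmod_eq_Jcusp hx).symm)
  · obtain ⟨x, hx⟩ := (h.and (h2.eventually (eventually_lt_atBot 0))).exists
    have : 0 ≤ Real.sqrt 3 / 2 := by positivity
    exact absurd (this.trans hx.1.2) hx.2.not_ge

theorem decided_lt (hC : ExpLogGood l C) {f g : (α → ℝ) → ℝ} (hf : (fun x => (f x : ℂ)) ∈ C)
    (hg : (fun x => (g x : ℂ)) ∈ C) : (∀ᶠ x in l, f x < g x) ∨ ∀ᶠ x in l, g x ≤ f x := by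
  rcases hC.sign (hC.real_sub hg hf) with h | h | h
  · exact Or.inr (h.mono fun x hx => (sub_eq_zero.1 hx).le)
  · exact Or.inl (h.mono fun x hx => sub_pos.1 hx)
  · exact Or.inr (h.mono fun x hx => (sub_neg.1 hx).le)

theorem ite_mem (hC : ExpLogGood l C) {p : (α → ℝ) → Prop} [∀ x, Decidable (p x)]
    {f : (α → ℝ) → ℝ} (hp : (∀ᶠ x in l, p x) ∨ ∀ᶠ x in l, ¬ p x)
    (hf : (∀ᶠ x in l, p x) → (fun x => (f x : ℂ)) ∈ C) :
    (fun x => ((if p x then f x else 0 : ℝ) : ℂ)) ∈ C := by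
  rcases hp with h | h
  · exact hC.congr (hf h) (h.mono fun x hx => by simp [hx])
  · exact hC.congr (hC.const 0) (h.mono fun x hx => by simp [hx])

theorem decided_and {p q : (α → ℝ) → Prop} (hp : (∀ᶠ x in l, p x) ∨ ∀ᶠ x in l, ¬ p x)
    (hq : (∀ᶠ x in l, q x) ∨ ∀ᶠ x in l, ¬ q x) :
    (∀ᶠ x in l, p x ∧ q x) ∨ ∀ᶠ x in l, ¬ (p x ∧ q x) := by
  rcases hp with hp | hp
  · rcases hq with hq | hq
    · exact Or.inl (hp.and hq)
    · exact Or.inr (hq.mono fun x hx h => hx h.2)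
  · exact Or.inr (hp.mono fun x hx h => hx h.1)

theorem decided_le (hC : ExpLogGood l C) {f g : (α → ℝ) → ℝ} (hf : (fun x => (f x : ℂ)) ∈ C)
    (hg : (fun x => (g x : ℂ)) ∈ C) : (∀ᶠ x in l, f x ≤ g x) ∨ ∀ᶠ x in l, ¬ f x ≤ g x := by
  simpa only [not_le] using (hC.decided_lt hg hf).symm

theorem exp_I_mem (hC : ExpLogGood l C) {f : (α → ℝ) → ℝ} (hf : (fun x => (f x : ℂ)) ∈ C)
    (h : ∀ᶠ x in l, -Real.pi ≤ f x ∧ f x ≤ Real.pi) : (fun x => Complex.exp (f x * I)) ∈ C := by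
  have := hC.neBot
  rcases hC.real_trichotomy hf with ⟨r, h1⟩ | h1 | h1
  · exact hC.exp_mem_of_tendsto (hC.mul hf (hC.const I))
      (((continuous_ofReal.tendsto _).comp h1).mul_const I)
  · obtain ⟨x, hx⟩ := (h.and (h1.eventually (eventually_gt_atTop Real.pi))).exists
    exact absurd hx.1.2 hx.2.not_ge
  · obtain ⟨x, hx⟩ := (h.and (h1.eventually (eventually_lt_atBot (-Real.pi)))).exists
    exact absurd hx.1.1 hx.2.not_ge

theorem funMap_mem (hC : ExpLogGood l C) {n : ℕ} (F : LJ.Functions n) {g : Fin n → (α → ℝ) → ℝ}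
    (hg : ∀ k, (fun x => (g k x : ℂ)) ∈ C) :
    (fun x => ((Structure.funMap F fun k => g k x : ℝ) : ℂ)) ∈ C := by
  match n, F with
  | 0, r => exact hC.real_const r
  | 1, Sum.inl _ => exact (hC.neg (hg 0) |> (hC.congr · (Eventually.of_forall fun x =>
      (ofReal_neg _).symm)))
  | 1, Sum.inr c =>
    have hd := decided_and (hC.decided_le (hC.real_const (-Real.pi)) (hg 0))
      (hC.decided_le (hg 0) (hC.real_const Real.pi))
    fin_cases c
    · refine hC.ite_mem hd fun h => ?_
      exact hC.congr (hC.im_mem (hC.exp_I_mem (hg 0) h)) (Eventually.of_forall fun x => by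
        simp only [exp_ofReal_mul_I_im])
    · refine hC.ite_mem hd fun h => ?_
      exact hC.congr (hC.re_mem (hC.exp_I_mem (hg 0) h)) (Eventually.of_forall fun x => by
        simp only [exp_ofReal_mul_I_re])
    · exact hC.exp (hg 0)
  | 2, Sum.inl c =>
    fin_cases c
    · exact hC.real_add (hg 0) (hg 1)
    · exact hC.real_mul (hg 0) (hg 1)
  | 2, Sum.inr (k, b) =>
    have ha : (fun x => ((|g 0 x| : ℝ) : ℂ)) ∈ C := by simpa using hC.norm_mem (hg 0)
    have hd := decided_and (hC.decided_le ha (hC.real_const (1 / 2)))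
      (hC.decided_le (hC.real_const (Real.sqrt 3 / 2)) (hg 1))
    cases b
    · exact hC.ite_mem hd fun h => hC.im_mem (hC.jmod_mem (hg 0) (hg 1) h k)
    · exact hC.ite_mem hd fun h => hC.re_mem (hC.jmod_mem (hg 0) (hg 1) h k)
  | _ + 3, e => exact e.elim

theorem term_mem (hC : ExpLogGood l C) {β : Type} (t : LJ.Term β) {v : β → (α → ℝ) → ℝ}
    (hv : ∀ b, (fun x => (v b x : ℂ)) ∈ C) :
    (fun x => ((t.realize fun b => v b x : ℝ) : ℂ)) ∈ C := by
  induction t with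
  | var b => exact hv b
  | func F ts ih => exact hC.funMap_mem F ih

theorem decided_qf (hC : ExpLogGood l C) {β : Type} {n : ℕ} {φ : LJ.BoundedFormula β n}
    (hφ : φ.IsQF) {v : β → (α → ℝ) → ℝ} (hv : ∀ b, (fun x => (v b x : ℂ)) ∈ C)
    {w : Fin n → (α → ℝ) → ℝ} (hw : ∀ b, (fun x => (w b x : ℂ)) ∈ C) :
    (∀ᶠ x in l, φ.Realize (fun b => v b x) fun b => w b x) ∨
      ∀ᶠ x in l, ¬ φ.Realize (fun b => v b x) fun b => w b x := by
  induction hφ with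
  | falsum => exact Or.inr (Eventually.of_forall fun x => id)
  | of_isAtomic h =>
    have ht : ∀ t : LJ.Term (β ⊕ Fin n), (fun x =>
        ((t.realize (Sum.elim (fun b => v b x) fun b => w b x) : ℝ) : ℂ)) ∈ C := fun t => by
      have := hC.term_mem t (v := Sum.elim v w) (Sum.rec hv hw)
      convert this using 5 with x b
      cases b <;> rfl
    cases h with
    | equal t s =>
      simp only [BoundedFormula.realize_bdEqual]
      simpa [sub_eq_zero] using hC.real_zero_or (hC.real_sub (ht t) (ht s))
    | @rel m R ts =>
      match m, R with
      | 0, e => exact e.elim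
      | 1, e => exact e.elim
      | 2, _ =>
        simp only [BoundedFormula.realize_rel]
        exact (hC.decided_lt (ht (ts 0)) (ht (ts 1))).imp_right fun h => h.mono fun x hx =>
          hx.not_gt
      | _ + 3, e => exact e.elim
  | imp _ _ ih1 ih2 =>
    rcases ih1 with h1 | h1
    · rcases ih2 with h2 | h2
      · exact Or.inl (h2.mono fun x hx _ => hx)
      · exact Or.inr ((h1.and h2).mono fun x hx h => hx.2 (h hx.1))
    · exact Or.inl (h1.mono fun x hx h => absurd h hx)

end ExpLogGood

end QuantifierFree

/-! ### Adjoining a coordinate -/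

section Coordinates

open Filter Function
open scoped Topology

variable {α : Type} {l l' : Filter (α → ℝ)} {C : Set ((α → ℝ) → ℂ)}

theorem ExpLogGood.pure_univ (x : α → ℝ) : ExpLogGood (pure x) Set.univ :=
  { toGood := PreGood.good
      { neBot := inferInstance
        const := fun _ => trivial
        add := fun _ _ => trivial
        mul := fun _ _ => trivial
        inv := fun _ => trivial
        conj := fun _ => trivial
        congr := fun _ _ => trivial
        zero_or := fun {f} _ => by simpa using em (f x = 0)
        lim_or := fun {f} _ => Or.inl ⟨f x, tendsto_pure_nhds f x⟩
        nthRoot := fun {n f} hn _ => by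
          obtain ⟨z, hz⟩ := IsAlgClosed.exists_pow_nat_eq (f x) hn
          exact ⟨fun _ => z, trivial, by simpa using hz⟩
        an := fun _ _ _ _ => trivial
        tame := fun {f} _ => ⟨fun _ => f x, TameC.const _, by
          simp [EventuallyEq]⟩ }
    log := fun _ => trivial
    exp := fun _ => trivial }

/-- Germs obtained by composition with a map between the domains. -/
def comapGerms (l' : Filter (α → ℝ)) (π : (α → ℝ) → α → ℝ) (C : Set ((α → ℝ) → ℂ)) :
    Set ((α → ℝ) → ℂ) :=
  {g | ∃ f ∈ C, g =ᶠ[l'] fun x => f (π x)}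

theorem comapGerms_real (hC : Good l C) {π : (α → ℝ) → α → ℝ} {c : (α → ℝ) → ℝ}
    (hc : (fun x => (c x : ℂ)) ∈ comapGerms l' π C) :
    ∃ f : (α → ℝ) → ℝ, (fun x => (f x : ℂ)) ∈ C ∧ c =ᶠ[l'] fun x => f (π x) := by
  obtain ⟨f, hf, h⟩ := hc
  refine ⟨fun x => (f x).re, hC.re_mem hf, ?_⟩
  filter_upwards [h] with x hx
  rw [← hx, ofReal_re]

theorem ExpLogGood.comap [Finite α] (hC : ExpLogGood l C) [hl' : l'.NeBot]
    {π : (α → ℝ) → α → ℝ} (hπ : Tendsto π l' l) (ht : ∀ a, Tame fun x => π x a) :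
    ExpLogGood l' (comapGerms l' π C) :=
  { toGood := PreGood.good
      { neBot := hl'
        const := fun c => ⟨_, hC.const c, EventuallyEq.rfl⟩
        add := by
          rintro f g ⟨f', hf, h⟩ ⟨g', hg, h'⟩
          exact ⟨_, hC.add hf hg, by filter_upwards [h, h'] with x h h'; rw [h, h']⟩
        mul := by
          rintro f g ⟨f', hf, h⟩ ⟨g', hg, h'⟩
          exact ⟨_, hC.mul hf hg, by filter_upwards [h, h'] with x h h'; rw [h, h']⟩
        inv := by
          rintro f ⟨f', hf, h⟩
          exact ⟨_, hC.inv hf, by filter_upwards [h] with x h; rw [h]⟩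
        conj := by
          rintro f ⟨f', hf, h⟩
          exact ⟨_, hC.conj hf, by filter_upwards [h] with x h; rw [h]⟩
        congr := by
          rintro f g ⟨f', hf, h⟩ hfg
          exact ⟨_, hf, hfg.symm.trans h⟩
        zero_or := by
          rintro f ⟨f', hf, h⟩
          refine (hC.zero_or hf).imp (fun h1 => ?_) fun h1 => ?_ <;>
            filter_upwards [h, hπ.eventually h1] with x h h1 <;> rwa [h]
        lim_or := by
          rintro f ⟨f', hf, h⟩
          exact (hC.lim_or hf).imp (fun ⟨c, hc⟩ => ⟨c, (hc.comp hπ).congr' h.symm⟩)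
            fun ⟨c, hc⟩ => ⟨c, (hc.comp hπ).congr' (h.symm.fun_comp (·⁻¹))⟩
        nthRoot := by
          rintro n f hn ⟨f', hf, h⟩
          obtain ⟨z, hz, h1⟩ := hC.nthRoot hn hf
          refine ⟨_, ⟨z, hz, EventuallyEq.rfl⟩, ?_⟩
          filter_upwards [h, hπ.eventually h1] with x h h1
          rwa [h]
        an := by
          intro κ _ F hF e he he0
          choose e' he' h using he
          have h0 : ∀ k, Tendsto (e' k) l (𝓝 0) := fun k => by
            rcases hC.lim_or_inv_zero (he' k) with ⟨c, hc⟩ | hc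
            · rwa [tendsto_nhds_unique (he0 k) ((hc.comp hπ).congr' (h k).symm)]
            · have h1 := (hc.comp hπ).mul ((he0 k).congr' (h k))
              rw [mul_zero] at h1
              rcases hC.zero_or (he' k) with h2 | h2
              · exact tendsto_const_nhds.congr' (h2.mono fun x hx => hx.symm)
              · refine absurd (tendsto_nhds_unique (tendsto_const_nhds.congr' ?_) h1)
                  (one_ne_zero (α := ℂ))
                filter_upwards [hπ.eventually h2] with x hx
                exact (inv_mul_cancel₀ hx).symm
          refine ⟨_, hC.an hF he' h0, ?_⟩
          filter_upwards [eventually_all.2 h] with x hx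
          simp only [hx]
        tame := by
          rintro f ⟨f', hf, h⟩
          obtain ⟨g, hg, h1⟩ := hC.tame hf
          exact ⟨_, ⟨hg.1.comp ht, hg.2.comp ht⟩, h.trans (hπ.eventually h1)⟩ }
    log := by
      rintro f ⟨f', hf, h⟩
      exact ⟨_, hC.log hf, by filter_upwards [h] with x h; rw [h]⟩
    exp := by
      intro f hf
      obtain ⟨f', hf', h⟩ := comapGerms_real hC.toGood hf
      exact ⟨_, hC.exp hf', by filter_upwards [h] with x h; rw [h]⟩ }

/-- Real elements realizing a finite part of a cut. -/
theorem ExpLogGood.exists_between (hC : ExpLogGood l C) {L U : ((α → ℝ) → ℝ) → Prop}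
    (hLU : ∀ f g, L f → U g → ∀ᶠ x in l, f x < g x) {s t : Set ((α → ℝ) → ℝ)}
    (hs : s.Finite) (ht : t.Finite) (hsL : ∀ f ∈ s, (fun x => (f x : ℂ)) ∈ C ∧ L f)
    (htU : ∀ g ∈ t, (fun x => (g x : ℂ)) ∈ C ∧ U g) :
    ∃ h : (α → ℝ) → ℝ, (fun x => (h x : ℂ)) ∈ C ∧ (∀ f ∈ s, ∀ᶠ x in l, f x < h x) ∧
      ∀ g ∈ t, ∀ᶠ x in l, h x < g x := by
  have hle : ∀ {f g : (α → ℝ) → ℝ}, (fun x => (f x : ℂ)) ∈ C → (fun x => (g x : ℂ)) ∈ C →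
      ((∀ᶠ x in l, f x ≤ g x) → ∀ᶠ x in l, g x ≤ f x) → ∀ᶠ x in l, g x ≤ f x := fun hf hg h =>
    (hC.decided_lt hf hg).elim (fun h1 => h (h1.mono fun x => le_of_lt)) id
  have hmax : s.Nonempty → ∃ f ∈ s, ∀ f' ∈ s, ∀ᶠ x in l, f' x ≤ f x := fun hne => by
    obtain ⟨f, hf, h⟩ := hs.exists_maximalFor (fun f : (α → ℝ) → ℝ => (f : l.Germ ℝ)) s hne
    exact ⟨f, hf, fun f' hf' => hle (hsL f hf).1 (hsL f' hf').1 fun h1 =>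
      Germ.coe_le.1 (h hf' (Germ.coe_le.2 h1))⟩
  have hmin : t.Nonempty → ∃ g ∈ t, ∀ g' ∈ t, ∀ᶠ x in l, g x ≤ g' x := fun hne => by
    obtain ⟨g, hg, h⟩ := ht.exists_minimalFor (fun f : (α → ℝ) → ℝ => (f : l.Germ ℝ)) t hne
    exact ⟨g, hg, fun g' hg' => hle (htU g' hg').1 (htU g hg).1 fun h1 =>
      Germ.coe_le.1 (h hg' (Germ.coe_le.2 h1))⟩
  rcases s.eq_empty_or_nonempty with rfl | hs'
  · rcases t.eq_empty_or_nonempty with rfl | ht'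
    · exact ⟨_, hC.real_const 0, by simp, by simp⟩
    · obtain ⟨g, hg, h⟩ := hmin ht'
      refine ⟨_, hC.real_sub (htU g hg).1 (hC.real_const 1), by simp, fun g' hg' => ?_⟩
      filter_upwards [h g' hg'] with x hx
      linarith
  · obtain ⟨f, hf, h⟩ := hmax hs'
    rcases t.eq_empty_or_nonempty with rfl | ht'
    · refine ⟨_, hC.real_add (hsL f hf).1 (hC.real_const 1), fun f' hf' => ?_, by simp⟩
      filter_upwards [h f' hf'] with x hx
      linarith
    · obtain ⟨g, hg, h'⟩ := hmin ht'
      have hfg := hLU f g (hsL f hf).2 (htU g hg).2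
      refine ⟨_, hC.real_mul (hC.real_add (hsL f hf).1 (htU g hg).1) (hC.real_const (1 / 2)),
        fun f' hf' => ?_, fun g' hg' => ?_⟩
      · filter_upwards [h f' hf', hfg] with x hx hx'
        linarith
      · filter_upwards [h' g' hg', hfg] with x hx hx'
        linarith

variable [DecidableEq α]

/-- The filter `l'` is obtained from `l` by adjoining the coordinate `d`. -/
def Adjoins (l : Filter (α → ℝ)) (d : α) (l' : Filter (α → ℝ)) : Prop :=
  ∀ S ∈ l', ∃ T ∈ l, ∃ h, Tame h ∧ ∀ x ∈ T, update x d (h x) ∈ S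

theorem tame_update [Finite α] {β : Type} {F : (β → ℝ) → α → ℝ} (hF : ∀ a, Tame fun x => F x a)
    (d : α) {h : (α → ℝ) → ℝ} (hh : Tame h) (a : α) :
    Tame fun x => update (F x) d (h (F x)) a := by
  by_cases ha : a = d
  · subst ha
    simpa using hh.comp hF
  · simpa [ha] using hF a

theorem ExpLogGood.exists_adjoins [Finite α] (hC : ExpLogGood l C) {d : α}
    (hd : ∀ᶠ x in l, x d = 0) (V : Ultrafilter (α → ℝ))
    (hV : Tendsto (fun x : α → ℝ => update x d 0) V l) :
    ∃ l' D, (V : Filter (α → ℝ)) ≤ l' ∧ ExpLogGood l' D ∧ Adjoins l d l' ∧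
      (fun x => (x d : ℂ)) ∈ D ∧ Tendsto (fun x : α → ℝ => update x d 0) l' l ∧
      ∀ f ∈ C, (fun x => f (update x d 0)) ∈ D := by
  have hπ0 : ∀ᶠ x in l, update x d 0 = x := hd.mono fun x hx => by rw [← hx, update_eq_self]
  have hπt : ∀ a, Tame fun x : α → ℝ => update x d 0 a :=
    tame_update (fun a => Tame.proj a) d (Tame.const 0)
  have := hC.neBot
  by_cases hcase : ∃ f : (α → ℝ) → ℝ, (fun x => (f x : ℂ)) ∈ C ∧
      ∀ᶠ x in (V : Filter (α → ℝ)), x d = f (update x d 0)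
  · obtain ⟨f, hf, h⟩ := hcase
    have hπ : Tendsto (fun x : α → ℝ => update x d 0) (l.map fun x => update x d (f x)) l := by
      rw [tendsto_map'_iff]
      exact tendsto_id.congr' (hπ0.mono fun x hx => by simp [hx])
    refine ⟨l.map fun x => update x d (f x), _, fun S hS => ?_, hC.comap hπ hπt, fun S hS => ?_,
      ⟨_, hf, ?_⟩, hπ, fun g hg => ⟨g, hg, EventuallyEq.rfl⟩⟩
    · filter_upwards [hV hS, h] with x hx h'
      simpa [← h'] using hx
    · obtain ⟨g, hg, h1⟩ := hC.tame hf
      refine ⟨_, inter_mem hS h1, fun x => (g x).re, hg.1, fun x hx => ?_⟩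
      have h2 : (f x : ℂ) = g x := hx.2
      simp only [← h2, ofReal_re]
      exact hx.1
    · rw [EventuallyEq, eventually_map]
      filter_upwards [hπ0] with x hx
      simp [hx]
  · push Not at hcase
    let L : ((α → ℝ) → ℝ) → Prop := fun f => ∀ᶠ x in (V : Filter (α → ℝ)), f (update x d 0) < x d
    let U : ((α → ℝ) → ℝ) → Prop := fun f => ∀ᶠ x in (V : Filter (α → ℝ)), x d < f (update x d 0)
    have hLU : ∀ f, (fun x => (f x : ℂ)) ∈ C → L f ∨ U f := fun f hf => by
      rw [← Ultrafilter.eventually_or]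
      exact (hcase f hf).mono fun x hx => (lt_or_gt_of_ne hx).symm
    let A : {f : (α → ℝ) → ℝ // (fun x => (f x : ℂ)) ∈ C ∧ L f} → Set (α → ℝ) := fun f =>
      {x | f.1 (update x d 0) < x d}
    let B : {f : (α → ℝ) → ℝ // (fun x => (f x : ℂ)) ∈ C ∧ U f} → Set (α → ℝ) := fun f =>
      {x | x d < f.1 (update x d 0)}
    let l' := l.comap (fun x : α → ℝ => update x d 0) ⊓ ((⨅ f, 𝓟 (A f)) ⊓ ⨅ f, 𝓟 (B f))
    have hVl : (V : Filter (α → ℝ)) ≤ l' := le_inf hV.le_comap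
      (le_inf (le_iInf fun f => le_principal_iff.2 f.2.2) (le_iInf fun f =>
        le_principal_iff.2 f.2.2))
    haveI : l'.NeBot := NeBot.mono V.neBot hVl
    have hπ : Tendsto (fun x : α → ℝ => update x d 0) l' l := tendsto_comap.mono_left inf_le_left
    have hdec : Decided l' (comapGerms l' (fun x : α → ℝ => update x d 0) C) fun x => x d := by
      refine ⟨⟨_, Tame.proj d, EventuallyEq.rfl⟩, fun {c} hc => ?_⟩
      obtain ⟨f, hf, h⟩ := comapGerms_real hC.toGood hc
      rcases hLU f hf with h1 | h1
      · have h2 : A ⟨f, hf, h1⟩ ∈ l' :=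
          mem_inf_of_right (mem_inf_of_left (mem_iInf_of_mem _ (mem_principal_self _)))
        refine Or.inr (Or.inr ?_)
        filter_upwards [h, h2] with x h h2
        rw [h]
        exact h2
      · have h2 : B ⟨f, hf, h1⟩ ∈ l' :=
          mem_inf_of_right (mem_inf_of_right (mem_iInf_of_mem _ (mem_principal_self _)))
        refine Or.inl ?_
        filter_upwards [h, h2] with x h h2
        rw [h]
        exact h2
    obtain ⟨D, hCD, hD, hdD⟩ := hdec.exists_expLogGood (hC.comap hπ hπt)
    refine ⟨l', D, hVl, hD, fun S hS => ?_, hdD, hπ, fun g hg => hCD ⟨g, hg, EventuallyEq.rfl⟩⟩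
    obtain ⟨⟨T, s, t⟩, ⟨hT, hs, ht⟩, hS⟩ := (((basis_sets l).comap _).inf
      ((hasBasis_iInf_principal_finite A).inf (hasBasis_iInf_principal_finite B))).mem_iff.1 hS
    obtain ⟨h, hh, h1, h2⟩ := hC.exists_between (L := fun f => (fun x => (f x : ℂ)) ∈ C ∧ L f)
      (U := fun f => (fun x => (f x : ℂ)) ∈ C ∧ U f) (fun f g hf hg => by
        rcases hC.decided_lt hf.1 hg.1 with h | h
        · exact h
        · obtain ⟨x, ⟨hx, hx'⟩, hx''⟩ := ((hf.2.and hg.2).and (hV.eventually h)).exists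
          exact absurd (hx.trans hx') hx''.not_gt) (hs.image Subtype.val) (ht.image Subtype.val)
      (by rintro _ ⟨f, hf, rfl⟩; exact ⟨f.2.1, f.2⟩) (by rintro _ ⟨f, hf, rfl⟩; exact ⟨f.2.1, f.2⟩)
    simp only [Set.forall_mem_image] at h1 h2
    obtain ⟨g, hg, h3⟩ := hC.tame hh
    refine ⟨_, inter_mem hT (inter_mem ((eventually_all_finite hs).2 h1)
      (inter_mem ((eventually_all_finite ht).2 h2) (inter_mem h3 hπ0))), fun x => (g x).re, hg.1,
      fun x ⟨hxT, hx1, hx2, hx3, hx4⟩ => hS ?_⟩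
    have h5 : h x = (g x).re := by rw [← show (h x : ℂ) = g x from hx3, ofReal_re]
    have h6 : update x d 0 = x := hx4
    simp only [← h5]
    refine ⟨?_, ?_, ?_⟩
    · simpa [h6] using hxT
    · simpa [A, h6] using hx1
    · simpa [B, h6] using hx2

end Coordinates

/-! ### Projections -/

section Projections

open Filter Function FirstOrder.Language

variable {α : Type} [DecidableEq α] {V : Ultrafilter (α → ℝ)} {s : Finset α} {l : Filter (α → ℝ)}
  {C : Set ((α → ℝ) → ℂ)}

/-- Good fields with some of the coordinates, along a filter containing the restriction of `V` to
these coordinates. -/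
structure Stage (V : Ultrafilter (α → ℝ)) (s : Finset α) (l : Filter (α → ℝ))
    (C : Set ((α → ℝ) → ℂ)) : Prop where
  good : ExpLogGood l C
  tendsto : Tendsto (fun (x : α → ℝ) a => if a ∈ s then x a else 0) V l
  coord : ∀ a ∈ s, (fun x => (x a : ℂ)) ∈ C
  zero : ∀ᶠ x in l, ∀ a ∉ s, x a = 0

theorem Stage.exists_insert [Finite α] (h : Stage V s l C) {d : α} (hd : d ∉ s) :
    ∃ l' D, Stage V (insert d s) l' D ∧ Adjoins l d l' := by
  obtain ⟨l', D, h1, h2, h3, h4, h5, h6⟩ := h.good.exists_adjoins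
    (h.zero.mono fun x hx => hx d hd) (V.map fun (x : α → ℝ) a => if a ∈ insert d s then x a else 0)
      (by
      rw [Ultrafilter.coe_map, tendsto_map'_iff]
      refine h.tendsto.congr fun x => funext fun a => ?_
      by_cases ha : a = d
      · subst ha
        simp [hd]
      · simp [ha])
  refine ⟨l', D, ⟨h2, h1, fun a ha => ?_, ?_⟩, h3⟩
  · rcases Finset.mem_insert.1 ha with rfl | ha
    · exact h4
    · have := h6 _ (h.coord a ha)
      simpa [ne_of_mem_of_not_mem ha hd] using this
  · filter_upwards [h5.eventually h.zero] with x hx a ha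
    rw [Finset.mem_insert, not_or] at ha
    simpa [ha.1] using hx a ha.2

theorem Stage.exists_union [Finite α] (h : Stage V s l C) {Q : Filter (α → ℝ) → Prop} (hl : Q l)
    (hQ : ∀ l l' d, d ∉ s → Q l → Adjoins l d l' → Q l') (t : Finset α) :
    ∃ l C, Stage V (t ∪ s) l C ∧ Q l := by
  induction t using Finset.induction_on with
  | empty => exact ⟨l, C, by rwa [Finset.empty_union], hl⟩
  | insert d t _ ih =>
    obtain ⟨l, C, h, hl⟩ := ih
    rw [Finset.insert_union]
    by_cases hd : d ∈ t ∪ s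
    · exact ⟨l, C, by rwa [Finset.insert_eq_of_mem hd], hl⟩
    · obtain ⟨l', D, h1, h2⟩ := h.exists_insert hd
      exact ⟨l', D, h1, hQ l l' d (fun h => hd (Finset.mem_union_right _ h)) hl h2⟩

variable {γ δ : Type} [Finite γ] [Finite δ]

/-- A quantifier-free set of an ultrafilter contains values of tame functions. -/
theorem QFSet.exists_tame {B : Set (γ ⊕ δ → ℝ)} (hB : QFSet B) (V : Ultrafilter (γ ⊕ δ → ℝ))
    (hV : B ∈ V) : ∃ F : (γ → ℝ) → γ ⊕ δ → ℝ, (∀ a, Tame fun x => F x a) ∧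
      ∀ᶠ x in (V : Filter (γ ⊕ δ → ℝ)), F (x ∘ Sum.inl) ∈ B ∧
        ∀ c, F (x ∘ Sum.inl) (Sum.inl c) = x (Sum.inl c) := by
  classical
  cases nonempty_fintype γ
  cases nonempty_fintype δ
  have h0 : Stage V ∅ (pure 0) Set.univ := ⟨.pure_univ 0, by
    simp only [Finset.notMem_empty, if_false]
    exact tendsto_const_pure, by simp, by simp⟩
  obtain ⟨l₁, C₁, h1, -⟩ := h0.exists_union (Q := fun _ => True) trivial (fun _ _ _ _ _ _ =>
      trivial)
    (Finset.univ.image Sum.inl)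
  rw [Finset.union_empty] at h1
  obtain ⟨l, C, h2, h3⟩ := h1.exists_union (Q := fun l => ∀ S ∈ l, ∃ F : (γ → ℝ) → γ ⊕ δ → ℝ,
    (∀ a, Tame fun x => F x a) ∧ ∀ᶠ x in (V : Filter (γ ⊕ δ → ℝ)), F (x ∘ Sum.inl) ∈ S ∧
        ∀ c, F (x ∘ Sum.inl) (Sum.inl c) = x (Sum.inl c)) (fun S hS =>
      ⟨fun x => Sum.elim x 0, Sum.rec (fun c => Tame.proj c) fun _ => Tame.const 0, by
        filter_upwards [h1.tendsto hS] with x hx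
        refine ⟨?_, fun c => rfl⟩
        convert Set.mem_preimage.1 hx using 1
        funext a
        cases a <;> simp⟩) (fun l l' d hd hl hl' S hS => by
      obtain ⟨T, hT, h, hh, hTS⟩ := hl' S hS
      obtain ⟨F, hF, h4⟩ := hl T hT
      refine ⟨fun x => update (F x) d (h (F x)), tame_update hF d hh, ?_⟩
      filter_upwards [h4] with x hx
      refine ⟨hTS _ hx.1, fun c => ?_⟩
      rw [update_of_ne (by rintro rfl; simp at hd), hx.2]) Finset.univ
  refine h3 B ?_
  obtain ⟨ψ, hψ, hψB⟩ := hB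
  have ha : ∀ a, (fun x => (x a : ℂ)) ∈ C := fun a => h2.coord a (by simp)
  rcases h2.good.decided_qf hψ ha (w := fun i => i.elim0) (fun i => i.elim0) with h | h
  · exact h.mono fun x hx => (hψB x).1 (by rw [Formula.Realize]; convert hx)
  · obtain ⟨x, hx, hx'⟩ := ((h2.tendsto.eventually h).and hV).exists
    refine absurd ((hψB x).2 hx') fun h => hx ?_
    rw [Formula.Realize] at h
    convert h
    simp

theorem QFSet.proj {B : Set (γ ⊕ δ → ℝ)} (hB : QFSet B) :
    TPred fun x : γ → ℝ => ∃ w : δ → ℝ, Sum.elim x w ∈ B := by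
  let D : {F : (γ → ℝ) → γ ⊕ δ → ℝ // ∀ a, Tame fun x => F x a} → Set (γ → ℝ) := fun F =>
    {x | F.1 x ∈ B ∧ ∀ c, F.1 x (Sum.inl c) = x c}
  let E : Set (γ → ℝ) := {x | ∃ w : δ → ℝ, Sum.elim x w ∈ B}
  by_cases hE : (⨅ F, 𝓟 (E \ D F)).NeBot
  · exfalso
    obtain ⟨U, hU⟩ := Ultrafilter.exists_le (⨅ F, 𝓟 (E \ D F))
    have hUD : ∀ F, E \ D F ∈ U := fun F => hU (mem_iInf_of_mem F (mem_principal_self _))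
    choose! w hw using fun (x : γ → ℝ) (hx : x ∈ E) => hx
    obtain ⟨F, hF, h⟩ := hB.exists_tame (U.map fun x => Sum.elim x (w x)) (by
      rw [Ultrafilter.mem_map]
      filter_upwards [hUD ⟨fun _ _ => 0, fun _ => Tame.const 0⟩] with x hx using hw x hx.1)
    rw [Ultrafilter.coe_map, eventually_map] at h
    obtain ⟨x, hx, hx'⟩ := (h.and (hUD ⟨F, hF⟩)).exists
    exact hx'.2 hx
  · rw [(hasBasis_iInf_principal_finite _).neBot_iff] at hE
    push Not at hE
    obtain ⟨t, ht, h⟩ := hE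
    have := ht.to_subtype
    refine (TPred.exists (κ := t) (p := fun F x => x ∈ D F) fun F =>
      (TPred.of_qf F.1.2 hB).and (TPred.forall fun c => TPred.eq (F.1.2 _) (Tame.proj c))).congr
      fun x => ⟨fun hx => ?_, fun ⟨F, hF⟩ => ⟨fun i => F.1.1 x (Sum.inr i), ?_⟩⟩
    · by_contra hcon
      push Not at hcon
      have : x ∈ (∅ : Set (γ → ℝ)) := h ▸ Set.mem_iInter₂.2 fun F hF => ⟨hx, hcon ⟨F, hF⟩⟩
      exact this
    · convert hF.1
      funext a
      cases a
      · exact (hF.2 _).symm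
      · rfl

theorem TPred.proj {p : (γ ⊕ δ → ℝ) → Prop} (hp : TPred p) :
    TPred fun x : γ → ℝ => ∃ w : δ → ℝ, p (Sum.elim x w) := by
  obtain ⟨ι, _, B, hB, h, -⟩ := hp.exists_qf
  refine (hB.preimage (Equiv.sumAssoc γ δ ι)).proj.congr fun x => ?_
  simp only [h, Set.mem_ofPred_eq, elim_comp_sumAssoc]
  exact ⟨fun ⟨w, u, hw⟩ => ⟨Sum.elim w u, hw⟩, fun ⟨w, hw⟩ => ⟨_, _, hw⟩⟩

theorem tame_term {α : Type} (t : LJ.Term α) : Tame fun x : α → ℝ => t.realize x := by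
  induction t with
  | var a => exact Tame.proj a
  | func F ts ih => exact Tame.funMap F ih

/-- Formulas define tame sets. -/
theorem tPred_realize [Finite α] {n : ℕ} (φ : LJ.BoundedFormula α n) :
    TPred fun y : α ⊕ Fin n → ℝ => φ.Realize (y ∘ Sum.inl) (y ∘ Sum.inr) := by
  induction φ with
  | falsum => exact TPred.const False
  | equal t s =>
    refine (TPred.eq (tame_term t) (tame_term s)).congr fun y => ?_
    rw [BoundedFormula.Realize, Sum.elim_comp_inl_inr]
  | @rel n m R ts =>
    match m, R with
    | 0, e => exact e.elim
    | 1, e => exact e.elim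
    | 2, R =>
      refine (TPred.lt (tame_term (ts 0)) (tame_term (ts 1))).congr fun y => ?_
      rw [BoundedFormula.Realize, Sum.elim_comp_inl_inr]
      rfl
    | _ + 3, e => exact e.elim
  | imp _ _ ih1 ih2 => exact ih1.imp ih2
  | @all n φ ih =>
    let σ : α ⊕ Fin (n + 1) → (α ⊕ Fin n) ⊕ Unit := Sum.elim (fun i => Sum.inl (Sum.inl i))
      (Fin.snoc (α := fun _ => (α ⊕ Fin n) ⊕ Unit) (fun i => Sum.inl (Sum.inr i)) (Sum.inr ()))
    refine (ih.comp fun b => Tame.proj (σ b)).not.proj.not.congr fun y => ?_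
    rw [BoundedFormula.realize_all, not_exists]
    have e : ∀ w : Unit → ℝ, (fun b => Sum.elim y w (σ b)) ∘ Sum.inr =
        Fin.snoc (α := fun _ => ℝ) (y ∘ Sum.inr) (w ()) := fun w => by
      funext i
      refine Fin.lastCases ?_ (fun i => ?_) i <;> simp [σ]
    simp only [e, not_not]
    exact ⟨fun h w => h (w ()), fun h a => h fun _ => a⟩

end Projections

/-- Theorem: the structure `ℛ_J` (the real field expanded by the real and imaginary parts
of `J`, `J'`, `J''` on the part of the fundamental domain strip, the restricted sine and
cosine, and the unrestricted exponential) is strongly model complete. -/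
theorem strong_model_completeness_RJ :
    StronglyModelComplete LJ ℝ LJStructure := by
  intro k φ
  have h : TPred fun x : Fin k → ℝ => φ.Realize x :=
    ((tPred_realize φ).comp (g := Sum.elim (fun i x => x i) fun i => i.elim0) fun b =>
      b.rec (fun i => Tame.proj i) fun i => i.elim0).congr fun x =>
        iff_of_eq (congrArg (Language.BoundedFormula.Realize φ x) (Subsingleton.elim _ _))
  obtain ⟨ι, _, B, hB, hpB, huniq⟩ := h.exists_qf
  obtain ⟨m, ⟨e⟩⟩ := Finite.exists_equiv_fin ι
  obtain ⟨ψ, hψ, hψB⟩ := hB.preimage (Sum.map id e)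
  have key : ∀ (x : Fin k → ℝ) (w : Fin m → ℝ),
      ψ.Realize (Sum.elim x w) ↔ Sum.elim x (w ∘ e) ∈ B := fun x w => by
    rw [hψB, Set.mem_ofPred_eq, Sum.elim_comp_map, Function.comp_id]
  refine ⟨m, ψ, hψ, fun x => ?_, fun x y z hy hz => ?_⟩
  · rw [hpB]
    refine ⟨fun ⟨w, hw⟩ => ⟨w ∘ e.symm, (key _ _).2 ?_⟩, fun ⟨w, hw⟩ => ⟨_, (key _ _).1 hw⟩⟩
    rwa [Function.comp_assoc, e.symm_comp_self, Function.comp_id]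
  · exact e.surjective.injective_comp_right
      (huniq x _ _ ((key _ _).1 hy) ((key _ _).1 hz))

end
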